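/- Let d = 9. For a general binary nonic E, the minimal generator dimensions of I_E are β_4 = 1, β_6 = 71, β_7 = 508, β_8 = 324, β_9 = 86, β_10 = 51, and β_m = 0 for all other m. -/

import Mathlib

/-!
Setup for the ideals of general binary orbits (Chipalkatti, "On the ideals of general
binary orbits: the low order cases").

A binary form `E = Σ_{i=0}^d binom(d,i) αᵢ x₁^{d−i} x₂^i` of order `d` over `ℂ` is
identified with its coefficient vector `α : Fin (d+1) → ℂ`.  `SL₂(ℂ)` acts on binary
`d`-ics by substitution of variables, inducing an action `actCoeff` on `ℂ^{d+1}` and an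
action `actPoly` on `R = ℂ[a_0, …, a_d]` (the polynomial ring `MvPolynomial (Fin (d+1)) ℂ`).

For `E ≠ 0`, `orbitVariety d E = X_E` is the Zariski closure of
`{λ • (g·E) : λ ∈ ℂ, g ∈ SL₂(ℂ)}` (the affine cone over the orbit closure `Ω_E ⊆ ℙ^d`),
and `orbitIdeal d E = I_E` is its vanishing ideal (automatically homogeneous).

`genPiece d m E = (I_E)_m`, `trivPiece d m E = (R₊·I_E)_m`, and
`minGenSpace d m E = B(0,m) = (I_E/(R₊·I_E))_m` is the space of minimal generators in
degree `m`, with `betti d m E = β_m` its dimension.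

`RepSum l` models the direct sum `⊕ᵢ S_{l i}` of the irreducible `SL₂(ℂ)`-representations
(binary forms of order `q`, via coefficient vectors), with action `repSumAct`.
-/

open MvPolynomial

noncomputable section

/-- The special linear group `SL₂(ℂ)`. -/
abbrev SL2 : Type := Matrix.SpecialLinearGroup (Fin 2) ℂ

/-- The binary form of order `d` with coefficient vector `α`:
`Σ_{i=0}^d binom(d,i) αᵢ x₁^{d−i} x₂^i`, with `x₁ = X 0`, `x₂ = X 1`. -/
def toForm (d : ℕ) (α : Fin (d + 1) → ℂ) : MvPolynomial (Fin 2) ℂ :=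
  ∑ i : Fin (d + 1), C ((d.choose (i : ℕ) : ℂ) * α i) * (X 0 ^ (d - (i : ℕ)) * X 1 ^ (i : ℕ))

/-- Substitution of variables by `g = [[p,q],[r,s]]`: `x₁ ↦ p x₁ + q x₂`, `x₂ ↦ r x₁ + s x₂`. -/
def substAction (g : SL2) (F : MvPolynomial (Fin 2) ℂ) : MvPolynomial (Fin 2) ℂ :=
  aeval (fun i : Fin 2 => C (g.1 i 0) * X 0 + C (g.1 i 1) * X 1) F

/-- The coefficient vector of `g·E`, where `E` is the binary `d`-ic with coefficient
vector `α`: the coefficient of `x₁^{d−i} x₂^i` in `g·E`, divided by `binom(d,i)`. -/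
def actCoeff (d : ℕ) (g : SL2) (α : Fin (d + 1) → ℂ) : Fin (d + 1) → ℂ := fun i =>
  coeff (Finsupp.single (0 : Fin 2) (d - (i : ℕ)) + Finsupp.single (1 : Fin 2) (i : ℕ))
      (substAction g (toForm d α)) / (d.choose (i : ℕ) : ℂ)

/-- The affine cone over the `SL₂(ℂ)`-orbit of `E`:
`{λ • (g·E) : λ ∈ ℂ, g ∈ SL₂(ℂ)} ⊆ ℂ^{d+1}`. -/
def orbitCone (d : ℕ) (E : Fin (d + 1) → ℂ) : Set (Fin (d + 1) → ℂ) :=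
  {v | ∃ (c : ℂ) (g : SL2), v = c • actCoeff d g E}

/-- The Zariski closure of a subset of affine space `ℂⁿ`: the set of points at which every
polynomial vanishing on `S` vanishes. -/
def zClosure {n : ℕ} (S : Set (Fin n → ℂ)) : Set (Fin n → ℂ) :=
  {v | ∀ f : MvPolynomial (Fin n) ℂ, (∀ w ∈ S, eval w f = 0) → eval v f = 0}

/-- A Zariski-open subset of `ℂⁿ`: the complement of the common zero locus of a family of
polynomials. -/
def IsZariskiOpen {n : ℕ} (U : Set (Fin n → ℂ)) : Prop :=
  ∃ T : Set (MvPolynomial (Fin n) ℂ), U = {v | ∃ f ∈ T, eval v f ≠ 0}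

/-- A Zariski-dense subset of `ℂⁿ`. -/
def IsZariskiDense {n : ℕ} (U : Set (Fin n → ℂ)) : Prop :=
  zClosure U = Set.univ

/-- A property `P` holds for a general `E ∈ ℂ^{d+1}` if it holds on some dense
Zariski-open subset of `ℂ^{d+1}`. -/
def ForGeneral (d : ℕ) (P : (Fin (d + 1) → ℂ) → Prop) : Prop :=
  ∃ U : Set (Fin (d + 1) → ℂ), IsZariskiOpen U ∧ IsZariskiDense U ∧ ∀ E ∈ U, P E

/-- `X_E`: the Zariski closure of the affine cone over the orbit of `E` (the affine cone
over the orbit closure `Ω_E ⊆ ℙ^d`). -/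
def orbitVariety (d : ℕ) (E : Fin (d + 1) → ℂ) : Set (Fin (d + 1) → ℂ) :=
  zClosure (orbitCone d E)

/-- `I_E`: the (homogeneous) vanishing ideal of `X_E` in `R = ℂ[a_0, …, a_d]`. -/
def orbitIdeal (d : ℕ) (E : Fin (d + 1) → ℂ) : Ideal (MvPolynomial (Fin (d + 1)) ℂ) where
  carrier := {f | ∀ v ∈ orbitVariety d E, eval v f = 0}
  zero_mem' := fun v _ => by simp
  add_mem' := fun hf hh v hv => by simp [hf v hv, hh v hv]
  smul_mem' := fun c f hf v hv => by simp [smul_eq_mul, hf v hv]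

/-- The linear polynomial expressing the `i`-th coordinate of `g·v` in terms of the
coordinates of `v`. -/
def actVarPoly (d : ℕ) (g : SL2) (i : Fin (d + 1)) : MvPolynomial (Fin (d + 1)) ℂ :=
  ∑ j : Fin (d + 1), C (actCoeff d g (Pi.single j 1) i) * X j

/-- The induced `SL₂(ℂ)`-action on `R = ℂ[a_0, …, a_d]`: `(g·f)(v) = f(g·v)`. -/
def actPoly (d : ℕ) (g : SL2) (f : MvPolynomial (Fin (d + 1)) ℂ) :
    MvPolynomial (Fin (d + 1)) ℂ :=
  aeval (actVarPoly d g) f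

/-- The degree-`m` graded piece of an ideal of `R`, as a `ℂ`-subspace. -/
def idealPiece (d m : ℕ) (I : Ideal (MvPolynomial (Fin (d + 1)) ℂ)) :
    Submodule ℂ (MvPolynomial (Fin (d + 1)) ℂ) :=
  Submodule.restrictScalars ℂ I ⊓ homogeneousSubmodule (Fin (d + 1)) ℂ m

/-- `(I_E)_m`, the degree-`m` graded piece of `I_E`. -/
def genPiece (d m : ℕ) (E : Fin (d + 1) → ℂ) :
    Submodule ℂ (MvPolynomial (Fin (d + 1)) ℂ) :=
  idealPiece d m (orbitIdeal d E)

/-- The irrelevant maximal ideal `R₊ = (a_0, …, a_d)`. -/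
def irrelevantIdeal (d : ℕ) : Ideal (MvPolynomial (Fin (d + 1)) ℂ) :=
  Ideal.span (Set.range X)

/-- `(R₊·I_E)_m`. -/
def trivPiece (d m : ℕ) (E : Fin (d + 1) → ℂ) :
    Submodule ℂ (MvPolynomial (Fin (d + 1)) ℂ) :=
  idealPiece d m (irrelevantIdeal d * orbitIdeal d E)

/-- `(R₊·I_E)_m` viewed inside `(I_E)_m`. -/
def minGenRel (d m : ℕ) (E : Fin (d + 1) → ℂ) : Submodule ℂ (genPiece d m E) :=
  (trivPiece d m E).comap (genPiece d m E).subtype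

/-- `B(0,m) = (I_E/(R₊·I_E))_m`, the degree-`m` space of minimal generators of `I_E`. -/
abbrev minGenSpace (d m : ℕ) (E : Fin (d + 1) → ℂ) : Type :=
  genPiece d m E ⧸ minGenRel d m E

/-- The canonical projection `(I_E)_m → B(0,m)`. -/
def minGenMk (d m : ℕ) (E : Fin (d + 1) → ℂ) : genPiece d m E →ₗ[ℂ] minGenSpace d m E :=
  (minGenRel d m E).mkQ

/-- `β_m = dim_ℂ B(0,m)`, the number of minimal generators of `I_E` in degree `m`. -/
def betti (d m : ℕ) (E : Fin (d + 1) → ℂ) : ℕ :=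
  Module.finrank ℂ (minGenSpace d m E)

/-- The direct sum `⊕ᵢ S_{l i}` of irreducible `SL₂(ℂ)`-representations, where `S_q`
(binary forms of order `q`) is modeled by coefficient vectors `Fin (q+1) → ℂ`. -/
abbrev RepSum (l : List ℕ) : Type :=
  ∀ i : Fin l.length, Fin (l.get i + 1) → ℂ

/-- The `SL₂(ℂ)`-action on `RepSum l`, by substitution on each binary form. -/
def repSumAct (l : List ℕ) (g : SL2) (v : RepSum l) : RepSum l :=
  fun i => actCoeff (l.get i) g (v i)

/-- `B(0,m) ≅ S_{l 0} ⊕ ⋯ ⊕ S_{l k}` as `SL₂(ℂ)`-representations: there is a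
`ℂ`-linear isomorphism intertwining the action induced on `B(0,m)` by the action on
`(I_E)_m ⊆ R` with the action on `⊕ᵢ S_{l i}`. -/
def HasMinGens (d m : ℕ) (E : Fin (d + 1) → ℂ) (l : List ℕ) : Prop :=
  ∃ e : minGenSpace d m E ≃ₗ[ℂ] RepSum l,
    ∀ (g : SL2) (f : MvPolynomial (Fin (d + 1)) ℂ)
      (hf : f ∈ genPiece d m E) (hgf : actPoly d g f ∈ genPiece d m E),
      e (minGenMk d m E ⟨actPoly d g f, hgf⟩) = repSumAct l g (e (minGenMk d m E ⟨f, hf⟩))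

end

noncomputable section

/-- A property of nine complex parameters that holds off the zero locus of a nonzero polynomial. -/
def Gen (P : (Fin 9 → ℂ) → Prop) : Prop :=
  ∃ D : MvPolynomial (Fin 9) ℂ, D ≠ 0 ∧ ∀ z, eval z D ≠ 0 → P z

theorem Gen.and {P Q : (Fin 9 → ℂ) → Prop} (hP : Gen P) (hQ : Gen Q) : Gen fun z => P z ∧ Q z := by
  obtain ⟨D, hD, h⟩ := hP
  obtain ⟨D', hD', h'⟩ := hQ
  refine ⟨D * D', mul_ne_zero hD hD', fun z hz => ?_⟩
  rw [map_mul] at hz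
  exact ⟨h z (left_ne_zero_of_mul hz), h' z (right_ne_zero_of_mul hz)⟩

theorem Gen.mono {P Q : (Fin 9 → ℂ) → Prop} (hP : Gen P) (h : ∀ z, P z → Q z) : Gen Q := by
  obtain ⟨D, hD, h'⟩ := hP
  exact ⟨D, hD, fun z hz => h z (h' z hz)⟩

theorem Gen.forall_mem {ι : Type*} (s : List ι) {P : ι → (Fin 9 → ℂ) → Prop}
    (h : ∀ i ∈ s, Gen (P i)) : Gen fun z => ∀ i ∈ s, P i z := by
  induction s with
  | nil => exact ⟨1, one_ne_zero, fun z _ i hi => absurd hi List.not_mem_nil⟩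
  | cons a s ih =>
    refine ((h a List.mem_cons_self).and
      (ih fun i hi => h i (List.mem_cons_of_mem _ hi))).mono fun z hz i hi => ?_
    rcases List.mem_cons.1 hi with rfl | hi
    · exact hz.1
    · exact hz.2 i hi

/-- The vectors in `l` take arbitrary values on the coordinates in `c`. -/
def FullOn {K κ : Type*} [CommRing K] (l : Set (κ → K)) (c : Finset κ) : Prop :=
  ∀ a : κ → K, ∃ u ∈ Submodule.span K l, ∀ k ∈ c, u k = a k

theorem FullOn.exists_minor {K κ : Type*} [DecidableEq κ] [Field K] {l : List (κ → K)} {c : Finset κ}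
    (h : FullOn {x | x ∈ l} c) :
    ∃ i : c → ℕ, (Matrix.of fun a b : c => (l.getD (i a) 0) b).det ≠ 0 := by
  classical
  let res : (κ → K) →ₗ[K] (c → K) := LinearMap.funLeft K K (fun x : c => (x : κ))
  let v : Fin l.length → (c → K) := fun i => res (l.get i)
  have hv : ⊤ ≤ Submodule.span K (Set.range v) := by
    intro a _
    obtain ⟨u, hu, hua⟩ := h (fun k => if hk : k ∈ c then a ⟨k, hk⟩ else 0)
    have : res u = a := by
      ext k
      simp [res, LinearMap.funLeft_apply, hua k k.2]
    rw [← this]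
    have hr : Set.range v = res '' {x | x ∈ l} := by
      ext y
      constructor
      · rintro ⟨i, rfl⟩
        exact ⟨l.get i, List.get_mem l i, rfl⟩
      · rintro ⟨x, hx, rfl⟩
        obtain ⟨i, rfl⟩ := List.get_of_mem hx
        exact ⟨i, rfl⟩
    rw [hr, ← Submodule.map_span]
    exact Submodule.mem_map_of_mem hu
  obtain ⟨s, hs, hspan, hli⟩ := exists_linearIndependent K (Set.range v)
  have hsp : ⊤ ≤ Submodule.span K (Set.range ((↑) : s → (c → K))) := by
    rw [Subtype.range_coe, hspan]; exact hv
  let b := Module.Basis.mk hli hsp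
  have e : s ≃ c := b.indexEquiv (Pi.basisFun K c)
  choose i hi using fun x : s => hs x.2
  refine ⟨fun a => (i (e.symm a) : ℕ), ?_⟩
  have hm : (Matrix.of fun a k : c => (l.getD ((i (e.symm a) : Fin l.length) : ℕ) 0) k) =
      Matrix.of fun a k : c => ((e.symm a : s) : c → K) k := by
    ext a k
    rw [Matrix.of_apply, Matrix.of_apply, ← hi (e.symm a)]
    simp [v, res, LinearMap.funLeft_apply]
  rw [hm]
  have hli' : LinearIndependent K (fun a : c => ((e.symm a : s) : c → K)) :=
    hli.comp _ e.symm.injective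
  have := (Matrix.linearIndependent_rows_iff_isUnit
    (A := Matrix.of fun a k : c => ((e.symm a : s) : c → K) k)).1 hli'
  exact ((Matrix.isUnit_iff_isUnit_det _).1 this).ne_zero

/-- Ranks of families of vectors depending polynomially on nine parameters are generically at
least as large as at any point in any characteristic. -/
theorem gen_rank {κ : Type} [DecidableEq κ] (V : ∀ (K : Type) [CommRing K], (Fin 9 → K) → List (κ → K))
    (nat : ∀ (K L : Type) [CommRing K] [CommRing L] (f : K →+* L) (z : Fin 9 → K),
      V L (f ∘ z) = (V K z).map (f ∘ ·))
    {F : Type} [Field F] (z₀ : Fin 9 → F) (c : Finset κ)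
    (h : FullOn {x | x ∈ V F z₀} c) :
    Gen fun z => c.card ≤ Module.finrank ℂ (Submodule.span ℂ {x | x ∈ V ℂ z}) := by
  classical
  obtain ⟨i, hi⟩ := h.exists_minor
  let Λ := MvPolynomial (Fin 9) ℤ
  let M : Matrix c c Λ := Matrix.of fun a b : c => ((V Λ X).getD (i a) 0) b
  have key : ∀ (K : Type) [CommRing K] (z : Fin 9 → K),
      (Matrix.of fun a b : c => ((V K z).getD (i a) 0) b) = M.map (eval₂Hom (Int.castRingHom K) z) := by
    intro K _ z
    have hz : z = (eval₂Hom (Int.castRingHom K) z : Λ →+* K) ∘ X := by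
      ext k; simp
    have h1 : V K z = (V Λ X).map ((eval₂Hom (Int.castRingHom K) z : Λ →+* K) ∘ ·) := by
      rw [← nat, ← hz]
    ext a b
    rw [h1]
    simp only [Matrix.of_apply, Matrix.map_apply, M]
    rcases lt_or_ge (i a) (V Λ X).length with h2 | h2
    · simp [List.getD_eq_getElem?_getD, h2]
    · simp [List.getD_eq_getElem?_getD, h2]
  have hM : M.det ≠ 0 := by
    intro h0
    apply hi
    rw [key, ← RingHom.mapMatrix_apply, ← RingHom.map_det, h0, map_zero]
  refine ⟨MvPolynomial.map (Int.castRingHom ℂ) M.det, ?_, fun z hz => ?_⟩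
  · rw [Ne, ← map_zero (MvPolynomial.map (Int.castRingHom ℂ))]
    exact fun h0 => hM (MvPolynomial.map_injective _ Int.cast_injective h0)
  · have hdet : (Matrix.of fun a b : c => ((V ℂ z).getD (i a) 0) b).det ≠ 0 := by
      rw [key, ← RingHom.mapMatrix_apply, ← RingHom.map_det]
      rwa [eval_map] at hz
    have hli := Matrix.linearIndependent_rows_of_det_ne_zero hdet
    let S := Submodule.span ℂ {x | x ∈ V ℂ z}
    have hfin : Module.Finite ℂ S :=
      Module.Finite.span_of_finite ℂ (List.finite_toSet (V ℂ z))
    let w : c → S := fun a => ⟨(V ℂ z).getD (i a) 0, by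
      rcases lt_or_ge (i a) (V ℂ z).length with h2 | h2
      · rw [List.getD_eq_getElem _ _ h2]
        exact Submodule.subset_span (List.getElem_mem h2)
      · rw [List.getD_eq_default _ _ h2]
        exact S.zero_mem⟩
    have hw : LinearIndependent ℂ w := by
      apply LinearIndependent.of_comp
        ((LinearMap.funLeft ℂ ℂ (fun x : c => (x : κ))).comp S.subtype)
      exact hli
    simpa using hw.fintype_card_le_finrank
end

noncomputable section

namespace Packed
open scoped Polynomial

instance : Fact (Nat.Prime 8191) := ⟨by norm_num⟩

/-- `X` packs, in `N` slots of 40 bits, integers below `b` representing the sequence `f`. -/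
def Rep (N b X : ℕ) (f : ℕ → ZMod 8191) : Prop :=
  ∃ g : ℕ[X], (∀ i, g.coeff i < b) ∧ (∀ i, N ≤ i → g.coeff i = 0) ∧ g.eval (2 ^ 40) = X ∧
    ∀ i, (g.coeff i : ZMod 8191) = f i

/-- The constant `c` repeated in `n` slots. -/
def mask (c n : ℕ) : ℕ := Nat.mul c (Nat.div (Nat.sub (Nat.pow 2 (Nat.mul 40 n)) 1) 1099511627775)

theorem mask_zero (c : ℕ) : mask c 0 = 0 := by change c * ((2 ^ 0 - 1) / _) = 0; simp

theorem mask_succ (c n : ℕ) : mask c (n + 1) = c + 2 ^ 40 * mask c n := by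
  have h : ∀ n, Nat.div (Nat.sub (Nat.pow 2 (Nat.mul 40 n)) 1) 1099511627775 =
      ∑ i ∈ Finset.range n, (2 ^ 40) ^ i := fun n => by
    rw [Nat.geomSum_eq (by norm_num)]
    change (2 ^ (40 * n) - 1) / _ = _
    rw [pow_mul, show (1099511627775 : ℕ) = 2 ^ 40 - 1 by norm_num]
  simp only [mask, h]
  change c * _ = c + _ * (c * _)
  rw [Finset.sum_range_succ', mul_add, pow_zero, mul_one, add_comm, mul_left_comm,
    Finset.mul_sum (s := Finset.range n)]
  simp only [pow_succ (2 ^ 40 : ℕ), mul_comm, Finset.mul_sum]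

/-- One partial reduction modulo `8191` in each slot. -/
def fold (n X : ℕ) : ℕ :=
  Nat.add (Nat.land X (mask 8191 n)) (Nat.land (Nat.shiftRight X 13) (mask 134217727 n))

theorem land_split {a c : ℕ} (b d : ℕ) (ha : a < 2 ^ 40) (hc : c < 2 ^ 40) :
    (a + 2 ^ 40 * b) &&& (c + 2 ^ 40 * d) = (a &&& c) + 2 ^ 40 * (b &&& d) := by
  have h1 : ((a + 2 ^ 40 * b) &&& (c + 2 ^ 40 * d)) % 2 ^ 40 = a &&& c := by
    rw [Nat.and_mod_two_pow, Nat.add_mul_mod_self_left, Nat.add_mul_mod_self_left,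
      Nat.mod_eq_of_lt ha, Nat.mod_eq_of_lt hc]
  have h2 : ((a + 2 ^ 40 * b) &&& (c + 2 ^ 40 * d)) / 2 ^ 40 = b &&& d := by
    rw [Nat.and_div_two_pow, Nat.add_mul_div_left _ _ (by norm_num),
      Nat.add_mul_div_left _ _ (by norm_num), Nat.div_eq_of_lt ha, Nat.div_eq_of_lt hc,
      zero_add, zero_add]
  rw [← h1, ← h2, Nat.mod_add_div]

theorem fold_succ (n a Y : ℕ) (ha : a < 2 ^ 40) :
    fold (n + 1) (a + 2 ^ 40 * Y) = (a % 2 ^ 13 + a / 2 ^ 13) + 2 ^ 40 * fold n Y := by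
  change ((a + 2 ^ 40 * Y) &&& mask 8191 (n + 1)) +
    (((a + 2 ^ 40 * Y) >>> 13) &&& mask 134217727 (n + 1)) = _ +
      2 ^ 40 * ((Y &&& mask 8191 n) + ((Y >>> 13) &&& mask 134217727 n))
  rw [mask_succ, mask_succ, land_split _ _ ha (by norm_num)]
  have h1 : a &&& 8191 = a % 2 ^ 13 := Nat.and_two_pow_sub_one_eq_mod a 13
  have h2 : (a + 2 ^ 40 * Y) >>> 13 = (a / 2 ^ 13 + 2 ^ 27 * (Y % 2 ^ 13)) + 2 ^ 40 * (Y >>> 13) := by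
    rw [Nat.shiftRight_eq_div_pow, Nat.shiftRight_eq_div_pow]
    omega
  have h3 : (a / 2 ^ 13 + 2 ^ 27 * (Y % 2 ^ 13)) &&& 134217727 = a / 2 ^ 13 := by
    have := Nat.and_two_pow_sub_one_eq_mod (a / 2 ^ 13 + 2 ^ 27 * (Y % 2 ^ 13)) 27
    norm_num at this ⊢
    rw [this]; omega
  rw [h1, h2, land_split _ _ (by omega) (by norm_num), h3]
  ring

theorem eval_eq_divX (g : ℕ[X]) : g.eval (2 ^ 40) = g.coeff 0 + 2 ^ 40 * g.divX.eval (2 ^ 40) := by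
  conv_lhs => rw [← Polynomial.divX_mul_X_add g]
  simp; ring

theorem fold_eval (n : ℕ) (g : ℕ[X]) (hg : ∀ i, g.coeff i < 2 ^ 40) :
    fold n (g.eval (2 ^ 40)) = ∑ i ∈ Finset.range n,
      (g.coeff i % 2 ^ 13 + g.coeff i / 2 ^ 13) * (2 ^ 40) ^ i := by
  induction n generalizing g with
  | zero => simp [fold, mask_zero]
  | succ n ih =>
    rw [eval_eq_divX, fold_succ _ _ _ (hg 0), ih _ fun i => by rw [Polynomial.coeff_divX]; exact hg _,
      Finset.sum_range_succ', Finset.mul_sum, add_comm]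
    congr 1
    · exact Finset.sum_congr rfl fun i _ => by rw [Polynomial.coeff_divX]; ring
    · simp

theorem eval_sum_monomial (n : ℕ) (c : ℕ → ℕ) :
    (∑ i ∈ Finset.range n, Polynomial.monomial i (c i) : ℕ[X]).eval (2 ^ 40) =
      ∑ i ∈ Finset.range n, c i * (2 ^ 40) ^ i := by
  simp [Polynomial.eval_finsetSum]

theorem coeff_sum_monomial (n : ℕ) (c : ℕ → ℕ) (i : ℕ) :
    (∑ i ∈ Finset.range n, Polynomial.monomial i (c i) : ℕ[X]).coeff i = if i < n then c i else 0 := by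
  simp [Polynomial.finsetSum_coeff, Polynomial.coeff_monomial]

/-- Truncation of a sequence. -/
def trunc {K : Type*} [Zero K] (n : ℕ) (f : ℕ → K) : ℕ → K := fun i => if i < n then f i else 0

theorem Rep.mono {N N' b b' X : ℕ} {f : ℕ → ZMod 8191} (h : Rep N b X f) (hN : N ≤ N')
    (hb : b ≤ b') : Rep N' b' X f := by
  obtain ⟨g, h1, h2, h3, h4⟩ := h
  exact ⟨g, fun i => (h1 i).trans_le hb, fun i hi => h2 i (hN.trans hi), h3, h4⟩

theorem Rep.fold {N b X : ℕ} {f : ℕ → ZMod 8191} (n : ℕ) (h : Rep N b X f) (hb : b ≤ 2 ^ 40) :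
    Rep n (2 ^ 13 + (b / 2 ^ 13 + 1)) (fold n X) (trunc n f) := by
  obtain ⟨g, h1, h2, h3, h4⟩ := h
  refine ⟨∑ i ∈ Finset.range n, Polynomial.monomial i (g.coeff i % 2 ^ 13 + g.coeff i / 2 ^ 13),
    fun i => ?_, fun i hi => ?_, ?_, fun i => ?_⟩
  · rw [coeff_sum_monomial]
    have := h1 i
    split_ifs <;> omega
  · rw [coeff_sum_monomial, if_neg (by omega)]
  · rw [eval_sum_monomial, ← h3, fold_eval _ _ fun i => (h1 i).trans_le hb]
  · rw [coeff_sum_monomial, trunc]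
    split_ifs with hi
    · rw [← h4 i]
      conv_rhs => rw [← Nat.mod_add_div (g.coeff i) (2 ^ 13)]
      push_cast
      have : (8192 : ZMod 8191) = 1 := by decide +kernel
      rw [this, one_mul]
    · simp

/-- Slotwise reduction modulo `8191` to values below `2 ^ 14`. -/
def red (n X : ℕ) : ℕ := fold n (fold n (fold n X))

theorem trunc_trunc {K : Type*} [Zero K] (n : ℕ) (f : ℕ → K) : trunc n (trunc n f) = trunc n f := by
  ext i; simp only [trunc]; split_ifs <;> rfl

theorem Rep.red {N b X : ℕ} {f : ℕ → ZMod 8191} (n : ℕ) (h : Rep N b X f) (hb : b ≤ 2 ^ 40) :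
    Rep n (2 ^ 14) (red n X) (trunc n f) := by
  have h1 := (h.mono le_rfl hb).fold n le_rfl
  have h2 := h1.fold n (by norm_num)
  have h3 := h2.fold n (by norm_num)
  rw [trunc_trunc, trunc_trunc] at h3
  exact h3.mono le_rfl (by norm_num)

theorem Rep.add {N b b' X Y : ℕ} {f g : ℕ → ZMod 8191} (h : Rep N b X f) (h' : Rep N b' Y g) :
    Rep N (b + b') (X + Y) (f + g) := by
  obtain ⟨u, h1, h2, h3, h4⟩ := h
  obtain ⟨v, k1, k2, k3, k4⟩ := h'
  refine ⟨u + v, fun i => ?_, fun i hi => ?_, by rw [Polynomial.eval_add, h3, k3], fun i => ?_⟩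
  · rw [Polynomial.coeff_add]; have := h1 i; have := k1 i; omega
  · rw [Polynomial.coeff_add, h2 i hi, k2 i hi]
  · simp [h4, k4]

theorem Rep.smul {N b X : ℕ} {f : ℕ → ZMod 8191} (h : Rep N b X f) {c B : ℕ} (hc : c < B) :
    Rep N (B * b) (c * X) ((c : ZMod 8191) • f) := by
  obtain ⟨u, h1, h2, h3, h4⟩ := h
  refine ⟨Polynomial.C c * u, fun i => ?_, fun i hi => ?_, by rw [Polynomial.eval_mul, Polynomial.eval_C, h3], fun i => ?_⟩
  · rw [Polynomial.coeff_C_mul]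
    exact Nat.mul_lt_mul'' hc (h1 i)
  · rw [Polynomial.coeff_C_mul, h2 i hi, mul_zero]
  · simp [h4]

theorem Rep.mul {N b b' X Y : ℕ} {f g : ℕ → ZMod 8191} (h : Rep N b X f) (h' : Rep N b' Y g)
    (hb : 0 < N * (b * b')) :
    Rep (2 * N) (N * (b * b')) (X * Y)
      (fun i => ∑ x ∈ Finset.HasAntidiagonal.antidiagonal i, f x.1 * g x.2) := by
  obtain ⟨u, h1, h2, h3, h4⟩ := h
  obtain ⟨v, k1, k2, k3, k4⟩ := h'
  have hN : 0 < N := Nat.pos_of_mul_pos_right hb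
  refine ⟨u * v, fun i => ?_, fun i hi => ?_, by rw [Polynomial.eval_mul, h3, k3], fun i => ?_⟩
  · rw [Polynomial.coeff_mul, Finset.Nat.sum_antidiagonal_eq_sum_range_succ_mk]
    calc ∑ k ∈ Finset.range (i + 1), u.coeff k * v.coeff (i - k)
        ≤ ∑ k ∈ Finset.range N, u.coeff k * v.coeff (i - k) := by
          refine Finset.sum_le_sum_of_ne_zero fun k _ hk => ?_
          rw [Finset.mem_range]
          by_contra hkN
          exact hk (by rw [h2 k (not_lt.1 hkN), zero_mul])
      _ < ∑ k ∈ Finset.range N, b * b' :=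
          Finset.sum_lt_sum_of_nonempty (by simpa using hN.ne') fun k _ =>
            Nat.mul_lt_mul'' (h1 k) (k1 _)
      _ = _ := by simp
  · rw [Polynomial.coeff_mul]
    refine Finset.sum_eq_zero fun x hx => ?_
    rw [Finset.HasAntidiagonal.mem_antidiagonal] at hx
    rcases le_or_gt N x.1 with hx1 | hx1
    · rw [h2 _ hx1, zero_mul]
    · rw [k2 _ (by omega), mul_zero]
  · rw [Polynomial.coeff_mul]; push_cast; simp only [h4, k4]

theorem Rep.head {N b X : ℕ} {f : ℕ → ZMod 8191} (h : Rep N b X f) (hb : b ≤ 2 ^ 40) :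
    ((Nat.mod (Nat.land X 1099511627775) 8191 : ℕ) : ZMod 8191) = f 0 := by
  obtain ⟨u, h1, h2, h3, h4⟩ := h
  have : Nat.land X 1099511627775 = u.coeff 0 := by
    have h5 := Nat.and_two_pow_sub_one_eq_mod X 40
    change X &&& 1099511627775 = _ at h5
    change X &&& 1099511627775 = _
    rw [h5, ← h3, eval_eq_divX u, Nat.add_mul_mod_self_left, Nat.mod_eq_of_lt ((h1 0).trans_le hb)]
  rw [this, ← h4 0]
  exact ZMod.natCast_mod _ _

theorem Rep.shift {N b X : ℕ} {f : ℕ → ZMod 8191} (h : Rep N b X f) (hb : b ≤ 2 ^ 40) :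
    Rep N b (Nat.shiftRight X 40) (fun i => f (i + 1)) := by
  obtain ⟨u, h1, h2, h3, h4⟩ := h
  refine ⟨u.divX, fun i => by rw [Polynomial.coeff_divX]; exact h1 _,
    fun i hi => by rw [Polynomial.coeff_divX]; exact h2 _ (by omega), ?_,
    fun i => by rw [Polynomial.coeff_divX]; exact h4 _⟩
  change _ = X >>> 40
  rw [Nat.shiftRight_eq_div_pow, ← h3, eval_eq_divX u, Nat.add_mul_div_left _ _ (by norm_num),
    Nat.div_eq_of_lt ((h1 0).trans_le hb), zero_add]

/-- Concatenation of a sequence truncated to `n` entries with another sequence. -/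
def cat {K : Type*} (n : ℕ) (f g : ℕ → K) : ℕ → K := fun i => if i < n then f i else g (i - n)

theorem Rep.cat {n N b X Y : ℕ} {f g : ℕ → ZMod 8191} (h : Rep n b X (trunc n f))
    (h' : Rep N b Y g) : Rep (n + N) b (X + Nat.shiftLeft Y (40 * n)) (cat n f g) := by
  obtain ⟨u, h1, h2, h3, h4⟩ := h
  obtain ⟨v, k1, k2, k3, k4⟩ := h'
  have hc : ∀ i, (u + v * Polynomial.X ^ n).coeff i = if i < n then u.coeff i else v.coeff (i - n) := by
    intro i
    rw [Polynomial.coeff_add, Polynomial.coeff_mul_X_pow']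
    split_ifs with a b b
    · omega
    · rw [h2 i a, zero_add]
    · rw [add_zero]
    · omega
  refine ⟨u + v * Polynomial.X ^ n, fun i => ?_, fun i hi => ?_, ?_, fun i => ?_⟩
  · rw [hc]; split_ifs <;> [exact h1 i; exact k1 _]
  · rw [hc, if_neg (by omega)]; exact k2 _ (by omega)
  · change _ = X + Y <<< (40 * n)
    rw [Nat.shiftLeft_eq, ← h3, ← k3]
    rw [Polynomial.eval_add, Polynomial.eval_mul, Polynomial.eval_pow, Polynomial.eval_X, pow_mul]
  · rw [hc, Packed.cat]
    split_ifs with a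
    · rw [h4, trunc, if_pos a]
    · exact k4 _

end Packed
end

noncomputable section

namespace Packed

/-- Elimination of the leading slot of `y` using the row `v` with leading entry `-1`. -/
def step (v y : ℕ) : ℕ :=
  Nat.shiftRight (Nat.add y (Nat.mul (Nat.mod (Nat.land y 1099511627775) 8191) v)) 40

/-- A multiple of the row `v` with leading entry `-1`, where `c` is the leading entry of `v`. -/
def normalize (N c v : ℕ) : ℕ :=
  red N (Nat.mul (Nat.sub 8191 (Nat.mod (Nat.pow c 8189) 8191)) v)

/-- Gaussian elimination: each of the first `n` rows has to provide a pivot in the next slot. The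
remaining rows, after elimination, are passed to `cont`. -/
def elim (N n : ℕ) : List ℕ → (ℕ → ℕ) → (List ℕ → Bool) → Bool :=
  Nat.rec (motive := fun _ => List ℕ → (ℕ → ℕ) → (List ℕ → Bool) → Bool)
    (fun rows f cont => cont (rows.map f))
    (fun _ ih rows f cont => List.rec (motive := fun _ => Bool) false
      (fun r t _ => (fun v₀ => (fun c =>
        Nat.rec (motive := fun _ => Bool) false
          (fun _ _ => Nat.rec (motive := fun _ => Bool) false
            (fun v _ => ih t (fun x => step (Nat.succ v) (f x)) cont) (normalize N c v₀)) c)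
        (Nat.mod (Nat.land v₀ 1099511627775) 8191)) (red N (f r))) rows) n

theorem elim_zero (N : ℕ) (rows : List ℕ) (f : ℕ → ℕ) (cont : List ℕ → Bool) :
    elim N 0 rows f cont = cont (rows.map f) := rfl

theorem elim_succ {N n : ℕ} {rows : List ℕ} {f : ℕ → ℕ} {cont : List ℕ → Bool}
    (h : elim N (n + 1) rows f cont = true) : ∃ r t c v, rows = r :: t ∧
      c = Nat.mod (Nat.land (red N (f r)) 1099511627775) 8191 ∧ c ≠ 0 ∧
      v = normalize N c (red N (f r)) ∧ elim N n t (fun x => step v (f x)) cont = true := by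
  rcases rows with _ | ⟨r, t⟩
  · exact absurd h (by simp [elim])
  · generalize hc : Nat.mod (Nat.land (red N (f r)) 1099511627775) 8191 = c
    generalize hv : normalize N c (red N (f r)) = v
    have h' : (Nat.rec (motive := fun _ => Bool) false
          (fun _ _ => Nat.rec (motive := fun _ => Bool) false
            (fun v _ => elim N n t (fun x => step (Nat.succ v) (f x)) cont) v) c : Bool) = true := by
      rw [← hv, ← hc]; exact h
    rcases c with _ | c
    · exact absurd h' (by simp)
    rcases v with _ | v
    · exact absurd h' (by simp)
    exact ⟨r, t, c + 1, v + 1, rfl, hc.symm, by simp, by rw [hv], h'⟩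

/-- The sequences in `U` can be prescribed on the first `n` entries, and the sequences in `W` are
tails of elements of `U` starting with `n` zeros. -/
def Full {K : Type*} [Field K] (n : ℕ) (U : Submodule K (ℕ → K)) (W : List (ℕ → K)) : Prop :=
  (∀ a : ℕ → K, ∃ u ∈ U, ∀ i < n, u i = a i) ∧
    ∀ s ∈ W, ∃ u ∈ U, (∀ i < n, u i = 0) ∧ ∀ i, u (n + i) = s i

/-- The elimination step on sequences. -/
def stepLin {K : Type*} [Field K] (v : ℕ → K) : (ℕ → K) →ₗ[K] (ℕ → K) where
  toFun f i := f (i + 1) + f 0 * v (i + 1)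
  map_add' f g := by ext i; simp; ring
  map_smul' c f := by ext i; simp; ring

theorem Full.succ {K : Type*} [Field K] {n : ℕ} {l : List (ℕ → K)} {v₀ : ℕ → K} {W : List (ℕ → K)}
    {v : ℕ → K} {k : K} (hv : v = k • v₀) (hv0 : v 0 = -1)
    (h : Full n (Submodule.span K {x | x ∈ l.map (stepLin v)}) W) :
    Full (n + 1) (Submodule.span K {x | x ∈ v₀ :: l}) W := by
  have hvm : v ∈ Submodule.span K {x | x ∈ v₀ :: l} :=
    hv ▸ Submodule.smul_mem _ _ (Submodule.subset_span List.mem_cons_self)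
  have lift : ∀ u' ∈ Submodule.span K {x | x ∈ l.map (stepLin v)},
      ∃ u ∈ Submodule.span K {x | x ∈ v₀ :: l}, u 0 = 0 ∧ ∀ i, u (i + 1) = u' i := by
    intro u' hu'
    have : {x | x ∈ l.map (stepLin v)} = stepLin v '' {x | x ∈ l} := by ext; simp
    rw [this, ← Submodule.map_span] at hu'
    obtain ⟨u, hu, rfl⟩ := hu'
    refine ⟨u + u 0 • v, add_mem ?_ (Submodule.smul_mem _ _ hvm), ?_, fun i => ?_⟩
    · exact Submodule.span_mono (fun x hx => List.mem_cons_of_mem _ hx) hu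
    · simp [hv0]
    · simp [stepLin]
  refine ⟨fun a => ?_, fun s hs => ?_⟩
  · obtain ⟨u', hu', h1⟩ := h.1 fun i => a (i + 1) + a 0 * v (i + 1)
    obtain ⟨u, hu, h2, h3⟩ := lift u' hu'
    refine ⟨u - a 0 • v, sub_mem hu (Submodule.smul_mem _ _ hvm), fun i hi => ?_⟩
    rcases i with _ | i
    · simp [h2, hv0]
    · simp [h3, h1 i (by omega)]
  · obtain ⟨u', hu', h1, h4⟩ := h.2 s hs
    obtain ⟨u, hu, h2, h3⟩ := lift u' hu'
    refine ⟨u, hu, fun i hi => ?_, fun i => ?_⟩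
    · rcases i with _ | i
      · exact h2
      · rw [h3, h1 i (by omega)]
    · rw [add_right_comm, h3, h4]

theorem Rep.trunc_eq {N b X : ℕ} {f : ℕ → ZMod 8191} (h : Rep N b X f) : trunc N f = f := by
  obtain ⟨u, h1, h2, h3, h4⟩ := h
  ext i
  rw [trunc]
  split_ifs with hi
  · rfl
  · rw [← h4, h2 i (by omega), Nat.cast_zero]

theorem Rep.step {N b X V : ℕ} {f v : ℕ → ZMod 8191} (h : Rep N b X f) (hv : Rep N (2 ^ 14) V v)
    (hb : b + 2 ^ 27 ≤ 2 ^ 40) : Rep N (b + 2 ^ 27) (step V X) (stepLin v f) := by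
  have h1 := h.head (by omega)
  have h2 := (h.add (hv.smul (B := 2 ^ 13)
    (c := Nat.mod (Nat.land X 1099511627775) 8191) ?_)).shift (by omega)
  · rw [h1] at h2
    exact h2
  · exact (Nat.mod_lt _ (by norm_num)).trans (by norm_num)

theorem cast_pow_sub (c : ℕ) (hc : (c : ZMod 8191) ≠ 0) :
    ((Nat.sub 8191 (Nat.mod (Nat.pow c 8189) 8191) : ℕ) : ZMod 8191) = -(c : ZMod 8191)⁻¹ := by
  have h1 : (c : ZMod 8191) ^ 8189 = (c : ZMod 8191)⁻¹ := by
    have := ZMod.pow_card_sub_one_eq_one hc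
    exact eq_inv_of_mul_eq_one_left (by rw [← pow_succ]; exact this)
  change ((8191 - c ^ 8189 % 8191 : ℕ) : ZMod 8191) = _
  rw [Nat.cast_sub (Nat.mod_lt _ (by norm_num)).le, ZMod.natCast_mod, Nat.cast_pow, h1,
    ZMod.natCast_self, zero_sub]

theorem elim_spec {N n : ℕ} {rows : List ℕ} {f : ℕ → ℕ} {cont : List ℕ → Bool} {b b' : ℕ}
    {fs : List (ℕ → ZMod 8191)} {T : (ℕ → ZMod 8191) →ₗ[ZMod 8191] (ℕ → ZMod 8191)}
    (h : elim N n rows f cont = true) (hr : List.Forall₂ (Rep N b) rows fs)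
    (hf : ∀ X g, Rep N b X g → Rep N b' (f X) (T g)) (hb : b' + n * 2 ^ 27 ≤ 2 ^ 40) :
    ∃ R W, cont R = true ∧ List.Forall₂ (Rep N (2 ^ 40)) R W ∧
      Full n (Submodule.span _ {x | x ∈ fs.map T}) W := by
  induction n generalizing rows f fs T b' with
  | zero =>
    refine ⟨_, fs.map T, h, List.forall₂_map_left_iff.2 (List.forall₂_map_right_iff.2
      (hr.imp fun X g hX => (hf X g hX).mono le_rfl (by omega))),
      fun a => ⟨0, zero_mem _, by simp⟩, fun s hs => ⟨s, Submodule.subset_span hs, by simp, by simp⟩⟩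
  | succ n ih =>
    obtain ⟨r, t, c, v, rfl, hc, hc0, hv, h⟩ := elim_succ h
    cases hr with
    | cons h1 h2 =>
    rename_i g gs
    have h3 := (hf _ _ h1).red N (by omega)
    rw [(hf _ _ h1).trunc_eq] at h3
    have h4 := h3.head (by norm_num)
    rw [← hc] at h4
    have hc' : (c : ZMod 8191) ≠ 0 := by
      intro h0
      rw [ZMod.natCast_eq_zero_iff] at h0
      have hlt : c < 8191 := hc ▸ Nat.mod_lt _ (by norm_num)
      exact hc0 (Nat.eq_zero_of_dvd_of_lt h0 hlt)
    have h5 := (h3.smul (B := 2 ^ 14) (c := Nat.sub 8191 (Nat.mod (Nat.pow c 8189) 8191)) (by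
      change 8191 - _ < _
      omega)).red N (by norm_num)
    rw [(h3.smul (B := 2 ^ 14) (c := Nat.sub 8191 (Nat.mod (Nat.pow c 8189) 8191)) (by
      change 8191 - _ < _
      omega)).trunc_eq, cast_pow_sub c hc'] at h5
    have h6 : Rep N (2 ^ 14) v (-(c : ZMod 8191)⁻¹ • T g) := by rw [hv]; exact h5
    obtain ⟨R, W, hR, hRW, hF⟩ := ih (T := (stepLin (-(c : ZMod 8191)⁻¹ • T g)).comp T)
      (b' := b' + 2 ^ 27) h h2 (fun X u hX => (hf X u hX).step h6 (by omega)) (by omega)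
    refine ⟨R, W, hR, hRW, ?_⟩
    rw [List.map_cons]
    refine Full.succ rfl ?_ ?_ (l := gs.map T) (k := -(c : ZMod 8191)⁻¹)
    · rw [h4] at hc' ⊢
      simp [hc']
    · rw [List.map_map]; exact hF

end Packed
end

noncomputable section

/-- `252 / binom(9, k)`. -/
def wt (k : ℕ) : ℕ := List.getD [252, 28, 7, 3, 2, 2, 3, 7, 28, 252] k 0

/-- The coefficient of `X ^ k` in `∏ (u + t X)` over the pairs `(u, t)` in a list. -/
def prodCoeff {B : Type*} [CommRing B] : List (B × B) → ℕ → B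
  | [], 0 => 1
  | [], _ + 1 => 0
  | (u, _) :: l, 0 => u * prodCoeff l 0
  | (u, t) :: l, k + 1 => u * prodCoeff l (k + 1) + t * prodCoeff l k

/-- `252` times the `k`-th coefficient of `∏ (x₁ - z_j x₂)` transformed by `[[p, q], [r, s]]`. -/
def orb {B : Type*} [CommRing B] (z : ℕ → B) (p q r s : B) (k : ℕ) : B :=
  wt k * prodCoeff ([0, 1, 2, 3, 4, 5, 6, 7, 8].map fun j => (p - z j * r, q - z j * s)) k

theorem prodCoeff_eq_zero {B : Type*} [CommRing B] {l : List (B × B)} {k : ℕ} (h : l.length < k) :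
    prodCoeff l k = 0 := by
  induction l generalizing k with
  | nil => cases k <;> simp [prodCoeff] at h ⊢
  | cons a l ih =>
    rcases k with _ | k
    · simp at h
    · rw [List.length_cons] at h
      rw [prodCoeff, ih (by omega), ih (by omega), mul_zero, mul_zero, add_zero]

theorem map_prodCoeff {B B' : Type*} [CommRing B] [CommRing B'] (f : B →+* B') (l : List (B × B))
    (k : ℕ) : f (prodCoeff l k) = prodCoeff (l.map fun x => (f x.1, f x.2)) k := by
  induction l generalizing k with
  | nil => cases k <;> simp [prodCoeff]
  | cons a l ih => cases k <;> simp [prodCoeff, ih]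

theorem map_orb {B B' : Type*} [CommRing B] [CommRing B'] (f : B →+* B') (z : ℕ → B) (p q r s : B)
    (k : ℕ) : f (orb z p q r s k) = orb (f ∘ z) (f p) (f q) (f r) (f s) k := by
  simp [orb, map_prodCoeff]

/-- Extension of nine parameters by zero. -/
def zext {K : Type*} [Zero K] (z : Fin 9 → K) (i : ℕ) : K := if h : i < 9 then z ⟨i, h⟩ else 0

/-- All products of `m` of the given values with total weight `w`. -/
def gen {B : Type*} (mul : B → B → B) : List (ℕ × B) → ℕ → ℕ → B → List B → List B :=
  List.rec (motive := fun _ => ℕ → ℕ → B → List B → List B)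
    (fun m w acc tail => Nat.rec (motive := fun _ => List B)
      (Nat.rec (motive := fun _ => List B) (acc :: tail) (fun _ _ => tail) w) (fun _ _ => tail) m)
    (fun a _ ih m => Nat.rec (motive := fun _ => ℕ → B → List B → List B)
      (fun w acc tail => Nat.rec (motive := fun _ => List B) (acc :: tail) (fun _ _ => tail) w)
      (fun m ihm w acc tail => Bool.rec (motive := fun _ => List B) tail
        (ih (Nat.succ m) w acc (Bool.rec (motive := fun _ => List B) tail
          (ihm (Nat.sub w a.1) (mul acc a.2) tail) (Nat.ble a.1 w)))
        (Nat.ble w (Nat.mul a.1 (Nat.succ m)))) m)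

/-- The sublist given by a bit mask. -/
def sel {B : Type*} (M : ℕ) (l : List B) : List B :=
  List.rec (motive := fun _ => ℕ → List B) (fun _ => [])
    (fun a _ ih M => Nat.rec (motive := fun _ => List B) (ih (Nat.div M 2))
      (fun _ _ => a :: ih (Nat.div M 2)) (Nat.land M 1)) l M

/-- Some products of given values. -/
structure MonoGroup where
  /-- indices of fixed factors -/
  pre : List ℕ
  /-- indices of variable factors -/
  vars : List ℕ
  /-- number of variable factors -/
  deg : ℕ
  /-- total weight of the variable factors -/
  wgt : ℕ
  /-- selection of products -/
  mask : ℕ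

/-- The products selected by a group. -/
def MonoGroup.run {B : Type*} (mul : B → B → B) (one : B) (val : ℕ → B) (g : MonoGroup) : List B :=
  sel g.mask (gen mul
    (List.rec (motive := fun _ => List (ℕ × B)) []
      (fun k _ ih => (Nat.mod k 10, val (Nat.mod k 10)) :: ih) g.vars) g.deg g.wgt
    (List.rec (motive := fun _ => B) one (fun k _ ih => mul ih (val (Nat.mod k 10))) g.pre) [])

/-- The products selected by a list of groups. -/
def groups {B : Type*} (mul : B → B → B) (one : B) (val : ℕ → B) (l : List MonoGroup) : List B :=
  List.rec (motive := fun _ => List B) [] (fun g _ ih => List.append (g.run mul one val) ih) l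

section rel
variable {B B' : Type*} {Q : B → B' → Prop} {mul : B → B → B} {mul' : B' → B' → B'}

theorem gen_rel {Q' : B → B' → Prop} (hm : ∀ a a' b b', Q a a' → Q' b b' → Q (mul a b) (mul' a' b'))
    {vs : List (ℕ × B)} {vs' : List (ℕ × B')}
    (hv : List.Forall₂ (fun x y => x.1 = y.1 ∧ Q' x.2 y.2) vs vs') (m w : ℕ) {acc acc' tail tail'}
    (ha : Q acc acc') (ht : List.Forall₂ Q tail tail') :
    List.Forall₂ Q (gen mul vs m w acc tail) (gen mul' vs' m w acc' tail') := by
  induction hv generalizing m w acc acc' tail tail' with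
  | nil =>
    rcases m with _ | m
    · rcases w with _ | w
      · exact .cons ha ht
      · exact ht
    · exact ht
  | @cons a b vs vs' hab hv ih =>
    induction m generalizing w acc acc' tail tail' with
    | zero =>
      rcases w with _ | w
      · exact .cons ha ht
      · exact ht
    | succ m ihm =>
      change List.Forall₂ Q (Bool.rec tail (gen mul vs (m + 1) w acc (Bool.rec tail
        (gen mul (a :: vs) m (Nat.sub w a.1) (mul acc a.2) tail) (Nat.ble a.1 w)))
          (Nat.ble w (Nat.mul a.1 (Nat.succ m))))
        (Bool.rec tail' (gen mul' vs' (m + 1) w acc' (Bool.rec tail'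
        (gen mul' (b :: vs') m (Nat.sub w b.1) (mul' acc' b.2) tail') (Nat.ble b.1 w)))
          (Nat.ble w (Nat.mul b.1 (Nat.succ m))))
      rw [← hab.1]
      cases Nat.ble w (Nat.mul a.1 (Nat.succ m)) with
      | false => exact ht
      | true =>
        refine ih _ _ ha ?_
        cases Nat.ble a.1 w with
        | false => exact ht
        | true => exact ihm _ (hm _ _ _ _ ha hab.2) ht

theorem sel_rel {l : List B} {l' : List B'} (h : List.Forall₂ Q l l') (M : ℕ) :
    List.Forall₂ Q (sel M l) (sel M l') := by
  induction h generalizing M with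
  | nil => exact .nil
  | @cons a b l l' hab h ih =>
    change List.Forall₂ Q (Nat.rec (sel (Nat.div M 2) l)
      (fun _ _ => a :: sel (Nat.div M 2) l) (Nat.land M 1)) (Nat.rec (sel (Nat.div M 2) l')
      (fun _ _ => b :: sel (Nat.div M 2) l') (Nat.land M 1))
    cases Nat.land M 1 with
    | zero => exact ih _
    | succ n => exact .cons hab (ih _)

theorem groups_rel (hm : ∀ a a' b b', Q a a' → Q b b' → Q (mul a b) (mul' a' b')) {one one'}
    (h1 : Q one one') {val : ℕ → B} {val' : ℕ → B'} (hv : ∀ k < 10, Q (val k) (val' k))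
    (l : List MonoGroup) : List.Forall₂ Q (groups mul one val l) (groups mul' one' val' l) := by
  induction l with
  | nil => exact .nil
  | cons g l ih =>
    refine List.rel_append ?_ ih
    refine sel_rel (gen_rel hm ?_ _ _ ?_ .nil) _
    · induction g.vars with
      | nil => exact .nil
      | cons k t ih => exact .cons ⟨rfl, hv _ (Nat.mod_lt _ (by norm_num))⟩ ih
    · induction g.pre with
      | nil => exact h1
      | cons k t ih => exact hm _ _ _ _ ih (hv _ (Nat.mod_lt _ (by norm_num)))

end rel

theorem mem_sel {B : Type*} {l : List B} {M : ℕ} {x : B} (h : x ∈ sel M l) : x ∈ l := by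
  induction l generalizing M with
  | nil => exact h
  | cons a l ih =>
    change x ∈ (Nat.rec (sel (Nat.div M 2) l) (fun _ _ => a :: sel (Nat.div M 2) l) (Nat.land M 1) :
      List B) at h
    cases hM : Nat.land M 1 with
    | zero => rw [hM] at h; exact List.mem_cons_of_mem _ (ih h)
    | succ n =>
      rw [hM] at h
      rcases List.mem_cons.1 h with rfl | h
      · exact List.mem_cons_self
      · exact List.mem_cons_of_mem _ (ih h)

/-- Membership of the products in graded pieces, for an abstract grading `S` acted on by `T`. -/
theorem mem_gen {B : Type*} {mul : B → B → B} {S : ℕ → ℕ → Set B} {T : ℕ → Set B}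
    (hS : ∀ m w k a b, a ∈ S m w → b ∈ T k → mul a b ∈ S (m + 1) (w + k))
    {vs : List (ℕ × B)} (hv : ∀ a ∈ vs, a.2 ∈ T a.1) {m w m₀ w₀ : ℕ} {acc : B} {tail : List B}
    (ha : acc ∈ S m₀ w₀) (ht : ∀ x ∈ tail, x ∈ S (m₀ + m) (w₀ + w)) :
    ∀ x ∈ gen mul vs m w acc tail, x ∈ S (m₀ + m) (w₀ + w) := by
  induction vs generalizing m w m₀ w₀ acc tail with
  | nil =>
    rcases m with _ | m
    · rcases w with _ | w
      · exact List.forall_mem_cons.2 ⟨ha, ht⟩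
      · exact ht
    · exact ht
  | cons a vs ih =>
    induction m generalizing w m₀ w₀ acc tail with
    | zero =>
      rcases w with _ | w
      · exact List.forall_mem_cons.2 ⟨ha, ht⟩
      · exact ht
    | succ m ihm =>
      change ∀ x ∈ (Bool.rec tail (gen mul vs (m + 1) w acc (Bool.rec tail
        (gen mul (a :: vs) m (Nat.sub w a.1) (mul acc a.2) tail) (Nat.ble a.1 w)))
          (Nat.ble w (Nat.mul a.1 (Nat.succ m))) : List B), _
      cases Nat.ble w (Nat.mul a.1 (Nat.succ m)) with
      | false => exact ht
      | true =>
        refine ih (fun b hb => hv b (List.mem_cons_of_mem _ hb)) ha ?_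
        cases hle : Nat.ble a.1 w with
        | false => exact ht
        | true =>
          have hle' := Nat.le_of_ble_eq_true hle
          have e1 : m₀ + (m + 1) = (m₀ + 1) + m := by omega
          have e2 : w₀ + w = (w₀ + a.1) + Nat.sub w a.1 := by
            change _ = _ + (w - a.1)
            omega
          rw [e1, e2]
          rw [e1, e2] at ht
          exact ihm (hS _ _ _ _ _ ha (hv a List.mem_cons_self)) ht
end

noncomputable section

/-- A polynomial in one variable, shifted by one of the parameters. -/
abbrev Co : Type := ℕ × List ℕ

/-- The polynomial with the given coefficients. -/
def listPoly (K : Type*) [CommRing K] : List ℕ → Polynomial K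
  | [] => 0
  | c :: l => Polynomial.C (c : K) + Polynomial.X * listPoly K l

/-- The value of an entry of an arc. -/
def coPoly {K : Type*} [CommRing K] (z : Fin 9 → K) (c : Co) : Polynomial K :=
  Polynomial.C (zext z c.1) + listPoly K c.2

/-- A polynomial curve, either in the orbit of a form or in the space of all forms. -/
inductive Arc
  | orbit (p q r s : Co)
  | free (l : List Co)

/-- An element of a list, by index. -/
def nth {B : Type*} (d : B) (l : List B) (i : ℕ) : B :=
  List.rec (motive := fun _ => ℕ → B) (fun _ => d)
    (fun a _ ih i => Nat.rec (motive := fun _ => B) a (fun i _ => ih i) i) l i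

/-- The values of the coordinates along an arc. -/
def Arc.val {K : Type*} [CommRing K] (z : Fin 9 → K) (a : Arc) (k : ℕ) : Polynomial K :=
  match a with
  | .orbit p q r s =>
    orb (fun i => Polynomial.C (zext z i)) (coPoly z p) (coPoly z q) (coPoly z r) (coPoly z s) k
  | .free l => coPoly z (nth (9, []) l k)

/-- Restriction of polynomials to an arc. -/
def Arc.ev {K : Type*} [CommRing K] (z : Fin 9 → K) (a : Arc) :
    MvPolynomial (Fin 10) ℤ →+* Polynomial K :=
  MvPolynomial.eval₂Hom (Int.castRingHom _) fun k => a.val z k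

theorem map_listPoly {K L : Type*} [CommRing K] [CommRing L] (f : K →+* L) (l : List ℕ) :
    (listPoly K l).map f = listPoly L l := by
  induction l with
  | nil => simp [listPoly]
  | cons a l ih => simp [listPoly, ih]

theorem map_zext {K L : Type*} [CommRing K] [CommRing L] (f : K →+* L) (z : Fin 9 → K) (i : ℕ) :
    f (zext z i) = zext (f ∘ z) i := by
  unfold zext; split_ifs <;> simp

theorem map_coPoly {K L : Type*} [CommRing K] [CommRing L] (f : K →+* L) (z : Fin 9 → K) (c : Co) :
    (coPoly z c).map f = coPoly (f ∘ z) c := by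
  simp [coPoly, map_listPoly, ← map_zext f]

theorem map_arc {K L : Type*} [CommRing K] [CommRing L] (f : K →+* L) (z : Fin 9 → K) (a : Arc)
    (k : ℕ) : (a.val z k).map f = a.val (f ∘ z) k := by
  cases a with
  | free l => exact map_coPoly _ _ _
  | orbit p q r s =>
    change Polynomial.mapRingHom f _ = _
    simp only [Arc.val]
    rw [map_orb]
    simp only [Polynomial.coe_mapRingHom, map_coPoly]
    congr 1
    ext1 i
    simp [← map_zext f]

theorem map_ev {K L : Type*} [CommRing K] [CommRing L] (f : K →+* L) (z : Fin 9 → K) (a : Arc)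
    (P : MvPolynomial (Fin 10) ℤ) : (a.ev z P).map f = a.ev (f ∘ z) P := by
  have : (Polynomial.mapRingHom f).comp (a.ev z) = a.ev (f ∘ z) := by
    apply MvPolynomial.ringHom_ext
    · intro n; simp
    · intro k; simp [Arc.ev, map_arc]
  exact congrArg (fun g => g P) this

/-- The coefficients along a list of arcs, `n` coefficients for each pair `(n, a)`. -/
def arcCoeffs {K : Type*} [CommRing K] (z : Fin 9 → K) (l : List (ℕ × Arc))
    (P : MvPolynomial (Fin 10) ℤ) : ℕ → K :=
  l.foldr (fun x g => Packed.cat x.1 (x.2.ev z P).coeff g) 0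

theorem map_cat {K L : Type*} (f : K → L) (n : ℕ) (g h : ℕ → K) :
    f ∘ Packed.cat n g h = Packed.cat n (f ∘ g) (f ∘ h) := by
  ext i; simp only [Packed.cat, Function.comp]; split_ifs <;> rfl

theorem map_coeffs {K L : Type*} [CommRing K] [CommRing L] (f : K →+* L) (z : Fin 9 → K)
    (l : List (ℕ × Arc)) (P : MvPolynomial (Fin 10) ℤ) :
    f ∘ arcCoeffs z l P = arcCoeffs (f ∘ z) l P := by
  induction l with
  | nil => ext; simp [arcCoeffs]
  | cons a l ih =>
    change f ∘ Packed.cat _ _ (arcCoeffs z l P) = Packed.cat _ _ (arcCoeffs (f ∘ z) l P)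
    rw [map_cat, ih, ← map_ev]
    congr 1
    ext i; simp

namespace Packed

/-- The point of the parameter space at which ranks are computed. -/
def zs : List ℕ := [3, 1417, 6210, 829, 5003, 7541, 2288, 4190, 3659]

/-- The point of the parameter space at which ranks are computed. -/
def z₀ (i : Fin 9) : ZMod 8191 := (nth 0 zs i : ℕ)

theorem zext_z₀ (i : ℕ) : zext z₀ i = (nth 0 zs i : ℕ) := by
  rw [zext]
  split_ifs with h
  · rfl
  · obtain ⟨j, rfl⟩ : ∃ j, i = j + 9 := ⟨i - 9, by omega⟩
    change 0 = ((0 : ℕ) : ZMod 8191)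
    simp

/-- The packed form of a list of coefficients. -/
def pack (l : List ℕ) : ℕ :=
  List.rec (motive := fun _ => ℕ) 0
    (fun c _ ih => Nat.add (Nat.mod c 8191) (Nat.shiftLeft ih 40)) l

/-- The first `n` coefficients of `coPoly`, packed. -/
def co (n : ℕ) (c : Co) : ℕ := red n (Nat.add (Nat.mod (nth 0 zs c.1) 8191) (pack c.2))

/-- Truncated product. -/
def mulN (n x y : ℕ) : ℕ := red n (Nat.mul x y)

/-- Truncated sum. -/
def addN (n x y : ℕ) : ℕ := red n (Nat.add x y)

/-- The coefficients of a product with `u + t X`; the last factor is the previous coefficient. -/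
def rowN (n u t : ℕ) (l : List ℕ) : ℕ → List ℕ :=
  List.rec (motive := fun _ => ℕ → List ℕ) (fun c => [mulN n t c])
    (fun b _ ih c => addN n (mulN n u b) (mulN n t c) :: ih b) l

/-- The coefficients of a product of linear factors. -/
def prodsN (n : ℕ) (l : List (ℕ × ℕ)) : List ℕ :=
  List.rec (motive := fun _ => List ℕ) [1] (fun a _ ih => rowN n a.1 a.2 ih 0) l

/-- Packed version of `prodCoeff`. -/
def prodN (n : ℕ) (l : List (ℕ × ℕ)) (k : ℕ) : ℕ := nth 0 (prodsN n l) k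

/-- Packed version of `orb`. -/
def orbN (n p q r s k : ℕ) : ℕ :=
  red n (Nat.mul (nth 0 [252, 28, 7, 3, 2, 2, 3, 7, 28, 252] k)
    (prodN n ([0, 1, 2, 3, 4, 5, 6, 7, 8].map fun j =>
      (addN n p (mulN n (Nat.sub 8191 (Nat.mod (nth 0 zs j) 8191)) r),
        addN n q (mulN n (Nat.sub 8191 (Nat.mod (nth 0 zs j) 8191)) s))) k))

/-- Packed version of `Arc.val`. -/
def arcN (n : ℕ) (a : Arc) (k : ℕ) : ℕ :=
  Arc.rec (motive := fun _ => ℕ) (fun p q r s => orbN n (co n p) (co n q) (co n r) (co n s) k)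
    (fun l => co n (nth (9, []) l k)) a

/-- The packed integer `X` represents the first `n` coefficients of `P`. -/
def PRep (n X : ℕ) (P : Polynomial (ZMod 8191)) : Prop := Rep n (2 ^ 14) X (trunc n P.coeff)

theorem Rep.congr {N b X : ℕ} {f g : ℕ → ZMod 8191} (h : Rep N b X f) (hf : f = g) : Rep N b X g :=
  hf ▸ h

theorem rep_const (N c b : ℕ) (hN : 0 < N) (hc : c < b) :
    Rep N b c (Polynomial.C (c : ZMod 8191)).coeff := by
  refine ⟨Polynomial.C c, fun i => ?_, fun i hi => ?_, by simp, fun i => ?_⟩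
  · rw [Polynomial.coeff_C]; split_ifs <;> omega
  · rw [Polynomial.coeff_C, if_neg (by omega)]
  · rw [Polynomial.coeff_C, Polynomial.coeff_C]; split_ifs <;> simp

theorem pack_rep (l : List ℕ) : Rep (l.length + 1) 8191 (pack l) (listPoly (ZMod 8191) l).coeff := by
  induction l with
  | nil => 
    refine Rep.congr (rep_const 1 0 8191 (by norm_num) (by norm_num)) ?_
    simp [listPoly]
  | cons c l ih =>
    have h1 : Rep 1 8191 (Nat.mod c 8191) (trunc 1 (Polynomial.C (c : ZMod 8191)).coeff) := by
      have h := rep_const 1 (c % 8191) 8191 (by norm_num) (Nat.mod_lt _ (by norm_num))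
      rw [ZMod.natCast_mod] at h
      rw [h.trunc_eq]
      exact h
    have h2 := Rep.cat h1 ih
    have h3 : (listPoly (ZMod 8191) (c :: l)).coeff =
        cat 1 (Polynomial.C (c : ZMod 8191)).coeff (listPoly (ZMod 8191) l).coeff := by
      ext i
      rw [listPoly, Polynomial.coeff_add, cat]
      rcases i with _ | i
      · simp
      · simp [Polynomial.coeff_X_mul]
    rw [h3]
    exact h2.mono (by simp; omega) le_rfl

theorem PRep.of_rep {N b X n : ℕ} {P : Polynomial (ZMod 8191)} (h : Rep N b X P.coeff)
    (hb : b ≤ 2 ^ 40) : PRep n (red n X) P := h.red n hb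

theorem trunc_add {K : Type*} [AddZeroClass K] (n : ℕ) (f g : ℕ → K) :
    trunc n (f + g) = trunc n f + trunc n g := by
  ext i; simp only [trunc, Pi.add_apply]; split_ifs <;> simp

theorem PRep.add {n X Y : ℕ} {P R : Polynomial (ZMod 8191)} (h : PRep n X P) (h' : PRep n Y R) :
    PRep n (addN n X Y) (P + R) := by
  have := (Rep.add h h').red n (by norm_num)
  rw [← trunc_add, trunc_trunc] at this
  exact this.congr (by ext i; simp [trunc])

theorem PRep.mul {n X Y : ℕ} {P R : Polynomial (ZMod 8191)} (h : PRep n X P) (h' : PRep n Y R)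
    (hn : 0 < n) (hn' : n ≤ 4096) : PRep n (mulN n X Y) (P * R) := by
  have := (Rep.mul h h' (by positivity)).red n (by norm_num; omega)
  refine this.congr ?_
  ext i
  simp only [trunc]
  split_ifs with hi
  · rw [Polynomial.coeff_mul]
    refine Finset.sum_congr rfl fun x hx => ?_
    have := Finset.HasAntidiagonal.mem_antidiagonal.1 hx
    rw [if_pos (by omega), if_pos (by omega)]
  · rfl

theorem PRep.const (n c : ℕ) (hn : 0 < n) (hc : c < 2 ^ 14) : PRep n c (Polynomial.C (c : ZMod 8191)) := by
  have h := rep_const n c (2 ^ 14) hn hc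
  rw [PRep, h.trunc_eq]
  exact h

theorem PRep.natMul {n X : ℕ} {P : Polynomial (ZMod 8191)} (h : PRep n X P) (c : ℕ) (hc : c < 2 ^ 14) :
    PRep n (red n (Nat.mul c X)) (c * P) := by
  have := (Rep.smul h hc).red n (by norm_num)
  refine this.congr ?_
  ext i
  rw [← Polynomial.C_eq_natCast]
  simp only [trunc, Polynomial.coeff_C_mul, Pi.smul_apply, smul_eq_mul]
  split_ifs <;> rfl

theorem co_rep (n : ℕ) (c : Co) : PRep n (co n c) (coPoly z₀ c) := by
  rw [coPoly, zext_z₀, co]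
  have h1 := rep_const (c.2.length + 1) (nth 0 zs c.1 % 8191) 8191 (by omega)
    (Nat.mod_lt _ (by norm_num))
  rw [ZMod.natCast_mod] at h1
  refine PRep.of_rep (b := 8191 + 8191) (N := c.2.length + 1) ?_ (by norm_num)
  refine (h1.add (pack_rep c.2)).congr ?_
  ext i; simp

theorem PRep.zero (n : ℕ) (hn : 0 < n) : PRep n 0 0 := by
  simpa using PRep.const n 0 hn (by norm_num)

theorem rowN_rep {n : ℕ} (hn : 0 < n) (hn' : n ≤ 4096) {u t : ℕ} {U T : Polynomial (ZMod 8191)}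
    (hu : PRep n u U) (ht : PRep n t T) {l : List ℕ} {g : ℕ → Polynomial (ZMod 8191)}
    (hl : ∀ k, PRep n (nth 0 l k) (g k)) (hg : ∀ k, l.length ≤ k → g k = 0) {c : ℕ}
    {C : Polynomial (ZMod 8191)} (hc : PRep n c C) (k : ℕ) :
    PRep n (nth 0 (rowN n u t l c) k) (U * g k + T * Nat.rec C (fun i _ => g i) k) := by
  induction l generalizing g c C k with
  | nil =>
    rcases k with _ | k
    · have := ht.mul hc hn hn'
      rw [hg 0 (by simp), mul_zero, zero_add]
      exact this
    · have := PRep.zero n hn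
      rw [hg _ (by simp : ([] : List ℕ).length ≤ k + 1), mul_zero, zero_add]
      change PRep n 0 (T * g k)
      rw [hg k (by simp), mul_zero]
      exact this
  | cons b l ih =>
    rcases k with _ | k
    · exact (hu.mul (hl 0) hn hn').add (ht.mul hc hn hn')
    · have := ih (g := fun k => g (k + 1)) (fun k => hl (k + 1))
        (fun k hk => hg _ (by simpa using hk)) (hl 0) k
      rcases k with _ | k <;> exact this

theorem prodsN_length (n : ℕ) (l : List (ℕ × ℕ)) : (prodsN n l).length = l.length + 1 := by
  have h (u t : ℕ) (l : List ℕ) (c : ℕ) : (rowN n u t l c).length = l.length + 1 := by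
    induction l generalizing c with
    | nil => rfl
    | cons b l ih => exact congrArg (· + 1) (ih b)
  induction l with
  | nil => rfl
  | cons a l ih => exact (h _ _ _ _).trans (congrArg (· + 1) ih)

theorem prodN_rep (n : ℕ) (hn : 0 < n) (hn' : n ≤ 4096) {l : List (ℕ × ℕ)}
    {l' : List (Polynomial (ZMod 8191) × Polynomial (ZMod 8191))}
    (h : List.Forall₂ (fun x y => PRep n x.1 y.1 ∧ PRep n x.2 y.2) l l') (k : ℕ) :
    PRep n (prodN n l k) (prodCoeff l' k) := by
  induction h generalizing k with
  | nil =>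
    rcases k with _ | k
    · have := PRep.const n 1 hn (by norm_num)
      rwa [Nat.cast_one, Polynomial.C_1] at this
    · exact PRep.zero n hn
  | @cons a b l l' hab h ih =>
    have := rowN_rep hn hn' hab.1 hab.2 ih (fun k hk => prodCoeff_eq_zero (by
      rw [prodsN_length, h.length_eq] at hk; omega)) (PRep.zero n hn) k
    rcases k with _ | k
    · change PRep n _ (_ + _ * 0) at this
      rw [mul_zero, add_zero] at this
      exact this
    · exact this

theorem negz_rep (n j : ℕ) (hn : 0 < n) : PRep n (Nat.sub 8191 (Nat.mod (nth 0 zs j) 8191))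
    (-Polynomial.C (zext z₀ j)) := by
  have := PRep.const n (8191 - nth 0 zs j % 8191) hn (by omega)
  rw [Nat.cast_sub (Nat.mod_lt _ (by norm_num)).le, ZMod.natCast_mod, ZMod.natCast_self,
    zero_sub, Polynomial.C_neg] at this
  rw [zext_z₀]
  exact this

theorem wt_eq (k : ℕ) : wt k = nth 0 [252, 28, 7, 3, 2, 2, 3, 7, 28, 252] k := by
  rcases lt_or_ge k 10 with h | h
  · interval_cases k <;> rfl
  · obtain ⟨j, rfl⟩ : ∃ j, k = j + 10 := ⟨k - 10, by omega⟩
    rfl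

theorem wt_lt (k : ℕ) : wt k < 2 ^ 14 := by
  rcases lt_or_ge k 10 with h | h
  · interval_cases k <;> norm_num [wt]
  · rw [wt, List.getD_eq_default _ _ (by simpa using h)]; norm_num

theorem orbN_rep {n : ℕ} (hn : 0 < n) (hn' : n ≤ 4096) {p q r s : ℕ}
    {p' q' r' s' : Polynomial (ZMod 8191)} (hp : PRep n p p') (hq : PRep n q q') (hr : PRep n r r')
    (hs : PRep n s s') (k : ℕ) :
    PRep n (orbN n p q r s k) (orb (fun i => Polynomial.C (zext z₀ i)) p' q' r' s' k) := by
  rw [orb, orbN, ← wt_eq]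
  refine PRep.natMul (prodN_rep n hn hn' ?_ k) _ (wt_lt k)
  refine List.forall₂_map_left_iff.2 (List.forall₂_map_right_iff.2 (List.forall₂_same.2 ?_))
  intro j _
  rw [sub_eq_add_neg, sub_eq_add_neg, ← neg_mul, ← neg_mul]
  exact ⟨hp.add ((negz_rep n j hn).mul hr hn hn'), hq.add ((negz_rep n j hn).mul hs hn hn')⟩

theorem arcN_rep {n : ℕ} (hn : 0 < n) (hn' : n ≤ 4096) (a : Arc) (k : ℕ) :
    PRep n (arcN n a k) (a.val z₀ k) := by
  cases a with
  | free l => exact co_rep n _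
  | orbit p q r s => exact orbN_rep hn hn' (co_rep n p) (co_rep n q) (co_rep n r) (co_rep n s) k

end Packed

/-- Coordinate functions. -/
def coordVar (K : Type*) [CommRing K] (k : ℕ) : MvPolynomial (Fin 10) K :=
  MvPolynomial.X (Fin.ofNat 10 k)

/-- The monomials selected by a list of groups. -/
def monos (K : Type*) [CommRing K] (l : List MonoGroup) : List (MvPolynomial (Fin 10) K) :=
  groups (· * ·) 1 (coordVar K) l

namespace Packed

/-- The values of the monomials along an arc. -/
def evN (l : List MonoGroup) (n : ℕ) (a : Arc) : List ℕ :=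
  groups (mulN n) 1 (arcN n a) l

theorem evN_rep {n : ℕ} (hn : 0 < n) (hn' : n ≤ 4096) (a : Arc) (l : List MonoGroup) :
    List.Forall₂ (fun X P => PRep n X (a.ev z₀ P)) (evN l n a) (monos ℤ l) := by
  refine groups_rel ?_ ?_ ?_ l
  · intro x x' y y' h h'
    rw [map_mul]
    exact h.mul h' hn hn'
  · rw [map_one]
    simpa using PRep.const n 1 hn (by norm_num)
  · intro k hk
    have : a.ev z₀ (coordVar ℤ k) = a.val z₀ k := by
      simp [Arc.ev, coordVar, Nat.mod_eq_of_lt hk]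
    rw [this]
    exact arcN_rep hn hn' a k

/-- Entrywise combination of two lists. -/
def zipR {A B C : Type*} (f : A → B → C) (l : List A) (l' : List B) : List C :=
  List.rec (motive := fun _ => List B → List C) (fun _ => [])
    (fun a _ ih l' => List.rec (motive := fun _ => List C) [] (fun b t _ => f a b :: ih t) l') l l'

/-- Concatenation of rows. -/
def zipCat (n : ℕ) (l l' : List ℕ) : List ℕ :=
  zipR (fun x y => Nat.add x (Nat.shiftLeft y (Nat.mul 40 n))) l l'

/-- The rows of coefficients of monomials along arcs. -/
def rows (l : List MonoGroup) (arcs : List (ℕ × Arc)) : List ℕ :=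
  List.rec (motive := fun _ => List ℕ) []
    (fun a t ih => List.rec (motive := fun _ => List ℕ) (evN l a.1 a.2)
      (fun _ _ _ => zipCat a.1 (evN l a.1 a.2) ih) t) arcs

/-- Total length. -/
def slots {A : Type*} (l : List (ℕ × A)) : ℕ :=
  List.rec (motive := fun _ => ℕ) 0 (fun a _ ih => Nat.add a.1 ih) l

/-- Validity of slot counts. -/
def slotsOk {A : Type*} (l : List (ℕ × A)) : Bool :=
  List.rec (motive := fun _ => Bool) true
    (fun a _ ih => and (Nat.ble 1 a.1) (and (Nat.ble a.1 4096) ih)) l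

theorem zipCat_rep {n N b : ℕ} {α : Type*} {l l' : List ℕ} {P : List α} {f g : α → ℕ → ZMod 8191}
    (h : List.Forall₂ (fun X x => Rep n b X (trunc n (f x))) l P)
    (h' : List.Forall₂ (fun X x => Rep N b X (g x)) l' P) :
    List.Forall₂ (fun X x => Rep (n + N) b X (cat n (f x) (g x))) (zipCat n l l') P := by
  induction h generalizing l' with
  | nil => exact .nil
  | cons h1 h2 ih =>
    cases h' with
    | cons h3 h4 => exact .cons (h1.cat h3) (ih h4)

theorem rows_rep {arcs : List (ℕ × Arc)} (h : slotsOk arcs = true) (h0 : arcs ≠ [])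
    (l : List MonoGroup) :
    List.Forall₂ (fun X P => Rep (slots arcs) (2 ^ 14) X (arcCoeffs z₀ arcs P)) (rows l arcs)
      (monos ℤ l) := by
  induction arcs with
  | nil => exact absurd rfl h0
  | cons a t ih =>
    have h' : (Nat.ble 1 a.1 && (Nat.ble a.1 4096 && slotsOk t)) = true := h
    rw [Bool.and_eq_true, Bool.and_eq_true] at h'
    have h1 := evN_rep (Nat.le_of_ble_eq_true h'.1) (Nat.le_of_ble_eq_true h'.2.1) a.2 l
    rcases t with _ | ⟨b, t⟩
    · refine h1.imp fun X P hP => ?_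
      have : arcCoeffs z₀ [a] P = trunc a.1 (a.2.ev z₀ P).coeff := by
        ext i; simp [arcCoeffs, cat, trunc]
      rw [this]
      exact hP
    · exact zipCat_rep h1 (ih h'.2.2 (by simp))

/-- Check that the monomials have independent restrictions. -/
def check (l : List MonoGroup) (arcs : List (ℕ × Arc)) (n : ℕ) : Bool :=
  and (slotsOk arcs) (and (Nat.ble 1 (slots arcs)) (and (Nat.ble n 8000)
    (elim (slots arcs) n (rows l arcs) (fun x => x) fun _ => true)))

theorem fullOn_of_check {l : List MonoGroup} {arcs : List (ℕ × Arc)} {n : ℕ}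
    (h : check l arcs n = true) :
    FullOn {x | x ∈ (monos ℤ l).map (arcCoeffs z₀ arcs)} (Finset.range n) := by
  have h' : (slotsOk arcs && (Nat.ble 1 (slots arcs) && (Nat.ble n 8000 && elim (slots arcs) n (rows l arcs)
    (fun x => x) fun _ => true))) = true := h
  simp only [Bool.and_eq_true] at h'
  obtain ⟨h1, h2, h3, h4⟩ := h'
  have h0 : arcs ≠ [] := by
    rintro rfl
    exact absurd h2 (by decide)
  have h5 := Nat.le_of_ble_eq_true h3
  obtain ⟨R, W, -, -, hF⟩ := elim_spec (T := LinearMap.id) (b := 2 ^ 14) (b' := 2 ^ 14) h4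
    (List.forall₂_map_right_iff.2 (rows_rep h1 h0 l)) (fun X g hX => hX) (by omega)
  intro a
  obtain ⟨u, hu, hua⟩ := hF.1 a
  refine ⟨u, ?_, fun k hk => hua k (Finset.mem_range.1 hk)⟩
  simpa using hu

end Packed

/-- Generic lower bound for the rank of the restriction of a family of monomials to arcs. -/
theorem gen_of_check {l : List MonoGroup} {arcs : List (ℕ × Arc)} {n : ℕ}
    (h : Packed.check l arcs n = true) :
    Gen fun z => n ≤ Module.finrank ℂ
      (Submodule.span ℂ {x | x ∈ (monos ℤ l).map (arcCoeffs z arcs)}) := by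
  have := gen_rank (fun K _ z => (monos ℤ l).map (arcCoeffs z arcs)) (fun K L _ _ f z => by
    rw [List.map_map]
    exact List.map_congr_left fun P _ => (map_coeffs f z arcs P).symm) _ _
    (Packed.fullOn_of_check h)
  simpa using this
end

noncomputable section

/-- A family of monomials to be multiplied by the variable `idx`, with the arcs on which the family
is tested. -/
structure Blk where
  /-- index of the multiplier -/
  idx : ℕ
  /-- the family of monomials -/
  gs : List MonoGroup
  /-- the arcs -/
  arcs : List (ℕ × Arc)

/-- The coefficients of `X_idx * P` along `sarcs` and of `P` along the arcs of the block. -/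
def Blk.vec {K : Type*} [CommRing K] (z : Fin 9 → K) (sarcs : List (ℕ × Arc)) (t : ℕ) (b : Blk)
    (P : MvPolynomial (Fin 10) ℤ) (k : ℕ × ℕ) : K :=
  if k.1 = 0 then arcCoeffs z sarcs (coordVar ℤ b.idx * P) k.2 else
    if k.1 = t + 1 then arcCoeffs z b.arcs P k.2 else 0

/-- The rows for all blocks. -/
def blkVecs {K : Type*} [CommRing K] (z : Fin 9 → K) (sarcs : List (ℕ × Arc)) :
    List Blk → List (ℕ × ℕ → K)
  | [] => []
  | b :: l => (monos ℤ b.gs).map (b.vec z sarcs l.length) ++ blkVecs z sarcs l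

theorem map_blkVecs {K L : Type*} [CommRing K] [CommRing L] (f : K →+* L) (z : Fin 9 → K)
    (sarcs : List (ℕ × Arc)) (l : List Blk) :
    blkVecs (f ∘ z) sarcs l = (blkVecs z sarcs l).map (f ∘ ·) := by
  induction l with
  | nil => rfl
  | cons b l ih =>
    rw [blkVecs, blkVecs, List.map_append, ih, List.map_map]
    congr 1
    refine List.map_congr_left fun P _ => ?_
    ext k
    simp only [Blk.vec, Function.comp, ← map_coeffs f]
    split_ifs <;> simp

namespace Packed

/-- The rows of a block. -/
def blkRows (sarcs : List (ℕ × Arc)) (b : Blk) : List ℕ :=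
  zipCat (slots b.arcs) (rows b.gs b.arcs)
    (rows (b.gs.map fun g => ⟨b.idx :: g.pre, g.vars, g.deg, g.wgt, g.mask⟩) sarcs)

/-- Blockwise elimination, with a final elimination of the pooled residual rows. -/
def blkElim (sarcs : List (ℕ × Arc)) (n : ℕ) : List Blk → List ℕ → Bool :=
  List.rec (motive := fun _ => List ℕ → Bool)
    (fun pool => elim (slots sarcs) n pool (fun x => x) fun _ => true)
    (fun b _ ih pool => and (and (slotsOk b.arcs) (and (Nat.ble 1 (slots b.arcs))
      (Nat.ble (slots b.arcs) 8000)))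
      (elim (Nat.add (slots b.arcs) (slots sarcs)) (slots b.arcs) (blkRows sarcs b) (fun x => x)
        fun R => ih (List.append (R.map (red (slots sarcs))) pool)))

/-- Check of the independence of the rows `blkVecs`. -/
def blkCheck (sarcs : List (ℕ × Arc)) (n : ℕ) (l : List Blk) : Bool :=
  and (slotsOk sarcs) (and (Nat.ble 1 (slots sarcs)) (and (Nat.ble n (slots sarcs))
    (and (Nat.ble n 8000) (blkElim sarcs n l []))))

/-- The coordinates on which `blkVecs` are checked to be independent. -/
def blkSet (n : ℕ) : List Blk → Finset (ℕ × ℕ)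
  | [] => (Finset.range n).map ⟨fun k => (0, k), fun _ _ h => (Prod.ext_iff.1 h).2⟩
  | b :: l => blkSet n l ∪
      (Finset.range (slots b.arcs)).map ⟨fun k => (l.length + 1, k), fun _ _ h => (Prod.ext_iff.1 h).2⟩

theorem fst_le_of_mem_blkSet {n : ℕ} {l : List Blk} {k : ℕ × ℕ} (h : k ∈ blkSet n l) :
    k.1 ≤ l.length := by
  induction l with
  | nil =>
    obtain ⟨i, -, rfl⟩ := Finset.mem_map.1 h
    exact le_rfl
  | cons b l ih =>
    rcases Finset.mem_union.1 h with h | h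
    · exact (ih h).trans (by simp)
    · obtain ⟨i, -, rfl⟩ := Finset.mem_map.1 h
      exact le_rfl

theorem card_blkSet (n : ℕ) (l : List Blk) :
    (blkSet n l).card = n + (l.map fun b => slots b.arcs).sum := by
  induction l with
  | nil => simp [blkSet]
  | cons b l ih =>
    rw [blkSet, Finset.card_union_of_disjoint, ih]
    · simp; ring
    · refine Finset.disjoint_left.2 fun k h h' => ?_
      have := fst_le_of_mem_blkSet h
      obtain ⟨i, -, rfl⟩ := Finset.mem_map.1 h'
      exact absurd this (Nat.not_succ_le_self _)

theorem monos_cons (i : ℕ) (l : List MonoGroup) :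
    monos ℤ (l.map fun g => ⟨i :: g.pre, g.vars, g.deg, g.wgt, g.mask⟩) =
      (monos ℤ l).map (coordVar ℤ i * ·) := by
  rw [eq_comm, ← List.forall₂_eq_eq_eq, List.forall₂_map_left_iff]
  induction l with
  | nil => exact .nil
  | cons g l ih =>
    refine List.rel_append ?_ ih
    refine sel_rel (gen_rel (Q := fun x y => coordVar ℤ i * x = y) (Q' := (· = ·)) ?_ ?_ _ _ ?_
      .nil) _
    · rintro a _ b _ rfl rfl
      exact (mul_assoc _ _ _).symm
    · exact List.forall₂_same.2 fun _ _ => ⟨rfl, rfl⟩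
    · have : coordVar ℤ i = coordVar ℤ (Nat.mod i 10) := by
        simp only [coordVar]
        congr 1
        exact Fin.ext (Nat.mod_mod i 10).symm
      rw [this, mul_comm]

/-- Restriction of a row of `blkVecs` to the coordinates of one block. -/
def blkProj {K : Type*} [Field K] (n t : ℕ) : (ℕ × ℕ → K) →ₗ[K] (ℕ → K) where
  toFun u := cat n (fun k => u (t, k)) fun k => u (0, k)
  map_add' u v := by ext k; simp only [cat, Pi.add_apply]; split_ifs <;> rfl
  map_smul' c u := by ext k; simp only [cat, Pi.smul_apply, RingHom.id_apply]; split_ifs <;> rfl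

theorem blk_lift {K : Type*} [Field K] (z : Fin 9 → K) (sarcs : List (ℕ × Arc)) (t : ℕ) (b : Blk)
    {x : ℕ → K} (hx : x ∈ Submodule.span K {x | x ∈ (monos ℤ b.gs).map fun P =>
      cat (slots b.arcs) (arcCoeffs z b.arcs P) (arcCoeffs z sarcs (coordVar ℤ b.idx * P))}) :
    ∃ u ∈ Submodule.span K {x | x ∈ (monos ℤ b.gs).map (b.vec z sarcs t)},
      (∀ k < slots b.arcs, u (t + 1, k) = x k) ∧ (∀ k, u (0, k) = x (slots b.arcs + k)) ∧
        ∀ j k, j ≠ 0 → j ≠ t + 1 → u (j, k) = 0 := by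
  have h1 : {x | x ∈ (monos ℤ b.gs).map fun P =>
      cat (slots b.arcs) (arcCoeffs z b.arcs P) (arcCoeffs z sarcs (coordVar ℤ b.idx * P))} =
      blkProj (slots b.arcs) (t + 1) '' {x | x ∈ (monos ℤ b.gs).map (b.vec z sarcs t)} := by
    ext y
    simp only [Set.mem_ofPred_eq, List.mem_map, Set.mem_image, exists_exists_and_eq_and]
    have : ∀ P, blkProj (slots b.arcs) (t + 1) (b.vec z sarcs t P) =
        cat (slots b.arcs) (arcCoeffs z b.arcs P) (arcCoeffs z sarcs (coordVar ℤ b.idx * P)) := by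
      intro P; ext k; simp [blkProj, Blk.vec]
    simp only [this]
  rw [h1, ← Submodule.map_span] at hx
  obtain ⟨u, hu, rfl⟩ := hx
  refine ⟨u, hu, fun k hk => by simp [blkProj, cat, hk], fun k => by simp [blkProj, cat], ?_⟩
  intro j k hj hj'
  induction hu using Submodule.span_induction with
  | mem x hx =>
    obtain ⟨P, -, rfl⟩ := List.mem_map.1 hx
    simp [Blk.vec, hj, hj']
  | zero => rfl
  | add x y _ _ h h' => simp [h, h']
  | smul c x _ h => simp [h]

theorem rows_ne_nil {arcs : List (ℕ × Arc)} (h : 1 ≤ slots arcs) : arcs ≠ [] := by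
  rintro rfl
  exact absurd h (by decide)

theorem blkElim_spec {sarcs : List (ℕ × Arc)} {n : ℕ} (hs : slotsOk sarcs = true)
    (hs1 : 1 ≤ slots sarcs) (hn : n ≤ slots sarcs) (hn' : n ≤ 8000) {l : List Blk} {pool : List ℕ}
    {F : List (ℕ → ZMod 8191)} (h : blkElim sarcs n l pool = true)
    (hF : List.Forall₂ (Rep (slots sarcs) (2 ^ 14)) pool F) (a : ℕ × ℕ → ZMod 8191) :
    ∃ u ∈ Submodule.span (ZMod 8191) {x | x ∈ blkVecs z₀ sarcs l},
      ∃ s ∈ Submodule.span (ZMod 8191) {x | x ∈ F},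
      (∀ k < n, u (0, k) + s k = a (0, k)) ∧ (∀ k ∈ blkSet n l, k.1 ≠ 0 → u k = a k) ∧
        ∀ j k, l.length < j → u (j, k) = 0 := by
  induction l generalizing pool F a with
  | nil =>
    obtain ⟨R, W, -, -, hW⟩ := elim_spec (T := LinearMap.id) (b := 2 ^ 14) (b' := 2 ^ 14) h hF
      (fun X g hX => hX) (by omega)
    obtain ⟨s, hs, hsa⟩ := hW.1 fun k => a (0, k)
    refine ⟨0, zero_mem _, s, by simpa using hs, fun k hk => by simpa using hsa k hk, ?_, by simp⟩
    intro k hk hk0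
    exact absurd (Nat.le_zero.1 (fst_le_of_mem_blkSet hk)) hk0
  | cons b l ih =>
    have h' : (((slotsOk b.arcs && (Nat.ble 1 (slots b.arcs) && Nat.ble (slots b.arcs) 8000))) &&
      (elim (Nat.add (slots b.arcs) (slots sarcs)) (slots b.arcs) (blkRows sarcs b) (fun x => x)
        fun R => blkElim sarcs n l (List.append (R.map (red (slots sarcs))) pool))) = true := h
    simp only [Bool.and_eq_true] at h'
    obtain ⟨⟨hb, hb1, hb2⟩, h⟩ := h'
    have hb1 := Nat.le_of_ble_eq_true hb1
    have hb2 := Nat.le_of_ble_eq_true hb2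
    have e1 := rows_rep hb (rows_ne_nil hb1) b.gs
    have e2 := rows_rep hs (rows_ne_nil hs1)
      (b.gs.map fun g => ⟨b.idx :: g.pre, g.vars, g.deg, g.wgt, g.mask⟩)
    rw [monos_cons, List.forall₂_map_right_iff] at e2
    have e3 := zipCat_rep (n := slots b.arcs) (N := slots sarcs) (b := 2 ^ 14)
      (e1.imp fun X P hP => by rwa [hP.trunc_eq]) e2
    obtain ⟨R, W, hc, hRW, hW⟩ := elim_spec (T := LinearMap.id) (b := 2 ^ 14) (b' := 2 ^ 14) h
      (List.forall₂_map_right_iff.2 e3) (fun X g hX => hX) (by omega)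
    simp only [LinearMap.id_coe, List.map_id_fun, id_eq] at hW
    obtain ⟨x, hx, hxa⟩ := hW.1 fun k => a (l.length + 1, k)
    obtain ⟨u₀, hu₀, h01, h02, h03⟩ := blk_lift z₀ sarcs l.length b hx
    have hpool : List.Forall₂ (Rep (slots sarcs) (2 ^ 14))
        (List.append (R.map (red (slots sarcs))) pool) (W.map (trunc (slots sarcs)) ++ F) :=
      List.rel_append (List.forall₂_map_left_iff.2 (List.forall₂_map_right_iff.2
        (hRW.imp fun X s hX => hX.red _ le_rfl))) hF
    obtain ⟨u, hu, s, hs, h1, h2, h3⟩ := ih hc hpool (a - u₀)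
    have h4 : {x | x ∈ W.map (trunc (slots sarcs)) ++ F} =
        {x | x ∈ W.map (trunc (slots sarcs))} ∪ {x | x ∈ F} := by
      ext y; simp
    rw [h4, Submodule.span_union] at hs
    obtain ⟨sW, hsW, sF, hsF, rfl⟩ := Submodule.mem_sup.1 hs
    have h5 : ∃ u₁ ∈ Submodule.span (ZMod 8191) {x | x ∈ (monos ℤ b.gs).map (b.vec z₀ sarcs l.length)},
        (∀ k < n, u₁ (0, k) = sW k) ∧ (∀ k < slots b.arcs, u₁ (l.length + 1, k) = 0) ∧
        ∀ j k, j ≠ 0 → j ≠ l.length + 1 → u₁ (j, k) = 0 := by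
      clear h1 hs
      induction hsW using Submodule.span_induction with
      | mem x hx =>
        obtain ⟨s, hs, rfl⟩ := List.mem_map.1 hx
        obtain ⟨y, hy, hy1, hy2⟩ := hW.2 s hs
        obtain ⟨u₁, hu₁, h11, h12, h13⟩ := blk_lift z₀ sarcs l.length b hy
        refine ⟨u₁, hu₁, fun k hk => ?_, fun k hk => ?_, h13⟩
        · rw [h12, hy2, trunc, if_pos (hk.trans_le hn)]
        · rw [h11 k hk, hy1 k hk]
      | zero => exact ⟨0, zero_mem _, by simp⟩
      | add x y _ _ hx hy =>
        obtain ⟨u, hu, h1, h2, h3⟩ := hx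
        obtain ⟨v, hv, h1', h2', h3'⟩ := hy
        refine ⟨u + v, add_mem hu hv, fun k hk => ?_, fun k hk => ?_, fun j k hj hj' => ?_⟩
        · simp [h1 k hk, h1' k hk]
        · simp [h2 k hk, h2' k hk]
        · simp [h3 j k hj hj', h3' j k hj hj']
      | smul c x _ hx =>
        obtain ⟨u, hu, h1, h2, h3⟩ := hx
        refine ⟨c • u, Submodule.smul_mem _ _ hu, fun k hk => ?_, fun k hk => ?_,
          fun j k hj hj' => ?_⟩
        · simp [h1 k hk]
        · simp [h2 k hk]
        · simp [h3 j k hj hj']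
    obtain ⟨u₁, hu₁, h11, h12, h13⟩ := h5
    refine ⟨u₀ + u + u₁, add_mem (add_mem ?_ ?_) ?_, sF, hsF, fun k hk => ?_, fun k hk hk0 => ?_,
      fun j k hj => ?_⟩
    · exact Submodule.span_mono (fun x hx => List.mem_append_left _ hx) hu₀
    · exact Submodule.span_mono (fun x hx => List.mem_append_right _ hx) hu
    · exact Submodule.span_mono (fun x hx => List.mem_append_left _ hx) hu₁
    · have := h1 k hk
      simp only [Pi.add_apply, Pi.sub_apply] at this ⊢
      rw [h11 k hk]
      linear_combination this
    · rcases Finset.mem_union.1 hk with hk | hk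
      · have h6 := fst_le_of_mem_blkSet hk
        have h7 := h2 k hk hk0
        have h8 : u₁ k = 0 := h13 k.1 k.2 hk0 (by omega)
        simp [h7, h8]
      · obtain ⟨i, hi, rfl⟩ := Finset.mem_map.1 hk
        have hi := Finset.mem_range.1 hi
        change u₀ (l.length + 1, i) + u (l.length + 1, i) + u₁ (l.length + 1, i) =
          a (l.length + 1, i)
        rw [h3 _ _ (Nat.lt_succ_self _), h12 i hi, h01 i hi, hxa i hi]
        simp
    · have hj : l.length + 1 < j := hj
      simp [h03 j k (by omega) (by omega), h3 j k (by omega), h13 j k (by omega) (by omega)]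

theorem fullOn_of_blkCheck {sarcs : List (ℕ × Arc)} {n : ℕ} {l : List Blk}
    (h : blkCheck sarcs n l = true) :
    FullOn {x | x ∈ blkVecs z₀ sarcs l} (blkSet n l) := by
  have h' : (slotsOk sarcs && (Nat.ble 1 (slots sarcs) && (Nat.ble n (slots sarcs) &&
    (Nat.ble n 8000 && (blkElim sarcs n l []))))) = true := h
  simp only [Bool.and_eq_true] at h'
  obtain ⟨h1, h2, h3, h4, h5⟩ := h'
  intro a
  obtain ⟨u, hu, s, hs, e1, e2, -⟩ := blkElim_spec h1 (Nat.le_of_ble_eq_true h2)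
    (Nat.le_of_ble_eq_true h3) (Nat.le_of_ble_eq_true h4) h5 .nil a
  refine ⟨u, hu, fun k hk => ?_⟩
  by_cases hk0 : k.1 = 0
  · have hs0 : s = 0 := by simpa using hs
    have hkn : k.2 < n := by
      clear h h5 hu e1 e2
      induction l with
      | nil =>
        obtain ⟨i, hi, rfl⟩ := Finset.mem_map.1 hk
        exact Finset.mem_range.1 hi
      | cons b l ih =>
        rcases Finset.mem_union.1 hk with hk | hk
        · exact ih hk
        · obtain ⟨i, -, rfl⟩ := Finset.mem_map.1 hk
          exact absurd hk0 (Nat.succ_ne_zero _)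
    have := e1 k.2 hkn
    rw [hs0, Pi.zero_apply, add_zero, ← hk0] at this
    exact this
  · exact e2 k hk hk0

end Packed

/-- Generic lower bound for the rank of `blkVecs`. -/
theorem gen_of_blkCheck {sarcs : List (ℕ × Arc)} {n : ℕ} {l : List Blk}
    (h : Packed.blkCheck sarcs n l = true) :
    Gen fun z => n + (l.map fun b => Packed.slots b.arcs).sum ≤ Module.finrank ℂ
      (Submodule.span ℂ {x | x ∈ blkVecs z sarcs l}) := by
  have := gen_rank (fun K _ z => blkVecs z sarcs l) (fun K L _ _ f z => map_blkVecs f z sarcs l)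
    _ _ (Packed.fullOn_of_blkCheck h)
  simpa only [Packed.card_blkSet] using this
end

noncomputable section

/-- The bidegree (degree, weight) of the variable `a_i`. -/
def bw (i : Fin 10) : ℕ × ℤ := (1, ((i : ℕ) : ℤ))

/-- Polynomials of degree `m` and weight `w`. -/
def Rp (m : ℕ) (w : ℤ) : Submodule ℂ (MvPolynomial (Fin 10) ℂ) :=
  weightedHomogeneousSubmodule ℂ bw (m, w)

theorem weight_bw (d : Fin 10 →₀ ℕ) : Finsupp.weight bw d = (∑ i, d i, ∑ i, (d i : ℤ) * (i : ℕ)) := by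
  rw [Finsupp.weight_apply, Finsupp.sum_fintype _ _ (by simp)]
  ext <;> simp [bw, Prod.fst_sum, Prod.snd_sum]

theorem finite_weight_bw (m : ℕ) (w : ℤ) : {d : Fin 10 →₀ ℕ | Finsupp.weight bw d = (m, w)}.Finite := by
  refine (Finsupp.finite_of_degree_le (σ := Fin 10) m).subset fun d hd => ?_
  have h : Finsupp.weight bw d = (m, w) := hd
  rw [weight_bw, Prod.mk.injEq] at h
  change Finsupp.degree d ≤ m
  rw [Finsupp.degree_eq_sum]
  exact h.1.le

theorem finrank_weightedHomogeneousSubmodule {σ M : Type*} [AddCommMonoid M] (w : σ → M) (m : M) :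
    Module.finrank ℂ (weightedHomogeneousSubmodule ℂ w m) = {d : σ →₀ ℕ | Finsupp.weight w d = m}.ncard := by
  rw [weightedHomogeneousSubmodule_eq_finsupp_supported]
  exact Module.finrank_eq_nat_card_basis (basisRestrictSupport ℂ {d : σ →₀ ℕ | Finsupp.weight w d = m})

theorem finite_weightedHomogeneousSubmodule {σ M : Type*} [AddCommMonoid M] (w : σ → M) (m : M)
    (h : {d : σ →₀ ℕ | Finsupp.weight w d = m}.Finite) :
    Module.Finite ℂ (weightedHomogeneousSubmodule ℂ w m) := by
  rw [weightedHomogeneousSubmodule_eq_finsupp_supported]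
  have := h.to_subtype
  exact Module.Finite.of_basis (basisRestrictSupport ℂ {d : σ →₀ ℕ | Finsupp.weight w d = m})

instance (m : ℕ) (w : ℤ) : Module.Finite ℂ (Rp m w) :=
  finite_weightedHomogeneousSubmodule _ _ (finite_weight_bw m w)

/-- The generating function for the number of monomials of given degree in `n` variables. -/
def gf : ℕ → ℕ → Polynomial ℕ
  | _, 0 => 1
  | 0, _ + 1 => 0
  | n + 1, m + 1 => gf n (m + 1) + Polynomial.X ^ n * gf (n + 1) m

theorem ncard_monomials (n m : ℕ) (hn : n ≤ 10) (w : ℤ) :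
    {d : Fin 10 →₀ ℕ | Finsupp.weight bw d = (m, w) ∧ ∀ i : Fin 10, n ≤ i → d i = 0}.ncard =
      if w < 0 then 0 else (gf n m).coeff w.toNat := by
  induction m generalizing n w with
  | zero =>
    have : {d : Fin 10 →₀ ℕ | Finsupp.weight bw d = (0, w) ∧ ∀ i : Fin 10, n ≤ i → d i = 0} =
        if w = 0 then {0} else ∅ := by
      ext d
      rw [Set.mem_ofPred_eq, weight_bw]
      have h0 : ∑ i, d i = 0 ↔ d = 0 := by
        rw [Finset.sum_eq_zero_iff]
        simp [Finsupp.ext_iff]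
      constructor
      · rintro ⟨h, -⟩
        obtain ⟨h1, h2⟩ := Prod.mk.inj h
        obtain rfl := h0.1 h1
        simp at h2
        simp [← h2]
      · split_ifs with hw
        · rintro rfl
          simp [hw]
        · exact False.elim
    rw [this, gf]
    split_ifs with h1 h2 h2
    · omega
    · simp [h1]
    · simp
    · rw [Set.ncard_empty, Polynomial.coeff_one, if_neg (by omega)]
  | succ m ihm =>
    induction n generalizing w with
    | zero =>
      have : {d : Fin 10 →₀ ℕ | Finsupp.weight bw d = (m + 1, w) ∧ ∀ i : Fin 10, 0 ≤ (i : ℕ) → d i = 0} = ∅ := by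
        refine Set.eq_empty_of_forall_notMem fun d hd => ?_
        have h1 := hd.1
        rw [weight_bw] at h1
        have h2 := (Prod.mk.inj h1).1
        rw [Finset.sum_eq_zero fun i _ => hd.2 i (Nat.zero_le _)] at h2
        omega
      rw [this]
      simp [gf]
    | succ n ihn =>
      let k : Fin 10 := ⟨n, by omega⟩
      have hw (d : Fin 10 →₀ ℕ) : Finsupp.weight bw (d + Finsupp.single k 1) =
          Finsupp.weight bw d + (1, (n : ℤ)) := by
        rw [map_add, Finsupp.weight_single]
        simp [bw, k]
      have : {d : Fin 10 →₀ ℕ | Finsupp.weight bw d = (m + 1, w) ∧ ∀ i : Fin 10, n + 1 ≤ i → d i = 0} =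
          {d : Fin 10 →₀ ℕ | Finsupp.weight bw d = (m + 1, w) ∧ ∀ i : Fin 10, n ≤ i → d i = 0} ∪
          (· + Finsupp.single k 1) ''
            {d : Fin 10 →₀ ℕ | Finsupp.weight bw d = (m, w - n) ∧ ∀ i : Fin 10, n + 1 ≤ i → d i = 0} := by
        ext d
        constructor
        · rintro ⟨h1, h2⟩
          by_cases hk : d k = 0
          · refine Or.inl ⟨h1, fun i hi => ?_⟩
            rcases hi.eq_or_lt with h | h
            · rwa [show i = k from Fin.ext h.symm]
            · exact h2 i h
          · have hd : d - Finsupp.single k 1 + Finsupp.single k 1 = d := by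
              ext i
              by_cases hi : k = i
              · subst hi
                simp; omega
              · simp [Finsupp.single_eq_of_ne' hi]
            refine Or.inr ⟨d - Finsupp.single k 1, ⟨?_, fun i hi => ?_⟩, hd⟩
            · rw [← hd, hw] at h1
              obtain ⟨a, b⟩ := Prod.mk.inj h1
              ext
              · simpa using a
              · simp only at b ⊢
                exact eq_sub_of_add_eq b
            · simp [h2 i hi]
        · rintro (⟨h1, h2⟩ | ⟨d, ⟨h1, h2⟩, rfl⟩)
          · exact ⟨h1, fun i hi => h2 i (by omega)⟩
          · refine ⟨by rw [hw, h1]; simp, fun i hi => ?_⟩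
            have hi' : k ≠ i := fun h => by subst h; simp [k] at hi
            simp [h2 i hi, Finsupp.single_eq_of_ne' hi']
      rw [this, Set.ncard_union_eq _ ((finite_weight_bw _ _).subset fun d hd => hd.1)
        (((finite_weight_bw _ _).subset fun d hd => hd.1).image _), ihn (by omega),
        Set.ncard_image_of_injective _ (add_left_injective _), ihm _ hn, gf, Polynomial.coeff_add,
        Polynomial.coeff_X_pow_mul']
      · by_cases h0 : w < 0
        · rw [if_pos h0, if_pos h0, if_pos (by omega)]
        · rw [if_neg h0, if_neg h0]
          by_cases h1 : w - n < 0
          · rw [if_pos h1, if_neg (by omega)]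
          · rw [if_neg h1, if_pos (by omega)]
            congr 2
            omega
      · rw [Set.disjoint_left]
        rintro d ⟨h1, h2⟩ ⟨d', h3, rfl⟩
        have := h2 k le_rfl
        simp at this

theorem finrank_Rp (m : ℕ) (w : ℤ) : Module.finrank ℂ (Rp m w) =
    if w < 0 then 0 else (gf 10 m).coeff w.toNat := by
  rw [Rp, finrank_weightedHomogeneousSubmodule, ← ncard_monomials 10 m le_rfl w]
  congr 1
  ext d
  simp only [Set.mem_ofPred_eq]
  exact ⟨fun h => ⟨h, fun i hi => absurd i.2 (by omega)⟩, fun h => h.1⟩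

theorem X_mul_mem_Rp {m : ℕ} {w : ℤ} {f : MvPolynomial (Fin 10) ℂ} (hf : f ∈ Rp m w) (i : Fin 10) :
    X i * f ∈ Rp (m + 1) (w + (i : ℕ)) := by
  have := (isWeightedHomogeneous_X ℂ bw i).mul ((mem_weightedHomogeneousSubmodule _ _ _ _).1 hf)
  have h : bw i + (m, w) = (m + 1, w + (i : ℕ)) := by
    simp [bw, add_comm]
  rwa [h] at this

theorem monomial_mem_Rp {d : Fin 10 →₀ ℕ} {m : ℕ} {w : ℤ} (h : Finsupp.weight bw d = (m, w)) (c : ℂ) :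
    monomial d c ∈ Rp m w :=
  isWeightedHomogeneous_monomial _ _ _ h

/-- A subspace containing all monomials of bidegree `(m, w)` contains `Rp m w`. -/
theorem Rp_le {m : ℕ} {w : ℤ} {U : Submodule ℂ (MvPolynomial (Fin 10) ℂ)}
    (h : ∀ d, Finsupp.weight bw d = (m, w) → monomial d 1 ∈ U) : Rp m w ≤ U := by
  intro f hf
  rw [f.as_sum]
  refine Submodule.sum_mem _ fun d hd => ?_
  rw [← mul_one (coeff d f), ← smul_eq_mul, ← smul_monomial]
  exact U.smul_mem _ (h d (hf (mem_support_iff.1 hd)))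

theorem weight_sub_single {d : Fin 10 →₀ ℕ} {m : ℕ} {w : ℤ} (h : Finsupp.weight bw d = (m + 1, w))
    {i : Fin 10} (hi : d i ≠ 0) :
    d = d - Finsupp.single i 1 + Finsupp.single i 1 ∧
      Finsupp.weight bw (d - Finsupp.single i 1) = (m, w - (i : ℕ)) := by
  have hd : d = d - Finsupp.single i 1 + Finsupp.single i 1 := by
    ext j
    by_cases hj : i = j
    · subst hj
      simp; omega
    · simp [Finsupp.single_eq_of_ne' hj]
  refine ⟨hd, ?_⟩
  rw [hd, map_add, Finsupp.weight_single] at h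
  obtain ⟨a, b⟩ := Prod.mk.inj h
  simp only [bw, one_smul] at a b
  ext
  · simpa using a
  · exact eq_sub_of_add_eq b

theorem monomial_eq_X_mul {d d' : Fin 10 →₀ ℕ} {i : Fin 10} (h : d = d' + Finsupp.single i 1) :
    (monomial d 1 : MvPolynomial (Fin 10) ℂ) = X i * monomial d' 1 := by
  rw [h, X, monomial_mul, add_comm, one_mul]

theorem Rp_succ (m : ℕ) (w : ℤ) :
    Rp (m + 1) w = ⨆ i : Fin 10, (Rp m (w - (i : ℕ))).map (LinearMap.mulLeft ℂ (X i)) := by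
  apply le_antisymm
  · refine Rp_le fun d hd => ?_
    have : ∃ i, d i ≠ 0 := by
      by_contra! h
      rw [weight_bw] at hd
      have := (Prod.mk.inj hd).1
      simp [h] at this
    obtain ⟨i, hi⟩ := this
    obtain ⟨h1, h2⟩ := weight_sub_single hd hi
    refine Submodule.mem_iSup_of_mem i ⟨_, monomial_mem_Rp h2 1, ?_⟩
    exact (monomial_eq_X_mul h1).symm
  · refine iSup_le fun i => ?_
    rintro _ ⟨f, hf, rfl⟩
    have := X_mul_mem_Rp hf i
    rwa [sub_add_cancel] at this

/-- Projection to a bigraded piece. -/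
abbrev comp (m : ℕ) (w : ℤ) : MvPolynomial (Fin 10) ℂ →ₗ[ℂ] MvPolynomial (Fin 10) ℂ :=
  weightedHomogeneousComponent bw (m, w)

theorem comp_mem (m : ℕ) (w : ℤ) (f : MvPolynomial (Fin 10) ℂ) : comp m w f ∈ Rp m w :=
  weightedHomogeneousComponent_mem _ _ _

theorem comp_X_mul (m : ℕ) (w : ℤ) (i : Fin 10) (f : MvPolynomial (Fin 10) ℂ) :
    comp (m + 1) w (X i * f) = X i * comp m (w - (i : ℕ)) f := by
  classical
  ext d
  rw [coeff_weightedHomogeneousComponent, coeff_X_mul', coeff_X_mul']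
  by_cases hi : i ∈ d.support
  · rw [if_pos hi, if_pos hi, coeff_weightedHomogeneousComponent]
    congr 1
    rw [eq_iff_iff]
    constructor
    · intro h
      exact (weight_sub_single h (Finsupp.mem_support_iff.1 hi)).2
    · intro h
      have hd : d = d - Finsupp.single i 1 + Finsupp.single i 1 := by
        ext j
        by_cases hj : i = j
        · subst hj
          have := Finsupp.mem_support_iff.1 hi
          simp; omega
        · simp [Finsupp.single_eq_of_ne' hj]
      rw [hd, map_add, h, Finsupp.weight_single]
      simp [bw]
  · rw [if_neg hi, if_neg hi, ite_self]

theorem comp_zero_X_mul (w : ℤ) (i : Fin 10) (f : MvPolynomial (Fin 10) ℂ) :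
    comp 0 w (X i * f) = 0 := by
  classical
  ext d
  rw [coeff_weightedHomogeneousComponent, coeff_X_mul']
  split_ifs with h1 h2
  · have := Finsupp.mem_support_iff.1 h2
    rw [weight_bw] at h1
    have h3 := (Prod.mk.inj h1).1
    rw [Finset.sum_eq_zero_iff] at h3
    exact absurd (h3 i (Finset.mem_univ _)) this
  · rfl
  · rfl

/-- An ideal generated by bihomogeneous elements. -/
def BiHom (J : Ideal (MvPolynomial (Fin 10) ℂ)) : Prop := ∀ f ∈ J, ∀ m w, comp m w f ∈ J

/-- The product of the irrelevant ideal with an ideal. -/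
def irr (J : Ideal (MvPolynomial (Fin 10) ℂ)) : Ideal (MvPolynomial (Fin 10) ℂ) :=
  Ideal.span (Set.range X) * J

theorem irr_le (J : Ideal (MvPolynomial (Fin 10) ℂ)) : irr J ≤ J := Ideal.mul_le_right

theorem X_mul_mem_irr {J : Ideal (MvPolynomial (Fin 10) ℂ)} {f : MvPolynomial (Fin 10) ℂ}
    (hf : f ∈ J) (i : Fin 10) : X i * f ∈ irr J :=
  Ideal.mul_mem_mul (Ideal.subset_span ⟨i, rfl⟩) hf

theorem irr_induction {J : Ideal (MvPolynomial (Fin 10) ℂ)} {P : MvPolynomial (Fin 10) ℂ → Prop}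
    (h : ∀ i, ∀ f ∈ J, P (X i * f)) (ha : ∀ f g, P f → P g → P (f + g)) {f} (hf : f ∈ irr J) :
    P f := by
  refine Submodule.mul_induction_on hf (fun a ha' b hb => ?_) ha
  induction ha' using Submodule.span_induction generalizing b with
  | mem x hx =>
    obtain ⟨i, rfl⟩ := hx
    exact h i b hb
  | zero =>
    have := h 0 0 J.zero_mem
    rwa [mul_zero, ← zero_mul b] at this
  | add x y _ _ hx hy =>
    rw [add_mul]
    exact ha _ _ (hx b hb) (hy b hb)
  | smul c x _ hx =>
    have := hx (c * b) (J.mul_mem_left c hb)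
    rwa [smul_eq_mul, mul_comm c x, mul_assoc]

/-- The pieces of an ideal. -/
def pc (J : Ideal (MvPolynomial (Fin 10) ℂ)) (m : ℕ) (w : ℤ) : Submodule ℂ (MvPolynomial (Fin 10) ℂ) :=
  J.restrictScalars ℂ ⊓ Rp m w

theorem mem_pc {J : Ideal (MvPolynomial (Fin 10) ℂ)} {m : ℕ} {w : ℤ} {f : MvPolynomial (Fin 10) ℂ} :
    f ∈ pc J m w ↔ f ∈ J ∧ f ∈ Rp m w := Iff.rfl

theorem pc_irr {J : Ideal (MvPolynomial (Fin 10) ℂ)} (hJ : BiHom J) (m : ℕ) (w : ℤ) :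
    pc (irr J) (m + 1) w =
      ⨆ i : Fin 10, (pc J m (w - (i : ℕ))).map (LinearMap.mulLeft ℂ (X i)) := by
  apply le_antisymm
  · rintro f ⟨hf, hfR⟩
    have key : comp (m + 1) w f ∈
        ⨆ i : Fin 10, (pc J m (w - (i : ℕ))).map (LinearMap.mulLeft ℂ (X i)) := by
      refine irr_induction (P := fun f => comp (m + 1) w f ∈
        ⨆ i : Fin 10, (pc J m (w - (i : ℕ))).map (LinearMap.mulLeft ℂ (X i))) (fun i f hf => ?_)
        (fun f g hf hg => ?_) hf
      · rw [comp_X_mul]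
        exact Submodule.mem_iSup_of_mem i ⟨_, ⟨hJ f hf _ _, comp_mem _ _ _⟩, rfl⟩
      · rw [map_add]
        exact Submodule.add_mem _ hf hg
    rwa [weightedHomogeneousComponent_eq_self hfR] at key
  · refine iSup_le fun i => ?_
    rintro _ ⟨f, ⟨hf, hfR⟩, rfl⟩
    have := X_mul_mem_Rp hfR i
    rw [sub_add_cancel] at this
    exact ⟨X_mul_mem_irr hf i, this⟩

theorem BiHom.irr {J : Ideal (MvPolynomial (Fin 10) ℂ)} (hJ : BiHom J) : BiHom (irr J) := by
  intro f hf m w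
  refine irr_induction (P := fun f => comp m w f ∈ _root_.irr J) (fun i f hf => ?_)
    (fun f g hf hg => ?_) hf
  · rcases m with _ | m
    · rw [comp_zero_X_mul]
      exact Ideal.zero_mem _
    · rw [comp_X_mul]
      exact X_mul_mem_irr (hJ f hf _ _) i
  · rw [map_add]
    exact Ideal.add_mem _ hf hg

instance (J : Ideal (MvPolynomial (Fin 10) ℂ)) (m : ℕ) (w : ℤ) : Module.Finite ℂ (pc J m w) :=
  Submodule.finiteDimensional_of_le (inf_le_right : pc J m w ≤ Rp m w)

end

noncomputable section

/-- If `F : W / U → W' / U'` is injective then `dim W / U ≤ dim W' / U'`. -/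
theorem finrank_add_le {V V' : Type*} [AddCommGroup V] [Module ℂ V] [AddCommGroup V'] [Module ℂ V']
    {W U : Submodule ℂ V} {W' U' : Submodule ℂ V'} [Module.Finite ℂ W] [Module.Finite ℂ W']
    [Module.Finite ℂ U] (F : V →ₗ[ℂ] V') (hF : ∀ x ∈ W, F x ∈ W') (hU : U' ≤ W')
    (h : ∀ x ∈ W, F x ∈ U' → x ∈ U) :
    Module.finrank ℂ W + Module.finrank ℂ U' ≤ Module.finrank ℂ W' + Module.finrank ℂ U := by
  let U'' : Submodule ℂ W' := U'.comap W'.subtype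
  let G : W →ₗ[ℂ] W' ⧸ U'' := U''.mkQ ∘ₗ F.restrict hF
  have h1 := G.finrank_range_add_finrank_ker
  have h2 : Module.finrank ℂ G.range ≤ Module.finrank ℂ (W' ⧸ U'') := Submodule.finrank_le _
  have h3 := U''.finrank_quotient_add_finrank
  have h4 : Module.finrank ℂ U'' = Module.finrank ℂ U' :=
    (Submodule.comapSubtypeEquivOfLe hU).finrank_eq
  have h5 : Module.finrank ℂ G.ker ≤ Module.finrank ℂ U := by
    have hk : ∀ x : G.ker, ((x : W) : V) ∈ U := by
      rintro ⟨x, hx⟩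
      refine h x x.2 ?_
      have : F.restrict hF x ∈ U'' := by
        rw [← Submodule.Quotient.mk_eq_zero]
        exact hx
      exact this
    refine LinearMap.finrank_le_finrank_of_injective
      (f := ((W.subtype ∘ₗ G.ker.subtype).codRestrict U hk)) fun x y hxy => ?_
    apply Subtype.ext
    apply Subtype.ext
    exact congrArg (Subtype.val : U → V) hxy
  omega

/-- The eigenvector argument for raising operators of `sl₂`. -/
theorem mem_of_raise {V : Type*} [AddCommGroup V] [Module ℂ V] (P : ℤ → Submodule ℂ V)
    (E F : V →ₗ[ℂ] V) (L : ℤ) (hneg : ∀ w < 0, P w = ⊥) (hE : ∀ w, ∀ x ∈ P w, E x ∈ P (w - 1))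
    (hc : ∀ w, ∀ x ∈ P w, E (F x) = F (E x) + ((L - 2 * w : ℤ) : ℂ) • x)
    (U : Submodule ℂ V) (hUE : ∀ w, ∀ x ∈ P w, x ∈ U → E x ∈ U)
    (hUF : ∀ w, ∀ x ∈ P w, x ∈ U → F x ∈ U) (hF : ∀ w, ∀ x ∈ P w, F x ∈ P (w + 1))
    {w : ℤ} (hw : 2 * w < L) {x : V} (hx : x ∈ P w) (hFx : F x ∈ U) : x ∈ U := by
  have key : ∀ n : ℕ, ∀ w : ℤ, w < n → 2 * w < L → ∀ c : ℤ, 0 < c → ∀ x ∈ P w,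
      F (E x) + (c : ℂ) • x ∈ U → x ∈ U := by
    intro n
    induction n with
    | zero =>
      intro w hw _ c _ x hx _
      rw [hneg w (by simpa using hw)] at hx
      rw [(Submodule.mem_bot _).1 hx]
      exact U.zero_mem
    | succ n ih =>
      intro w hw hL c hc0 x hx hxU
      have hEx := hE w x hx
      have h1 : E x ∈ U := by
        refine ih (w - 1) (by push_cast at hw; omega) (by omega) (L - 2 * (w - 1) + c) (by omega) _ hEx ?_
        have := hUE _ _ (Submodule.add_mem _ (show F (E x) ∈ P w by
          have := hF _ _ hEx; rwa [sub_add_cancel] at this) ((P w).smul_mem (c : ℂ) hx)) hxU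
        rw [map_add, hc _ _ hEx, map_smul, add_assoc, ← add_smul] at this
        rwa [Int.cast_add]
      have h2 : (c : ℂ) • x ∈ U := by
        have := U.sub_mem hxU (hUF _ _ hEx h1)
        rwa [add_sub_cancel_left] at this
      exact (U.smul_mem_iff (by exact_mod_cast hc0.ne')).1 h2
  obtain ⟨n, hn⟩ : ∃ n : ℕ, w < n := ⟨(w + 1).toNat, by omega⟩
  refine key n w hn hw (L - 2 * w) (by omega) x hx ?_
  rw [← hc w x hx]
  exact hUE _ _ (hF _ _ hx) hFx

/-- Derivations shifting the weights of variables shift all weights. -/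
theorem derivation_homogeneous {σ M : Type*} [AddCommMonoid M] {wt : σ → M} {v : M}
    {D : Derivation ℂ (MvPolynomial σ ℂ) (MvPolynomial σ ℂ)}
    (hD : ∀ i, IsWeightedHomogeneous wt (D (X i)) (wt i + v)) {f : MvPolynomial σ ℂ} {m : M}
    (hf : IsWeightedHomogeneous wt f m) : IsWeightedHomogeneous wt (D f) (m + v) := by
  have key : ∀ d : σ →₀ ℕ, IsWeightedHomogeneous wt (D (monomial d 1)) (Finsupp.weight wt d + v) := by
    intro d
    induction d using Finsupp.induction_linear with
    | zero =>
      rw [show monomial (0 : σ →₀ ℕ) (1 : ℂ) = 1 from rfl, D.map_one_eq_zero]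
      exact isWeightedHomogeneous_zero _ _ _
    | add f g hf hg =>
      have h : (monomial (f + g) 1 : MvPolynomial σ ℂ) = monomial f 1 * monomial g 1 := by
        rw [monomial_mul, one_mul]
      rw [h, D.leibniz, map_add, smul_eq_mul, smul_eq_mul]
      refine IsWeightedHomogeneous.add ?_ ?_
      · have := (isWeightedHomogeneous_monomial wt f (1 : ℂ) rfl).mul hg
        rwa [← add_assoc] at this
      · have := (isWeightedHomogeneous_monomial wt g (1 : ℂ) rfl).mul hf
        rwa [← add_assoc, add_comm (Finsupp.weight wt g)] at this
    | single i n =>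
      rw [← X_pow_eq_monomial, D.leibniz_pow, Finsupp.weight_single]
      rcases n with _ | n
      · rw [zero_smul]
        exact isWeightedHomogeneous_zero _ _ _
      · have := ((isWeightedHomogeneous_X ℂ wt i).pow n).mul (hD i)
        rw [← add_assoc, ← succ_nsmul] at this
        rw [Nat.add_sub_cancel, smul_eq_mul]
        exact Submodule.smul_of_tower_mem (weightedHomogeneousSubmodule ℂ wt _) _ this
  rw [f.as_sum, map_sum]
  refine Submodule.sum_mem (weightedHomogeneousSubmodule ℂ wt _) fun d hd => ?_
  rw [← mul_one (coeff d f), ← smul_eq_mul, ← smul_monomial, D.map_smul,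
    ← hf (mem_support_iff.1 hd)]
  exact Submodule.smul_mem _ _ (key d)

/-- A derivation acting diagonally on variables acts diagonally on monomials. -/
theorem derivation_eigen {σ : Type*} {c : σ → ℂ}
    {D : Derivation ℂ (MvPolynomial σ ℂ) (MvPolynomial σ ℂ)} (hD : ∀ i, D (X i) = c i • X i)
    (d : σ →₀ ℕ) : D (monomial d 1) = Finsupp.weight c d • monomial d 1 := by
  induction d using Finsupp.induction_linear with
  | zero =>
    rw [show monomial (0 : σ →₀ ℕ) (1 : ℂ) = 1 from rfl, D.map_one_eq_zero, map_zero, zero_smul]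
  | add f g hf hg =>
    have h : (monomial (f + g) 1 : MvPolynomial σ ℂ) = monomial f 1 * monomial g 1 := by
      rw [monomial_mul, one_mul]
    rw [h, D.leibniz, hf, hg, map_add, smul_eq_mul, smul_eq_mul, mul_smul_comm, mul_smul_comm,
      mul_comm (monomial g 1), ← add_smul, add_comm]
  | single i n =>
    rw [← X_pow_eq_monomial, D.leibniz_pow, Finsupp.weight_single, hD]
    rcases n with _ | n
    · simp
    · rw [Nat.add_sub_cancel, smul_eq_mul, mul_smul_comm, ← pow_succ, ← smul_assoc]

theorem derivation_eigen_of_homogeneous {σ M : Type*} [AddCommMonoid M] {wt : σ → M} {c : σ → ℂ}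
    {D : Derivation ℂ (MvPolynomial σ ℂ) (MvPolynomial σ ℂ)} (hD : ∀ i, D (X i) = c i • X i)
    {m : M} {e : ℂ} (he : ∀ d : σ →₀ ℕ, Finsupp.weight wt d = m → Finsupp.weight c d = e)
    {f : MvPolynomial σ ℂ} (hf : IsWeightedHomogeneous wt f m) : D f = e • f := by
  conv_lhs => rw [f.as_sum]
  conv_rhs => rw [f.as_sum]
  rw [map_sum, Finset.smul_sum]
  refine Finset.sum_congr rfl fun d hd => ?_
  have h : monomial d (coeff d f) = coeff d f • monomial d (1 : ℂ) := by
    rw [smul_monomial, smul_eq_mul, mul_one]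
  rw [h, D.map_smul, derivation_eigen hD, he d (hf (mem_support_iff.1 hd)), smul_comm]

end

noncomputable section

/-- The entries of the matrix `[[p, q], [r, s]]` have weights `(1, 0)`, `(0, 1)`, `(1, 0)`, `(0, 1)`. -/
def pw (i : Fin 4) : ℤ × ℤ := if i = 0 ∨ i = 2 then (1, 0) else (0, 1)

/-- Bihomogeneous polynomials in the entries of a matrix. -/
def Qp (a b : ℤ) : Submodule ℂ (MvPolynomial (Fin 4) ℂ) := weightedHomogeneousSubmodule ℂ pw (a, b)

theorem weight_pw (d : Fin 4 →₀ ℕ) :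
    Finsupp.weight pw d = ((d 0 + d 2 : ℤ), (d 1 + d 3 : ℤ)) := by
  rw [Finsupp.weight_apply, Finsupp.sum_fintype _ _ (by simp), Fin.sum_univ_four]
  ext <;> simp [pw]

theorem ncard_pw (a b : ℕ) :
    {d : Fin 4 →₀ ℕ | Finsupp.weight pw d = ((a : ℤ), (b : ℤ))}.ncard = (a + 1) * (b + 1) := by
  let f : Fin (a + 1) × Fin (b + 1) → (Fin 4 →₀ ℕ) := fun x =>
    Finsupp.equivFunOnFinite.symm ![x.1, x.2, a - x.1, b - x.2]
  have hf : Function.Injective f := by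
    intro x y h
    have h0 := DFunLike.congr_fun h 0
    have h1 := DFunLike.congr_fun h 1
    simp [f] at h0 h1
    exact Prod.ext (Fin.ext h0) (Fin.ext h1)
  have hr : {d : Fin 4 →₀ ℕ | Finsupp.weight pw d = ((a : ℤ), (b : ℤ))} = f '' Set.univ := by
    ext d
    rw [Set.mem_ofPred_eq, weight_pw, Prod.mk.injEq]
    constructor
    · rintro ⟨h1, h2⟩
      refine ⟨(⟨d 0, by omega⟩, ⟨d 1, by omega⟩), trivial, ?_⟩
      ext i
      fin_cases i <;> simp [f] <;> omega
    · rintro ⟨x, -, rfl⟩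
      have := x.1.2
      have := x.2.2
      simp [f]
      omega
  rw [hr, Set.ncard_image_of_injective _ hf, Set.ncard_univ]
  simp

theorem finrank_Qp (a b : ℕ) : Module.finrank ℂ (Qp a b) = (a + 1) * (b + 1) := by
  rw [Qp, finrank_weightedHomogeneousSubmodule, ncard_pw]

instance finite_Qp (a b : ℕ) : Module.Finite ℂ (Qp a b) :=
  finite_weightedHomogeneousSubmodule _ _ (Set.finite_of_ncard_pos (by rw [ncard_pw]; positivity))

theorem Qp_eq_bot {a b : ℤ} (h : a < 0 ∨ b < 0) : Qp a b = ⊥ := by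
  refine (Submodule.eq_bot_iff _).2 fun f hf => ?_
  ext d
  by_contra hd
  have := hf hd
  rw [weight_pw, Prod.mk.injEq] at this
  omega

theorem Rp_eq_bot {m : ℕ} {w : ℤ} (h : w < 0 ∨ 9 * m < w) : Rp m w = ⊥ := by
  refine (Submodule.eq_bot_iff _).2 fun f hf => ?_
  ext d
  by_contra hd
  have := hf hd
  rw [weight_bw, Prod.mk.injEq] at this
  obtain ⟨h1, h2⟩ := this
  have h3 : (0 : ℤ) ≤ ∑ i, (d i : ℤ) * (i : ℕ) := Finset.sum_nonneg fun i _ => by positivity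
  have h4 : ∑ i, (d i : ℤ) * (i : ℕ) ≤ ∑ i, (d i : ℤ) * 9 :=
    Finset.sum_le_sum fun i _ => by
      have := i.2
      exact mul_le_mul_of_nonneg_left (by omega) (by positivity)
  rw [← Finset.sum_mul, ← Nat.cast_sum, h1] at h4
  omega

/-- Pullback to matrices along the orbit map. -/
def phi (z : Fin 9 → ℂ) : MvPolynomial (Fin 10) ℂ →ₐ[ℂ] MvPolynomial (Fin 4) ℂ :=
  aeval fun k => orb (fun i => C (zext z i)) (X 0) (X 1) (X 2) (X 3) k

/-- The pairs of coefficients of the linear factors. -/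
def factors (z : Fin 9 → ℂ) : List (MvPolynomial (Fin 4) ℂ × MvPolynomial (Fin 4) ℂ) :=
  [0, 1, 2, 3, 4, 5, 6, 7, 8].map fun j => (X 0 - C (zext z j) * X 2, X 1 - C (zext z j) * X 3)

theorem phi_X (z : Fin 9 → ℂ) (k : Fin 10) : phi z (X k) = (wt k : ℂ) • prodCoeff (factors z) k := by
  rw [phi, aeval_X, orb, smul_eq_C_mul, factors, map_natCast]

theorem prodCoeff_homogeneous {l : List (MvPolynomial (Fin 4) ℂ × MvPolynomial (Fin 4) ℂ)}
    (hl : ∀ x ∈ l, x.1 ∈ Qp 1 0 ∧ x.2 ∈ Qp 0 1) (k : ℕ) :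
    prodCoeff l k ∈ Qp (l.length - k) k := by
  induction l generalizing k with
  | nil =>
    rcases k with _ | k
    · exact isWeightedHomogeneous_one _ _
    · exact Submodule.zero_mem _
  | cons a l ih =>
    have ha := hl a List.mem_cons_self
    replace ih := ih fun x hx => hl x (List.mem_cons_of_mem _ hx)
    have hu (k : ℕ) : a.1 * prodCoeff l k ∈ Qp ((a :: l).length - k) k := by
      have := IsWeightedHomogeneous.mul ha.1 (ih k)
      have h : ((1, 0) + ((l.length - k : ℤ), (k : ℤ)) : ℤ × ℤ) = (((a :: l).length - k : ℤ), (k : ℤ)) := by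
        ext <;> simp; ring
      rwa [h] at this
    rcases k with _ | k
    · exact hu 0
    · refine Submodule.add_mem _ (hu _) ?_
      have := IsWeightedHomogeneous.mul ha.2 (ih k)
      have h : ((0, 1) + ((l.length - k : ℤ), (k : ℤ)) : ℤ × ℤ) =
          (((a :: l).length - (k + 1 : ℕ) : ℤ), ((k + 1 : ℕ) : ℤ)) := by
        ext <;> simp; ring
      rwa [h] at this

theorem X_mem_Qp (i : Fin 4) : (X i : MvPolynomial (Fin 4) ℂ) ∈ Qp (pw i).1 (pw i).2 :=
  isWeightedHomogeneous_X _ _ _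

theorem factors_homogeneous (z : Fin 9 → ℂ) :
    ∀ x ∈ factors z, x.1 ∈ Qp 1 0 ∧ x.2 ∈ Qp 0 1 := by
  intro x hx
  obtain ⟨j, -, rfl⟩ := List.mem_map.1 hx
  have h0 := X_mem_Qp 0
  have h1 := X_mem_Qp 1
  have h2 := X_mem_Qp 2
  have h3 := X_mem_Qp 3
  simp [pw] at h0 h1 h2 h3
  constructor
  · rw [← smul_eq_C_mul]
    exact Submodule.sub_mem _ h0 (Submodule.smul_mem _ _ h2)
  · change X 1 - C (zext z j) * X 3 ∈ _
    rw [← smul_eq_C_mul]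
    exact Submodule.sub_mem _ h1 (Submodule.smul_mem _ _ h3)

theorem aeval_homogeneous {σ τ M N : Type*} [AddCommMonoid M] [AddCommMonoid N] {wt : σ → M}
    {wt' : τ → N} {g : σ → MvPolynomial τ ℂ} (v : M →+ N)
    (hg : ∀ i, IsWeightedHomogeneous wt' (g i) (v (wt i))) {f : MvPolynomial σ ℂ} {m : M}
    (hf : IsWeightedHomogeneous wt f m) : IsWeightedHomogeneous wt' (aeval g f) (v m) := by
  have key : ∀ d : σ →₀ ℕ, IsWeightedHomogeneous wt' (aeval g (monomial d (1 : ℂ)))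
      (v (Finsupp.weight wt d)) := by
    intro d
    induction d using Finsupp.induction_linear with
    | zero =>
      rw [map_zero, map_zero]
      rw [show monomial (0 : σ →₀ ℕ) (1 : ℂ) = 1 from rfl, map_one]
      exact isWeightedHomogeneous_one _ _
    | add f g hf hg =>
      have h : (monomial (f + g) 1 : MvPolynomial σ ℂ) = monomial f 1 * monomial g 1 := by
        rw [monomial_mul, one_mul]
      rw [h, map_mul, map_add, map_add]
      exact hf.mul hg
    | single i n =>
      rw [← X_pow_eq_monomial, Finsupp.weight_single, map_pow, aeval_X, map_nsmul]
      exact (hg i).pow n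
  rw [f.as_sum, map_sum]
  refine Submodule.sum_mem (weightedHomogeneousSubmodule ℂ wt' _) fun d hd => ?_
  rw [← mul_one (coeff d f), ← smul_eq_mul, ← smul_monomial, map_smul,
    ← hf (mem_support_iff.1 hd)]
  exact Submodule.smul_mem _ _ (key d)

/-- The bidegree of the pullback of a polynomial. -/
def wtMap : ℕ × ℤ →+ ℤ × ℤ where
  toFun x := (9 * x.1 - x.2, x.2)
  map_zero' := by simp
  map_add' x y := by ext <;> simp; ring

theorem phi_mem (z : Fin 9 → ℂ) {m : ℕ} {w : ℤ} {f : MvPolynomial (Fin 10) ℂ} (hf : f ∈ Rp m w) :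
    phi z f ∈ Qp (9 * m - w) w := by
  refine aeval_homogeneous wtMap (fun k => ?_) hf
  have h := phi_X z k
  rw [phi, aeval_X] at h
  rw [h]
  have := prodCoeff_homogeneous (factors_homogeneous z) k
  exact Submodule.smul_mem _ _ this

/-- The ideal of the orbit. -/
def idl (z : Fin 9 → ℂ) : Ideal (MvPolynomial (Fin 10) ℂ) := RingHom.ker (phi z)

theorem mem_idl {z : Fin 9 → ℂ} {f : MvPolynomial (Fin 10) ℂ} : f ∈ idl z ↔ phi z f = 0 := Iff.rfl

theorem finite_support_comp (f : MvPolynomial (Fin 10) ℂ) :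
    f = ∑ x ∈ (f.support.image (Finsupp.weight bw)), comp x.1 x.2 f := by
  classical
  ext d
  rw [coeff_sum]
  simp_rw [coeff_weightedHomogeneousComponent]
  simp only [Prod.mk.eta]
  rw [Finset.sum_ite_eq]
  split_ifs with h
  · rfl
  · by_contra hd
    exact h (Finset.mem_image_of_mem _ (mem_support_iff.2 hd))

theorem idl_biHom (z : Fin 9 → ℂ) : BiHom (idl z) := by
  intro f hf m w
  rw [mem_idl] at hf ⊢
  have h1 : ∀ (m' : ℕ) (w' : ℤ), weightedHomogeneousComponent pw (9 * m - w, w)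
      (phi z (comp m' w' f)) = if (m', w') = (m, w) then phi z (comp m' w' f) else 0 := by
    intro m' w'
    have h := phi_mem z (comp_mem m' w' f)
    split_ifs with heq
    · obtain ⟨rfl, rfl⟩ := Prod.mk.inj heq
      exact weightedHomogeneousComponent_eq_self h
    · refine IsWeightedHomogeneous.weightedHomogeneousComponent_ne _ h ?_
      intro h2
      obtain ⟨h3, rfl⟩ := Prod.mk.inj h2
      exact heq (by rw [Prod.mk.injEq]; exact ⟨by omega, rfl⟩)
  have h2 : weightedHomogeneousComponent pw (9 * m - w, w) (phi z f) = 
      if (m, w) ∈ f.support.image (Finsupp.weight bw) then phi z (comp m w f) else 0 := by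
    conv_lhs => rw [finite_support_comp f]
    rw [map_sum, map_sum, Finset.sum_congr rfl fun x _ => h1 x.1 x.2]
    simp only [Prod.mk.eta]
    rw [Finset.sum_ite_eq']
  rw [hf, map_zero] at h2
  split_ifs at h2 with h3
  · exact h2.symm
  · have : comp m w f = 0 := by
      classical
      ext d
      rw [coeff_weightedHomogeneousComponent, coeff_zero]
      split_ifs with h4
      · by_contra h5
        exact h3 (Finset.mem_image.2 ⟨d, mem_support_iff.2 h5, h4⟩)
      · rfl
    rw [this, map_zero]

end

noncomputable section

/-- The lowering operator on matrices. -/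
def lowQ : Derivation ℂ (MvPolynomial (Fin 4) ℂ) (MvPolynomial (Fin 4) ℂ) :=
  mkDerivation ℂ ![0, X 0, 0, X 2]

/-- The raising operator on matrices. -/
def raiseQ : Derivation ℂ (MvPolynomial (Fin 4) ℂ) (MvPolynomial (Fin 4) ℂ) :=
  mkDerivation ℂ ![X 1, 0, X 3, 0]

/-- The lowering operator on functions of forms. -/
def lowR : Derivation ℂ (MvPolynomial (Fin 10) ℂ) (MvPolynomial (Fin 10) ℂ) :=
  mkDerivation ℂ fun i => ((i : ℕ) : ℂ) • X (i - 1)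

/-- The raising operator on functions of forms. -/
def raiseR : Derivation ℂ (MvPolynomial (Fin 10) ℂ) (MvPolynomial (Fin 10) ℂ) :=
  mkDerivation ℂ fun i => ((9 - (i : ℕ) : ℕ) : ℂ) • X (i + 1)

theorem low_prodCoeff {l : List (MvPolynomial (Fin 4) ℂ × MvPolynomial (Fin 4) ℂ)}
    (hl : ∀ x ∈ l, lowQ x.1 = 0 ∧ lowQ x.2 = x.1) :
    lowQ (prodCoeff l 0) = 0 ∧ ∀ k : ℕ, lowQ (prodCoeff l (k + 1)) =
      ((l.length - k : ℤ) : MvPolynomial (Fin 4) ℂ) * prodCoeff l k := by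
  induction l with
  | nil => refine ⟨by simp [prodCoeff], fun k => ?_⟩; cases k <;> simp [prodCoeff]
  | cons a l ih =>
    obtain ⟨h1, h2⟩ := hl a List.mem_cons_self
    obtain ⟨i0, ih⟩ := ih fun x hx => hl x (List.mem_cons_of_mem _ hx)
    refine ⟨by simp [prodCoeff, h1, i0], fun k => ?_⟩
    rcases k with _ | k
    · simp only [prodCoeff, map_add, Derivation.leibniz, smul_eq_mul, h1, h2, i0, ih,
        List.length_cons]
      push_cast
      ring
    · simp only [prodCoeff, map_add, Derivation.leibniz, smul_eq_mul, h1, h2, ih,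
        List.length_cons]
      push_cast
      ring

theorem raise_prodCoeff {l : List (MvPolynomial (Fin 4) ℂ × MvPolynomial (Fin 4) ℂ)}
    (hl : ∀ x ∈ l, raiseQ x.1 = x.2 ∧ raiseQ x.2 = 0) (k : ℕ) :
    raiseQ (prodCoeff l k) = ((k + 1 : ℕ) : MvPolynomial (Fin 4) ℂ) * prodCoeff l (k + 1) := by
  induction l generalizing k with
  | nil => cases k <;> simp [prodCoeff]
  | cons a l ih =>
    obtain ⟨h1, h2⟩ := hl a List.mem_cons_self
    replace ih := ih fun x hx => hl x (List.mem_cons_of_mem _ hx)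
    rcases k with _ | k
    · simp only [prodCoeff, Derivation.leibniz, smul_eq_mul, h1, ih]
      push_cast
      ring
    · simp only [prodCoeff, map_add, Derivation.leibniz, smul_eq_mul, h1, h2, ih]
      push_cast
      ring

theorem prodCoeff_swap {B : Type*} [CommRing B] (l : List (B × B)) {j k : ℕ}
    (h : j + k = l.length) : prodCoeff (l.map Prod.swap) j = prodCoeff l k := by
  induction l generalizing j k with
  | nil =>
    obtain ⟨rfl, rfl⟩ : j = 0 ∧ k = 0 := by simpa using h
    rfl
  | cons a l ih =>
    rw [List.length_cons] at h
    have hz : prodCoeff (l.map Prod.swap) (l.length + 1) = 0 :=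
      prodCoeff_eq_zero (by rw [List.length_map]; omega)
    rcases j with _ | j <;> rcases k with _ | k
    · omega
    · have : k = l.length := by omega
      subst this
      rw [List.map_cons, prodCoeff, prodCoeff, Prod.fst_swap, ih (zero_add _),
        prodCoeff_eq_zero (l := l) (k := l.length + 1) (by omega)]
      ring
    · have : j = l.length := by omega
      subst this
      rw [List.map_cons, prodCoeff, prodCoeff, hz, Prod.snd_swap, ih (add_zero _)]
      ring
    · rw [List.map_cons, prodCoeff, prodCoeff, Prod.fst_swap, Prod.snd_swap, ih (j := j + 1) (k := k) (by omega),
        ih (j := j) (k := k + 1) (by omega)]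
      ring

theorem low_factors (z : Fin 9 → ℂ) : ∀ x ∈ factors z, lowQ x.1 = 0 ∧ lowQ x.2 = x.1 := by
  intro x hx
  obtain ⟨j, -, rfl⟩ := List.mem_map.1 hx
  simp [lowQ, mkDerivation_X, ← smul_eq_C_mul, -map_mul]

theorem raise_factors (z : Fin 9 → ℂ) : ∀ x ∈ factors z, raiseQ x.1 = x.2 ∧ raiseQ x.2 = 0 := by
  intro x hx
  obtain ⟨j, -, rfl⟩ := List.mem_map.1 hx
  simp [raiseQ, mkDerivation_X, ← smul_eq_C_mul, -map_mul]

theorem length_factors (z : Fin 9 → ℂ) : (factors z).length = 9 := rfl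

/-- Derivations related by a homomorphism on generators are related. -/
theorem derivation_comm (z : Fin 9 → ℂ)
    {D : Derivation ℂ (MvPolynomial (Fin 10) ℂ) (MvPolynomial (Fin 10) ℂ)}
    {D' : Derivation ℂ (MvPolynomial (Fin 4) ℂ) (MvPolynomial (Fin 4) ℂ)}
    (h : ∀ i, phi z (D (X i)) = D' (phi z (X i))) (f : MvPolynomial (Fin 10) ℂ) :
    phi z (D f) = D' (phi z f) := by
  induction f using MvPolynomial.induction_on with
  | C a =>
    rw [← algebraMap_eq, AlgHom.commutes, D.map_algebraMap, D'.map_algebraMap, map_zero]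
  | add f g hf hg => simp only [map_add, hf, hg]
  | mul_X f i hf =>
    simp only [Derivation.leibniz, map_mul, map_add, smul_eq_mul, hf, h]

theorem phi_low (z : Fin 9 → ℂ) (f : MvPolynomial (Fin 10) ℂ) : phi z (lowR f) = lowQ (phi z f) := by
  refine derivation_comm z (fun i => ?_) f
  obtain ⟨h0, h1⟩ := low_prodCoeff (low_factors z)
  rw [lowR, mkDerivation_X, map_smul, phi_X, phi_X, Derivation.map_smul]
  fin_cases i
  · simp [h0]
  all_goals
    simp only [h1, length_factors, Fin.reduceFinMk, Fin.isValue, Fin.reduceSub, wt]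
    simp only [smul_eq_C_mul, ← mul_assoc, ← map_mul, ← map_intCast (C (σ := Fin 4) (R := ℂ))]
    norm_num
    try norm_num [Fin.isValue]

theorem phi_raise (z : Fin 9 → ℂ) (f : MvPolynomial (Fin 10) ℂ) :
    phi z (raiseR f) = raiseQ (phi z f) := by
  refine derivation_comm z (fun i => ?_) f
  rw [raiseR, mkDerivation_X, map_smul, phi_X, phi_X, Derivation.map_smul,
    raise_prodCoeff (raise_factors z)]
  fin_cases i
  on_goal 10 => simp [prodCoeff_eq_zero (l := factors z) (k := 10) (by rw [length_factors]; norm_num)]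
  all_goals
    simp only [Fin.reduceFinMk, Fin.isValue, Fin.reduceAdd, wt]
    simp only [smul_eq_C_mul, ← mul_assoc, ← map_mul, ← map_natCast (C (σ := Fin 4) (R := ℂ))]
    norm_num
    try norm_num [Fin.isValue]

theorem lowR_mem {m : ℕ} {w : ℤ} {f : MvPolynomial (Fin 10) ℂ} (hf : f ∈ Rp m w) :
    lowR f ∈ Rp m (w - 1) := by
  refine derivation_homogeneous (wt := bw) (v := (0, -1)) (fun i => ?_) hf
  rw [lowR, mkDerivation_X]
  rcases eq_or_ne i 0 with rfl | hi
  · simp [isWeightedHomogeneous_zero]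
  · have := isWeightedHomogeneous_X ℂ bw (i - 1)
    have h : bw (i - 1) = bw i + (0, -1) := by
      fin_cases i <;> simp [bw] at hi ⊢
    rw [h] at this
    exact Submodule.smul_mem (weightedHomogeneousSubmodule ℂ bw _) _ this

theorem raiseR_mem {m : ℕ} {w : ℤ} {f : MvPolynomial (Fin 10) ℂ} (hf : f ∈ Rp m w) :
    raiseR f ∈ Rp m (w + 1) := by
  refine derivation_homogeneous (wt := bw) (v := (0, 1)) (fun i => ?_) hf
  rw [raiseR, mkDerivation_X]
  rcases eq_or_ne i 9 with rfl | hi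
  · simp [isWeightedHomogeneous_zero]
  · have := isWeightedHomogeneous_X ℂ bw (i + 1)
    have h : bw (i + 1) = bw i + (0, 1) := by
      fin_cases i <;> simp [bw] at hi ⊢
    rw [h] at this
    exact Submodule.smul_mem (weightedHomogeneousSubmodule ℂ bw _) _ this

theorem lowQ_mem {a b : ℤ} {f : MvPolynomial (Fin 4) ℂ} (hf : f ∈ Qp a b) :
    lowQ f ∈ Qp (a + 1) (b - 1) := by
  refine derivation_homogeneous (wt := pw) (v := (1, -1)) (fun i => ?_) hf
  rw [lowQ, mkDerivation_X]
  have h0 := X_mem_Qp 0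
  have h2 := X_mem_Qp 2
  fin_cases i <;> simp [pw, isWeightedHomogeneous_zero] at h0 h2 ⊢ <;> assumption

theorem raiseQ_mem {a b : ℤ} {f : MvPolynomial (Fin 4) ℂ} (hf : f ∈ Qp a b) :
    raiseQ f ∈ Qp (a - 1) (b + 1) := by
  refine derivation_homogeneous (wt := pw) (v := (-1, 1)) (fun i => ?_) hf
  rw [raiseQ, mkDerivation_X]
  have h1 := X_mem_Qp 1
  have h3 := X_mem_Qp 3
  fin_cases i <;> simp [pw, isWeightedHomogeneous_zero] at h1 h3 ⊢ <;> assumption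

theorem lowR_raiseR {m : ℕ} {w : ℤ} {f : MvPolynomial (Fin 10) ℂ} (hf : f ∈ Rp m w) :
    lowR (raiseR f) = raiseR (lowR f) + ((9 * m - 2 * w : ℤ) : ℂ) • f := by
  have h := derivation_eigen_of_homogeneous (D := ⁅lowR, raiseR⁆)
    (c := fun i : Fin 10 => ((9 - 2 * (i : ℕ) : ℤ) : ℂ)) (e := ((9 * m - 2 * w : ℤ) : ℂ)) (fun i => ?_) (fun d hd => ?_) hf
  · rw [Derivation.commutator_apply] at h
    rw [← h]
    abel
  · rw [Derivation.commutator_apply]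
    have h0 (i : Fin 10) : lowR (X i) = ((i : ℕ) : ℂ) • X (i - 1) := by
      rw [lowR, mkDerivation_X]
    have h1 (i : Fin 10) : raiseR (X i) = ((9 - (i : ℕ) : ℕ) : ℂ) • X (i + 1) := by
      rw [raiseR, mkDerivation_X]
    rw [h0, h1, Derivation.map_smul, Derivation.map_smul, h0, h1, add_sub_cancel_right,
      sub_add_cancel, smul_smul, smul_smul, ← sub_smul]
    congr 1
    have key : ∀ i : Fin 10, (((9 - (i : ℕ) : ℕ) : ℤ) * (((i + 1 : Fin 10) : ℕ) : ℤ) -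
        ((i : ℕ) : ℤ) * ((9 - ((i - 1 : Fin 10) : ℕ) : ℕ) : ℤ)) = 9 - 2 * ((i : ℕ) : ℤ) := by decide
    exact_mod_cast congrArg (Int.cast : ℤ → ℂ) (key i)
  · rw [weight_bw, Prod.mk.injEq] at hd
    obtain ⟨h1, h2⟩ := hd
    rw [Finsupp.weight_apply, Finsupp.sum_fintype _ _ (by simp), ← h1, ← h2]
    push_cast
    rw [Finset.mul_sum, Finset.mul_sum, ← Finset.sum_sub_distrib]
    refine Finset.sum_congr rfl fun i _ => ?_
    rw [nsmul_eq_mul]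
    ring

theorem lowQ_raiseQ {a b : ℤ} {f : MvPolynomial (Fin 4) ℂ} (hf : f ∈ Qp a b) :
    lowQ (raiseQ f) = raiseQ (lowQ f) + ((a - b : ℤ) : ℂ) • f := by
  have h := derivation_eigen_of_homogeneous (D := ⁅lowQ, raiseQ⁆)
    (c := ![1, -1, 1, -1]) (e := ((a - b : ℤ) : ℂ)) (fun i => ?_) (fun d hd => ?_) hf
  · rw [Derivation.commutator_apply] at h
    rw [← h]
    abel
  · rw [Derivation.commutator_apply, lowQ, raiseQ]
    fin_cases i <;> simp [mkDerivation_X]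
  · rw [weight_pw, Prod.mk.injEq] at hd
    obtain ⟨h1, h2⟩ := hd
    rw [Finsupp.weight_apply, Finsupp.sum_fintype _ _ (by simp), ← h1, ← h2, Fin.sum_univ_four]
    simp
    ring

/-- The reversal of forms. -/
def revR : MvPolynomial (Fin 10) ℂ →ₐ[ℂ] MvPolynomial (Fin 10) ℂ := aeval fun i => X (Fin.rev i)

/-- The exchange of columns of a matrix. -/
def revQ : MvPolynomial (Fin 4) ℂ →ₐ[ℂ] MvPolynomial (Fin 4) ℂ := aeval ![X 1, X 0, X 3, X 2]

theorem revQ_revQ (f : MvPolynomial (Fin 4) ℂ) : revQ (revQ f) = f := by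
  have : revQ.comp revQ = AlgHom.id ℂ _ := by
    ext1 i
    fin_cases i <;> simp [revQ]
  exact congrArg (fun g => g f) this

theorem revR_revR (f : MvPolynomial (Fin 10) ℂ) : revR (revR f) = f := by
  have : revR.comp revR = AlgHom.id ℂ _ := by
    ext1 i
    simp [revR]
  exact congrArg (fun g => g f) this

theorem map_swap_factors (z : Fin 9 → ℂ) :
    (factors z).map (fun x => (revQ x.1, revQ x.2)) = (factors z).map Prod.swap := by
  rw [factors, List.map_map, List.map_map]
  refine List.map_congr_left fun j _ => ?_
  simp [revQ, ← algebraMap_eq]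

theorem phi_revR (z : Fin 9 → ℂ) (f : MvPolynomial (Fin 10) ℂ) : phi z (revR f) = revQ (phi z f) := by
  have : (phi z).comp revR = revQ.comp (phi z) := by
    ext1 i
    have hi := i.2
    rw [AlgHom.comp_apply, AlgHom.comp_apply, revR, aeval_X, phi_X, phi_X, map_smul]
    have h := map_prodCoeff (revQ : MvPolynomial (Fin 4) ℂ →+* MvPolynomial (Fin 4) ℂ) (factors z) i
    change revQ (prodCoeff (factors z) i) = prodCoeff ((factors z).map fun x => (revQ x.1, revQ x.2)) i at h
    rw [h, map_swap_factors, prodCoeff_swap (factors z) (j := i) (k := 9 - i) (by rw [length_factors]; omega)]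
    have hw : wt (Fin.rev i) = wt i := by
      fin_cases i <;> rfl
    rw [hw, Fin.val_rev]
    congr 2
    omega
  exact congrArg (fun g => g f) this

theorem revR_mem {m : ℕ} {w : ℤ} {f : MvPolynomial (Fin 10) ℂ} (hf : f ∈ Rp m w) :
    revR f ∈ Rp m (9 * m - w) := by
  let v : ℕ × ℤ →+ ℕ × ℤ :=
    { toFun := fun x => (x.1, 9 * x.1 - x.2)
      map_zero' := by simp
      map_add' := fun x y => by ext <;> simp; ring }
  refine aeval_homogeneous (wt := bw) (wt' := bw) (g := fun i => X (Fin.rev i)) v (fun i => ?_) hf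
  have := isWeightedHomogeneous_X ℂ bw (Fin.rev i)
  have h : bw (Fin.rev i) = v (bw i) := by
    have := i.2
    ext
    · rfl
    · simp only [bw, v, AddMonoidHom.coe_mk, ZeroHom.coe_mk, Fin.val_rev]
      omega
  rwa [h] at this

end

noncomputable section

/-- Dimensions of the pieces of the ideal of an orbit. -/
def hh (z : Fin 9 → ℂ) (m : ℕ) (w : ℤ) : ℕ := Module.finrank ℂ (pc (idl z) m w)

/-- Dimensions of the pieces of the non-minimal part of the ideal of an orbit. -/
def rr (z : Fin 9 → ℂ) (m : ℕ) (w : ℤ) : ℕ := Module.finrank ℂ (pc (irr (idl z)) m w)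

/-- Dimensions of the pieces of the coordinate ring of an orbit. -/
def AA (z : Fin 9 → ℂ) (m : ℕ) (w : ℤ) : ℕ :=
  Module.finrank ℂ ((Rp m w).map (phi z).toLinearMap)

/-- Numbers of monomials. -/
def NN (m : ℕ) (w : ℤ) : ℕ := Module.finrank ℂ (Rp m w)

theorem finrank_map_add {V V' : Type*} [AddCommGroup V] [Module ℂ V] [AddCommGroup V'] [Module ℂ V']
    (U : Submodule ℂ V) [Module.Finite ℂ U] (f : V →ₗ[ℂ] V') :
    Module.finrank ℂ (U.map f) + Module.finrank ℂ (U ⊓ f.ker : Submodule ℂ V) = Module.finrank ℂ U := by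
  rw [← (f.domRestrict U).finrank_range_add_finrank_ker, LinearMap.range_domRestrict,
    LinearMap.ker_domRestrict]
  congr 1
  have : U ⊓ f.ker = (f.ker.comap U.subtype).map U.subtype := by
    rw [Submodule.map_comap_subtype]
  rw [this]
  exact (Submodule.equivMapOfInjective _ U.injective_subtype _).finrank_eq.symm

theorem AA_add_hh (z : Fin 9 → ℂ) (m : ℕ) (w : ℤ) : AA z m w + hh z m w = NN m w := by
  rw [NN, ← finrank_map_add (Rp m w) (phi z).toLinearMap, AA, hh, pc, inf_comm]
  rfl

theorem revR_idl {z : Fin 9 → ℂ} {f : MvPolynomial (Fin 10) ℂ} (hf : f ∈ idl z) :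
    revR f ∈ idl z := by
  rw [mem_idl] at hf ⊢
  rw [phi_revR, hf, map_zero]

theorem revR_irr {z : Fin 9 → ℂ} {f : MvPolynomial (Fin 10) ℂ} (hf : f ∈ irr (idl z)) :
    revR f ∈ irr (idl z) := by
  refine irr_induction (P := fun f => revR f ∈ irr (idl z)) (fun i f hf => ?_)
    (fun f g hf hg => ?_) hf
  · rw [map_mul, revR, aeval_X]
    exact X_mul_mem_irr (revR_idl hf) _
  · rw [map_add]
    exact Ideal.add_mem _ hf hg

theorem finrank_pc_rev {J : Ideal (MvPolynomial (Fin 10) ℂ)} (hJ : ∀ f ∈ J, revR f ∈ J) (m : ℕ) (w : ℤ) :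
    Module.finrank ℂ (pc J m (9 * m - w)) = Module.finrank ℂ (pc J m w) := by
  have key (w : ℤ) : Module.finrank ℂ (pc J m w) ≤ Module.finrank ℂ (pc J m (9 * m - w)) := by
    have := finrank_add_le (W := pc J m w) (W' := pc J m (9 * m - w)) (U := ⊥) (U' := ⊥)
      revR.toLinearMap (fun x hx => ⟨hJ x hx.1, revR_mem hx.2⟩) bot_le (fun x _ h => by
        rw [Submodule.mem_bot] at h ⊢
        rw [← revR_revR x]
        exact (congrArg revR h).trans (map_zero _))
    simpa using this
  refine le_antisymm ?_ (key w)
  have := key (9 * m - w)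
  rwa [sub_sub_cancel] at this

theorem hh_rev (z : Fin 9 → ℂ) (m : ℕ) (w : ℤ) : hh z m (9 * m - w) = hh z m w :=
  finrank_pc_rev (fun _ => revR_idl) m w

theorem rr_rev (z : Fin 9 → ℂ) (m : ℕ) (w : ℤ) : rr z m (9 * m - w) = rr z m w :=
  finrank_pc_rev (fun _ => revR_irr) m w

theorem hh_eq_zero {m : ℕ} {w : ℤ} (h : w < 0 ∨ 9 * m < w) (z : Fin 9 → ℂ) : hh z m w = 0 := by
  rw [hh, pc, Rp_eq_bot h, inf_bot_eq, finrank_bot]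

theorem rr_le_hh (z : Fin 9 → ℂ) (m : ℕ) (w : ℤ) : rr z m w ≤ hh z m w :=
  Submodule.finrank_mono fun _ hf => ⟨irr_le _ hf.1, hf.2⟩

theorem lowR_idl {z : Fin 9 → ℂ} {f : MvPolynomial (Fin 10) ℂ} (hf : f ∈ idl z) :
    lowR f ∈ idl z := by
  rw [mem_idl] at hf ⊢
  rw [phi_low, hf, map_zero]

theorem raiseR_idl {z : Fin 9 → ℂ} {f : MvPolynomial (Fin 10) ℂ} (hf : f ∈ idl z) :
    raiseR f ∈ idl z := by
  rw [mem_idl] at hf ⊢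
  rw [phi_raise, hf, map_zero]

theorem derivation_irr {J : Ideal (MvPolynomial (Fin 10) ℂ)}
    {D : Derivation ℂ (MvPolynomial (Fin 10) ℂ) (MvPolynomial (Fin 10) ℂ)}
    (hD : ∀ i, ∃ (c : ℂ) (j : Fin 10), D (X i) = c • X j) (hJ : ∀ f ∈ J, D f ∈ J)
    {f : MvPolynomial (Fin 10) ℂ} (hf : f ∈ irr J) : D f ∈ irr J := by
  refine irr_induction (P := fun f => D f ∈ irr J) (fun i f hf => ?_)
    (fun f g hf hg => ?_) hf
  · obtain ⟨c, j, h⟩ := hD i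
    rw [D.leibniz, h, smul_eq_mul, smul_eq_mul, mul_smul_comm]
    refine Ideal.add_mem _ (X_mul_mem_irr (hJ f hf) _) ?_
    rw [smul_eq_C_mul, mul_comm f]
    exact Ideal.mul_mem_left _ _ (X_mul_mem_irr hf _)
  · rw [map_add]
    exact Ideal.add_mem _ hf hg

theorem lowR_irr {z : Fin 9 → ℂ} {f : MvPolynomial (Fin 10) ℂ} (hf : f ∈ irr (idl z)) :
    lowR f ∈ irr (idl z) :=
  derivation_irr (fun i => ⟨_, _, by rw [lowR, mkDerivation_X]⟩) (fun _ => lowR_idl) hf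

theorem raiseR_irr {z : Fin 9 → ℂ} {f : MvPolynomial (Fin 10) ℂ} (hf : f ∈ irr (idl z)) :
    raiseR f ∈ irr (idl z) :=
  derivation_irr (fun i => ⟨_, _, by rw [raiseR, mkDerivation_X]⟩) (fun _ => raiseR_idl) hf

/-- An ideal stable under `sl₂` contains an element when it contains its image under raising. -/
theorem mem_of_raiseR {J : Ideal (MvPolynomial (Fin 10) ℂ)} (hl : ∀ f ∈ J, lowR f ∈ J)
    (hr : ∀ f ∈ J, raiseR f ∈ J) {m : ℕ} {w : ℤ} (hw : 2 * w < 9 * m)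
    {f : MvPolynomial (Fin 10) ℂ} (hf : f ∈ Rp m w) (h : raiseR f ∈ J) : f ∈ J :=
  mem_of_raise (Rp m) lowR.toLinearMap raiseR.toLinearMap (9 * m) (fun _ h => Rp_eq_bot (Or.inl h))
    (fun _ _ h => lowR_mem h) (fun _ _ h => lowR_raiseR h) (J.restrictScalars ℂ)
    (fun _ x _ h => hl x h) (fun _ x _ h => hr x h) (fun _ _ h => raiseR_mem h) hw hf h

theorem hh_mono {m : ℕ} {w : ℤ} (hw : 2 * w < 9 * m) (z : Fin 9 → ℂ) :
    hh z m w ≤ hh z m (w + 1) := by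
  have := finrank_add_le (W := pc (idl z) m w) (W' := pc (idl z) m (w + 1)) (U := ⊥) (U' := ⊥)
    raiseR.toLinearMap (fun x hx => ⟨raiseR_idl hx.1, raiseR_mem hx.2⟩) bot_le (fun x hx h =>
      mem_of_raiseR (J := ⊥) (fun f hf => by
        rw [Ideal.mem_bot] at hf ⊢; rw [hf, map_zero]) (fun f hf => by
        rw [Ideal.mem_bot] at hf ⊢; rw [hf, map_zero]) hw hx.2 h)
  simpa [hh] using this

theorem gg_mono {m : ℕ} {w : ℤ} (hw : 2 * w < 9 * m) (z : Fin 9 → ℂ) :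
    hh z m w + rr z m (w + 1) ≤ hh z m (w + 1) + rr z m w :=
  finrank_add_le (W := pc (idl z) m w) (W' := pc (idl z) m (w + 1))
    raiseR.toLinearMap (fun x hx => ⟨raiseR_idl hx.1, raiseR_mem hx.2⟩)
    (fun _ hf => ⟨irr_le _ hf.1, hf.2⟩) (fun x hx h =>
      ⟨mem_of_raiseR (fun _ => lowR_irr) (fun _ => raiseR_irr) hw hx.2 h.1, hx.2⟩)

theorem AA_mono {m : ℕ} {w : ℤ} (hw : 2 * w < 9 * m) (z : Fin 9 → ℂ) :
    NN m w + hh z m (w + 1) ≤ NN m (w + 1) + hh z m w :=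
  finrank_add_le (W := Rp m w) (W' := Rp m (w + 1))
    raiseR.toLinearMap (fun x hx => raiseR_mem hx)
    inf_le_right (fun x hx h =>
      ⟨mem_of_raiseR (fun _ => lowR_idl) (fun _ => raiseR_idl) hw hx h.1, hx⟩)

theorem AA_step {m w : ℕ} (hw : 2 * w < 9 * m) (z : Fin 9 → ℂ) :
    AA z m (w + 1) ≤ AA z m w + (9 * m - 2 * w - 1) := by
  let Q : ℤ → Submodule ℂ (MvPolynomial (Fin 4) ℂ) := fun w => Qp (9 * m - w) w
  have h1 : Q w = Qp ((9 * m - w : ℕ) : ℤ) w := by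
    simp only [Q]; congr 1; omega
  have h2 : Q (w + 1) = Qp ((9 * m - w - 1 : ℕ) : ℤ) ((w + 1 : ℕ) : ℤ) := by
    simp only [Q]; congr 1; omega
  have f1 : Module.Finite ℂ (Q w) := by rw [h1]; infer_instance
  have f2 : Module.Finite ℂ (Q (w + 1)) := by rw [h2]; infer_instance
  have hr (w : ℤ) (x : MvPolynomial (Fin 4) ℂ) (hx : x ∈ Q w) : raiseQ x ∈ Q (w + 1) := by
    have := raiseQ_mem hx
    rwa [sub_sub] at this
  have hl (w : ℤ) (x : MvPolynomial (Fin 4) ℂ) (hx : x ∈ Q w) : lowQ x ∈ Q (w - 1) := by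
    have := lowQ_mem hx
    rwa [show (9 * m - w + 1 : ℤ) = 9 * m - (w - 1) by ring] at this
  let U : Submodule ℂ (MvPolynomial (Fin 4) ℂ) := LinearMap.range (phi z).toLinearMap
  have hUP (v : ℤ) (y : MvPolynomial (Fin 4) ℂ) (hy : y ∈ Q v) (hyU : y ∈ U) :
      y ∈ (Rp m v).map (phi z).toLinearMap := by
    obtain ⟨f, rfl⟩ := hyU
    refine ⟨comp m v f, comp_mem _ _ _, ?_⟩
    change phi z (comp m v f) = phi z f
    have hd : f - comp m v f = ∑ x ∈ ((f - comp m v f).support.image (Finsupp.weight bw)),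
        comp x.1 x.2 (f - comp m v f) := finite_support_comp _
    have h5 : weightedHomogeneousComponent pw (9 * m - v, v) (phi z (f - comp m v f)) = 0 := by
      rw [hd, map_sum, map_sum]
      refine Finset.sum_eq_zero fun x _ => ?_
      by_cases hx : x = (m, v)
      · subst hx
        rw [map_sub, weightedHomogeneousComponent_eq_self (comp_mem m v f), sub_self, map_zero,
          map_zero]
      · refine IsWeightedHomogeneous.weightedHomogeneousComponent_ne _
          (phi_mem z (comp_mem x.1 x.2 (f - comp m v f))) ?_
        intro h
        rw [Prod.mk.injEq] at h
        exact hx (Prod.ext (by omega) h.2.symm)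
    rw [map_sub, map_sub, weightedHomogeneousComponent_eq_self (show phi z f ∈ Q v from hy),
      weightedHomogeneousComponent_eq_self (phi_mem z (comp_mem m v f)), sub_eq_zero] at h5
    exact h5.symm
  have := finrank_add_le (W := Q w) (W' := Q (w + 1))
    (U := (Rp m w).map (phi z).toLinearMap) (U' := (Rp m (w + 1)).map (phi z).toLinearMap)
    raiseQ.toLinearMap (hr w) (by
      rintro _ ⟨f, hf, rfl⟩
      exact phi_mem z hf) (fun x hx h => by
      refine hUP _ _ hx ?_
      refine mem_of_raise Q lowQ.toLinearMap raiseQ.toLinearMap (9 * m)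
        (fun _ h => Qp_eq_bot (Or.inr h)) hl (fun w x hx => ?_) U ?_ ?_ hr
        (w := w) (by omega) hx ?_
      · have := lowQ_raiseQ hx
        rwa [sub_sub, ← two_mul] at this
      · rintro _ _ _ ⟨f, rfl⟩
        exact ⟨lowR f, phi_low z f⟩
      · rintro _ _ _ ⟨f, rfl⟩
        exact ⟨raiseR f, phi_raise z f⟩
      · obtain ⟨f, -, hf⟩ := h
        exact ⟨f, hf⟩)
  rw [h1, h2, finrank_Qp, finrank_Qp] at this
  change _ + AA z m (w + 1) ≤ _ + AA z m w at this
  obtain ⟨k, hk⟩ : ∃ k, 9 * m = 2 * w + 1 + k := ⟨9 * m - 2 * w - 1, by omega⟩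
  rw [hk] at this ⊢
  rw [show 2 * w + 1 + k - w = w + 1 + k by omega, show w + 1 + k - 1 = w + k by omega] at this
  rw [show 2 * w + 1 + k - 2 * w - 1 = k by omega]
  nlinarith

end

noncomputable section

/-- Multiplication by a coordinate. -/
abbrev mulX (i : Fin 10) : MvPolynomial (Fin 10) ℂ →ₗ[ℂ] MvPolynomial (Fin 10) ℂ :=
  LinearMap.mulLeft ℂ (X i)

theorem mulX_injective (i : Fin 10) : Function.Injective (mulX i) := fun _ _ h =>
  mul_left_cancel₀ (X_ne_zero i) h

theorem finrank_map_mulX (i : Fin 10) (U : Submodule ℂ (MvPolynomial (Fin 10) ℂ)) :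
    Module.finrank ℂ (U.map (mulX i)) = Module.finrank ℂ U :=
  LinearEquiv.finrank_eq (Submodule.equivMapOfInjective _ (mulX_injective i) U).symm

/-- Enlarging a space by the image of `A`, when it already contains the image of `B`. -/
theorem finrank_step (i : Fin 10) (P A B : Submodule ℂ (MvPolynomial (Fin 10) ℂ))
    [Module.Finite ℂ P] [Module.Finite ℂ A] (hBA : B ≤ A) (hB : B.map (mulX i) ≤ P) :
    Module.finrank ℂ (P ⊔ A.map (mulX i) : Submodule ℂ (MvPolynomial (Fin 10) ℂ)) +
      Module.finrank ℂ B ≤ Module.finrank ℂ P + Module.finrank ℂ A := by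
  have := Submodule.finiteDimensional_of_le hBA
  rw [← finrank_map_mulX i A, ← finrank_map_mulX i B, ← Submodule.finrank_sup_add_finrank_inf_eq P]
  exact Nat.add_le_add_left (Submodule.finrank_mono (le_inf hB (Submodule.map_mono hBA))) _

theorem finrank_steps (s : Finset (Fin 10)) (P : Submodule ℂ (MvPolynomial (Fin 10) ℂ))
    (A B : Fin 10 → Submodule ℂ (MvPolynomial (Fin 10) ℂ))
    [Module.Finite ℂ P] [∀ i, Module.Finite ℂ (A i)] (hBA : ∀ i ∈ s, B i ≤ A i)
    (hB : ∀ i ∈ s, (B i).map (mulX i) ≤ P) :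
    Module.finrank ℂ (P ⊔ s.sup fun i => (A i).map (mulX i) : Submodule ℂ (MvPolynomial (Fin 10) ℂ)) +
      ∑ i ∈ s, Module.finrank ℂ (B i) ≤ Module.finrank ℂ P + ∑ i ∈ s, Module.finrank ℂ (A i) := by
  induction s using Finset.cons_induction with
  | empty =>
    rw [Finset.sup_empty, sup_bot_eq, Finset.sum_empty, Finset.sum_empty]
  | cons i s hi ih =>
    have fin : Module.Finite ℂ (s.sup fun i => (A i).map (mulX i) :) := by
      rw [Finset.sup_eq_iSup]
      exact Submodule.finite_iSup _
    have h1 := ih (fun j hj => hBA j (Finset.mem_cons_of_mem hj)) fun j hj => hB j (Finset.mem_cons_of_mem hj)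
    have h2 := finrank_step i (P ⊔ s.sup fun i => (A i).map (mulX i)) (A i) (B i)
      (hBA i (Finset.mem_cons_self _ _)) ((hB i (Finset.mem_cons_self _ _)).trans le_sup_left)
    rw [Finset.sum_cons, Finset.sum_cons, Finset.sup_cons, sup_left_comm, sup_comm, sup_assoc] 
    rw [sup_assoc] at h2
    omega

/-- Coordinates of the transforms of a form. -/
def orbHom {K : Type*} [CommRing K] [Algebra ℂ K] (z : Fin 9 → ℂ) (p q r s : K) :
    MvPolynomial (Fin 10) ℂ →ₐ[ℂ] K :=
  aeval fun k => orb (fun i => algebraMap ℂ K (zext z i)) p q r s k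

theorem orbHom_X {K : Type*} [CommRing K] [Algebra ℂ K] (z : Fin 9 → ℂ) (p q r s : K) (k : Fin 10) :
    orbHom z p q r s (X k) = orb (fun i => algebraMap ℂ K (zext z i)) p q r s k := aeval_X _ _

theorem orbHom_comp {K K' : Type*} [CommRing K] [Algebra ℂ K] [CommRing K'] [Algebra ℂ K']
    (g : K →ₐ[ℂ] K') (z : Fin 9 → ℂ) (p q r s : K) (f : MvPolynomial (Fin 10) ℂ) :
    g (orbHom z p q r s f) = orbHom z (g p) (g q) (g r) (g s) f := by
  have : g.comp (orbHom z p q r s) = orbHom z (g p) (g q) (g r) (g s) := by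
    ext k
    rw [AlgHom.comp_apply, orbHom_X, orbHom_X]
    refine (map_orb g.toRingHom _ _ _ _ _ _).trans ?_
    congr 1
    ext i
    exact g.commutes _
  exact congrArg (fun g => g f) this

theorem phi_eq (z : Fin 9 → ℂ) : phi z = orbHom z (X 0) (X 1) (X 2) (X 3) := rfl

theorem orbHom_eq_zero {K : Type*} [CommRing K] [Algebra ℂ K] {z : Fin 9 → ℂ} (p q r s : K)
    {f : MvPolynomial (Fin 10) ℂ} (hf : f ∈ idl z) : orbHom z p q r s f = 0 := by
  have := orbHom_comp (aeval ![p, q, r, s]) z (X 0) (X 1) (X 2) (X 3) f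
  rw [← phi_eq, hf, map_zero] at this
  simpa using this.symm

theorem phi_X_ne_zero (z : Fin 9 → ℂ) (k : Fin 10) : phi z (X k) ≠ 0 := by
  intro h
  have := orbHom_eq_zero (K := ℂ) (z := z) 1 1 0 0 (f := X k) h
  rw [orbHom_X] at this
  revert this
  fin_cases k <;> norm_num [orb, prodCoeff, wt]

theorem mem_idl_of_X_mul {z : Fin 9 → ℂ} {i : Fin 10} {f : MvPolynomial (Fin 10) ℂ}
    (h : X i * f ∈ idl z) : f ∈ idl z := by
  rw [mem_idl, map_mul] at h
  exact (mul_eq_zero.1 h).resolve_left (phi_X_ne_zero z i)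

theorem mem_idl_of_mul {z : Fin 9 → ℂ} {g f : MvPolynomial (Fin 10) ℂ} (hg : g ∉ idl z)
    (h : g * f ∈ idl z) : f ∈ idl z := by
  rw [mem_idl, map_mul] at h
  exact (mul_eq_zero.1 h).resolve_left hg

theorem map_mulX_Rp_le (m : ℕ) (w : ℤ) (i : Fin 10) :
    (Rp m (w - (i : ℕ))).map (mulX i) ≤ Rp (m + 1) w := by
  rintro _ ⟨f, hf, rfl⟩
  have := X_mul_mem_Rp hf i
  rwa [sub_add_cancel] at this

theorem map_mulX_pc_le (J : Ideal (MvPolynomial (Fin 10) ℂ)) (m : ℕ) (w : ℤ) (i : Fin 10) :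
    (pc J m (w - (i : ℕ))).map (mulX i) ≤ pc (irr J) (m + 1) w := by
  rintro _ ⟨f, hf, rfl⟩
  exact ⟨X_mul_mem_irr hf.1 i, map_mulX_Rp_le m w i ⟨f, hf.2, rfl⟩⟩

theorem hh_le_rr (z : Fin 9 → ℂ) (m : ℕ) (w : ℤ) (i : Fin 10) :
    hh z m (w - (i : ℕ)) ≤ rr z (m + 1) w := by
  rw [hh, ← finrank_map_mulX i]
  exact Submodule.finrank_mono (map_mulX_pc_le _ m w i)

theorem mem_Rp_of_X_mul {m : ℕ} {w : ℤ} {i : Fin 10} {f : MvPolynomial (Fin 10) ℂ}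
    (h : X i * f ∈ Rp (m + 1) w) : f ∈ Rp m (w - (i : ℕ)) := by
  have h1 := comp_X_mul m w i f
  rw [weightedHomogeneousComponent_eq_self h] at h1
  rw [mul_left_cancel₀ (X_ne_zero i) h1]
  exact comp_mem _ _ _

/-- Common multiples of two variables. -/
theorem exists_of_X_mul_eq {i j : Fin 10} (hij : i ≠ j) {f g : MvPolynomial (Fin 10) ℂ}
    (h : X i * f = X j * g) : ∃ k, f = X j * k ∧ g = X i * k := by
  have h1 : (X j : MvPolynomial (Fin 10) ℂ) ∣ X i * f := ⟨g, h⟩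
  have hp : Prime (X j : MvPolynomial (Fin 10) ℂ) := X_prime
  obtain ⟨k, rfl⟩ := (hp.dvd_or_dvd h1).resolve_left fun h => hij (by
    rw [X_dvd_X] at h
    simpa using h.symm)
  refine ⟨k, rfl, ?_⟩
  rw [mul_left_comm] at h
  exact (mul_left_cancel₀ (X_ne_zero j) h).symm

theorem finrank_two (z : Fin 9 → ℂ) (m : ℕ) (w : ℤ) {i j : Fin 10} (hij : i ≠ j) :
    hh z (m + 1) (w - (i : ℕ)) + hh z (m + 1) (w - (j : ℕ)) ≤
      Module.finrank ℂ ((pc (idl z) (m + 1) (w - (i : ℕ))).map (mulX i) ⊔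
        (pc (idl z) (m + 1) (w - (j : ℕ))).map (mulX j) : Submodule ℂ (MvPolynomial (Fin 10) ℂ)) +
      hh z m (w - (i : ℕ) - (j : ℕ)) := by
  rw [hh, hh, ← finrank_map_mulX i, ← finrank_map_mulX j (pc (idl z) (m + 1) (w - (j : ℕ))),
    ← Submodule.finrank_sup_add_finrank_inf_eq]
  refine Nat.add_le_add_left ?_ _
  rw [hh, ← finrank_map_mulX j (pc _ m _), ← finrank_map_mulX i (Submodule.map _ (pc _ m _))]
  refine Submodule.finrank_mono ?_
  rintro _ ⟨⟨f, ⟨hf, hfR⟩, rfl⟩, ⟨g, hg, h⟩⟩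
  obtain ⟨k, rfl, rfl⟩ := exists_of_X_mul_eq hij h.symm
  exact ⟨_, ⟨k, ⟨mem_idl_of_X_mul hf, mem_Rp_of_X_mul hfR⟩, rfl⟩, rfl⟩

theorem rr_two (z : Fin 9 → ℂ) (m : ℕ) (w : ℤ) {i j : Fin 10} (hij : i ≠ j) :
    hh z (m + 1) (w - (i : ℕ)) + hh z (m + 1) (w - (j : ℕ)) ≤
      rr z (m + 2) w + hh z m (w - (i : ℕ) - (j : ℕ)) :=
  (finrank_two z m w hij).trans (Nat.add_le_add_right (Submodule.finrank_mono (sup_le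
    (map_mulX_pc_le _ _ _ _) (map_mulX_pc_le _ _ _ _))) _)

/-- Adding the multiples of a variable which is not a zero divisor. -/
theorem finrank_sup_mulX {J : Ideal (MvPolynomial (Fin 10) ℂ)} {i : Fin 10}
    (hJ : ∀ f, X i * f ∈ J → f ∈ J) (m : ℕ) (w : ℤ) :
    Module.finrank ℂ (pc J (m + 1) w) + NN m (w - (i : ℕ)) ≤
      Module.finrank ℂ (pc J (m + 1) w ⊔ (Rp m (w - (i : ℕ))).map (mulX i) :
        Submodule ℂ (MvPolynomial (Fin 10) ℂ)) + Module.finrank ℂ (pc J m (w - (i : ℕ))) := by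
  rw [NN, ← finrank_map_mulX i (Rp _ _), ← Submodule.finrank_sup_add_finrank_inf_eq]
  refine Nat.add_le_add_left ?_ _
  rw [← finrank_map_mulX i (pc J m _)]
  refine Submodule.finrank_mono ?_
  rintro _ ⟨hf, ⟨f, hfR, rfl⟩⟩
  exact ⟨f, ⟨hJ f hf.1, hfR⟩, rfl⟩

/-- Upper bound for the non-minimal part. -/
theorem rr_le (z : Fin 9 → ℂ) (m : ℕ) (w : ℤ) :
    rr z (m + 2) w + ∑ i ∈ Finset.univ.erase (0 : Fin 10), hh z m (w - (i : ℕ)) ≤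
      ∑ i : Fin 10, hh z (m + 1) (w - (i : ℕ)) := by
  have h := finrank_steps (Finset.univ.erase 0) ((pc (idl z) (m + 1) w).map (mulX 0))
    (fun i => pc (idl z) (m + 1) (w - (i : ℕ)))
    (fun i => (pc (idl z) m (w - (i : ℕ))).map (mulX 0))
    (fun i _ => by
      rintro _ ⟨f, hf, rfl⟩
      refine ⟨Ideal.mul_mem_left _ _ hf.1, ?_⟩
      simpa using X_mul_mem_Rp hf.2 0)
    (fun i _ => by
      rintro _ ⟨_, ⟨f, hf, rfl⟩, rfl⟩
      refine ⟨X i * f, ⟨Ideal.mul_mem_left _ _ hf.1, ?_⟩, mul_left_comm _ _ _⟩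
      simpa using X_mul_mem_Rp hf.2 i)
  simp only [finrank_map_mulX] at h
  rw [← Finset.add_sum_erase _ _ (Finset.mem_univ (0 : Fin 10))]
  refine le_trans (Nat.add_le_add_right (Submodule.finrank_mono ?_) _) (h.trans (le_of_eq ?_))
  · rw [pc_irr (idl_biHom z), ← Finset.sup_univ_eq_iSup, ← Finset.insert_erase (Finset.mem_univ (0 : Fin 10)),
      Finset.sup_insert]
    simp
  · rw [show w - (((0 : Fin 10) : ℕ) : ℤ) = w from sub_zero w]
    rfl

end

noncomputable section

/-- Extension of scalars for polynomials with integral coefficients. -/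
abbrev toC : MvPolynomial (Fin 10) ℤ →+* MvPolynomial (Fin 10) ℂ := MvPolynomial.map (Int.castRingHom ℂ)

/-- Restriction of complex polynomials to an arc. -/
def arcHom (z : Fin 9 → ℂ) (a : Arc) : MvPolynomial (Fin 10) ℂ →ₐ[ℂ] Polynomial ℂ :=
  aeval fun k => a.val z k

theorem arcHom_toC (z : Fin 9 → ℂ) (a : Arc) (P : MvPolynomial (Fin 10) ℤ) :
    arcHom z a (toC P) = a.ev z P := by
  have : (arcHom z a).toRingHom.comp toC = a.ev z := by
    apply MvPolynomial.ringHom_ext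
    · intro n; simp
    · intro k; simp [Arc.ev, arcHom]
  exact congrArg (fun g => g P) this

/-- The coefficients of complex polynomials along a list of arcs. -/
def coeffsC (z : Fin 9 → ℂ) (arcs : List (ℕ × Arc)) : MvPolynomial (Fin 10) ℂ →ₗ[ℂ] (ℕ → ℂ) where
  toFun f := arcs.foldr (fun x g => Packed.cat x.1 (arcHom z x.2 f).coeff g) 0
  map_add' f g := by
    induction arcs with
    | nil => simp
    | cons a l ih =>
      rw [List.foldr_cons, ih]
      ext i
      simp only [Packed.cat, List.foldr_cons, Pi.add_apply, map_add, Polynomial.coeff_add]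
      split_ifs <;> rfl
  map_smul' c f := by
    induction arcs with
    | nil => simp
    | cons a l ih =>
      rw [List.foldr_cons, ih]
      ext i
      simp only [Packed.cat, List.foldr_cons, Pi.smul_apply, map_smul, Polynomial.coeff_smul,
        RingHom.id_apply]
      split_ifs <;> rfl

theorem coeffsC_toC (z : Fin 9 → ℂ) (arcs : List (ℕ × Arc)) (P : MvPolynomial (Fin 10) ℤ) :
    coeffsC z arcs (toC P) = arcCoeffs z arcs P := by
  change arcs.foldr _ _ = arcs.foldr _ _
  simp only [arcHom_toC]

theorem coeffsC_eq_zero {z : Fin 9 → ℂ} {arcs : List (ℕ × Arc)} {f : MvPolynomial (Fin 10) ℂ}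
    (h : ∀ a ∈ arcs, arcHom z a.2 f = 0) : coeffsC z arcs f = 0 := by
  change arcs.foldr (fun x g => Packed.cat x.1 (arcHom z x.2 f).coeff g) 0 = 0
  induction arcs with
  | nil => rfl
  | cons a l ih =>
    rw [List.foldr_cons, ih fun b hb => h b (List.mem_cons_of_mem _ hb), h a List.mem_cons_self]
    ext i
    simp [Packed.cat]

/-- A rank computed along arcs bounds the space of polynomials vanishing on them. -/
theorem finrank_vanish_le {z : Fin 9 → ℂ} {l : List MonoGroup} {arcs : List (ℕ × Arc)} {n : ℕ}
    (h : n ≤ Module.finrank ℂ (Submodule.span ℂ {x | x ∈ (monos ℤ l).map (arcCoeffs z arcs)}))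
    {U V : Submodule ℂ (MvPolynomial (Fin 10) ℂ)} [Module.Finite ℂ U]
    (hU : ∀ P ∈ monos ℤ l, toC P ∈ U) (hVU : V ≤ U) (hV : ∀ f ∈ V, ∀ a ∈ arcs, arcHom z a.2 f = 0) :
    n + Module.finrank ℂ V ≤ Module.finrank ℂ U := by
  rw [← finrank_map_add U (coeffsC z arcs)]
  refine add_le_add (h.trans (Submodule.finrank_mono (Submodule.span_le.2 ?_)))
    (Submodule.finrank_mono (le_inf hVU fun f hf => coeffsC_eq_zero (hV f hf)))
  rintro _ hx
  obtain ⟨P, hP, rfl⟩ := List.mem_map.1 hx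
  exact ⟨_, hU P hP, coeffsC_toC z arcs P⟩

/-- Orbit arcs. -/
def Arc.isOrb : Arc → Bool
  | .orbit _ _ _ _ => true
  | .free _ => false

theorem Arc.isOrb.vanish {z : Fin 9 → ℂ} {a : Arc} (ha : a.isOrb = true) {f : MvPolynomial (Fin 10) ℂ}
    (hf : f ∈ idl z) : arcHom z a f = 0 := by
  cases a with
  | free l => exact absurd ha (by simp [Arc.isOrb])
  | orbit p q r s => exact orbHom_eq_zero _ _ _ _ hf

/-- The ideal of the curves on the boundary given by the linear factors. -/
def didl (z : Fin 9 → ℂ) : Ideal (MvPolynomial (Fin 10) ℂ) :=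
  ⨅ i, RingHom.ker (orbHom z (Polynomial.C (z i)) Polynomial.X 1 1)

theorem mem_didl {z : Fin 9 → ℂ} {f : MvPolynomial (Fin 10) ℂ} :
    f ∈ didl z ↔ ∀ i, orbHom z (Polynomial.C (z i)) Polynomial.X 1 1 f = 0 := by
  simp [didl, Submodule.mem_iInf]

/-- The ideal of the points given by pairs of linear factors. -/
def fidl (z : Fin 9 → ℂ) : Ideal (MvPolynomial (Fin 10) ℂ) :=
  ⨅ (i) (j) (_ : i ≠ j), RingHom.ker (orbHom z (z i) (z j) 1 1)

theorem mem_fidl {z : Fin 9 → ℂ} {f : MvPolynomial (Fin 10) ℂ} :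
    f ∈ fidl z ↔ ∀ i j, i ≠ j → orbHom z (z i) (z j) 1 1 f = 0 := by
  simp [fidl, Submodule.mem_iInf]

/-- Boundary arcs. -/
def Arc.isD : Arc → Bool
  | .orbit (i, []) _ (9, [1]) (9, [1]) => Nat.blt i 9
  | _ => false

theorem zext_of_lt {z : Fin 9 → ℂ} {i : ℕ} (h : i < 9) : zext z i = z ⟨i, h⟩ := dif_pos h

theorem coPoly_one (z : Fin 9 → ℂ) : coPoly z (9, [1]) = 1 := by
  simp [coPoly, listPoly, zext]

theorem coPoly_nil (z : Fin 9 → ℂ) {i : ℕ} (h : i < 9) : coPoly z (i, []) = Polynomial.C (z ⟨i, h⟩) := by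
  simp [coPoly, listPoly, zext, h]

theorem Arc.isD.vanish {z : Fin 9 → ℂ} {a : Arc} (ha : a.isD = true) {f : MvPolynomial (Fin 10) ℂ}
    (hf : f ∈ didl z) : arcHom z a f = 0 := by
  unfold Arc.isD at ha
  split at ha
  · rename_i i q
    have hi : i < 9 := Nat.le_of_ble_eq_true ha
    change orbHom z (coPoly z (i, [])) (coPoly z q) (coPoly z (9, [1])) (coPoly z (9, [1])) f = 0
    have := orbHom_comp (Polynomial.aeval (R := ℂ) (coPoly z q)) z (Polynomial.C (z ⟨i, hi⟩))
      Polynomial.X 1 1 f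
    rw [mem_didl.1 hf, map_zero, Polynomial.aeval_C, Polynomial.aeval_X, map_one] at this
    rw [coPoly_one, coPoly_nil z hi]
    exact this.symm
  · exact absurd ha (by simp)

/-- Boundary points. -/
def Arc.isF : Arc → Bool
  | .orbit (i, []) (j, []) (9, [1]) (9, [1]) => Nat.blt i 9 && Nat.blt j 9 && !Nat.beq i j
  | _ => false

theorem Arc.isF.vanish {z : Fin 9 → ℂ} {a : Arc} (ha : a.isF = true) {f : MvPolynomial (Fin 10) ℂ}
    (hf : f ∈ fidl z) : arcHom z a f = 0 := by
  unfold Arc.isF at ha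
  split at ha
  · rename_i i j
    simp only [Bool.and_eq_true, Bool.not_eq_true'] at ha
    have hi : i < 9 := Nat.le_of_ble_eq_true ha.1.1
    have hj : j < 9 := Nat.le_of_ble_eq_true ha.1.2
    have hij : (⟨i, hi⟩ : Fin 9) ≠ ⟨j, hj⟩ := fun h => Nat.ne_of_beq_eq_false ha.2 (Fin.mk.inj_iff.1 h)
    change orbHom z (coPoly z (i, [])) (coPoly z (j, [])) (coPoly z (9, [1])) (coPoly z (9, [1])) f = 0
    have := orbHom_comp (Algebra.ofId ℂ (Polynomial ℂ)) z (z ⟨i, hi⟩) (z ⟨j, hj⟩) 1 1 f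
    rw [mem_fidl.1 hf _ _ hij, map_zero, map_one] at this
    rw [coPoly_one, coPoly_nil z hi, coPoly_nil z hj]
    exact this.symm
  · exact absurd ha (by simp)

/-- Arcs on which the extreme coordinates vanish. -/
def Arc.isZ : Arc → Bool
  | .free [(9, []), _, _, _, _, _, _, _, _, (9, [])] => true
  | _ => false

theorem Arc.isZ.vanish {z : Fin 9 → ℂ} {a : Arc} (ha : a.isZ = true) :
    arcHom z a (X 0) = 0 ∧ arcHom z a (X 9) = 0 := by
  unfold Arc.isZ at ha
  split at ha
  · constructor
    · refine (aeval_X _ _).trans ?_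
      change coPoly z (9, []) = 0
      simp [coPoly, listPoly, zext]
    · refine (aeval_X _ _).trans ?_
      change coPoly z (9, []) = 0
      simp [coPoly, listPoly, zext]
  · exact absurd ha (by simp)

theorem toC_coordVar_mem (k : ℕ) : toC (coordVar ℤ k) ∈ Rp 1 ((k % 10 : ℕ) : ℤ) := by
  rw [coordVar, map_X]
  have : bw (Fin.ofNat 10 k) = (1, ((k % 10 : ℕ) : ℤ)) := rfl
  rw [Rp, ← this]
  exact isWeightedHomogeneous_X _ _ _

theorem mul_mem_Rp {m m' : ℕ} {w w' : ℤ} {f g : MvPolynomial (Fin 10) ℂ} (hf : f ∈ Rp m w)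
    (hg : g ∈ Rp m' w') : f * g ∈ Rp (m + m') (w + w') :=
  ((mem_weightedHomogeneousSubmodule _ _ _ _).1 hf).mul ((mem_weightedHomogeneousSubmodule _ _ _ _).1 hg)

/-- The fixed factor of a group of products. -/
def preProd {B : Type*} (mul : B → B → B) (one : B) (val : ℕ → B) (l : List ℕ) : B :=
  List.rec (motive := fun _ => B) one (fun k _ ih => mul ih (val (Nat.mod k 10))) l

theorem mem_run {B : Type*} {mul : B → B → B} {one : B} {val : ℕ → B} {S : ℕ → ℕ → Set B}
    (hS : ∀ m w k a, a ∈ S m w → mul a (val (k % 10)) ∈ S (m + 1) (w + k % 10)) {g : MonoGroup}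
    {m w : ℕ} (h : preProd mul one val g.pre ∈ S m w) :
    ∀ x ∈ g.run mul one val, x ∈ S (m + g.deg) (w + g.wgt) := by
  intro x hx
  refine mem_gen (T := fun k => {b | b = val k ∧ k = k % 10}) (fun m w k a b ha hb => ?_)
    (fun a ha => ?_) h (by simp) x (mem_sel hx)
  · obtain ⟨rfl, hk⟩ := hb
    rw [hk]
    exact hS m w k a ha
  · generalize g.vars = l at ha
    induction l with
    | nil => exact absurd ha List.not_mem_nil
    | cons k l ih =>
      rcases List.mem_cons.1 ha with rfl | ha
      · exact ⟨rfl, (Nat.mod_mod _ _).symm⟩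
      · exact ih ha

/-- The weight of the fixed factor. -/
def preWt (l : List ℕ) : ℕ := (l.map (· % 10)).sum

theorem preProd_mem (l : List ℕ) :
    toC (preProd (· * ·) 1 (coordVar ℤ) l) ∈ Rp l.length (preWt l : ℕ) := by
  induction l with
  | nil =>
    change toC 1 ∈ _
    rw [map_one]
    exact isWeightedHomogeneous_one _ _
  | cons k l ih =>
    change toC (preProd (· * ·) 1 (coordVar ℤ) l * coordVar ℤ (k % 10)) ∈ _
    rw [map_mul]
    have := mul_mem_Rp ih (toC_coordVar_mem (k % 10))
    rw [Nat.mod_mod] at this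
    have e : ((preWt (k :: l) : ℕ) : ℤ) = (preWt l : ℕ) + ((k % 10 : ℕ) : ℤ) := by
      rw [show preWt (k :: l) = k % 10 + preWt l from rfl]
      push_cast
      ring
    rw [e]
    exact this

theorem toC_mem_of_run {g : MonoGroup} {P : MvPolynomial (Fin 10) ℤ}
    (hP : P ∈ g.run (· * ·) 1 (coordVar ℤ)) :
    toC P ∈ Rp (g.pre.length + g.deg) ((preWt g.pre + g.wgt : ℕ) : ℤ) := by
  refine mem_run (S := fun m w => {P | toC P ∈ Rp m (w : ℕ)}) (fun m w k a ha => ?_)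
    (preProd_mem g.pre) P hP
  have := mul_mem_Rp ha (toC_coordVar_mem (k % 10))
  rw [Nat.mod_mod, ← map_mul] at this
  exact_mod_cast this

theorem toC_mem_of_run_cons {i : ℕ} {pre vars : List ℕ} {d w M : ℕ} {P : MvPolynomial (Fin 10) ℤ}
    (hP : P ∈ MonoGroup.run (· * ·) 1 (coordVar ℤ) ⟨i :: pre, vars, d, w, M⟩) :
    toC P ∈ (Rp (pre.length + d) ((preWt pre + w : ℕ) : ℤ)).map (mulX (Fin.ofNat 10 i)) := by
  refine mem_run (S := fun m w => {P | toC P ∈ (Rp m (w : ℕ)).map (mulX (Fin.ofNat 10 i))})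
    (fun m w k a ha => ?_) ?_ P hP
  · obtain ⟨f, hf, h⟩ := ha
    have := mul_mem_Rp hf (toC_coordVar_mem (k % 10))
    rw [Nat.mod_mod] at this
    refine ⟨f * toC (coordVar ℤ (k % 10)), by exact_mod_cast this, ?_⟩
    rw [map_mul toC, ← h]
    exact (mul_assoc _ _ _).symm
  · refine ⟨_, preProd_mem pre, ?_⟩
    change _ = toC (preProd (· * ·) 1 (coordVar ℤ) pre * coordVar ℤ (i % 10))
    rw [map_mul toC, mul_comm, show coordVar ℤ (i % 10) = coordVar ℤ i by
      simp only [coordVar]; congr 1; exact Fin.ext (Nat.mod_mod i 10), coordVar, map_X]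
    rfl

theorem mem_monos {l : List MonoGroup} {P : MvPolynomial (Fin 10) ℤ} (hP : P ∈ monos ℤ l) :
    ∃ g ∈ l, P ∈ g.run (· * ·) 1 (coordVar ℤ) := by
  induction l with
  | nil => exact absurd hP List.not_mem_nil
  | cons g l ih =>
    rcases List.mem_append.1 (show P ∈ g.run (· * ·) 1 (coordVar ℤ) ++ monos ℤ l from hP) with h | h
    · exact ⟨g, List.mem_cons_self, h⟩
    · obtain ⟨g', h', h''⟩ := ih h
      exact ⟨g', List.mem_cons_of_mem _ h', h''⟩

/-- The bidegree of a list of groups. -/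
def bidegOk (m w : ℕ) (l : List MonoGroup) : Bool :=
  l.all fun g => Nat.beq (g.pre.length + g.deg) m && Nat.beq (preWt g.pre + g.wgt) w

theorem toC_mem_of_bidegOk {m w : ℕ} {l : List MonoGroup} (h : bidegOk m w l = true)
    {P : MvPolynomial (Fin 10) ℤ} (hP : P ∈ monos ℤ l) : toC P ∈ Rp m (w : ℤ) := by
  obtain ⟨g, hg, hP⟩ := mem_monos hP
  have := List.all_eq_true.1 h g hg
  rw [Bool.and_eq_true] at this
  rw [← Nat.eq_of_beq_eq_true this.1, ← Nat.eq_of_beq_eq_true this.2]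
  exact toC_mem_of_run hP

/-- The multiples of some of the variables. -/
def multRp (L : List (Fin 10)) (m : ℕ) (w : ℤ) : Submodule ℂ (MvPolynomial (Fin 10) ℂ) :=
  L.foldr (fun (i : Fin 10) P => (Rp m (w - (i : ℕ))).map (mulX i) ⊔ P) ⊥

theorem le_multRp {L : List (Fin 10)} {i : Fin 10} (hi : i ∈ L) (m : ℕ) (w : ℤ) :
    (Rp m (w - (i : ℕ))).map (mulX i) ≤ multRp L m w := by
  induction L with
  | nil => exact absurd hi List.not_mem_nil
  | cons j L ih =>
    rcases List.mem_cons.1 hi with rfl | hi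
    · exact le_sup_left
    · exact (ih hi).trans le_sup_right

theorem multRp_le (L : List (Fin 10)) (m : ℕ) (w : ℤ) : multRp L m w ≤ Rp (m + 1) w := by
  induction L with
  | nil => exact bot_le
  | cons j L ih => exact sup_le (map_mulX_Rp_le m w j) ih

/-- Groups consisting of multiples of some of the variables. -/
def headOk (L : List (Fin 10)) (l : List MonoGroup) : Bool :=
  l.all fun g => match g.pre with
    | [] => false
    | i :: _ => L.contains (Fin.ofNat 10 i)

theorem toC_mem_multRp {L : List (Fin 10)} {m w : ℕ} {l : List MonoGroup}
    (h : bidegOk (m + 1) w l = true) (h' : headOk L l = true)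
    {P : MvPolynomial (Fin 10) ℤ} (hP : P ∈ monos ℤ l) : toC P ∈ multRp L m (w : ℤ) := by
  obtain ⟨g, hg, hP⟩ := mem_monos hP
  have h1 := List.all_eq_true.1 h g hg
  have h2 := List.all_eq_true.1 h' g hg
  obtain ⟨pre, vars, d, wg, M⟩ := g
  cases pre with
  | nil => exact absurd h2 (by simp)
  | cons i pre =>
    rw [Bool.and_eq_true] at h1
    have e1 := Nat.eq_of_beq_eq_true h1.1
    have e2 := Nat.eq_of_beq_eq_true h1.2
    have e3 : preWt (i :: pre) = i % 10 + preWt pre := rfl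
    simp only [List.length_cons] at e1 e2
    refine le_multRp (List.contains_iff_mem.1 h2) m _ ?_
    have := toC_mem_of_run_cons hP
    rw [show pre.length + d = m by omega,
      show (((preWt pre + wg : ℕ) : ℤ)) = (w : ℤ) - ((Fin.ofNat 10 i : Fin 10) : ℕ) by
        rw [Fin.val_ofNat]; omega] at this
    exact this

end

noncomputable section

theorem finrank_step_map {V V' : Type*} [AddCommGroup V] [Module ℂ V] [AddCommGroup V'] [Module ℂ V']
    (f : V →ₗ[ℂ] V') {A B : Submodule ℂ V} {P : Submodule ℂ V'} [Module.Finite ℂ A] [Module.Finite ℂ P]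
    (hBA : B ≤ A) (hB : B.map f ≤ P) :
    Module.finrank ℂ (P ⊔ A.map f : Submodule ℂ V') + Module.finrank ℂ B ≤
      Module.finrank ℂ P + Module.finrank ℂ A := by
  have := Submodule.finiteDimensional_of_le hBA
  have h1 := Submodule.finrank_sup_add_finrank_inf_eq P (A.map f)
  have h2 := finrank_map_add A f
  have h3 := finrank_map_add B f
  have h4 := Submodule.finrank_mono (le_inf hB (Submodule.map_mono (f := f) hBA))
  have h5 := Submodule.finrank_mono (inf_le_inf_right f.ker hBA)
  omega

instance (L : List (Fin 10)) (m : ℕ) (w : ℤ) : Module.Finite ℂ (multRp L m w) :=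
  Submodule.finiteDimensional_of_le (multRp_le L m w)

/-- Dimensions of the sum of the ideal of an orbit and the ideal of some coordinates. -/
def bb (z : Fin 9 → ℂ) (L : List (Fin 10)) (m : ℕ) (w : ℤ) : ℕ :=
  Module.finrank ℂ (pc (idl z) (m + 1) w ⊔ multRp L m w : Submodule ℂ (MvPolynomial (Fin 10) ℂ))

/-- Sum of the dimensions `bb` when variables are added successively. -/
def bsum (z : Fin 9 → ℂ) (m : ℕ) (w : ℤ) : List (Fin 10) → ℕ
  | [] => 0
  | i :: L => bb z L m (w - (i : ℕ)) + bsum z m w L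

theorem pc_le_Rp (J : Ideal (MvPolynomial (Fin 10) ℂ)) (m : ℕ) (w : ℤ) : pc J m w ≤ Rp m w :=
  fun _ hf => hf.2

theorem map_multRp_le (L : List (Fin 10)) (i : Fin 10) (m : ℕ) (w : ℤ) :
    (multRp L m (w - (i : ℕ))).map (mulX i) ≤ multRp L (m + 1) w := by
  induction L with
  | nil => simp [multRp]
  | cons j L ih =>
    change (Submodule.map (mulX j) _ ⊔ multRp L m _).map (mulX i) ≤ Submodule.map (mulX j) _ ⊔ multRp L (m + 1) w
    rw [Submodule.map_sup]
    refine sup_le_sup ?_ ih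
    rintro _ ⟨_, ⟨f, hf, rfl⟩, rfl⟩
    refine ⟨X i * f, ?_, mul_left_comm _ _ _⟩
    have := X_mul_mem_Rp hf i
    rwa [show w - (i : ℕ) - (j : ℕ) + (i : ℕ) = w - (j : ℕ) by ring] at this

theorem finrank_bsum (z : Fin 9 → ℂ) (m : ℕ) (w : ℤ) (L : List (Fin 10)) :
    Module.finrank ℂ (pc (irr (idl z)) (m + 2) w ⊔ multRp L (m + 1) w :
      Submodule ℂ (MvPolynomial (Fin 10) ℂ)) + bsum z m w L ≤
      rr z (m + 2) w + (L.map fun i : Fin 10 => NN (m + 1) (w - (i : ℕ))).sum := by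
  induction L with
  | nil =>
    change Module.finrank ℂ (pc (irr (idl z)) (m + 2) w ⊔ ⊥ : Submodule ℂ (MvPolynomial (Fin 10) ℂ)) + 0 ≤ _
    rw [sup_bot_eq]
    simp [rr]
  | cons i L ih =>
    have h := finrank_step i (pc (irr (idl z)) (m + 2) w ⊔ multRp L (m + 1) w)
      (Rp (m + 1) (w - (i : ℕ))) (pc (idl z) (m + 1) (w - (i : ℕ)) ⊔ multRp L m (w - (i : ℕ)))
      (sup_le (pc_le_Rp _ _ _) (multRp_le _ _ _)) (by
        rw [Submodule.map_sup]
        exact sup_le_sup (map_mulX_pc_le _ _ _ _) (map_multRp_le _ _ _ _))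
    rw [show multRp (i :: L) (m + 1) w = (Rp (m + 1) (w - (i : ℕ))).map (mulX i) ⊔ multRp L (m + 1) w
      from rfl, sup_comm (Submodule.map _ _), ← sup_assoc, List.map_cons, List.sum_cons, bsum]
    unfold bb NN
    unfold NN at ih
    omega

/-- Lower bound for the non-minimal part. -/
theorem le_rr_of_bsum (z : Fin 9 → ℂ) (m : ℕ) (w : ℤ) {L : List (Fin 10)} (hL : ∀ i, i ∈ L) :
    NN (m + 2) w + bsum z m w L ≤ rr z (m + 2) w + (L.map fun i : Fin 10 => NN (m + 1) (w - (i : ℕ))).sum := by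
  refine le_trans (Nat.add_le_add_right (Submodule.finrank_mono ?_) _) (finrank_bsum z m w L)
  rw [Rp_succ]
  exact iSup_le fun i => (le_multRp (hL i) (m + 1) w).trans le_sup_right

theorem hh_le_bb (z : Fin 9 → ℂ) (L : List (Fin 10)) (m : ℕ) (w : ℤ) : hh z (m + 1) w ≤ bb z L m w :=
  Submodule.finrank_mono le_sup_left

theorem bb_zero (z : Fin 9 → ℂ) (m : ℕ) (w : ℤ) :
    hh z (m + 1) w + NN m w ≤ bb z [0] m w + hh z m w := by
  have := finrank_sup_mulX (J := idl z) (i := 0) (fun f => mem_idl_of_X_mul) m w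
  rw [show w - (((0 : Fin 10) : ℕ) : ℤ) = w from sub_zero w] at this
  refine this.trans (Nat.add_le_add_right (Submodule.finrank_mono ?_) _)
  have h := le_multRp (L := [0]) List.mem_cons_self m w
  rw [show w - (((0 : Fin 10) : ℕ) : ℤ) = w from sub_zero w] at h
  exact sup_le_sup_left h _

/-- Lower bound for the sum of the ideal of an orbit and the ideal of some coordinates. -/
theorem add_hh_le_bb {z : Fin 9 → ℂ} {L : List (Fin 10)} {m w n : ℕ} {l : List MonoGroup}
    {arcs : List (ℕ × Arc)}
    (h : n ≤ Module.finrank ℂ (Submodule.span ℂ {x | x ∈ (monos ℤ l).map (arcCoeffs z arcs)}))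
    (hl : bidegOk (m + 1) w l = true) (hL : headOk L l = true)
    (ha : (arcs.all fun a => a.2.isOrb) = true) : n + hh z (m + 1) w ≤ bb z L m w :=
  finrank_vanish_le h (fun _ hP => (le_sup_right : multRp L m w ≤ _) (toC_mem_multRp hl hL hP))
    le_sup_left fun _ hf a hm => Arc.isOrb.vanish (List.all_eq_true.1 ha a hm) hf.1

theorem idl_le_didl (z : Fin 9 → ℂ) : idl z ≤ didl z := fun _ hf =>
  mem_didl.2 fun _ => orbHom_eq_zero _ _ _ _ hf

theorem X_zero_mem_didl (z : Fin 9 → ℂ) : X 0 ∈ didl z := by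
  refine mem_didl.2 fun i => ?_
  rw [orbHom_X]
  fin_cases i <;> simp [orb, prodCoeff, zext]

/-- Lower bound for the sum of the ideal of an orbit and the ideal of some coordinates, by restriction
to the boundary. -/
theorem add_hh_le_bb_boundary {z : Fin 9 → ℂ} {L : List (Fin 10)} {m w n : ℕ} {l : List MonoGroup}
    {arcs : List (ℕ × Arc)}
    (h : n ≤ Module.finrank ℂ (Submodule.span ℂ {x | x ∈ (monos ℤ l).map (arcCoeffs z arcs)}))
    (hl : bidegOk (m + 1) w l = true) (hL : headOk L l = true)
    (ha : (arcs.all fun a => a.2.isD) = true) (h0 : 0 ∈ L) :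
    n + (hh z (m + 1) w + NN m w) ≤ bb z L m w + hh z m w := by
  have h1 := finrank_sup_mulX (J := idl z) (i := 0) (fun f => mem_idl_of_X_mul) m w
  have h2 := finrank_vanish_le (U := pc (idl z) (m + 1) w ⊔ multRp L m w)
    (V := pc (idl z) (m + 1) w ⊔ (Rp m (w - ((0 : Fin 10) : ℕ))).map (mulX 0)) h
    (fun P hP => (le_sup_right : multRp L m w ≤ _) (toC_mem_multRp hl hL hP))
    (sup_le_sup_left (le_multRp h0 m w) _) fun f hf a hm => Arc.isD.vanish (List.all_eq_true.1 ha a hm) ?_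
  · rw [show (w : ℤ) - (((0 : Fin 10) : ℕ) : ℤ) = w from sub_zero _] at h1 h2
    unfold bb hh
    omega
  · obtain ⟨p, hp, _, ⟨g, -, rfl⟩, rfl⟩ := Submodule.mem_sup.1 hf
    exact Ideal.add_mem _ (idl_le_didl z hp.1) (Ideal.mul_mem_right _ _ (X_zero_mem_didl z))

/-- The coordinate ring modulo some coordinates vanishes in the given bidegree. -/
def FullAt (z : Fin 9 → ℂ) (L : List (Fin 10)) (m : ℕ) (w : ℤ) : Prop :=
  Rp (m + 1) w ≤ pc (idl z) (m + 1) w ⊔ multRp L m w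

theorem fullAt_of_bb {z : Fin 9 → ℂ} {L : List (Fin 10)} {m : ℕ} {w : ℤ} (h : NN (m + 1) w ≤ bb z L m w) :
    FullAt z L m w :=
  (Submodule.eq_of_le_of_finrank_le (sup_le (pc_le_Rp _ _ _) (multRp_le _ _ _)) h).ge

theorem FullAt.bb {z : Fin 9 → ℂ} {L : List (Fin 10)} {m : ℕ} {w : ℤ} (h : FullAt z L m w) :
    NN (m + 1) w ≤ bb z L m w := Submodule.finrank_mono h

theorem FullAt.succ {z : Fin 9 → ℂ} {L : List (Fin 10)} {m : ℕ} {w : ℤ} (S : List (Fin 10))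
    (hS : ∀ i ∈ S, FullAt z L m (w - (i : ℕ)))
    (h : ∀ d : Fin 10 → ℕ, (∀ i ∈ L ++ S, d i = 0) → ∑ i, d i = m + 2 →
      ∑ i, (d i : ℤ) * (i : ℕ) = w → False) : FullAt z L (m + 1) w := by
  refine Rp_le fun d hd => ?_
  by_contra hc
  have hw := hd
  rw [weight_bw, Prod.mk.injEq] at hw
  refine h d (fun i hi => ?_) hw.1 hw.2
  by_contra hi0
  obtain ⟨e1, e2⟩ := weight_sub_single hd hi0
  refine hc ?_
  rw [monomial_eq_X_mul e1]
  have hm := monomial_mem_Rp e2 1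
  rcases List.mem_append.1 hi with hi | hi
  · exact (le_multRp hi (m + 1) w).trans le_sup_right ⟨_, hm, rfl⟩
  · have h1 : _ ∈ Submodule.map (mulX i) _ := ⟨_, hS i hi hm, rfl⟩
    rw [Submodule.map_sup] at h1
    exact sup_le_sup ((map_mulX_pc_le _ _ _ _).trans (inf_le_inf_right _ fun f hf => irr_le _ hf))
      (map_multRp_le _ _ _ _) h1

/-- Multiplication of `pc` by a fixed form. -/
theorem pc_irr_le_mul {J : Ideal (MvPolynomial (Fin 10) ℂ)} (hJ : BiHom J)
    {f : MvPolynomial (Fin 10) ℂ} {m n : ℕ} {v : ℤ}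
    (h : ∀ w, pc J m w ≤ (Rp n (w - v)).map (LinearMap.mulLeft ℂ f)) (w : ℤ) :
    pc (irr J) (m + 1) w ≤ (Rp (n + 1) (w - v)).map (LinearMap.mulLeft ℂ f) := by
  rw [pc_irr hJ]
  refine iSup_le fun i => ?_
  rintro _ ⟨g, hg, rfl⟩
  obtain ⟨g, hg', rfl⟩ := h _ hg
  refine ⟨X i * g, ?_, mul_left_comm _ _ _⟩
  have := X_mul_mem_Rp hg' i
  rwa [show w - (i : ℕ) - v + (i : ℕ) = w - v by ring] at this

theorem finrank_map_mul {f : MvPolynomial (Fin 10) ℂ} (hf : f ≠ 0)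
    (U : Submodule ℂ (MvPolynomial (Fin 10) ℂ)) :
    Module.finrank ℂ (U.map (LinearMap.mulLeft ℂ f)) = Module.finrank ℂ U :=
  (LinearEquiv.finrank_eq (Submodule.equivMapOfInjective _
    (fun _ _ h => mul_left_cancel₀ hf h) U)).symm

/-- The first component of the rows of the blocks. -/
def blkIncl : (ℕ → ℂ) →ₗ[ℂ] (ℕ × ℕ → ℂ) :=
  LinearMap.pi fun k => if k.1 = 0 then LinearMap.proj k.2 else 0

theorem blkIncl_apply (u : ℕ → ℂ) (k : ℕ × ℕ) : blkIncl u k = if k.1 = 0 then u k.2 else 0 := by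
  rw [blkIncl, LinearMap.pi_apply]
  split_ifs <;> rfl

/-- The rows of a block. -/
def blkMap (z : Fin 9 → ℂ) (sarcs : List (ℕ × Arc)) (t : ℕ) (b : Blk) :
    MvPolynomial (Fin 10) ℂ →ₗ[ℂ] (ℕ × ℕ → ℂ) :=
  LinearMap.pi fun k =>
    if k.1 = 0 then LinearMap.proj k.2 ∘ₗ coeffsC z sarcs ∘ₗ mulX (Fin.ofNat 10 b.idx) else
      if k.1 = t + 1 then LinearMap.proj k.2 ∘ₗ coeffsC z b.arcs else 0

theorem blkMap_apply (z : Fin 9 → ℂ) (sarcs : List (ℕ × Arc)) (t : ℕ) (b : Blk)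
    (f : MvPolynomial (Fin 10) ℂ) (k : ℕ × ℕ) :
    blkMap z sarcs t b f k = if k.1 = 0 then coeffsC z sarcs (X (Fin.ofNat 10 b.idx) * f) k.2 else
      if k.1 = t + 1 then coeffsC z b.arcs f k.2 else 0 := by
  rw [blkMap, LinearMap.pi_apply]
  split_ifs <;> rfl

theorem finrank_blkVecs_step {z : Fin 9 → ℂ} {sarcs : List (ℕ × Arc)} {m : ℕ} {w : ℤ} (t : ℕ) {b : Blk}
    (h10 : b.idx < 10) (hO : ∀ a ∈ b.arcs, a.2.isOrb = true) {U : Submodule ℂ (ℕ × ℕ → ℂ)}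
    [Module.Finite ℂ U]
    (hU : ((pc (irr (idl z)) (m + 2) w).map (coeffsC z sarcs)).map blkIncl ≤ U) :
    Module.finrank ℂ (U ⊔ (Rp (m + 1) (w - (b.idx : ℕ))).map (blkMap z sarcs t b) :
      Submodule ℂ (ℕ × ℕ → ℂ)) ≤ Module.finrank ℂ U + AA z (m + 1) (w - (b.idx : ℕ)) := by
  have e10 : ((Fin.ofNat 10 b.idx : Fin 10) : ℕ) = b.idx := Nat.mod_eq_of_lt h10
  have hI : (pc (idl z) (m + 1) (w - (b.idx : ℕ))).map (blkMap z sarcs t b) ≤ U := by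
    refine le_trans ?_ hU
    rintro _ ⟨f, hf, rfl⟩
    have hf' : f ∈ pc (idl z) (m + 1) (w - ((Fin.ofNat 10 b.idx : Fin 10) : ℕ)) := by rwa [e10]
    have hX : mulX (Fin.ofNat 10 b.idx) f ∈ pc (irr (idl z)) (m + 2) w :=
      map_mulX_pc_le _ _ _ _ (Submodule.mem_map_of_mem hf')
    have h0 : coeffsC z b.arcs f = 0 := coeffsC_eq_zero fun a ha => Arc.isOrb.vanish (hO a ha) hf.1
    have e : blkMap z sarcs t b f = blkIncl (coeffsC z sarcs (mulX (Fin.ofNat 10 b.idx) f)) := by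
      funext k
      rw [blkIncl_apply, blkMap_apply, h0, Pi.zero_apply, ite_self]
      rfl
    rw [e]
    exact Submodule.mem_map_of_mem (Submodule.mem_map_of_mem hX)
  have h1 := finrank_step_map _ (pc_le_Rp (idl z) (m + 1) (w - (b.idx : ℕ))) hI
  have h2 := AA_add_hh z (m + 1) (w - (b.idx : ℕ))
  unfold hh NN at h2
  omega

/-- The span of the rows of the blocks. -/
theorem finrank_blkVecs_le {z : Fin 9 → ℂ} {sarcs : List (ℕ × Arc)} {m : ℕ} {w : ℤ} {l : List Blk}
    (hl : ∀ b ∈ l, b.idx < 10 ∧ (∀ P ∈ monos ℤ b.gs, toC P ∈ Rp (m + 1) (w - (b.idx : ℕ))) ∧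
      (∀ a ∈ b.arcs, a.2.isOrb = true) ∧ AA z (m + 1) (w - (b.idx : ℕ)) ≤ Packed.slots b.arcs) :
    Module.finrank ℂ (Submodule.span ℂ {x | x ∈ blkVecs z sarcs l}) ≤
      Module.finrank ℂ ((pc (irr (idl z)) (m + 2) w).map (coeffsC z sarcs)) +
        (l.map fun b => Packed.slots b.arcs).sum := by
  set Z := ((pc (irr (idl z)) (m + 2) w).map (coeffsC z sarcs)).map blkIncl with hZ
  have key : ∃ U : Submodule ℂ (ℕ × ℕ → ℂ), Module.Finite ℂ U ∧ Z ≤ U ∧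
      Submodule.span ℂ {x | x ∈ blkVecs z sarcs l} ≤ U ∧
      Module.finrank ℂ U ≤ Module.finrank ℂ Z + (l.map fun b => Packed.slots b.arcs).sum := by
    induction l with
    | nil => exact ⟨Z, inferInstance, le_rfl, by simp [blkVecs], by simp⟩
    | cons b l ih =>
      obtain ⟨U, hU, hZU, hlU, hr⟩ := ih fun b hb => hl b (List.mem_cons_of_mem _ hb)
      obtain ⟨h10, hR, hO, hA⟩ := hl b List.mem_cons_self
      have h1 := finrank_blkVecs_step (m := m) (w := w) l.length h10 hO hZU
      refine ⟨U ⊔ (Rp (m + 1) (w - (b.idx : ℕ))).map (blkMap z sarcs l.length b), inferInstance, hZU.trans le_sup_left,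
        Submodule.span_le.2 fun x hx => ?_, ?_⟩
      · rcases List.mem_append.1 hx with hx | hx
        · obtain ⟨P, hP, rfl⟩ := List.mem_map.1 hx
          refine (le_sup_right : Submodule.map (blkMap z sarcs l.length b) _ ≤ _) ⟨_, hR P hP, ?_⟩
          ext k
          rw [blkMap_apply, Blk.vec, ← coeffsC_toC, ← coeffsC_toC, map_mul toC, coordVar, map_X]
        · exact (le_sup_left : U ≤ _) (hlU (Submodule.subset_span hx))
      · rw [List.map_cons, List.sum_cons]
        omega
  obtain ⟨U, hU, -, hlU, hr⟩ := key
  exact (Submodule.finrank_mono hlU).trans (hr.trans (Nat.add_le_add_right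
    (Submodule.finrank_map_le blkIncl _) _))

theorem finrank_blkVecs_le_of_all {z : Fin 9 → ℂ} {sarcs : List (ℕ × Arc)} {m w : ℕ} {l : List Blk}
    (hl : (l.all fun b => Nat.blt b.idx 10 && (Nat.ble b.idx w && bidegOk (m + 2) (w - b.idx) b.gs) &&
      b.arcs.all fun a => a.2.isOrb) = true)
    (hA : ∀ b ∈ l, AA z (m + 2) (w - (b.idx : ℕ)) ≤ Packed.slots b.arcs) :
    Module.finrank ℂ (Submodule.span ℂ {x | x ∈ blkVecs z sarcs l}) ≤
      Module.finrank ℂ ((pc (irr (idl z)) (m + 1 + 2) w).map (coeffsC z sarcs)) +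
        (l.map fun b => Packed.slots b.arcs).sum := by
  refine finrank_blkVecs_le (m := m + 1) fun b hb => ?_
  have := List.all_eq_true.1 hl b hb
  simp only [Bool.and_eq_true] at this
  obtain ⟨⟨h1, h2, h3⟩, h4⟩ := this
  refine ⟨Nat.le_of_ble_eq_true h1, fun P hP => ?_, fun a ha => List.all_eq_true.1 h4 a ha, hA b hb⟩
  have := toC_mem_of_bidegOk h3 hP
  rwa [Nat.cast_sub (Nat.le_of_ble_eq_true h2)] at this

def Arc.isY : Arc → Bool
  | .free [(9, []), _, _, _, _, _, _, _, _, _] => true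
  | _ => false

theorem Arc.isY.vanish {z : Fin 9 → ℂ} {a : Arc} (ha : a.isY = true) : arcHom z a (X 0) = 0 := by
  unfold Arc.isY at ha
  split at ha
  · refine (aeval_X _ _).trans ?_
    change coPoly z (9, []) = 0
    simp [coPoly, listPoly, zext]
  · exact absurd ha (by simp)

/-- Lower bound for the non-minimal part from restrictions modulo the extreme coordinates. -/
theorem le_rr_of_blk {z : Fin 9 → ℂ} {sarcs : List (ℕ × Arc)} {m w n : ℕ} {l : List Blk}
    (h : n + (l.map fun b => Packed.slots b.arcs).sum ≤ Module.finrank ℂ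
      (Submodule.span ℂ {x | x ∈ blkVecs z sarcs l}))
    (hs : (sarcs.all fun a => a.2.isZ) = true)
    (hl : (l.all fun b => Nat.blt b.idx 10 && (Nat.ble b.idx w && bidegOk (m + 2) (w - b.idx) b.gs) &&
      b.arcs.all fun a => a.2.isOrb) = true)
    (hA : ∀ b ∈ l, AA z (m + 2) (w - (b.idx : ℕ)) ≤ Packed.slots b.arcs) :
    n + (hh z (m + 2) w + hh z (m + 2) (w - 9)) ≤ rr z (m + 3) w + hh z (m + 1) (w - 9) := by
  have h1 := finrank_blkVecs_le_of_all (z := z) (sarcs := sarcs) hl hA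
  have h2 := finrank_two z (m + 1) w (i := 0) (j := 9) (by decide)
  have h3 := finrank_map_add (pc (irr (idl z)) (m + 1 + 2) w) (coeffsC z sarcs)
  have h4 : (pc (idl z) (m + 1 + 1) (w - ((0 : Fin 10) : ℕ))).map (mulX 0) ⊔
      (pc (idl z) (m + 1 + 1) (w - ((9 : Fin 10) : ℕ))).map (mulX 9) ≤
      pc (irr (idl z)) (m + 1 + 2) w ⊓ (coeffsC z sarcs).ker := by
    refine sup_le ?_ ?_ <;> refine le_inf (map_mulX_pc_le _ _ _ _) ?_ <;> rintro _ ⟨f, -, rfl⟩ <;>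
      refine coeffsC_eq_zero fun a ha => ?_
    · rw [LinearMap.mulLeft_apply, map_mul, (Arc.isZ.vanish (List.all_eq_true.1 hs a ha)).1, zero_mul]
    · rw [LinearMap.mulLeft_apply, map_mul, (Arc.isZ.vanish (List.all_eq_true.1 hs a ha)).2, zero_mul]
  have h5 := Submodule.finrank_mono h4
  rw [show (w : ℤ) - ((0 : Fin 10) : ℕ) = w from sub_zero _] at h2 h5
  rw [show (((9 : Fin 10) : ℕ) : ℤ) = 9 from rfl] at h2 h5
  change _ + (hh z (m + 1 + 1) w + hh z (m + 1 + 1) (w - 9)) ≤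
    Module.finrank ℂ (pc (irr (idl z)) (m + 1 + 2) w) + _
  omega

/-- Lower bound for the non-minimal part from restrictions modulo the first coordinate. -/
theorem le_rr_of_blk_zero {z : Fin 9 → ℂ} {sarcs : List (ℕ × Arc)} {m w n : ℕ} {l : List Blk}
    (h : n + (l.map fun b => Packed.slots b.arcs).sum ≤ Module.finrank ℂ
      (Submodule.span ℂ {x | x ∈ blkVecs z sarcs l}))
    (hs : (sarcs.all fun a => a.2.isY) = true)
    (hl : (l.all fun b => Nat.blt b.idx 10 && (Nat.ble b.idx w && bidegOk (m + 2) (w - b.idx) b.gs) &&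
      b.arcs.all fun a => a.2.isOrb) = true)
    (hA : ∀ b ∈ l, AA z (m + 2) (w - (b.idx : ℕ)) ≤ Packed.slots b.arcs) :
    n + hh z (m + 2) w ≤ rr z (m + 3) w := by
  have h1 := finrank_blkVecs_le_of_all (z := z) (sarcs := sarcs) hl hA
  have h2 := finrank_map_mulX 0 (pc (idl z) (m + 1 + 1) w)
  have h3 := finrank_map_add (pc (irr (idl z)) (m + 1 + 2) w) (coeffsC z sarcs)
  have h4 : (pc (idl z) (m + 1 + 1) w).map (mulX 0) ≤
      pc (irr (idl z)) (m + 1 + 2) w ⊓ (coeffsC z sarcs).ker := by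
    have := map_mulX_pc_le (idl z) (m + 1 + 1) w 0
    rw [show (w : ℤ) - ((0 : Fin 10) : ℕ) = w from sub_zero _] at this
    refine le_inf this ?_
    rintro _ ⟨f, -, rfl⟩
    refine coeffsC_eq_zero fun a ha => ?_
    rw [LinearMap.mulLeft_apply, map_mul, Arc.isY.vanish (List.all_eq_true.1 hs a ha), zero_mul]
  have h5 := Submodule.finrank_mono h4
  change _ + hh z (m + 1 + 1) w ≤ Module.finrank ℂ (pc (irr (idl z)) (m + 1 + 2) w)
  change _ = hh z (m + 1 + 1) w at h2
  omega

end

noncomputable section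

theorem gf_zero_right (n : ℕ) : gf n 0 = 1 := by cases n <;> rw [gf]

theorem gf_zero_left (m : ℕ) : gf 0 (m + 1) = 0 := by rw [gf]

theorem gf_succ (n m : ℕ) : gf (n + 1) (m + 1) = gf n (m + 1) + Polynomial.X ^ n * gf (n + 1) m := by rw [gf]

theorem gf_coeff_lt (n m w : ℕ) : (gf n m).coeff w < 2 ^ (n + m + 1) := by
  induction m generalizing n w with
  | zero =>
    rw [gf_zero_right, Polynomial.coeff_one]
    exact lt_of_le_of_lt (by split_ifs <;> decide) (Nat.one_lt_two_pow (Nat.succ_ne_zero _))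
  | succ m ihm =>
    induction n generalizing w with
    | zero => simp [gf_zero_left]
    | succ n ihn =>
      have h1 := ihn w
      have h2 := ihm (n + 1) (w - n)
      rw [gf_succ, Polynomial.coeff_add, Polynomial.coeff_X_pow_mul']
      have e1 : 2 ^ (n + 1 + (m + 1) + 1) = 2 ^ (n + (m + 1) + 1) + 2 ^ (n + 1 + m + 1) := by ring
      split_ifs <;> omega

theorem coeff_of_eval (p : Polynomial ℕ) (hp : ∀ i, p.coeff i < 2 ^ 40) (w : ℕ) :
    p.coeff w = p.eval (2 ^ 40) / 2 ^ (40 * w) % 2 ^ 40 := by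
  induction w generalizing p with
  | zero =>
    rw [Packed.eval_eq_divX, mul_zero, pow_zero, Nat.div_one, Nat.add_mul_mod_self_left,
      Nat.mod_eq_of_lt (hp 0)]
  | succ w ih =>
    rw [Packed.eval_eq_divX, ← Polynomial.coeff_divX, ih _ fun i => by
      rw [Polynomial.coeff_divX]; exact hp _, show 40 * (w + 1) = 40 + 40 * w by ring, pow_add,
      ← Nat.div_div_eq_div_mul, Nat.add_mul_div_left _ _ (by norm_num),
      Nat.div_eq_of_lt (hp 0), zero_add]

/-- The next row of values of `gf` at `2 ^ 40`, starting from column `n` with value `a`. -/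
def gfRow : ℕ → ℕ → List ℕ → List ℕ
  | _, _, [] => []
  | n, a, b :: l => (a + 2 ^ (40 * n) * b) :: gfRow (n + 1) (a + 2 ^ (40 * n) * b) l

theorem gfRow_eq (m k n : ℕ) :
    gfRow n ((gf n (m + 1)).eval (2 ^ 40)) ((List.range' (n + 1) k).map fun i => (gf i m).eval (2 ^ 40)) =
      (List.range' (n + 1) k).map fun i => (gf i (m + 1)).eval (2 ^ 40) := by
  induction k generalizing n with
  | zero => rfl
  | succ k ih =>
    have h : (gf n (m + 1)).eval (2 ^ 40) + 2 ^ (40 * n) * (gf (n + 1) m).eval (2 ^ 40) =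
        (gf (n + 1) (m + 1)).eval (2 ^ 40) := by
      rw [gf_succ, Polynomial.eval_add, Polynomial.eval_mul, Polynomial.eval_pow, Polynomial.eval_X,
        pow_mul]
    rw [List.range'_succ, List.map_cons, List.map_cons, gfRow, h, ih]

/-- Generating polynomials of the numbers of monomials, at `2 ^ 40`. -/
def cntPacked : List ℕ :=
  [1,
    2348542582775969214925403449540624276577770085264820666376112219229092929013923173950988053960908309354512385,
    5515652263107003755238850450967583647108616808156662323124614622053053576237332035852952914281562735787051511222645820177970810520032466793275023919179133518782337289469794285564778536338799615221291316933303996514305,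
    12953744211679660936288357293715746180252341540135766035709209036073465364752775916032590126788220794733851614725767250825473876250923410324507453444269939595129298625304043854851960718829332817742384079904567993233691382998811088846913901075553524048015498319084452659179352885274653278646525423121157849613704239541433401345,
    30422419887489743148773943379776816755471378256258044564531160789481967255588944582423214289164807858912935946506638397980213895996533471719888238186149468886423742805421653212315044110850315593310903936509575383939783544989094543696076885101163000626758886458590593755146222842826075881419263409367470030867915119258714623212272477638464143608660303168610881417550148616530413631588479932407763855077722048078774047333595504877502465,
    71448348576795190254883684186979905665147958390777301187936289432823425470900801961508102566933086640826377354177532399209517666423575702698925684860730722249347341237033931507117590379678219224908394665139058848801440592897285866593818735068874144005707015198459028832124017901004471586199776289282736831730871919612886851669063341786857400044790361979291988603774642089560070781504980429675466362276444081893135711399257995051153850730376299047985512328860050229242559192330814205790874661582967014007903060559934714742994380100248719589377,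
    167799489101471707612939964894878316951358971089742180921545235783940785774438141153243518319377354389055108325985337691846315248220834609685179655720738030808088931192733389840123264116792604584624076150588560163390442773940748246192544359280723038536013517611729820548480720030046157453977803891941297399435245203090958989392489747580207350130560025169669940997093027729448332569288055137054881520058827346312805628032109738574775411192181423847819424468100862571371657338458009182347107045532901377574183587134102007044083000101307597350231216080140224115541718962106352998480887648185116398351244269618003074524583185961947818053153034500522901505,
    394084245522500044486840653423451589947838866220646843169889730501942630822529112117065528625769012412444815361321013203517097005907299947451354953990640323414107401040002414504412631844593129956198809214784366664750138442537038404739873660971802111969271309129865004906213912713316510863635039776755805535085226856176241814036342909555141190380926105436956830799859302583767846603583975079386489358613420091325797677594328137051480464019270462576835001261592115529389500830834311846538472091016418926934843878661568671152623431573393975677441346257115535549026337857867404663427714804997700417590882474864108274939495391074581586922928033980775528824795625621453036441667547721093314810326443403526926568454525967596042388438992893176919441032396330514776065,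
    925523631809889677347306413639204556158061236650644091875569507244125805131978416647414858412351159041161239474818866259266804441526273292581332847044392338627350466225444014409943102752382838056616833501487129750197794699421712231509494591085489063524809962001358279543808593253637860729563587182106547428140506062241798929157171086044910423875405061180409895564555836108555100630394936662700226723461340339626413003397957286340629263574834800418954365121334102271812654735729621290069324749424266319749478906819762454670376563707831389877737090693860308481942308935298692332924559326695167189666070239156417695749830707168260510796081123175398591778377408327593185057849133693695501971351455343819220113902627443156437919096933849767719087673734468841824818171597449910744870317501011773424585563145472522648831694086479669287964230413898885666917406572923987165185,
    2173631660669016575463832007333927707769733444229470956061698896065314920155654654624170837826798123936022537067805800317925523757774355938816344455122444850197704622982979974393809151327163451765949830028731327685944157947109433099527972795052748698581602994892716191892456129719306996141833074887787941585068489409372162769033619795395424163991723742313768827189331987771123138384660338436412808427993029723343090152580422312742572611596974584367448675303358538042516110891445457374725984804483914866841419534337430511775697560243739981087058924402167182281918628356865804404854583826731280878245293328935896121713694429092998026400258964780075330074137399834051787037757424852619992648134960525293981849791884089630818832245565884437743891576713738537768020831310839764191930219268614250996098460079739868619144827953667766051789961843620532883464152264448015669038638304789651225991122344135479917318381841784839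988717856483345341583897965364902419483572855557923478175745,
    5104866514346588439758903132358006234947570316936161575654049931162108152346994265188948182547774260496994861212391910439143688267627137810206277829727953482431234964651821045479454124776294913622910305422132816467525883155203255322617239460147686611284081686786193718052940201935590619537096287358191014438765120011632282003634124452243283175101003953039912208887522471812691788017357167305573974198365731031544482988436024617609844031592914285988512533072610267807174611351259141070256723894154213967355241786284316389631205908643235888708440693784773457043734216066237486685623131641144721423419232681390293876512134653317003317714923465163719610033663222834174767953328023409352758462533405499401500517301441815549061063649862906032409834392517513590457291283000930680970417879448679687475362110183790217439182522075978200950809151202560547638172738404137335578989229823868271384610683136384264700086608258804750067823866782948086806848045593443237777235832852025711275588423320120718611054141013101633410273889331661702453331352056383287067325815732614536837906632738353816010753]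

theorem gf_eval : ∀ m ≤ 10, (gf 10 m).eval (2 ^ 40) = cntPacked.getD m 0 := by
  have key (m : ℕ) : (List.range' 1 10).map (fun i => (gf i m).eval (2 ^ 40)) =
      (gfRow 0 0)^[m] [1, 1, 1, 1, 1, 1, 1, 1, 1, 1] := by
    induction m with
    | zero => simp [gf_zero_right, List.range']
    | succ m ih => rw [Function.iterate_succ_apply', ← ih, ← gfRow_eq, gf_zero_left, Polynomial.eval_zero]
  have h : ∀ m < 11, ((gfRow 0 0)^[m] [1, 1, 1, 1, 1, 1, 1, 1, 1, 1]).getD 9 0 = cntPacked.getD m 0 := by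
    decide +kernel
  intro m hm
  rw [← h m (by omega), ← key]
  rfl

/-- Numbers of monomials. -/
def cnt (m w : ℕ) : ℕ := Nat.mod (Nat.div (cntPacked.getD m 0) (Nat.pow 2 (Nat.mul 40 w))) 1099511627776

theorem NN_eq {m : ℕ} (hm : m ≤ 10) (w : ℕ) : NN m w = cnt m w := by
  have h1 : NN m w = (gf 10 m).coeff w := by
    rw [NN, finrank_Rp, if_neg (by omega), Int.toNat_natCast]
  rw [h1, coeff_of_eval _ fun i => (gf_coeff_lt 10 m i).trans_le (Nat.pow_le_pow_right (by norm_num) (by omega)),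
    gf_eval m hm]
  rfl

end

noncomputable section

/-- Dimensions of the pieces of the ideal of a general orbit, in degrees at least four. -/
def hTable : List (List ℕ) :=
  [[0, 0, 0, 0, 0, 0, 0, 0, 0, 0, 0, 0, 0, 0, 0, 0, 0, 0, 1, 0, 0, 0, 0, 0, 0, 0, 0, 0, 0, 0, 0, 0, 0, 0, 0, 0, 0],
    [0, 0, 0, 0, 0, 0, 0, 0, 0, 0, 0, 0, 0, 0, 0, 0, 0, 0, 1, 1, 1, 1, 1, 1, 1, 1, 1, 1, 0, 0, 0, 0, 0, 0, 0, 0, 0, 0, 0, 0, 0, 0, 0, 0, 0, 0],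
    [0, 0, 0, 0, 0, 0, 0, 0, 0, 0, 0, 0, 0, 0, 0, 0, 0, 0, 1, 1, 3, 3, 6, 6, 11, 11, 14, 14, 14, 11, 11, 6, 6, 3, 3, 1, 1, 0, 0, 0, 0, 0, 0, 0, 0, 0, 0, 0, 0, 0, 0, 0, 0, 0, 0],
    [0, 0, 0, 0, 0, 0, 0, 0, 0, 0, 0, 0, 0, 0, 0, 0, 0, 0, 1, 1, 6, 13, 22, 32, 45, 56, 68, 79, 88, 95, 101, 103, 103, 101, 95, 88, 79, 68, 56, 45, 32, 22, 13, 6, 1, 1, 0, 0, 0, 0, 0, 0, 0, 0, 0, 0, 0, 0, 0, 0, 0, 0, 0, 0],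
    [0, 0, 0, 0, 0, 0, 0, 0, 0, 0, 0, 0, 0, 0, 0, 0, 0, 0, 1, 2, 13, 25, 45, 65, 94, 119, 152, 181, 215, 242, 274, 296, 322, 337, 353, 358, 365, 358, 353, 337, 322, 296, 274, 242, 215, 181, 152, 119, 94, 65, 45, 25, 13, 2, 1, 0, 0, 0, 0, 0, 0, 0, 0, 0, 0, 0, 0, 0, 0, 0, 0, 0, 0],
    [0, 0, 0, 0, 0, 0, 0, 0, 0, 0, 0, 0, 0, 0, 0, 0, 0, 0, 1, 3, 16, 35, 62, 95, 138, 183, 236, 293, 354, 416, 482, 544, 608, 668, 723, 773, 819, 854, 882, 902, 911, 911, 902, 882, 854, 819, 773, 723, 668, 608, 544, 482, 416, 354, 293, 236, 183, 138, 95, 62, 35, 16, 3, 1, 0, 0, 0, 0, 0, 0, 0, 0, 0, 0, 0, 0, 0, 0, 0, 0, 0, 0],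
    [0, 0, 0, 0, 0, 0, 0, 0, 0, 0, 0, 0, 0, 0, 0, 0, 0, 0, 1, 3, 18, 39, 74, 115, 173, 234, 311, 392, 487, 583, 694, 800, 919, 1032, 1152, 1262, 1379, 1479, 1582, 1667, 1750, 1811, 1870, 1902, 1931, 1935, 1931, 1902, 1870, 1811, 1750, 1667, 1582, 1479, 1379, 1262, 1152, 1032, 919, 800, 694, 583, 487, 392, 311, 234, 173, 115, 74, 39, 18, 3, 1, 0, 0, 0, 0, 0, 0, 0, 0, 0, 0, 0, 0, 0, 0, 0, 0, 0, 0]]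

/-- Dimensions of the pieces of the ideal of a general orbit. -/
def hTab (m w : ℕ) : ℕ := if m < 4 then 0 else (hTable.getD (m - 4) []).getD w 0

theorem hh_le_succ (z : Fin 9 → ℂ) (m : ℕ) (w : ℤ) : hh z m w ≤ hh z (m + 1) w := by
  have := hh_le_rr z m w 0
  rw [show w - (((0 : Fin 10) : ℕ) : ℤ) = w from sub_zero w] at this
  exact this.trans (rr_le_hh _ _ _)

theorem hh_le_of_le (z : Fin 9 → ℂ) {m n : ℕ} (h : m ≤ n) (w : ℤ) : hh z m w ≤ hh z n w := by
  induction n, h using Nat.le_induction with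
  | base => exact le_rfl
  | succ n _ ih => exact ih.trans (hh_le_succ z n w)

theorem hh_le_hh (z : Fin 9 → ℂ) {m v w : ℕ} (h : v ≤ w) (hw : 2 * w ≤ 9 * m + 1) : hh z m v ≤ hh z m w := by
  induction w, h using Nat.le_induction with
  | base => exact le_rfl
  | succ w _ ih =>
    have := hh_mono (m := m) (w := w) (by omega) z
    push_cast
    exact (ih (by omega)).trans this

/-- The growth of the dimensions is determined by the dimension in the middle weight. -/
theorem AA_eq_of_mid {z : Fin 9 → ℂ} {m s M : ℕ} (T : ℕ → ℕ) (hM : 2 * M ≤ 9 * m + 1)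
    (hs : AA z m s ≤ T s) (hmid : T M ≤ AA z m M)
    (hT : ∀ w, s ≤ w → w < M → NN m w ≤ NN m (w + 1) ∧
      T (w + 1) = T w + min (9 * m - 2 * w - 1) (NN m (w + 1) - NN m w)) (w : ℕ) (hw : s ≤ w) (hwM : w ≤ M) :
    AA z m w = T w := by
  have step (w : ℕ) (h1 : s ≤ w) (h2 : w < M) : AA z m ((w + 1 : ℕ) : ℤ) + T w ≤ AA z m w + T (w + 1) := by
    have h3 := AA_step (m := m) (w := w) (by omega) z
    have h4 := hh_mono (m := m) (w := w) (by omega) z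
    have h5 := AA_add_hh z m w
    have h6 := AA_add_hh z m (w + 1)
    have h7 := hT w h1 h2
    push_cast
    omega
  have up (w : ℕ) (hw : s ≤ w) (hwM : w ≤ M) : AA z m w ≤ T w := by
    induction w, hw using Nat.le_induction with
    | base => exact hs
    | succ w hw ih =>
      have := step w hw hwM
      have := ih (by omega)
      omega
  have down (w : ℕ) (hw : s ≤ w) (hwM : w ≤ M) : T w ≤ AA z m w := by
    induction hwM using Nat.decreasingInduction with
    | self => exact hmid
    | of_succ w hwM ih =>
      have := step w hw hwM
      have := ih (by omega)
      omega
  exact le_antisymm (up w hw hwM) (down w hw hwM)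

/-- Lower bounds for the coordinate ring that determine its dimensions. -/
structure MidBounds (z : Fin 9 → ℂ) : Prop where
  full : hh z 10 17 = 0
  five : 101 ≤ AA z 5 22
  six : 213 ≤ AA z 6 27
  seven : 365 ≤ AA z 7 31
  eight : 545 ≤ AA z 8 36
  nine : 756 ≤ AA z 9 40
  ten : 999 ≤ AA z 10 45

variable {z : Fin 9 → ℂ}

theorem MidBounds.hh_eq_zero (h : MidBounds z) {m w : ℕ} (hm : m ≤ 10) (hw : w ≤ 17) : hh z m w = 0 := by
  have h1 := hh_le_of_le z hm (w : ℤ)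
  have h2 := hh_le_hh z (m := 10) hw (by norm_num)
  have h3 := h.full
  push_cast at h2
  omega

theorem MidBounds.hh_low (h : MidBounds z) {m w : ℕ} (hm : m < 4) : hh z m w = 0 := by
  rcases le_or_gt w 17 with hw | hw
  · exact h.hh_eq_zero (by omega) hw
  · rcases le_or_gt w (9 * m) with hw' | hw'
    · rw [← hh_rev, ← Nat.cast_ofNat (n := 9), ← Nat.cast_mul, ← Nat.cast_sub hw']
      exact h.hh_eq_zero (by omega) (by omega)
    · exact _root_.hh_eq_zero (Or.inr (by omega)) z

theorem one_le_hh_four (z : Fin 9 → ℂ) : 1 ≤ hh z 4 18 := by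
  have h1 := AA_step (m := 4) (w := 17) (by norm_num) z
  have h2 := AA_add_hh z 4 17
  have h3 := AA_add_hh z 4 18
  have h4 : NN 4 (17 : ℕ) = cnt 4 17 := NN_eq (by norm_num) _
  have h5 : NN 4 (18 : ℕ) = cnt 4 18 := NN_eq (by norm_num) _
  rw [show cnt 4 17 = 41 by decide +kernel] at h4
  rw [show cnt 4 18 = 43 by decide +kernel] at h5
  norm_num at h1 h4 h5
  omega

theorem hh_eq_half {m s M : ℕ} (hm : m ≤ 10) (hM : 2 * M ≤ 9 * m + 1)
    (hs : hTab m s ≤ hh z m s) (hmid : cnt m M ≤ AA z m M + hTab m M)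
    (hc : ∀ w ≤ M, hTab m w ≤ cnt m w ∧ (s ≤ w → w < M → cnt m w ≤ cnt m (w + 1) ∧
      cnt m (w + 1) + hTab m w = cnt m w + hTab m (w + 1) +
        min (9 * m - 2 * w - 1) (cnt m (w + 1) - cnt m w))) (w : ℕ) (hw : s ≤ w) (hwM : w ≤ M) :
    hh z m w = hTab m w := by
  have h1 := AA_add_hh z m s
  rw [NN_eq hm] at h1
  have h2 := AA_eq_of_mid (z := z) (m := m) (s := s) (M := M) (fun w => cnt m w - hTab m w) hM
    (by omega) (by omega) (fun w hw hwM => by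
      rw [show (w : ℤ) + 1 = ((w + 1 : ℕ) : ℤ) by push_cast; rfl, NN_eq hm, NN_eq hm]
      have h3 := hc w hwM.le
      have h4 := hc (w + 1) hwM
      have h5 := h3.2 hw hwM
      refine ⟨h5.1, ?_⟩
      omega) w hw hwM
  have h3 := AA_add_hh z m w
  rw [NN_eq hm] at h3
  have h4 := hc w hwM
  omega

theorem one_le_hh_eighteen (z : Fin 9 → ℂ) {m : ℕ} (hm : 4 ≤ m) : 1 ≤ hh z m 18 :=
  (one_le_hh_four z).trans (hh_le_of_le z hm 18)

theorem MidBounds.hh_half (h : MidBounds z) : ∀ m, 4 ≤ m → m ≤ 9 → ∀ w : ℕ, w ≤ 9 * m / 2 → hh z m w = hTab m w := by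
  have key {m M : ℕ} (hm : 4 ≤ m) (hm' : m ≤ 10) (hM : 2 * M ≤ 9 * m + 1) (hsM : 18 ≤ M)
      (hmid : cnt m M ≤ AA z m M + hTab m M)
      (hc : (∀ w ≤ M, hTab m w ≤ cnt m w ∧ (18 ≤ w → w < M → cnt m w ≤ cnt m (w + 1) ∧
        cnt m (w + 1) + hTab m w = cnt m w + hTab m (w + 1) +
          min (9 * m - 2 * w - 1) (cnt m (w + 1) - cnt m w))) ∧ (∀ w ≤ 17, hTab m w = 0) ∧
            hTab m 18 ≤ 1) (w : ℕ) (hw : w ≤ M) :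
      hh z m w = hTab m w := by
    rcases le_or_gt w 17 with h1 | h1
    · rw [h.hh_eq_zero hm' h1, hc.2.1 w h1]
    · exact hh_eq_half hm' hM (hc.2.2.trans (one_le_hh_eighteen z hm)) hmid hc.1 w h1 hw
  have h5 := key (m := 5) (M := 22) (by norm_num) (by norm_num) (by norm_num) (by norm_num)
    ((show _ ≤ 101 + _ by decide +kernel).trans (Nat.add_le_add_right h.five _)) (by decide +kernel)
  intro m h1 h2 w hw
  interval_cases m
  · refine key (M := 18) (by norm_num) (by norm_num) (by norm_num) (by norm_num) ?_ (by decide +kernel) w hw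
    have e1 := AA_add_hh z 4 (18 : ℕ)
    have e2 := hh_le_succ z 4 (18 : ℕ)
    rw [h5 18 (by norm_num)] at e2
    rw [NN_eq (by norm_num)] at e1
    have e3 : hTab 5 18 = hTab 4 18 := by decide +kernel
    omega
  · exact h5 w hw
  · exact key (M := 27) (by norm_num) (by norm_num) (by norm_num) (by norm_num)
      ((show _ ≤ 213 + _ by decide +kernel).trans (Nat.add_le_add_right h.six _)) (by decide +kernel) w hw
  · exact key (M := 31) (by norm_num) (by norm_num) (by norm_num) (by norm_num)
      ((show _ ≤ 365 + _ by decide +kernel).trans (Nat.add_le_add_right h.seven _)) (by decide +kernel) w hw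
  · exact key (M := 36) (by norm_num) (by norm_num) (by norm_num) (by norm_num)
      ((show _ ≤ 545 + _ by decide +kernel).trans (Nat.add_le_add_right h.eight _)) (by decide +kernel) w hw
  · exact key (M := 40) (by norm_num) (by norm_num) (by norm_num) (by norm_num)
      ((show _ ≤ 756 + _ by decide +kernel).trans (Nat.add_le_add_right h.nine _)) (by decide +kernel) w hw

theorem MidBounds.hh_half_ten (h : MidBounds z) (w : ℕ) (hw : w ≤ 45) : hh z 10 w = hTab 10 w := by
  have h19 : ∀ w : ℕ, 19 ≤ w → w ≤ 45 → hh z 10 w = hTab 10 w := by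
    refine hh_eq_half (s := 19) (by norm_num) (by norm_num) ?_
      ((show _ ≤ 999 + _ by decide +kernel).trans (Nat.add_le_add_right h.ten _)) (by decide +kernel)
    have e := hh_le_succ z 9 (19 : ℕ)
    rw [h.hh_half 9 (by norm_num) (by norm_num) 19 (by norm_num)] at e
    exact le_trans (by decide +kernel) e
  rcases lt_trichotomy w 18 with h1 | rfl | h1
  · rw [h.hh_eq_zero le_rfl (by omega)]
    revert w
    decide +kernel
  · have e1 : hh z 10 18 + rr z 10 19 ≤ hh z 10 19 + rr z 10 18 :=
      gg_mono (m := 10) (w := 18) (by norm_num) z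
    have e2 : 1 ≤ hh z 10 18 := one_le_hh_eighteen z (by norm_num)
    have e3 := rr_le z 8 18
    have e4 := hh_le_rr z 9 19 0
    rw [show (19 : ℤ) - ((0 : Fin 10) : ℕ) = 19 from sub_zero _] at e4
    have e5 : hh z 10 19 = hTab 10 19 := h19 19 (by norm_num) (by norm_num)
    have e6 : hh z 9 19 = hTab 9 19 := h.hh_half 9 (by norm_num) (by norm_num) 19 (by norm_num)
    have e7 : hh z 9 18 = hTab 9 18 := h.hh_half 9 (by norm_num) (by norm_num) 18 (by norm_num)
    have e8 : ∑ i : Fin 10, hh z (8 + 1) (18 - (i : ℕ)) = hh z 9 (18 - ((0 : Fin 10) : ℕ)) := by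
      refine Finset.sum_eq_single_of_mem 0 (Finset.mem_univ _) fun i _ hi => ?_
      have := i.2
      have hi' : (i : ℕ) ≠ 0 := fun h => hi (Fin.ext h)
      have := h.hh_eq_zero (m := 9) (w := 18 - i) (by norm_num) (by omega)
      rwa [Nat.cast_sub (by omega)] at this
    rw [show (18 : ℤ) - ((0 : Fin 10) : ℕ) = 18 from sub_zero _] at e8
    rw [show hTab 10 19 = 3 by decide +kernel] at e5
    rw [show hTab 9 19 = 3 by decide +kernel] at e6
    rw [show hTab 9 18 = 1 by decide +kernel] at e7
    rw [show hTab 10 18 = 1 by decide +kernel]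
    change hh z 10 18 = 1
    simp only [Nat.reduceAdd] at e3 e4 e8
    omega
  · exact h19 w h1 hw

/-- The dimensions of the pieces of the ideal. -/
theorem MidBounds.hh_eq (h : MidBounds z) {m : ℕ} (hm : m ≤ 10) (w : ℕ) : hh z m w = hTab m w := by
  have half {w : ℕ} (h4 : 4 ≤ m) (hw : w ≤ 9 * m / 2) : hh z m w = hTab m w := by
    rcases hm.lt_or_eq with h1 | rfl
    · exact h.hh_half m h4 (by omega) w hw
    · exact h.hh_half_ten w hw
  rcases lt_or_ge m 4 with h4 | h4
  · rw [h.hh_low h4, hTab, if_pos h4]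
  · rcases le_or_gt w (9 * m / 2) with h1 | h1
    · exact half h4 h1
    · have h0 : (∀ m ≤ 10, ∀ w ≤ 9 * m, hTab m (9 * m - w) = hTab m w) ∧ ∀ m ≤ 10, (hTable.getD (m - 4) []).length ≤ 9 * (max m 4) + 1 := by
        decide +kernel
      rcases le_or_gt w (9 * m) with h2 | h2
      · rw [← hh_rev, ← Nat.cast_ofNat (n := 9), ← Nat.cast_mul, ← Nat.cast_sub h2, half h4 (by omega)]
        exact h0.1 m hm w h2
      · rw [_root_.hh_eq_zero (Or.inr (by omega)), hTab, if_neg (by omega), List.getD_eq_default]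
        have := h0.2 m hm
        omega

end

noncomputable section

/-- Multiplicities of the weights in the spaces of generators, in degrees from four to ten. -/
def gTable : List (List ℕ) :=
  [[0, 0, 0, 0, 0, 0, 0, 0, 0, 0, 0, 0, 0, 0, 0, 0, 0, 0, 1, 0, 0, 0, 0, 0, 0, 0, 0, 0, 0, 0, 0, 0, 0, 0, 0, 0, 0],
    [0, 0, 0, 0, 0, 0, 0, 0, 0, 0, 0, 0, 0, 0, 0, 0, 0, 0, 0, 0, 0, 0, 0, 0, 0, 0, 0, 0, 0, 0, 0, 0, 0, 0, 0, 0, 0, 0, 0, 0, 0, 0, 0, 0, 0, 0],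
    [0, 0, 0, 0, 0, 0, 0, 0, 0, 0, 0, 0, 0, 0, 0, 0, 0, 0, 0, 0, 1, 1, 3, 3, 7, 7, 9, 9, 9, 7, 7, 3, 3, 1, 1, 0, 0, 0, 0, 0, 0, 0, 0, 0, 0, 0, 0, 0, 0, 0, 0, 0, 0, 0, 0],
    [0, 0, 0, 0, 0, 0, 0, 0, 0, 0, 0, 0, 0, 0, 0, 0, 0, 0, 0, 0, 3, 8, 13, 19, 23, 26, 27, 27, 27, 27, 27, 27, 27, 27, 27, 27, 27, 27, 26, 23, 19, 13, 8, 3, 0, 0, 0, 0, 0, 0, 0, 0, 0, 0, 0, 0, 0, 0, 0, 0, 0, 0, 0, 0],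
    [0, 0, 0, 0, 0, 0, 0, 0, 0, 0, 0, 0, 0, 0, 0, 0, 0, 0, 0, 1, 7, 9, 10, 10, 10, 10, 10, 10, 10, 10, 10, 10, 10, 10, 10, 10, 10, 10, 10, 10, 10, 10, 10, 10, 10, 10, 10, 10, 10, 10, 10, 9, 7, 1, 0, 0, 0, 0, 0, 0, 0, 0, 0, 0, 0, 0, 0, 0, 0, 0, 0, 0, 0],
    [0, 0, 0, 0, 0, 0, 0, 0, 0, 0, 0, 0, 0, 0, 0, 0, 0, 0, 0, 1, 2, 2, 2, 2, 2, 2, 2, 2, 2, 2, 2, 2, 2, 2, 2, 2, 2, 2, 2, 2, 2, 2, 2, 2, 2, 2, 2, 2, 2, 2, 2, 2, 2, 2, 2, 2, 2, 2, 2, 2, 2, 2, 1, 0, 0, 0, 0, 0, 0, 0, 0, 0, 0, 0, 0, 0, 0, 0, 0, 0, 0, 0],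
    [0, 0, 0, 0, 0, 0, 0, 0, 0, 0, 0, 0, 0, 0, 0, 0, 0, 0, 0, 0, 1, 1, 1, 1, 1, 1, 1, 1, 1, 1, 1, 1, 1, 1, 1, 1, 1, 1, 1, 1, 1, 1, 1, 1, 1, 1, 1, 1, 1, 1, 1, 1, 1, 1, 1, 1, 1, 1, 1, 1, 1, 1, 1, 1, 1, 1, 1, 1, 1, 1, 1, 0, 0, 0, 0, 0, 0, 0, 0, 0, 0, 0, 0, 0, 0, 0, 0, 0, 0, 0, 0]]

/-- Multiplicities of the weights in the spaces of generators. -/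
def gTab (m w : ℕ) : ℕ := if m < 4 then 0 else (gTable.getD (m - 4) []).getD w 0

/-- The number of minimal generators in a bidegree. -/
def gg (z : Fin 9 → ℂ) (m : ℕ) (w : ℤ) : ℕ := hh z m w - rr z m w

theorem gg_add_rr (z : Fin 9 → ℂ) (m : ℕ) (w : ℤ) : gg z m w + rr z m w = hh z m w :=
  Nat.sub_add_cancel (rr_le_hh z m w)

theorem gg_le_gg (z : Fin 9 → ℂ) {m v w : ℕ} (h : v ≤ w) (hw : 2 * w ≤ 9 * m + 1) : gg z m v ≤ gg z m w := by
  induction w, h using Nat.le_induction with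
  | base => exact le_rfl
  | succ w _ ih =>
    refine (ih (by omega)).trans ?_
    have h1 := gg_mono (m := m) (w := w) (by omega) z
    have h2 := gg_add_rr z m w
    have h3 := gg_add_rr z m (w + 1)
    push_cast
    omega

theorem gg_rev (z : Fin 9 → ℂ) (m : ℕ) (w : ℤ) : gg z m (9 * m - w) = gg z m w := by
  rw [gg, gg, hh_rev, rr_rev]

/-- A multiple of an element of an ideal is in the non-minimal part. -/
theorem map_mul_le_pc_irr {J : Ideal (MvPolynomial (Fin 10) ℂ)} {f : MvPolynomial (Fin 10) ℂ} {m : ℕ} {v : ℤ}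
    (hf : f ∈ pc J m v) (n : ℕ) (w : ℤ) :
    (Rp (n + 1) (w - v)).map (LinearMap.mulLeft ℂ f) ≤ pc (irr J) (m + (n + 1)) w := by
  rw [Rp_succ, Submodule.map_iSup]
  refine iSup_le fun i => ?_
  rintro _ ⟨_, ⟨g, hg, rfl⟩, rfl⟩
  have hg' := map_mulX_Rp_le n (w - v) i ⟨g, hg, rfl⟩
  refine ⟨?_, ?_⟩
  · have e : LinearMap.mulLeft ℂ f (LinearMap.mulLeft ℂ (X i) g) = X i * (g * f) := by
      simp only [LinearMap.mulLeft_apply]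
      ring
    rw [e]
    exact X_mul_mem_irr (Ideal.mul_mem_left _ _ hf.1) i
  · have := mul_mem_Rp hf.2 hg'
    rwa [add_sub_cancel] at this

/-- Entry of the table, extended by zero. -/
def hTabSub (m w i : ℕ) : ℕ := if i ≤ w then hTab m (w - i) else 0

/-- Lower bounds for the non-minimal part that determine the number of generators. -/
structure GenBounds (z : Fin 9 → ℂ) : Prop extends MidBounds z where
  gen_seven : ∀ p ∈ [(22, 3), (23, 7), (24, 11), (25, 19), (31, 65)],
    p.2 + (hh z 6 (p.1 : ℕ) + hh z 6 ((p.1 : ℕ) - 9)) ≤ rr z 7 (p.1 : ℕ) + hh z 5 ((p.1 : ℕ) - 9)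
  gen_eight : 276 + hh z 7 (36 : ℕ) ≤ rr z 8 (36 : ℕ)
  gen_nine : gg z 9 (40 : ℕ) ≤ 2
  gen_ten : gg z 10 (45 : ℕ) ≤ 1

variable {z : Fin 9 → ℂ}

theorem MidBounds.hh_sub (h : MidBounds z) {m : ℕ} (hm : m ≤ 10) (w i : ℕ) :
    hh z m ((w : ℤ) - i) = hTabSub m w i := by
  unfold hTabSub
  split_ifs with hi
  · rw [← Nat.cast_sub hi, h.hh_eq hm]
  · exact _root_.hh_eq_zero (Or.inl (by omega)) z

theorem MidBounds.gg_le_zero (h : MidBounds z) {m : ℕ} (hm : m < 10) (w : ℕ) :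
    gg z (m + 1) w + hTab m w ≤ hTab (m + 1) w := by
  have h1 := hh_le_rr z m w 0
  rw [show (w : ℤ) - ((0 : Fin 10) : ℕ) = w from sub_zero _, h.hh_eq (by omega)] at h1
  have h2 := gg_add_rr z (m + 1) w
  rw [h.hh_eq (show m + 1 ≤ 10 from hm)] at h2
  omega

theorem MidBounds.gg_le_one (h : MidBounds z) {m : ℕ} (hm : m + 2 ≤ 10) (w : ℕ) :
    gg z (m + 2) w + (hTab (m + 1) w + hTabSub (m + 1) w 1) ≤ hTab (m + 2) w + hTabSub m w 1 := by
  have h1 := rr_two z m w (i := 0) (j := 1) (by decide)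
  rw [show (w : ℤ) - ((0 : Fin 10) : ℕ) = w from sub_zero _, h.hh_eq (by omega)] at h1
  have e (m : ℕ) (hm : m ≤ 10) := h.hh_sub hm w 1
  rw [show ((1 : Fin 10) : ℕ) = 1 from rfl, e _ (by omega), e _ (by omega)] at h1
  have h2 := gg_add_rr z (m + 2) w
  rw [h.hh_eq hm] at h2
  omega

theorem MidBounds.le_gg (h : MidBounds z) {m : ℕ} (hm : m + 2 ≤ 10) (w : ℕ) :
    hTab (m + 2) w + ∑ i ∈ Finset.univ.erase (0 : Fin 10), hTabSub m w i ≤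
      gg z (m + 2) w + ∑ i : Fin 10, hTabSub (m + 1) w i := by
  have h1 := rr_le z m w
  have h2 := gg_add_rr z (m + 2) w
  rw [h.hh_eq hm] at h2
  simp only [h.hh_sub (show m ≤ 10 by omega), h.hh_sub (show m + 1 ≤ 10 by omega)] at h1
  omega

theorem gg_eq_of_bounds {m M : ℕ} (ups lows : List (ℕ × ℕ)) (hu : ∀ p ∈ ups, gg z m (p.1 : ℕ) ≤ p.2)
    (hl : ∀ p ∈ lows, p.2 ≤ gg z m (p.1 : ℕ)) (hM : 2 * M ≤ 9 * m + 1)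
    (hc : ∀ w ≤ M, (∃ p ∈ ups, w ≤ p.1 ∧ p.1 ≤ M ∧ p.2 ≤ gTab m w) ∧
      (gTab m w = 0 ∨ ∃ p ∈ lows, p.1 ≤ w ∧ gTab m w ≤ p.2)) (w : ℕ) (hw : w ≤ M) :
    gg z m w = gTab m w := by
  obtain ⟨⟨p, hp, h1, h2, h3⟩, h4⟩ := hc w hw
  refine le_antisymm ((gg_le_gg z h1 (by omega)).trans ((hu p hp).trans h3)) ?_
  rcases h4 with h4 | ⟨q, hq, h5, h6⟩
  · omega
  · exact h6.trans ((hl q hq).trans (gg_le_gg z h5 (by omega)))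

theorem gg_eq_of_half {m : ℕ} (h4 : 4 ≤ m) (h10 : m ≤ 10) (h : ∀ w : ℕ, w ≤ 9 * m / 2 → gg z m w = gTab m w) (w : ℕ) :
    gg z m w = gTab m w := by
  rcases le_or_gt w (9 * m / 2) with h1 | h1
  · exact h w h1
  · have h0 : (∀ m ≤ 10, ∀ w ≤ 9 * m, gTab m (9 * m - w) = gTab m w) ∧
        ∀ m ≤ 10, (gTable.getD (m - 4) []).length ≤ 9 * (max m 4) + 1 := by
      decide +kernel
    rcases le_or_gt w (9 * m) with h2 | h2
    · rw [← gg_rev, ← Nat.cast_ofNat (n := 9), ← Nat.cast_mul, ← Nat.cast_sub h2, h _ (by omega)]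
      exact h0.1 m h10 w h2
    · rw [gg, _root_.hh_eq_zero (Or.inr (by omega)), Nat.zero_sub, gTab, if_neg (by omega),
        List.getD_eq_default]
      have := h0.2 m h10
      omega

theorem MidBounds.gg_four (h : MidBounds z) : ∀ w : ℕ, gg z 4 w = gTab 4 w := by
  refine gg_eq_of_half (by norm_num) (by norm_num) fun w hw => ?_
  have h1 := h.le_gg (m := 2) (by norm_num) w
  have h2 := gg_add_rr z 4 w
  rw [h.hh_eq (by norm_num)] at h2
  have h3 : ∀ w ≤ 9 * 4 / 2, hTab 4 w = gTab 4 w ∧ ∑ i : Fin 10, hTabSub (2 + 1) w i = 0 := by decide +kernel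
  have h4 := h3 w hw
  simp only [Nat.reduceAdd] at h1 h4
  omega

theorem MidBounds.gg_five (h : MidBounds z) : ∀ w : ℕ, gg z 5 w = gTab 5 w := by
  refine gg_eq_of_half (by norm_num) (by norm_num) (gg_eq_of_bounds [(22, 0)] [] ?_ (by simp) (by norm_num)
    (by decide +kernel))
  have h1 := hh_le_rr z 4 22 4
  have h2 := gg_add_rr z 5 22
  have h3 : hh z 4 18 = hTab 4 18 := h.hh_eq (by norm_num) 18
  have h4 : hh z 5 22 = hTab 5 22 := h.hh_eq (by norm_num) 22
  have h5 : hTab 4 18 = 1 ∧ hTab 5 22 = 1 := by decide +kernel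
  rw [show (22 : ℤ) - ((4 : Fin 10) : ℕ) = 18 from rfl] at h1
  simp only [List.mem_singleton, forall_eq, Nat.reduceAdd, Nat.cast_ofNat] at h1 ⊢
  omega

/-- The invariant of degree four generates the ideal in degrees four and five. -/
theorem MidBounds.exists_invariant (h : MidBounds z) : ∃ f : MvPolynomial (Fin 10) ℂ, f ≠ 0 ∧ f ∈ pc (idl z) 4 18 ∧
    (∀ w, pc (idl z) 4 w ≤ (Rp 0 (w - 18)).map (LinearMap.mulLeft ℂ f)) ∧
    ∀ w, pc (idl z) 5 w ≤ (Rp 1 (w - 18)).map (LinearMap.mulLeft ℂ f) := by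
  have h1 : Module.finrank ℂ (pc (idl z) 4 18) = 1 := (h.hh_eq (by norm_num) 18).trans (by decide +kernel)
  obtain ⟨⟨f, hf⟩, hf0, hf1⟩ := finrank_eq_one_iff'.1 h1
  have h4 (w : ℤ) : pc (idl z) 4 w ≤ (Rp 0 (w - 18)).map (LinearMap.mulLeft ℂ f) := by
    by_cases hw : w = 18
    · subst hw
      intro g hg
      obtain ⟨c, hc⟩ := hf1 ⟨g, hg⟩
      refine ⟨C c, ?_, ?_⟩
      · exact isWeightedHomogeneous_C _ _
      · have : c • f = g := congrArg Subtype.val hc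
        rw [← this, LinearMap.mulLeft_apply, mul_comm, smul_eq_C_mul]
    · have : hh z 4 w = 0 := by
        rcases lt_or_ge w 0 with h0 | h0
        · exact _root_.hh_eq_zero (Or.inl h0) z
        · lift w to ℕ using h0
          rw [h.hh_eq (by norm_num)]
          rcases le_or_gt w 36 with h2 | h2
          · have : ∀ w ≤ 36, w ≠ 18 → hTab 4 w = 0 := by decide +kernel
            exact this w h2 (by exact_mod_cast hw)
          · rw [← h.hh_eq (by norm_num)]
            exact _root_.hh_eq_zero (Or.inr (by push_cast; omega)) z
      rw [Submodule.finrank_eq_zero.1 this]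
      exact bot_le
  refine ⟨f, fun h0 => hf0 (Subtype.ext h0), hf, h4, fun w => ?_⟩
  have h5 : gg z 5 w = 0 := by
    rcases lt_or_ge w 0 with h0 | h0
    · rw [gg, _root_.hh_eq_zero (Or.inl h0) z, Nat.zero_sub]
    · lift w to ℕ using h0
      rcases le_or_gt w 45 with h2 | h2
      · have : ∀ w ≤ 45, gTab 5 w = 0 := by decide +kernel
        rw [h.gg_five, this w h2]
      · rw [gg, _root_.hh_eq_zero (Or.inr (by push_cast; omega)) z, Nat.zero_sub]
  have h6 : pc (irr (idl z)) 5 w = pc (idl z) 5 w := by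
    have := gg_add_rr z 5 w
    refine Submodule.eq_of_le_of_finrank_le (fun f hf => ⟨irr_le _ hf.1, hf.2⟩) ?_
    change hh z 5 w ≤ rr z 5 w
    omega
  rw [← h6]
  exact pc_irr_le_mul (idl_biHom z) h4 w

theorem MidBounds.gg_six (h : MidBounds z) : ∀ w : ℕ, gg z 6 w = gTab 6 w := by
  obtain ⟨f, hf0, hf, -, h5⟩ := h.exists_invariant
  refine gg_eq_of_half (by norm_num) (by norm_num) fun w hw => ?_
  have h1 := Submodule.finrank_mono (pc_irr_le_mul (idl_biHom z) h5 w)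
  have h2 := Submodule.finrank_mono (map_mul_le_pc_irr hf 1 w)
  rw [finrank_map_mul hf0] at h1 h2
  have h3 := gg_add_rr z 6 w
  rw [h.hh_eq (by norm_num)] at h3
  have h4 : rr z 6 w = NN 2 (w - 18) := le_antisymm h1 h2
  have h6 : NN 2 ((w : ℤ) - 18) = if 18 ≤ w then cnt 2 (w - 18) else 0 := by
    split_ifs with h0
    · rw [← NN_eq (by norm_num), Nat.cast_sub h0]
      rfl
    · rw [NN, Rp_eq_bot (Or.inl (by omega)), finrank_bot]
  have h7 : ∀ w ≤ 9 * 6 / 2, gTab 6 w + (if 18 ≤ w then cnt 2 (w - 18) else 0) = hTab 6 w := by decide +kernel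
  have h8 := h7 w hw
  omega

/-- Entry of the table, extended by zero. -/
def gTabSub (m w i : ℕ) : ℕ := if i ≤ w then gTab m (w - i) else 0

theorem MidBounds.le_gg_seven (h : MidBounds z) {w : ℕ} (hw : 18 ≤ w) :
    hTab 7 w ≤ gg z 7 w + (cnt 3 (w - 18) + ∑ i : Fin 10, gTabSub 6 w i) := by
  obtain ⟨f, hf0, -, -, h5⟩ := h.exists_invariant
  have h6 := pc_irr_le_mul (idl_biHom z) h5
  have h1 := finrank_steps Finset.univ ((Rp 3 ((w : ℤ) - 18)).map (LinearMap.mulLeft ℂ f))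
    (fun i => pc (idl z) 6 ((w : ℤ) - (i : ℕ))) (fun i => pc (irr (idl z)) 6 ((w : ℤ) - (i : ℕ)))
    (fun _ _ _ hg => ⟨irr_le _ hg.1, hg.2⟩) (fun i _ => by
      rintro _ ⟨g, hg, rfl⟩
      obtain ⟨g, hg', rfl⟩ := h6 _ hg
      refine ⟨X i * g, ?_, mul_left_comm _ _ _⟩
      have := X_mul_mem_Rp hg' i
      rwa [show (w : ℤ) - (i : ℕ) - 18 + (i : ℕ) = w - 18 by ring] at this)
  have h2 : pc (irr (idl z)) 7 w ≤ (Rp 3 ((w : ℤ) - 18)).map (LinearMap.mulLeft ℂ f) ⊔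
      Finset.univ.sup fun i : Fin 10 => (pc (idl z) 6 ((w : ℤ) - (i : ℕ))).map (mulX i) := by
    rw [pc_irr (idl_biHom z)]
    exact iSup_le fun i => le_sup_of_le_right (Finset.le_sup (f := fun i : Fin 10 =>
      (pc (idl z) 6 ((w : ℤ) - (i : ℕ))).map (mulX i)) (Finset.mem_univ i))
  have h3 := Submodule.finrank_mono h2
  rw [finrank_map_mul hf0] at h1
  have h4 : Module.finrank ℂ (Rp 3 ((w : ℤ) - 18)) = cnt 3 (w - 18) := by
    rw [← NN_eq (by norm_num), Nat.cast_sub hw]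
    rfl
  have h7 : ∑ i : Fin 10, Module.finrank ℂ (pc (idl z) 6 ((w : ℤ) - (i : ℕ))) =
      ∑ i : Fin 10, gTabSub 6 w i + ∑ i : Fin 10, Module.finrank ℂ (pc (irr (idl z)) 6 ((w : ℤ) - (i : ℕ))) := by
    rw [← Finset.sum_add_distrib]
    refine Finset.sum_congr rfl fun i _ => ?_
    refine (gg_add_rr z 6 _).symm.trans (congrArg₂ _ ?_ rfl)
    unfold gTabSub
    split_ifs with hi
    · rw [← Nat.cast_sub hi, h.gg_six]
    · rw [gg, _root_.hh_eq_zero (Or.inl (by omega)), Nat.zero_sub]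
  have h8 := gg_add_rr z 7 w
  rw [h.hh_eq (by norm_num)] at h8
  change rr z 7 w ≤ _ at h3
  omega

theorem GenBounds.gg_seven (h : GenBounds z) : ∀ w : ℕ, gg z 7 w = gTab 7 w := by
  refine gg_eq_of_half (by norm_num) (by norm_num) (gg_eq_of_bounds
    [(19, 0), (20, 3), (21, 8), (22, 13), (23, 19), (24, 23), (25, 26), (31, 27)]
    [(20, 3), (21, 8), (22, 13), (23, 19), (24, 23), (25, 26), (26, 27)] ?_ ?_ (by norm_num) (by decide +kernel))
  · have h1 (w : ℕ) := h.gg_le_zero (m := 6) (by norm_num) w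
    have h2 (w : ℕ) := h.gg_le_one (m := 5) (by norm_num) w
    have h3 (p : ℕ × ℕ) (hp : p ∈ [(22, 3), (23, 7), (24, 11), (25, 19), (31, 65)]) :
        gg z 7 (p.1 : ℕ) + p.2 + (hTab 6 p.1 + hTabSub 6 p.1 9) ≤ hTab 7 p.1 + hTabSub 5 p.1 9 := by
      have h1 := h.gen_seven p hp
      have h2 := gg_add_rr z 7 p.1
      have h3 := h.hh_sub (m := 6) (by norm_num) p.1 9
      have h4 := h.hh_sub (m := 5) (by norm_num) p.1 9
      rw [h.hh_eq (by norm_num)] at h1 h2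
      push_cast at h3 h4
      omega
    have e : hTab 6 19 = hTab 7 19 ∧ hTab 7 20 ≤ 3 + hTab 6 20 ∧
        hTab 7 21 + hTabSub 5 21 1 ≤ 8 + (hTab 6 21 + hTabSub 6 21 1) ∧
        ∀ q ∈ [((22, 3), 13), ((23, 7), 19), ((24, 11), 23), ((25, 19), 26), ((31, 65), 27)],
          hTab 7 q.1.1 + hTabSub 5 q.1.1 9 ≤ q.2 + q.1.2 + (hTab 6 q.1.1 + hTabSub 6 q.1.1 9) := by
      decide +kernel
    obtain ⟨e1, e2, e3, e4⟩ := e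
    simp only [List.forall_mem_cons, Nat.reduceAdd] at h1 h2 h3 e4 ⊢
    have a1 := h1 19
    have a2 := h1 20
    have a3 := h2 21
    obtain ⟨a4, a5, a6, a7, a8, -⟩ := h3
    refine ⟨?_, ?_, ?_, ?_, ?_, ?_, ?_, ?_, fun _ h => by cases h⟩ <;> omega
  · intro p hp
    have e : ∀ p ∈ [(20, 3), (21, 8), (22, 13), (23, 19), (24, 23), (25, 26), (26, 27)], 18 ≤ p.1 ∧
        p.2 + (cnt 3 (p.1 - 18) + ∑ i : Fin 10, gTabSub 6 p.1 i) ≤ hTab 7 p.1 := by decide +kernel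
    have h1 := e p hp
    have h2 := h.le_gg_seven h1.1
    omega

theorem GenBounds.gg_eight (h : GenBounds z) : ∀ w : ℕ, gg z 8 w = gTab 8 w := by
  refine gg_eq_of_half (by norm_num) (by norm_num) (gg_eq_of_bounds
    [(18, 0), (19, 1), (20, 7), (21, 9), (36, 10)]
    [(19, 1), (20, 7), (21, 9), (22, 10)] ?_ ?_ (by norm_num) (by decide +kernel))
  · have h1 (w : ℕ) := h.gg_le_zero (m := 7) (by norm_num) w
    have h2 := h.gg_le_one (m := 6) (by norm_num) 21
    have h3 : gg z 8 (36 : ℕ) + 276 + hTab 7 36 ≤ hTab 8 36 := by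
      have h1 := h.gen_eight
      have h2 := gg_add_rr z 8 (36 : ℕ)
      rw [h.hh_eq (by norm_num)] at h1 h2
      omega
    have e : hTab 7 18 = hTab 8 18 ∧ hTab 8 19 ≤ 1 + hTab 7 19 ∧ hTab 8 20 ≤ 7 + hTab 7 20 ∧
        hTab 8 21 + hTabSub 6 21 1 ≤ 9 + (hTab 7 21 + hTabSub 7 21 1) ∧
        hTab 8 36 ≤ 10 + 276 + hTab 7 36 := by
      decide +kernel
    have a1 := h1 18
    have a2 := h1 19
    have a3 := h1 20
    simp only [List.forall_mem_cons, Nat.reduceAdd] at *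
    refine ⟨?_, ?_, ?_, ?_, ?_, fun _ h => (List.not_mem_nil h).elim⟩ <;> omega
  · intro p hp
    have e : ∀ p ∈ [(19, 1), (20, 7), (21, 9), (22, 10)],
        p.2 + ∑ i : Fin 10, hTabSub (6 + 1) p.1 i ≤
          hTab (6 + 2) p.1 + ∑ i ∈ Finset.univ.erase (0 : Fin 10), hTabSub 6 p.1 i := by decide +kernel
    have h1 := e p hp
    have h2 := h.le_gg (m := 6) (by norm_num) p.1
    simp only [Nat.reduceAdd] at *
    omega

theorem GenBounds.gg_nine (h : GenBounds z) : ∀ w : ℕ, gg z 9 w = gTab 9 w := by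
  refine gg_eq_of_half (by norm_num) (by norm_num) (gg_eq_of_bounds
    [(18, 0), (19, 1), (40, 2)] [(19, 1), (20, 2)] ?_ ?_ (by norm_num) (by decide +kernel))
  · have h1 := h.gg_le_zero (m := 8) (by norm_num) 18
    have h2 := h.gg_le_zero (m := 8) (by norm_num) 19
    have h3 := h.gen_nine
    have e : hTab 8 18 = hTab 9 18 ∧ hTab 9 19 ≤ 1 + hTab 8 19 := by decide +kernel
    simp only [List.forall_mem_cons, Nat.reduceAdd] at *
    refine ⟨?_, ?_, ?_, fun _ h => (List.not_mem_nil h).elim⟩ <;> omega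
  · intro p hp
    have e : ∀ p ∈ [(19, 1), (20, 2)], p.2 + ∑ i : Fin 10, hTabSub (7 + 1) p.1 i ≤
        hTab (7 + 2) p.1 + ∑ i ∈ Finset.univ.erase (0 : Fin 10), hTabSub 7 p.1 i := by decide +kernel
    have h1 := e p hp
    have h2 := h.le_gg (m := 7) (by norm_num) p.1
    simp only [Nat.reduceAdd] at *
    omega

theorem GenBounds.gg_ten (h : GenBounds z) : ∀ w : ℕ, gg z 10 w = gTab 10 w := by
  refine gg_eq_of_half (by norm_num) (by norm_num) (gg_eq_of_bounds
    [(19, 0), (45, 1)] [(20, 1)] ?_ ?_ (by norm_num) (by decide +kernel))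
  · have h1 := h.gg_le_zero (m := 9) (by norm_num) 19
    have h3 := h.gen_ten
    have e : hTab 9 19 = hTab 10 19 := by decide +kernel
    simp only [List.forall_mem_cons, Nat.reduceAdd] at *
    refine ⟨?_, ?_, fun _ h => (List.not_mem_nil h).elim⟩ <;> omega
  · intro p hp
    have e : ∀ p ∈ [(20, 1)], p.2 + ∑ i : Fin 10, hTabSub (8 + 1) p.1 i ≤
        hTab (8 + 2) p.1 + ∑ i ∈ Finset.univ.erase (0 : Fin 10), hTabSub 8 p.1 i := by decide +kernel
    have h1 := e p hp
    have h2 := h.le_gg (m := 8) (by norm_num) p.1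
    simp only [Nat.reduceAdd] at *
    omega

/-- The number of minimal generators of a general orbit. -/
theorem GenBounds.gg_eq (h : GenBounds z) {m : ℕ} (hm : m ≤ 10) (w : ℕ) : gg z m w = gTab m w := by
  rcases lt_or_ge m 4 with h4 | h4
  · rw [gg, h.hh_low h4, Nat.zero_sub, gTab, if_pos h4]
  · interval_cases m
    exacts [h.gg_four w, h.gg_five w, h.gg_six w, h.gg_seven w, h.gg_eight w, h.gg_nine w, h.gg_ten w]

end

noncomputable section
set_option maxRecDepth 100000

/-- An arc in the orbit. -/
def arcA : Arc := .orbit (9, [1]) (9, [1]) (9, [5, 1])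
  (9, [2653, 7765, 1236, 3235, 5333, 396, 594, 6728, 4390, 772, 2996, 4775, 476, 7453, 4157, 1759, 308,
    705, 3553, 3426, 573, 1972, 744, 4515, 3478, 485, 6774, 4633, 1015, 7762, 1829, 5167, 5140, 4776,
    7764, 507, 4728, 4797, 3250, 407, 7998, 1812, 382, 4561, 7033, 1091, 2373, 3434])

/-- An arc on which the extreme coordinates vanish. -/
def arcZ : Arc := .free [(9, []),
  (9, [1182, 4430, 965, 4677, 2528, 4590, 6686, 5587, 1481, 845, 4765, 4680, 5234, 1540, 3051, 799, 4488,
    5834, 515, 4624, 489, 5071, 1688, 4067, 5574, 4356, 3503, 6368, 2574, 3815, 4797, 7565, 3713, 2963,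
    2456, 2036, 6508, 1473, 5727, 6389]),
  (9, [2000, 671, 4706, 2460, 4303, 4056, 7170, 2814, 5976, 3677, 2359, 4989, 8030, 600, 968, 4194, 3426,
    1352, 6203, 2803, 1246, 7646, 4006, 3455, 322, 7881, 5475, 636, 6264, 4572, 4695, 6465, 7172, 6704,
    2571, 2787, 5696, 2869, 4870, 4069]),
  (9, [4751, 6529, 3738, 564, 6882, 767, 7739, 2212, 3884, 5711, 5441, 533, 498, 5990, 5747, 2537, 5302,
    4735, 8136, 5581, 6734, 3651, 2332, 5871, 3161, 7267, 5478, 2843, 185, 7706, 3783, 2912, 1377,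
    5005, 960, 4045, 483, 1788, 6294, 2355]),
  (9, [1060, 6049, 2029, 3260, 3203, 7511, 7139, 4068, 661, 1363, 3680, 3291, 4502, 2277, 7237, 1122,
    6712, 3527, 7078, 4508, 2281, 5787, 3403, 8082, 2940, 5593, 7244, 3117, 7846, 1891, 1237, 680,
    1444, 1240, 1901, 5395, 1912, 99, 3973, 6809]),
  (9, [4827, 1494, 2153, 2310, 34, 1194, 3433, 4380, 3025, 4996, 4640, 2611, 7808, 1029, 5657, 7039, 4223,
    7785, 5060, 5366, 5540, 6061, 443, 3741, 7369, 7136, 6390, 7798, 7165, 5576, 6537, 4582, 3215,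
    3261, 3269, 3229, 849, 3945, 5197, 3281]),
  (9, [510, 1562, 552, 8067, 1711, 3610, 1330, 901, 2786, 4922, 431, 839, 2, 4644, 1240, 4396, 832, 7774,
    2979, 5028, 209, 577, 7163, 1704, 5031, 3083, 1217, 5198, 2067, 7828, 2846, 4934, 2984, 3885, 1007,
    945, 6955, 3999, 8136, 8011]),
  (9, [3818, 3936, 3964, 2555, 704, 1181, 838, 6142, 2807, 6065, 2169, 3921, 6790, 5670, 1323, 4230, 190,
    1682, 7791, 7799, 4328, 2964, 1201, 5654, 4450, 7489, 222, 6211, 4327, 2442, 8016, 5267, 7073, 746,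
    5704, 6926, 2140, 4247, 3005, 7441]),
  (9, [1369, 2914, 6324, 1826, 4363, 4437, 6383, 4119, 2701, 5214, 1828, 5024, 6648, 6459, 8069, 6213,
    6985, 1599, 6604, 1962, 6704, 3283, 6062, 6581, 1858, 1638, 4241, 4037, 2913, 5989, 238, 8107, 229,
    6473, 2289, 3869, 2124, 1587, 5674, 4958]), (9, [])]

/-- An arc on which the first coordinate vanishes. -/
def arcY : Arc := .free [(9, []),
  (9, [3706, 7093, 4586, 7020, 7572, 6400, 3815, 3702, 4161, 7005, 4812, 1556, 1513, 6586, 4194, 3898,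
    5160, 5030, 6497, 1526, 772, 3659, 2486, 1162, 743, 4413, 6633, 7294, 5681, 5198, 344, 4878, 8047,
    3246, 7904, 3711, 5357, 6054, 5043, 5326, 1291, 5105, 123, 6814, 4329]),
  (9, [518, 488, 293, 1559, 7206, 1982, 4913, 247, 6375, 3801, 2673, 3609, 4842, 6902, 1601, 4253, 1915,
    5246, 2410, 4095, 38, 5427, 697, 3747, 5365, 2279, 3333, 8173, 4516, 8157, 7633, 6884, 682, 5799,
    2081, 2583, 6210, 1882, 4202, 2368, 244, 576, 4614, 6278, 885]),
  (9, [3281, 884, 6936, 2384, 3167, 548, 7849, 139, 6942, 5611, 5, 1750, 1719, 7595, 7457, 429, 3851,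
    3076, 8032, 5808, 3256, 3439, 599, 4639, 5157, 1627, 6378, 5529, 2211, 2760, 714, 2550, 2725, 125,
    7898, 3360, 6210, 7560, 967, 1103, 2019, 5792, 828, 90, 491]),
  (9, [3809, 6530, 3989, 1456, 5588, 4582, 1544, 3666, 4169, 1563, 8072, 5996, 6304, 1073, 3435, 5274,
    3144, 955, 3235, 3447, 8111, 1744, 4, 2211, 7081, 7954, 7987, 6582, 4856, 2492, 8175, 7249, 161,
    1727, 1535, 3230, 8158, 7000, 4932, 5258, 4727, 822, 345, 8105, 1199]),
  (9, [1747, 3618, 2116, 79, 6330, 5000, 2695, 6802, 2428, 3164, 602, 609, 739, 1710, 4774, 5215, 1991,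
    128, 4926, 3021, 3045, 5097, 3713, 1043, 7858, 4811, 3963, 6819, 4707, 1112, 7099, 3163, 1498,
    5139, 1263, 2547, 7442, 1871, 6700, 5001, 2044, 5943, 1555, 1299, 6058]),
  (9, [5153, 7704, 4538, 1611, 5628, 7784, 3181, 7227, 3953, 4945, 644, 3453, 389, 851, 894, 318, 4198,
    7887, 2091, 1954, 6061, 5772, 3209, 2106, 3448, 6748, 7413, 4887, 4023, 2404, 4261, 1438, 7613,
    5902, 8006, 564, 1036, 1872, 3927, 4583, 5354, 6983, 5046, 5033, 608]),
  (9, [2296, 1740, 7516, 7496, 1671, 6136, 136, 567, 2206, 3371, 3652, 2041, 496, 382, 1444, 2310, 3022,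
    4350, 4688, 7972, 1078, 756, 2967, 1134, 7299, 3690, 8033, 2712, 5382, 6004, 5663, 4276, 4788,
    7757, 1150, 4833, 288, 7567, 147, 3890, 7457, 2929, 5743, 2555, 7888]),
  (9, [275, 175, 4902, 5212, 614, 3951, 552, 5985, 2549, 2613, 1120, 8187, 594, 617, 3712, 4474, 3013,
    6038, 365, 7375, 7670, 6039, 6039, 5765, 1062, 6499, 7893, 7496, 2799, 2883, 696, 5613, 3878, 7380,
    637, 7137, 7023, 3418, 7736, 6477, 248, 7074, 4096, 4693, 120]),
  (9, [5120, 5426, 3133, 3107, 4774, 102, 4988, 592, 658, 743, 5239, 947, 8138, 2108, 7208, 3410, 5966,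
    2705, 3183, 7654, 6022, 5687, 4760, 3750, 3609, 3790, 6868, 4434, 687, 4250, 6146, 4216, 245, 2542,
    4926, 719, 3940, 183, 1886, 7843, 5721, 925, 4074, 6390, 5035])]

/-- Arcs on the boundary. -/
def arcsD (n : ℕ) : List (ℕ × Arc) :=
  [((n + 8) / 9, .orbit (0, []) (9, [5407, 1]) (9, [1]) (9, [1])),
    ((n + 7) / 9, .orbit (1, []) (9, [7540, 1]) (9, [1]) (9, [1])),
    ((n + 6) / 9, .orbit (2, []) (9, [3983, 1]) (9, [1]) (9, [1])),
    ((n + 5) / 9, .orbit (3, []) (9, [2095, 1]) (9, [1]) (9, [1])),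
    ((n + 4) / 9, .orbit (4, []) (9, [7343, 1]) (9, [1]) (9, [1])),
    ((n + 3) / 9, .orbit (5, []) (9, [92, 1]) (9, [1]) (9, [1])),
    ((n + 2) / 9, .orbit (6, []) (9, [3014, 1]) (9, [1]) (9, [1])),
    ((n + 1) / 9, .orbit (7, []) (9, [2466, 1]) (9, [1]) (9, [1])),
    ((n + 0) / 9, .orbit (8, []) (9, [1173, 1]) (9, [1]) (9, [1]))].filter fun a => Nat.ble 1 a.1

/-- Boundary points. -/
def arcsF (n : ℕ) : List (ℕ × Arc) :=
  ([(4, 3), (4, 5), (0, 6), (8, 5), (7, 5), (4, 0), (6, 7), (4, 7), (7, 6), (1, 8), (0, 4), (4, 8),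
    (0, 7), (4, 1), (8, 7), (0, 1), (1, 2), (1, 4), (2, 3), (6, 2), (2, 8), (7, 2), (5, 7), (0, 2),
    (8, 4), (7, 3), (8, 3), (2, 4), (3, 6), (4, 2), (5, 4), (6, 1), (5, 6), (6, 4), (3, 2), (6, 8),
    (8, 0), (8, 1), (3, 5), (0, 8), (1, 3), (2, 1), (0, 5), (0, 3), (2, 7), (3, 8), (5, 8), (1, 0),
    (6, 5), (2, 5), (4, 6), (1, 7), (3, 0), (1, 6), (7, 4), (6, 0), (7, 1), (8, 6), (3, 4), (5, 0),
    (1, 5), (2, 0), (5, 2), (6, 3), (5, 1), (3, 7), (7, 8), (7, 0), (5, 3), (2, 6), (8, 2), (3, 1)].map fun p =>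
    (1, .orbit (p.1, []) (p.2, []) (9, [1]) (9, [1]))).take n

/-- Monomials of given degree and weight. -/
def fam (m w M : ℕ) : List MonoGroup := [⟨[], [9, 8, 7, 6, 5, 4, 3, 2, 1, 0], m, w, M⟩]

/-- Blocks of monomials. -/
def blk (m w i n M M' : ℕ) : Blk :=
  ⟨i, [⟨[], [9, 8, 7, 6, 5, 4, 3, 2, 1, 0], m, w - i, M⟩,
    ⟨[], [9, 8, 7, 6, 5, 4, 3, 2, 1, 0], m, w - i, M'⟩], [(n, arcA)]⟩

theorem check_10_17 : Packed.check (fam 10 17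
    6739986666787659948666753771754907668409286105635143120275902562303) [(222, arcA)] 222 = true := by
  decide +kernel

theorem check_5_22 : Packed.check (fam 5 22
    2535301200456458802993406410751) [(101, arcA)] 101 = true := by
  decide +kernel

theorem check_6_27 : Packed.check (fam 6 27
    13164036458569648337239753460458804039861886925068638906788872191) [(213, arcA)] 213 = true := by
  decide +kernel

theorem check_8_36 : Packed.check (fam 8 36
    1167984798111281975972139931707953163987153994228998523276126927663027431978674181204907449241643480802704352123047912740007565863592381417596452202553596194048874989082161227706633132906530209791) [(545, arcA)] 545 = true := by
  decide +kernel

/-- Multiples of the extreme coordinates. -/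
def fam_8_39 : List MonoGroup :=
    [⟨[0], [9, 8, 7, 6, 5, 4, 3, 2, 1, 0], 7, 39,
      2085861182392253299648692496003440443849170776726616660143575440749844126542039182859730681855⟩,
    ⟨[9], [9, 8, 7, 6, 5, 4, 3, 2, 1], 7, 30,
      654754160771937213315131863342864242300994161999871⟩]

theorem check_8_39 : Packed.check fam_8_39 [(462, arcA)] 462 = true := by decide +kernel

/-- Multiples of three coordinates. -/
def fam_8_32 : List MonoGroup :=
    [⟨[0], [9, 8, 7, 6, 5, 4, 3, 2, 1, 0], 7, 32,
      75153362648762663292463379097258784876021841565066235862633311089030688803667470190838367948312598497021919231⟩,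
    ⟨[9], [9, 8, 7, 6, 5, 4, 3, 2, 1], 7, 23,
      13944311345015434088998097649663⟩,
    ⟨[1], [8, 7, 6, 5, 4, 3, 2, 1], 7, 31,
      18889465931478580854783⟩]

theorem check_8_32 : Packed.check fam_8_32 [(529, arcA)] 529 = true := by decide +kernel

/-- Multiples of four coordinates. -/
def famSeven (y M₀ M₁ M₂ M₃ : ℕ) : List MonoGroup :=
  [⟨[0], [9, 8, 7, 6, 5, 4, 3, 2, 1, 0], 6, y, M₀⟩,
    ⟨[9], [9, 8, 7, 6, 5, 4, 3, 2, 1], 6, y - 9, M₁⟩,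
    ⟨[1], [8, 7, 6, 5, 4, 3, 2, 1], 6, y - 1, M₂⟩,
    ⟨[8], [8, 7, 6, 5, 4, 3, 2], 6, y - 8, M₃⟩]

/-- The families used in degree seven. -/
def famsSeven : List (ℕ × ℕ × List MonoGroup) :=
  [(29, 359, famSeven 29 1645504557321206042154969182557350504982735865633579863348609023
      885443715538058477567
      604462909807314587353087 1),
    (30, 363, famSeven 30 179977060957006910860699754342210211482486735303672797553754111
      226673591177742970257407
      604462909807314587353087 1),
    (31, 365, famSeven 31 1556721230375896829431275776955501271193384150227080559198207
      193428131138340667952988159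
      37778931862957161709567 31),
    (32, 365, famSeven 32 4695566337213083462009975291188547338607816670370557067263
      39614081257132168796771975167
      4722366482869645213695 255),
    (33, 363, famSeven 33 1508550298039859344946497854851085602624696323399483391
      20282409603651670423947251286015
      147573952589676412927 8191)]

theorem check_seven : ∀ p ∈ famsSeven, Packed.check p.2.2 [(p.2.1, arcA)] p.2.1 = true := by
  decide +kernel

/-- Some monomials. -/
def fam_10_45 : List MonoGroup :=
    [⟨[], [8, 7, 6, 5, 4, 3], 10, 45,
      4722366482869645213695⟩,
    ⟨[9], [8, 6, 5, 4, 3, 1], 9, 36,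
      18889465931478580854783⟩,
    ⟨[9, 9], [8, 7, 6, 5, 3, 2, 1], 8, 27,
      75557863725914323419135⟩,
    ⟨[9, 9, 9], [8, 7, 6, 5, 4, 3, 2, 1], 7, 18,
      2199023255551⟩,
    ⟨[9, 9, 9, 9], [4, 3, 2, 1], 6, 9,
      0⟩]

theorem check_10_45 : Packed.check fam_10_45 (arcsD 263) 263 = true := by decide +kernel

/-- Multiples of the last coordinate. -/
def fam_9_44 : List MonoGroup :=
    [⟨[9], [8, 7, 6, 5, 3, 2, 1], 8, 35,
      83076749736557242056487941267521535⟩,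
    ⟨[9, 9], [8, 7, 5, 4, 3, 2, 1], 7, 26,
      18889465931478580854783⟩,
    ⟨[9, 9, 9], [8, 7, 6, 5, 4, 3, 2, 1], 6, 17,
      0⟩,
    ⟨[9, 9, 9, 9], [4, 3, 2, 1], 5, 8,
      0⟩]

theorem check_9_44 : Packed.check fam_9_44 (arcsD 190) 190 = true := by decide +kernel

/-- Multiples of two coordinates. -/
def fam_9_37 : List MonoGroup :=
    [⟨[9], [8, 7, 5, 4, 3, 2, 1], 8, 28,
      1048575⟩,
    ⟨[9, 9], [8, 7, 6, 5, 4, 3, 2, 1], 7, 19,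
      0⟩,
    ⟨[9, 9, 9], [5, 4, 3, 2, 1], 6, 10,
      0⟩,
    ⟨[1], [8, 7, 6, 5, 4, 3, 2, 1], 8, 36,
      1532495540865888858358347027150309183618739122183602175⟩]

theorem check_9_37 : Packed.check fam_9_37 (arcsD 200) 200 = true := by decide +kernel

/-- Ranks on the boundary curves: weight, rank and monomials. -/
def tabD : List (ℕ × ℕ × List MonoGroup) :=
  [(9, 1, [⟨[], [1], 9, 9, 1⟩]), (10, 1, [⟨[], [2, 1], 9, 10, 1⟩]),
    (11, 2, [⟨[], [3, 2, 1], 9, 11, 3⟩]), (12, 3, [⟨[], [4, 3, 2, 1], 9, 12, 7⟩]),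
    (13, 5, [⟨[], [5, 4, 3, 2, 1], 9, 13, 31⟩]), (14, 7, [⟨[], [6, 5, 4, 3, 2, 1], 9, 14, 127⟩]),
    (15, 11, [⟨[], [7, 6, 5, 4, 3, 2, 1], 9, 15, 2047⟩]),
    (16, 15, [⟨[], [8, 7, 6, 5, 4, 3, 2, 1], 9, 16, 32767⟩]),
    (17, 22, [⟨[], [8, 7, 6, 5, 4, 3, 2, 1], 9, 17, 2097151⟩, ⟨[9], [1], 8, 8, 1⟩]),
    (18, 29, [⟨[], [8, 7, 6, 5, 4, 3, 2, 1], 9, 18, 268435455⟩, ⟨[9], [2, 1], 8, 9, 1⟩]),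
    (19, 38, [⟨[], [8, 7, 6, 5, 4, 3, 2, 1], 9, 19, 137438953471⟩, ⟨[9], [3, 2, 1], 8, 10, 1⟩]),
    (20, 47, [⟨[], [8, 7, 6, 5, 4, 3, 2, 1], 9, 20, 70368744177663⟩, ⟨[9], [4, 3, 2, 1], 8, 11, 1⟩]),
    (21, 56, [⟨[], [8, 7, 6, 5, 4, 3, 2, 1], 9, 21, 285411228338094079⟩, ⟨[9], [5, 4, 3, 2, 1], 8, 12, 1⟩]),
    (22, 65, [⟨[], [8, 7, 6, 5, 4, 3, 2, 1], 9, 22, 440847797374089691135⟩, ⟨[9], [6, 5, 4, 3, 2, 1], 8, 13, 1⟩]),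
    (23, 74, [⟨[], [8, 7, 5, 4, 3, 2, 1], 9, 23, 73786976294838206463⟩, ⟨[9], [7, 6, 5, 4, 3, 2, 1], 8, 14, 639⟩]),
    (24, 83, [⟨[], [8, 7, 5, 4, 3, 2, 1], 9, 24, 75557863725914323419135⟩, ⟨[9], [8, 7, 6, 5, 4, 3, 2, 1], 8, 15, 2111⟩]),
    (25, 92, [⟨[], [8, 7, 6, 4, 3, 2, 1], 9, 25, 75557863725914323419135⟩, ⟨[9], [8, 7, 6, 5, 4, 3, 2, 1], 8, 16, 65535⟩, ⟨[9, 9], [1], 7, 7, 0⟩]),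
    (26, 101, [⟨[], [8, 7, 6, 4, 3, 2, 1], 9, 26, 154742504910672534362390527⟩, ⟨[9], [8, 7, 6, 5, 4, 3, 2, 1], 8, 17, 16383⟩, ⟨[9, 9], [2, 1], 7, 8, 0⟩]),
    (27, 110, [⟨[], [7, 5, 4, 3, 2, 1], 9, 27, 1208925819614629174706175⟩, ⟨[9], [8, 7, 6, 5, 4, 3, 2, 1], 8, 18, 17177903103⟩, ⟨[9, 9], [3, 2, 1], 7, 9, 0⟩]),
    (28, 119, [⟨[], [8, 7, 6, 5, 4, 2, 1], 9, 28, 9444732965739290427391⟩, ⟨[9], [8, 7, 6, 5, 4, 3, 2, 1], 8, 19, 35184372088831⟩, ⟨[9, 9], [4, 3, 2, 1], 7, 10, 1⟩]),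
    (29, 128, [⟨[], [7, 6, 4, 3, 2, 1], 9, 29, 37778931862957161709567⟩, ⟨[9], [8, 7, 6, 5, 4, 3, 2, 1], 8, 20, 34621422135410687⟩, ⟨[9, 9], [5, 4, 3, 2, 1], 7, 11, 0⟩]),
    (30, 137, [⟨[], [7, 6, 4, 3, 2, 1], 9, 30, 604462891792916077871103⟩, ⟨[9], [8, 7, 6, 5, 4, 3, 2, 1], 8, 21, 864691128455135231⟩, ⟨[9, 9], [6, 5, 4, 3, 2, 1], 7, 12, 0⟩]),
    (31, 146, [⟨[], [7, 6, 4, 3, 2, 1], 9, 31, 1208925819614629174706175⟩, ⟨[9], [8, 6, 5, 4, 3, 2, 1], 8, 22, 73786976294838206463⟩, ⟨[9, 9], [8, 7, 6, 5, 4, 3, 2, 1], 7, 13, 0⟩]),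
    (32, 155, [⟨[], [8, 6, 4, 3, 2, 1], 9, 32, 37778931862957161709567⟩, ⟨[9], [8, 7, 5, 4, 3, 2, 1], 8, 23, 147573952589676412927⟩, ⟨[9, 9], [8, 7, 6, 5, 4, 3, 2, 1], 7, 14, 8191⟩]),
    (33, 164, [⟨[], [8, 6, 4, 3, 2, 1], 9, 33, 18889465931478580854783⟩, ⟨[9], [8, 7, 5, 4, 3, 2, 1], 8, 24, 302231454903657293676543⟩, ⟨[9, 9], [8, 7, 6, 5, 4, 3, 2, 1], 7, 15, 4095⟩, ⟨[9, 9, 9], [1], 6, 6, 0⟩]),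
    (34, 173, [⟨[], [7, 6, 5, 4, 2, 1], 9, 34, 18889465931478580854783⟩, ⟨[9], [8, 7, 6, 4, 3, 2, 1], 8, 25, 18889465931478580854783⟩, ⟨[9, 9], [8, 7, 6, 5, 4, 3, 2, 1], 7, 16, 33554431⟩, ⟨[9, 9, 9], [2, 1], 6, 7, 0⟩]),
    (35, 182, [⟨[], [7, 6, 5, 4, 2, 1], 9, 35, 75557863725914323419135⟩, ⟨[9], [8, 7, 6, 4, 3, 2, 1], 8, 26, 9671406556917033397649407⟩, ⟨[9, 9], [8, 7, 6, 5, 4, 3, 2, 1], 7, 17, 8388607⟩, ⟨[9, 9, 9], [4, 3, 2, 1], 6, 8, 0⟩]),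
    (36, 191, [⟨[], [8, 6, 5, 4, 3, 1], 9, 36, 18889465931478580854783⟩, ⟨[9], [8, 7, 6, 5, 3, 2, 1], 8, 27, 75557863725914323419135⟩, ⟨[9, 9], [8, 7, 6, 5, 4, 3, 2, 1], 7, 18, 2199023255551⟩, ⟨[9, 9, 9], [4, 3, 2, 1], 6, 9, 0⟩]),
    (37, 200, [⟨[], [7, 6, 4, 3, 2, 1], 9, 37, 75557863725914323288063⟩, ⟨[9], [8, 7, 6, 5, 4, 2, 1], 8, 28, 4722366482869645213695⟩, ⟨[9, 9], [8, 7, 6, 5, 4, 3, 2, 1], 7, 19, 3377699720527871⟩, ⟨[9, 9, 9], [5, 4, 3, 2, 1], 6, 10, 3⟩]),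
    (38, 209, [⟨[], [7, 6, 4, 3, 2, 1], 9, 38, 18889465931478580789247⟩, ⟨[9], [8, 7, 6, 5, 4, 2, 1], 8, 29, 302231454903657293676543⟩, ⟨[9, 9], [8, 7, 6, 5, 4, 3, 2, 1], 7, 20, 288230376151711743⟩, ⟨[9, 9, 9], [6, 5, 4, 3, 2, 1], 6, 11, 0⟩]),
    (39, 218, [⟨[], [8, 6, 5, 4, 2, 1], 9, 39, 18889465931478580854783⟩, ⟨[9], [8, 7, 6, 5, 4, 3, 1], 8, 30, 302231454903657293676543⟩, ⟨[9, 9], [8, 7, 6, 5, 4, 3, 2, 1], 7, 21, 73786976294838206463⟩, ⟨[9, 9, 9], [7, 6, 5, 4, 3, 2, 1], 6, 12, 0⟩]),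
    (40, 227, [⟨[], [8, 7, 5, 4, 3, 1], 9, 40, 9444732965739290427391⟩, ⟨[9], [8, 7, 6, 5, 4, 3, 2], 8, 31, 2417851639229258349412351⟩, ⟨[9, 9], [8, 7, 6, 5, 4, 3, 2, 1], 7, 22, 9444732965739290427391⟩, ⟨[9, 9, 9], [8, 7, 6, 5, 4, 3, 2, 1], 6, 13, 0⟩]),
    (41, 236, [⟨[], [7, 6, 5, 3, 2, 1], 9, 41, 9444732965739290427391⟩, ⟨[9], [8, 7, 6, 5, 4, 3, 2], 8, 32, 19807040628566084398385987583⟩, ⟨[9, 9], [8, 7, 6, 5, 4, 3, 2, 1], 7, 23, 590295810358705651711⟩, ⟨[9, 9, 9], [8, 7, 6, 5, 4, 3, 2, 1], 6, 14, 0⟩, ⟨[9, 9, 9, 9], [1], 5, 5, 0⟩])]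

theorem check_tabD : ∀ p ∈ tabD, Packed.check p.2.2 (arcsD p.2.1) p.2.1 = true := by
  decide +kernel

/-- Ranks on the boundary points: weight, rank and monomials. -/
def tabF : List (ℕ × ℕ × List MonoGroup) :=
  [(9, 1, [⟨[], [1], 9, 9, 1⟩]), (10, 1, [⟨[], [2, 1], 9, 10, 1⟩]),
    (11, 2, [⟨[], [3, 2, 1], 9, 11, 3⟩]), (12, 3, [⟨[], [4, 3, 2, 1], 9, 12, 7⟩]),
    (13, 5, [⟨[], [5, 4, 3, 2, 1], 9, 13, 31⟩]), (14, 7, [⟨[], [6, 5, 4, 3, 2, 1], 9, 14, 127⟩]),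
    (15, 11, [⟨[], [7, 6, 5, 4, 3, 2, 1], 9, 15, 2047⟩]),
    (16, 15, [⟨[], [8, 7, 6, 5, 4, 3, 2, 1], 9, 16, 32767⟩]),
    (17, 21, [⟨[], [8, 7, 6, 5, 4, 3, 2, 1], 9, 17, 2097151⟩]),
    (18, 28, [⟨[], [8, 7, 6, 5, 4, 3, 2, 1], 9, 18, 268435455⟩]),
    (19, 36, [⟨[], [8, 7, 6, 5, 4, 3, 2, 1], 9, 19, 68719476735⟩]),
    (20, 44, [⟨[], [8, 7, 6, 5, 4, 3, 2, 1], 9, 20, 17592186044415⟩]),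
    (21, 51, [⟨[], [8, 7, 6, 5, 4, 3, 2, 1], 9, 21, 19703248369745919⟩]),
    (22, 58, [⟨[], [8, 7, 6, 5, 4, 3, 2, 1], 9, 22, 18590859261785407487⟩]),
    (23, 63, [⟨[], [8, 7, 5, 4, 3, 2, 1], 9, 23, 9223372036854775807⟩]),
    (24, 68, [⟨[], [8, 7, 5, 4, 3, 2, 1], 9, 24, 295147905179352825855⟩]),
    (25, 70, [⟨[], [8, 7, 6, 4, 3, 2, 1], 9, 25, 1180591620717411303423⟩])]

theorem check_tabF : ∀ p ∈ tabF, Packed.check p.2.2 (arcsF p.2.1) p.2.1 = true := by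
  decide +kernel

theorem check_7_31 : Packed.check [⟨[], [8, 7, 6, 4, 3, 2, 1], 7, 31, 4722366482869645213695⟩] (arcsF 72) 72 = true := by
  decide +kernel

theorem check_8_25 : Packed.check [⟨[], [8, 7, 6, 4, 3, 2, 1], 8, 25, 4722366482869645213695⟩] (arcsF 72) 72 = true := by
  decide +kernel

/-- Blocks in degree 7 and weight 22. -/
def blks_7_22 : List Blk :=
  [blk 6 22 1 179
      766247770432944429179173513575154591809369561091801087
      766247770432944429179173513575154591809369561091801088,
    blk 6 22 2 166
      93536104789177786765035829293842113257979682750463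
      280608314367533360295107487881526339773939048251392]

theorem check_blks_7_22 : Packed.blkCheck [(3, arcZ)] 3 blks_7_22 = true := by decide +kernel

/-- Blocks in degree 7 and weight 23. -/
def blks_7_23 : List Blk :=
  [blk 6 23 1 190
      1569275433846670190958947355801916604025588861116008628223
      10984928036926691336712631490613416228179122027812060397568,
    blk 6 23 2 179
      766247770432944429179173513575154591809369561091801087
      2298743311298833287537520540725463775428108683275403264,
    blk 6 23 3 166
      93536104789177786765035829293842113257979682750463
      280608314367533360295107487881526339773939048251392]

theorem check_blks_7_23 : Packed.blkCheck [(7, arcZ)] 7 blks_7_23 = true := by decide +kernel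

/-- Blocks in degree 7 and weight 24. -/
def blks_7_24 : List Blk :=
  [blk 6 24 1 199
      803469022129495137770981046170581301261101496891396417650687
      5624283154906465964396867323194069108827710478239774923554816,
    blk 6 24 2 190
      1569275433846670190958947355801916604025588861116008628223
      23539131507700052864384210337028749060383832916740129423360,
    blk 6 24 3 179
      766247770432944429179173513575154591809369561091801087
      2298743311298833287537520540725463775428108683275403264,
    blk 6 24 4 166
      93536104789177786765035829293842113257979682750463
      280608314367533360295107487881526339773939048251392,
    blk 6 24 5 151
      2854495385411919762116571938898990272765493247
      0]

theorem check_blks_7_24 : Packed.blkCheck [(11, arcZ)] 11 blks_7_24 = true := by decide +kernel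

/-- Blocks in degree 7 and weight 25. -/
def blks_7_25 : List Blk :=
  [blk 6 25 1 206
      154266052248863066452028360864751609842131487403148112188932095
      19591788635605609439407601829823454449950698900199810247994376192,
    blk 6 25 2 199
      803469022129495137770981046170581301261101496891396417650687
      5624283154906465964396867323194069108827710478239774923554816,
    blk 6 25 3 190
      1569275433846670190958947355801916604025588861116008628223
      48647538449246775919727368029859414724793254694596267474944,
    blk 6 25 4 179
      766247770432944429179173513575154591809369561091801087
      2298743311298833287537520540725463775428108683275403264,
    blk 6 25 5 166
      93536104789177786765035829293842113257979682750463
      280608314367533360295107487881526339773939048251392]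

theorem check_blks_7_25 : Packed.blkCheck [(19, arcZ)] 19 blks_7_25 = true := by decide +kernel

/-- Blocks in degree 7 and weight 31. -/
def blks_7_31 : List Blk :=
  [blk 6 31 1 206
      179977060957006910860699754342210211482486735303672797553754111
      5553577880959070392273020991131057954316733546513332038801555456,
    blk 6 31 8 199
      803469022129495137770981046170581301261101496891396417650687
      5624283154906465964396867323194069108827710478239774923554816,
    blk 6 31 2 210
      1645504557321206042154969182557350504982735865633579863348609023
      1206154840516444028899592410814537920152345389509414039834530414592,
    blk 6 31 7 206
      154266052248863066452028360864751609842131487403148112188932095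
      19591788635605609439407601829823454449950698900199810247994376192,
    blk 6 31 3 213
      26328072917139296674479506920917608074772013692995756713981247487
      106023149637319947708128974370535207737052589054659959276377173131264,
    blk 6 31 6 210
      1645504557321206042154969182557350504982735865633579863348609023
      1156789703796807847634943335337817405002863313540406643934072143872,
    blk 6 31 4 213
      13164036458569648337239753460458804039861886925068638906788872191
      106984124298795532036747476373148700431957555040032828395473164304384,
    blk 6 31 5 213
      13164036458569648337239753460458804039861886925068638906788872191
      107826622632143989530330820594618063890508715803237221285507652124672]

theorem check_blks_7_31 : Packed.blkCheck [(65, arcZ)] 65 blks_7_31 = true := by decide +kernel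

/-- Blocks in degree 8 and weight 36. -/
def blks_8_36 : List Blk :=
  [blk 7 36 9 345
      57717782713587007462436449886307109755376315074797318396386191522474598986994093641598190723202172546885867274239
      387337481713036292836047825726770229631485296557965867764902432563775582171604827982515078633955966716524485114990463811584,
    blk 7 36 8 353
      3693938085498979658131303032610105584830399438199265603456714754123214094851709246997057077535497947545872747200511
      1766341549075443681204016336578704016294513863095556156058498150706648597177855396648171529893048209980325641160008845576110080,
    blk 7 36 7 359
      3693938374479805272880313495573538392893353978566454238660136345059407857603991634146142894357835639421709253083135
      45427841361126904481526810261424281019581641488198306195388260485627883400077116231249319247234623900699642587178001445510449972903936,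
    blk 7 36 6 363
      461746957199163350935350780134751552952332945940864769779760477912947616427783166069397860072429374703108735631359
      207143369087393180860983845222531704664347028367723444259592105973273479961595473688713042798120111540353618192290583172781839932240953344,
    blk 7 36 5 365
      469708516554766645577896119357867405475136509781663974141458194306441805022921688692739799676953740606386995199
      35539506263157994520299736910022161195200881326589207756165877373661402121811040884815979421393741496636122567767251236561154140626355224576]

theorem check_blks_8_36 : Packed.blkCheck [(276, arcY)] 276 blks_8_36 = true := by decide +kernel

end

noncomputable section
set_option maxRecDepth 100000

/-- The number of independent restrictions of products of coordinates to arcs. -/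
abbrev Rk (z : Fin 9 → ℂ) (l : List MonoGroup) (arcs : List (ℕ × Arc)) (n : ℕ) : Prop :=
  n ≤ Module.finrank ℂ (Submodule.span ℂ {x | x ∈ (monos ℤ l).map (arcCoeffs z arcs)})

/-- Dimensions of the pieces of the ideal of the boundary curves. -/
def hd (z : Fin 9 → ℂ) (m : ℕ) (w : ℤ) : ℕ := Module.finrank ℂ (pc (didl z) m w)

/-- Dimensions of the pieces of the ideal of the boundary points. -/
def hf (z : Fin 9 → ℂ) (m : ℕ) (w : ℤ) : ℕ := Module.finrank ℂ (pc (fidl z) m w)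

theorem le_AA {z : Fin 9 → ℂ} {l : List MonoGroup} {arcs : List (ℕ × Arc)} {n m w : ℕ}
    (h : Rk z l arcs n) (hl : bidegOk m w l = true) (ha : (arcs.all fun a => a.2.isOrb) = true) :
    n ≤ AA z m w := by
  have h1 := finrank_vanish_le h (fun _ hP => toC_mem_of_bidegOk hl hP) (pc_le_Rp (idl z) m w)
    fun _ hf a hm => Arc.isOrb.vanish (List.all_eq_true.1 ha a hm) hf.1
  have h2 := AA_add_hh z m w
  unfold hh NN at h2
  omega

theorem add_hd_le {z : Fin 9 → ℂ} {l : List MonoGroup} {arcs : List (ℕ × Arc)} {n m w : ℕ}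
    (h : Rk z l arcs n) (hl : bidegOk m w l = true) (ha : (arcs.all fun a => a.2.isD) = true) :
    n + hd z m w ≤ NN m w :=
  finrank_vanish_le h (fun _ hP => toC_mem_of_bidegOk hl hP) (pc_le_Rp (didl z) m w)
    fun _ hf a hm => Arc.isD.vanish (List.all_eq_true.1 ha a hm) hf.1

theorem add_hf_le {z : Fin 9 → ℂ} {l : List MonoGroup} {arcs : List (ℕ × Arc)} {n m w : ℕ}
    (h : Rk z l arcs n) (hl : bidegOk m w l = true) (ha : (arcs.all fun a => a.2.isF) = true) :
    n + hf z m w ≤ NN m w :=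
  finrank_vanish_le h (fun _ hP => toC_mem_of_bidegOk hl hP) (pc_le_Rp (fidl z) m w)
    fun _ hf a hm => Arc.isF.vanish (List.all_eq_true.1 ha a hm) hf.1

theorem pc_sup_X_zero_le (z : Fin 9 → ℂ) (m : ℕ) (w : ℤ) :
    pc (idl z) (m + 1) w ⊔ (Rp m (w - ((0 : Fin 10) : ℕ))).map (mulX 0) ≤ pc (didl z) (m + 1) w := by
  refine sup_le (inf_le_inf_right _ fun f hf => idl_le_didl z hf) ?_
  rintro _ ⟨g, hg, rfl⟩
  exact ⟨Ideal.mul_mem_right _ _ (X_zero_mem_didl z), map_mulX_Rp_le _ _ _ ⟨g, hg, rfl⟩⟩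

theorem hh_add_AA_le_hd (z : Fin 9 → ℂ) (m : ℕ) (w : ℤ) : hh z (m + 1) w + AA z m w ≤ hd z (m + 1) w := by
  have h1 := finrank_sup_mulX (J := idl z) (i := 0) (fun f => mem_idl_of_X_mul) m w
  have h2 := Submodule.finrank_mono (pc_sup_X_zero_le z m w)
  have h3 := AA_add_hh z m w
  rw [show (w : ℤ) - (((0 : Fin 10) : ℕ) : ℤ) = w from sub_zero _] at h1 h2
  unfold hd hh at *
  omega

/-- The rank computations for which the coordinates are restricted to the orbit or its boundary. -/
structure Ranks (z : Fin 9 → ℂ) : Prop where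
  rank_10_17 : ∃ M, Rk z (fam 10 17 M) [(222, arcA)] 222
  rank_5_22 : ∃ M, Rk z (fam 5 22 M) [(101, arcA)] 101
  rank_6_27 : ∃ M, Rk z (fam 6 27 M) [(213, arcA)] 213
  rank_8_36 : ∃ M, Rk z (fam 8 36 M) [(545, arcA)] 545
  rank_8_39 : Rk z fam_8_39 [(462, arcA)] 462
  rank_8_32 : Rk z fam_8_32 [(529, arcA)] 529
  rank_seven : ∀ p ∈ famsSeven, Rk z p.2.2 [(p.2.1, arcA)] p.2.1
  rank_10_45 : Rk z fam_10_45 (arcsD 263) 263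
  rank_9_44 : Rk z fam_9_44 (arcsD 190) 190
  rank_9_37 : Rk z fam_9_37 (arcsD 200) 200
  rank_tabD : ∀ p ∈ tabD, Rk z p.2.2 (arcsD p.2.1) p.2.1

theorem gen_ranks : Gen Ranks := by
  have h1 := gen_of_check check_10_17
  have h2 := gen_of_check check_5_22
  have h3 := gen_of_check check_6_27
  have h4 := gen_of_check check_8_36
  have h5 := gen_of_check check_8_39
  have h6 := gen_of_check check_8_32
  have h7 := Gen.forall_mem famsSeven fun p hp => gen_of_check (check_seven p hp)
  have h8 := gen_of_check check_10_45
  have h9 := gen_of_check check_9_44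
  have h10 := gen_of_check check_9_37
  have h11 := Gen.forall_mem tabD fun p hp => gen_of_check (check_tabD p hp)
  refine (h1.and (h2.and (h3.and (h4.and (h5.and (h6.and (h7.and (h8.and (h9.and
    (h10.and h11)))))))))).mono fun z h => ?_
  obtain ⟨h1, h2, h3, h4, h5, h6, h7, h8, h9, h10, h11⟩ := h
  exact ⟨⟨_, h1⟩, ⟨_, h2⟩, ⟨_, h3⟩, ⟨_, h4⟩, h5, h6, h7, h8, h9, h10, h11⟩

variable {z : Fin 9 → ℂ}

theorem Ranks.add_hd_le (h : Ranks z) : ∀ p ∈ tabD, p.2.1 + hd z 9 p.1 ≤ NN 9 p.1 := by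
  have e : ∀ p ∈ tabD, bidegOk 9 p.1 p.2.2 = true ∧ ((arcsD p.2.1).all fun a => a.2.isD) = true := by
    decide +kernel
  exact fun p hp => _root_.add_hd_le (h.rank_tabD p hp) (e p hp).1 (e p hp).2

/-- Comparison of the ranks on the orbit and on its boundary. -/
theorem add_AA_le_AA {m n : ℕ} {w : ℤ} (h : n + hd z (m + 1) w ≤ NN (m + 1) w) :
    n + AA z m w ≤ AA z (m + 1) w := by
  have h1 := hh_add_AA_le_hd z m w
  have h2 := AA_add_hh z (m + 1) w
  omega

theorem AA_eq_AA {m v w : ℕ} (hvw : v + w = 9 * m) (hm : m ≤ 10) (hc : cnt m v = cnt m w) :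
    AA z m v = AA z m w := by
  have h1 := AA_add_hh z m v
  have h2 := AA_add_hh z m w
  rw [NN_eq hm] at h1 h2
  have h3 := hh_rev z m w
  rw [show 9 * (m : ℤ) - w = v by omega] at h3
  omega

theorem Ranks.midBounds (h : Ranks z) : MidBounds z := by
  have hD := h.add_hd_le
  obtain ⟨M1, h1⟩ := h.rank_10_17
  obtain ⟨M2, h2⟩ := h.rank_5_22
  obtain ⟨M3, h3⟩ := h.rank_6_27
  obtain ⟨M4, h4⟩ := h.rank_8_36
  have e8 : 545 ≤ AA z 8 (36 : ℕ) := le_AA h4 rfl rfl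
  have e9 : 736 ≤ AA z 9 (36 : ℕ) := by
    have : ∃ p ∈ tabD, p.1 = 36 ∧ p.2.1 = 191 := by decide +kernel
    obtain ⟨p, hp, e, e'⟩ := this
    have := add_AA_le_AA (hD p hp)
    rw [e, e'] at this
    simp only [Nat.reduceAdd] at this
    omega
  refine ⟨?_, le_AA h2 rfl rfl, le_AA h3 rfl rfl, ?_, e8, ?_, ?_⟩
  · have e := le_AA h1 (m := 10) (w := 17) rfl rfl
    have e' := AA_add_hh z 10 (17 : ℕ)
    rw [NN_eq le_rfl, show cnt 10 17 = 222 by decide +kernel] at e'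
    push_cast at *
    omega
  · have : ∃ p ∈ famsSeven, p.1 = 31 ∧ p.2.1 = 365 ∧ bidegOk 7 31 p.2.2 = true := by decide +kernel
    obtain ⟨p, hp, e, e', e''⟩ := this
    have := le_AA (h.rank_seven p hp) e'' rfl
    rwa [e'] at this
  · have e1 := le_AA h.rank_8_32 (m := 8) (w := 32) rfl rfl
    have e2 := AA_eq_AA (z := z) (m := 8) (v := 40) (w := 32) rfl (by norm_num) (by decide +kernel)
    have : ∃ p ∈ tabD, p.1 = 40 ∧ p.2.1 = 227 := by decide +kernel
    obtain ⟨p, hp, e, e'⟩ := this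
    have := add_AA_le_AA (hD p hp)
    rw [e, e'] at this
    push_cast at *
    omega
  · have e2 := AA_eq_AA (z := z) (m := 9) (v := 45) (w := 36) rfl (by norm_num) (by decide +kernel)
    have := add_AA_le_AA (_root_.add_hd_le h.rank_10_45 (m := 10) (w := 45) rfl (by decide +kernel))
    push_cast at *
    omega

end

noncomputable section
set_option maxRecDepth 100000

/-- The number of independent rows of blocks. -/
abbrev BlkRk (z : Fin 9 → ℂ) (sarcs : List (ℕ × Arc)) (n : ℕ) (l : List Blk) : Prop :=
  n + (l.map fun b => Packed.slots b.arcs).sum ≤ Module.finrank ℂ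
    (Submodule.span ℂ {x | x ∈ blkVecs z sarcs l})

/-- The rank computations for blocks. -/
structure BlkRanks (z : Fin 9 → ℂ) : Prop where
  rank_7_22 : BlkRk z [(3, arcZ)] 3 blks_7_22
  rank_7_23 : BlkRk z [(7, arcZ)] 7 blks_7_23
  rank_7_24 : BlkRk z [(11, arcZ)] 11 blks_7_24
  rank_7_25 : BlkRk z [(19, arcZ)] 19 blks_7_25
  rank_7_31 : BlkRk z [(65, arcZ)] 65 blks_7_31
  rank_8_36 : BlkRk z [(276, arcY)] 276 blks_8_36

theorem gen_blkRanks : Gen BlkRanks := by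
  have h1 := gen_of_blkCheck check_blks_7_22
  have h2 := gen_of_blkCheck check_blks_7_23
  have h3 := gen_of_blkCheck check_blks_7_24
  have h4 := gen_of_blkCheck check_blks_7_25
  have h5 := gen_of_blkCheck check_blks_7_31
  have h6 := gen_of_blkCheck check_blks_8_36
  refine (h1.and (h2.and (h3.and (h4.and (h5.and h6))))).mono fun z h => ?_
  obtain ⟨h1, h2, h3, h4, h5, h6⟩ := h
  exact ⟨h1, h2, h3, h4, h5, h6⟩

variable {z : Fin 9 → ℂ}

/-- The arcs of a block determine the coordinate ring of the orbit. -/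
def slotsFull (m w : ℕ) (l : List Blk) : Bool :=
  l.all fun b => Nat.ble b.idx w &&
    Nat.ble (cnt m (w - b.idx)) (Packed.slots b.arcs + hTab m (w - b.idx))

theorem MidBounds.AA_le_slots (h : MidBounds z) {m w : ℕ} (hm : m ≤ 10) {l : List Blk}
    (hl : slotsFull m w l = true) : ∀ b ∈ l, AA z m (w - (b.idx : ℕ)) ≤ Packed.slots b.arcs := by
  intro b hb
  have := List.all_eq_true.1 hl b hb
  rw [Bool.and_eq_true] at this
  have h1 := Nat.le_of_ble_eq_true this.1
  have h2 := Nat.le_of_ble_eq_true this.2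
  have h3 := AA_add_hh z m (w - b.idx : ℕ)
  rw [NN_eq hm, h.hh_eq hm] at h3
  rw [← Nat.cast_sub h1]
  omega

theorem MidBounds.gen_seven_of (h : MidBounds z) {w n : ℕ} {l : List Blk}
    (hr : BlkRk z [(n, arcZ)] n l)
    (hl : (l.all fun b => Nat.blt b.idx 10 && (Nat.ble b.idx w && bidegOk (4 + 2) (w - b.idx) b.gs) &&
      b.arcs.all fun a => a.2.isOrb) = true) (hs : slotsFull 6 w l = true) :
    n + (hh z 6 w + hh z 6 (w - 9)) ≤ rr z 7 w + hh z 5 (w - 9) :=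
  le_rr_of_blk (m := 4) hr rfl hl (h.AA_le_slots (by norm_num) hs)

theorem multRp_mono {L L' : List (Fin 10)} (hL : ∀ i ∈ L, i ∈ L') (m : ℕ) (w : ℤ) :
    multRp L m w ≤ multRp L' m w := by
  induction L with
  | nil => exact bot_le
  | cons i L ih =>
    rw [List.forall_mem_cons] at hL
    exact sup_le (le_multRp hL.1 m w) (ih hL.2)

theorem FullAt.mono {L L' : List (Fin 10)} {m : ℕ} {w : ℤ} (h : FullAt z L m w)
    (hL : ∀ i ∈ L, i ∈ L') : FullAt z L' m w :=
  h.trans (sup_le_sup_left (multRp_mono hL m w) _)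

theorem Ranks.fullAt_six (h : Ranks z) (y : ℕ) (hy : 29 ≤ y) (hy' : y ≤ 33) : FullAt z [8, 1, 9, 0] 6 y := by
  have e : ∀ y ∈ Finset.Icc 29 33, ∃ p ∈ famsSeven, p.1 = y ∧ bidegOk (6 + 1) y p.2.2 = true ∧
      headOk [8, 1, 9, 0] p.2.2 = true ∧ cnt 7 y ≤ p.2.1 + hTab 7 y := by
    decide +kernel
  obtain ⟨p, hp, rfl, e1, e2, e3⟩ := e y (Finset.mem_Icc.2 ⟨hy, hy'⟩)
  have h1 := add_hh_le_bb (h.rank_seven p hp) e1 e2 rfl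
  rw [h.midBounds.hh_eq (by norm_num)] at h1
  refine fullAt_of_bb ?_
  rw [NN_eq (by norm_num)]
  exact e3.trans h1

/-- In low weights, modulo the extreme coordinates, a coordinate of index at most four occurs. -/
theorem FullAt.low {m : ℕ} {w : ℤ} (hw : w < 5 * (m + 2))
    (hS : ∀ i ∈ ([2, 3, 4] : List (Fin 10)), FullAt z [8, 1, 9, 0] m (w - (i : ℕ))) :
    FullAt z [8, 1, 9, 0] (m + 1) w := by
  refine FullAt.succ [2, 3, 4] hS fun d h0 h1 h2 => ?_
  have h3 : ∀ i : Fin 10, (d i : ℤ) * 5 ≤ (d i : ℤ) * (i : ℕ) := by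
    intro i
    by_cases hi : 5 ≤ (i : ℕ)
    · exact mul_le_mul_of_nonneg_left (by exact_mod_cast hi) (by positivity)
    · rw [h0 i (by revert hi; revert i; decide)]
      simp
  have h4 := Finset.sum_le_sum fun i (_ : i ∈ Finset.univ) => h3 i
  rw [← Finset.sum_mul, h2] at h4
  have h5 : (∑ i, (d i : ℤ)) = m + 2 := by exact_mod_cast h1
  omega

/-- In high weights, modulo the extreme coordinates, a coordinate of index at least five occurs. -/
theorem FullAt.high {m : ℕ} {w : ℤ} (hw : 4 * (m + 2) < w)
    (hS : ∀ i ∈ ([5, 6, 7] : List (Fin 10)), FullAt z [8, 1, 9, 0] m (w - (i : ℕ))) :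
    FullAt z [8, 1, 9, 0] (m + 1) w := by
  refine FullAt.succ [5, 6, 7] hS fun d h0 h1 h2 => ?_
  have h3 : ∀ i : Fin 10, (d i : ℤ) * (i : ℕ) ≤ (d i : ℤ) * 4 := by
    intro i
    by_cases hi : (i : ℕ) ≤ 4
    · exact mul_le_mul_of_nonneg_left (by exact_mod_cast hi) (by positivity)
    · rw [h0 i (by revert hi; revert i; decide)]
      simp
  have h4 := Finset.sum_le_sum fun i (_ : i ∈ Finset.univ) => h3 i
  rw [← Finset.sum_mul, h2] at h4
  have h5 : (∑ i, (d i : ℤ)) = m + 2 := by exact_mod_cast h1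
  omega

theorem Ranks.fullAt_seven (h : Ranks z) (y : ℕ) (hy : 33 ≤ y) (hy' : y ≤ 38) : FullAt z [8, 1, 9, 0] 7 y := by
  rcases le_or_gt y 35 with h35 | h35
  · refine FullAt.low (by push_cast; omega) fun i hi => ?_
    have : 2 ≤ (i : ℕ) ∧ (i : ℕ) ≤ 4 := by revert i; decide
    rw [← Nat.cast_sub (by omega)]
    exact h.fullAt_six _ (by omega) (by omega)
  · refine FullAt.high (by push_cast; omega) fun i hi => ?_
    have : 5 ≤ (i : ℕ) ∧ (i : ℕ) ≤ 7 := by revert i; decide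
    rw [← Nat.cast_sub (by omega)]
    exact h.fullAt_six _ (by omega) (by omega)

theorem Ranks.fullAt_eight (h : Ranks z) (y : ℕ) (hy : 38 ≤ y) (hy' : y ≤ 43) : FullAt z [8, 1, 9, 0] 8 y := by
  rcases le_or_gt y 40 with h40 | h40
  · refine FullAt.low (by push_cast; omega) fun i hi => ?_
    have : 2 ≤ (i : ℕ) ∧ (i : ℕ) ≤ 4 := by revert i; decide
    rw [← Nat.cast_sub (by omega)]
    exact h.fullAt_seven _ (by omega) (by omega)
  · refine FullAt.high (by push_cast; omega) fun i hi => ?_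
    have : 5 ≤ (i : ℕ) ∧ (i : ℕ) ≤ 7 := by revert i; decide
    rw [← Nat.cast_sub (by omega)]
    exact h.fullAt_seven _ (by omega) (by omega)

/-- The order in which coordinates are added. -/
def bOrder : List (Fin 10) := [7, 6, 5, 4, 3, 2, 8, 1, 9, 0]

theorem add_bb_le_rr (z : Fin 9 → ℂ) {m w : ℕ} (hw : 9 ≤ w)
    (hfull : ∀ y : ℕ, w - 7 ≤ y → y ≤ w - 2 → FullAt z [8, 1, 9, 0] m y) :
    NN (m + 2) w + (bb z [1, 9, 0] m (w - 8 : ℕ) + bb z [9, 0] m (w - 1 : ℕ) + bb z [0] m (w - 9 : ℕ) +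
      bb z [] m w) ≤ rr z (m + 2) w + (NN (m + 1) (w - 8 : ℕ) + NN (m + 1) (w - 1 : ℕ) +
        NN (m + 1) (w - 9 : ℕ) + NN (m + 1) w) := by
  have hb := le_rr_of_bsum z m w (L := bOrder) (by decide)
  have hF (L : List (Fin 10)) (i : ℕ) (hi : 2 ≤ i) (hi' : i ≤ 7)
      (hL : ∀ i ∈ ([8, 1, 9, 0] : List (Fin 10)), i ∈ L) :
      NN (m + 1) (w - i : ℕ) ≤ bb z L m (w - i : ℕ) :=
    ((hfull (w - i) (by omega) (by omega)).mono hL).bb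
  have f7 := hF [6, 5, 4, 3, 2, 8, 1, 9, 0] 7 (by decide) (by decide) (by decide)
  have f6 := hF [5, 4, 3, 2, 8, 1, 9, 0] 6 (by decide) (by decide) (by decide)
  have f5 := hF [4, 3, 2, 8, 1, 9, 0] 5 (by decide) (by decide) (by decide)
  have f4 := hF [3, 2, 8, 1, 9, 0] 4 (by decide) (by decide) (by decide)
  have f3 := hF [2, 8, 1, 9, 0] 3 (by decide) (by decide) (by decide)
  have f2 := hF [8, 1, 9, 0] 2 (by decide) (by decide) (by decide)
  simp only [bOrder, bsum, List.map_cons, List.map_nil, List.sum_cons, List.sum_nil] at hb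
  have c (i : Fin 10) : (w : ℤ) - (i : ℕ) = ((w - i : ℕ) : ℤ) := (Nat.cast_sub (by omega)).symm
  simp only [c] at hb
  change NN (m + 2) w + (bb z [6, 5, 4, 3, 2, 8, 1, 9, 0] m (w - 7 : ℕ) +
    (bb z [5, 4, 3, 2, 8, 1, 9, 0] m (w - 6 : ℕ) + (bb z [4, 3, 2, 8, 1, 9, 0] m (w - 5 : ℕ) +
    (bb z [3, 2, 8, 1, 9, 0] m (w - 4 : ℕ) + (bb z [2, 8, 1, 9, 0] m (w - 3 : ℕ) +
    (bb z [8, 1, 9, 0] m (w - 2 : ℕ) + (bb z [1, 9, 0] m (w - 8 : ℕ) + (bb z [9, 0] m (w - 1 : ℕ) +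
    (bb z [0] m (w - 9 : ℕ) + (bb z [] m w + 0)))))))))) ≤ rr z (m + 2) w + (NN (m + 1) (w - 7 : ℕ) +
    (NN (m + 1) (w - 6 : ℕ) + (NN (m + 1) (w - 5 : ℕ) + (NN (m + 1) (w - 4 : ℕ) +
    (NN (m + 1) (w - 3 : ℕ) + (NN (m + 1) (w - 2 : ℕ) + (NN (m + 1) (w - 8 : ℕ) +
    (NN (m + 1) (w - 1 : ℕ) + (NN (m + 1) (w - 9 : ℕ) + (NN (m + 1) w + 0)))))))))) at hb
  omega

theorem Ranks.gen_nine (h : Ranks z) : gg z 9 (40 : ℕ) ≤ 2 := by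
  have hb := add_bb_le_rr z (m := 7) (w := 40) (by norm_num)
    fun y h1 h2 => h.fullAt_seven y (by omega) (by omega)
  have f8 := add_hh_le_bb (L := [1, 9, 0]) (m := 7) (w := 32) h.rank_8_32 rfl rfl rfl
  have f1 := add_hh_le_bb (L := [9, 0]) (m := 7) (w := 39) h.rank_8_39 rfl rfl rfl
  have f9 := bb_zero z 7 (31 : ℕ)
  have f0 := hh_le_bb z [] 7 (40 : ℕ)
  have hg := gg_add_rr z 9 (40 : ℕ)
  have e {m : ℕ} (hm : m ≤ 10) (w : ℕ) := h.midBounds.hh_eq hm w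
  rw [e (by norm_num)] at f8 f1 f0 hg
  rw [e (by norm_num), e (by norm_num), NN_eq (by norm_num)] at f9
  iterate 5 rw [NN_eq (by norm_num)] at hb
  have key : cnt 9 40 + (529 + hTab 8 32 + (462 + hTab 8 39) + (hTab 8 31 + cnt 7 31 - hTab 7 31) +
      hTab 8 40) + 2 = hTab 9 40 + (cnt 8 32 + cnt 8 39 + cnt 8 31 + cnt 8 40) := by
    decide +kernel
  simp only [Nat.reduceAdd, Nat.reduceSub] at hb f8 f1 f9 f0
  omega

theorem Ranks.gen_ten (h : Ranks z) : gg z 10 (45 : ℕ) ≤ 1 := by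
  have hb := add_bb_le_rr z (m := 8) (w := 45) (by norm_num)
    fun y h1 h2 => h.fullAt_eight y (by omega) (by omega)
  have f8 := add_hh_le_bb_boundary (L := [1, 9, 0]) (m := 8) (w := 37) h.rank_9_37 rfl rfl (by decide +kernel)
    (by decide)
  have f1 := add_hh_le_bb_boundary (L := [9, 0]) (m := 8) (w := 44) h.rank_9_44 rfl rfl (by decide +kernel)
    (by decide)
  have f9 := bb_zero z 8 (36 : ℕ)
  have f0 := hh_le_bb z [] 8 (45 : ℕ)
  have hg := gg_add_rr z 10 (45 : ℕ)
  have e {m : ℕ} (hm : m ≤ 10) (w : ℕ) := h.midBounds.hh_eq hm w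
  rw [e (by norm_num)] at f0 hg
  rw [e (by norm_num), e (by norm_num), NN_eq (by norm_num)] at f8 f1 f9
  iterate 5 rw [NN_eq (by norm_num)] at hb
  have key : cnt 10 45 + ((200 + (hTab 9 37 + cnt 8 37) - hTab 8 37) +
      (190 + (hTab 9 44 + cnt 8 44) - hTab 8 44) + (hTab 9 36 + cnt 8 36 - hTab 8 36) +
      hTab 9 45) + 1 = hTab 10 45 + (cnt 9 37 + cnt 9 44 + cnt 9 36 + cnt 9 45) := by
    decide +kernel
  simp only [Nat.reduceAdd, Nat.reduceSub] at hb f8 f1 f9 f0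
  omega

theorem MidBounds.gen_eight_of (h : MidBounds z) {n : ℕ} {l : List Blk}
    (hr : BlkRk z [(n, arcY)] n l)
    (hl : (l.all fun b => Nat.blt b.idx 10 && (Nat.ble b.idx 36 && bidegOk (5 + 2) (36 - b.idx) b.gs) &&
      b.arcs.all fun a => a.2.isOrb) = true) (hs : slotsFull 7 36 l = true) :
    n + hh z 7 (36 : ℕ) ≤ rr z 8 (36 : ℕ) :=
  le_rr_of_blk_zero (m := 5) hr rfl hl (h.AA_le_slots (by norm_num) hs)

theorem gen_genBounds : Gen GenBounds := by
  refine (gen_ranks.and gen_blkRanks).mono fun z ⟨h, b⟩ => ⟨h.midBounds, ?_, ?_, h.gen_nine, h.gen_ten⟩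
  · have hm := h.midBounds
    intro p hp
    simp only [List.mem_cons, List.not_mem_nil, or_false] at hp
    rcases hp with rfl | rfl | rfl | rfl | rfl
    · exact hm.gen_seven_of b.rank_7_22 (by decide +kernel) (by decide +kernel)
    · exact hm.gen_seven_of b.rank_7_23 (by decide +kernel) (by decide +kernel)
    · exact hm.gen_seven_of b.rank_7_24 (by decide +kernel) (by decide +kernel)
    · exact hm.gen_seven_of b.rank_7_25 (by decide +kernel) (by decide +kernel)
    · exact hm.gen_seven_of b.rank_7_31 (by decide +kernel) (by decide +kernel)
  · exact h.midBounds.gen_eight_of b.rank_8_36 (by decide +kernel) (by decide +kernel)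

end

noncomputable section
set_option maxRecDepth 100000

/-- Facts on the boundary points. -/
structure PointBounds (z : Fin 9 → ℂ) : Prop where
  ne_zero : ∀ i j, i ≠ j → ∀ k : Fin 10, k ≠ 0 → k ≠ 9 → orbHom z (z i) (z j) 1 1 (X k) ≠ 0
  hf_nine : ∀ p ∈ tabF, p.2.1 + hf z 9 p.1 ≤ NN 9 p.1
  hf_seven : 72 + hf z 7 (31 : ℕ) ≤ NN 7 (31 : ℕ)
  hf_eight : 72 + hf z 8 (25 : ℕ) ≤ NN 8 (25 : ℕ)

/-- The product of the coordinates other than the extreme ones. -/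
def midProd : List MonoGroup := [⟨[8, 7, 6, 5, 4, 3, 2, 1], [], 0, 0, 1⟩]

theorem check_midProd : ∀ i : Fin 9, ∀ j : Fin 9, i ≠ j →
    Packed.check midProd [(1, .orbit (i, []) (j, []) (9, [1]) (9, [1]))] 1 = true := by
  decide +kernel

theorem monos_midProd : monos ℤ midProd = [1 * coordVar ℤ 1 * coordVar ℤ 2 * coordVar ℤ 3 * coordVar ℤ 4 *
    coordVar ℤ 5 * coordVar ℤ 6 * coordVar ℤ 7 * coordVar ℤ 8] := rfl

theorem orbHom_X_ne_zero {z : Fin 9 → ℂ} {i j : Fin 9}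
    (h : Rk z midProd [(1, .orbit (i, []) (j, []) (9, [1]) (9, [1]))] 1) {k : Fin 10} (h0 : k ≠ 0) (h9 : k ≠ 9) :
    orbHom z (z i) (z j) 1 1 (X k) ≠ 0 := by
  intro hk
  set P := 1 * coordVar ℤ 1 * coordVar ℤ 2 * coordVar ℤ 3 * coordVar ℤ 4 *
    coordVar ℤ 5 * coordVar ℤ 6 * coordVar ℤ 7 * coordVar ℤ 8 with hP
  have hz : arcHom z (.orbit (i, []) (j, []) (9, [1]) (9, [1])) (toC P) = 0 := by
    change orbHom z (coPoly z (i, [])) (coPoly z (j, [])) (coPoly z (9, [1])) (coPoly z (9, [1])) (toC P) = 0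
    have := orbHom_comp (Algebra.ofId ℂ (Polynomial ℂ)) z (z i) (z j) 1 1 (toC P)
    rw [map_one] at this
    rw [coPoly_one, coPoly_nil z i.2, coPoly_nil z j.2]
    refine this.symm.trans ?_
    have : orbHom z (z i) (z j) 1 1 (toC P) = 0 := by
      simp only [hP, map_mul, coordVar, map_X]
      fin_cases k
      · exact absurd rfl h0
      iterate 8
        · simp only [Fin.reduceFinMk, show (Fin.ofNat 10 1 : Fin 10) = 1 from rfl, Fin.ofNat_eq_cast,
            Nat.cast_ofNat] at hk ⊢
          simp [hk]
      · exact absurd rfl h9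
    rw [this, map_zero]
  have := finrank_vanish_le h (U := Submodule.span ℂ {toC P}) (V := Submodule.span ℂ {toC P})
    (fun Q hQ => ?_) le_rfl fun f hf a ha => ?_
  · omega
  · rw [monos_midProd, List.mem_singleton] at hQ
    rw [hQ]
    exact Submodule.mem_span_singleton_self _
  · rw [List.mem_singleton] at ha
    obtain ⟨c, rfl⟩ := Submodule.mem_span_singleton.1 hf
    rw [ha, map_smul, hz, smul_zero]

theorem gen_pointBounds : Gen PointBounds := by
  have h1 := Gen.forall_mem ((List.finRange 9 ×ˢ List.finRange 9).filter fun p => p.1 ≠ p.2) fun p hp =>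
    gen_of_check (check_midProd p.1 p.2 (by simpa using (List.mem_filter.1 hp).2))
  have h2 := Gen.forall_mem tabF fun p hp => gen_of_check (check_tabF p hp)
  refine (h1.and (h2.and ((gen_of_check check_7_31).and (gen_of_check check_8_25)))).mono fun z h => ?_
  obtain ⟨h1, h2, h3, h4⟩ := h
  have e : ∀ p ∈ tabF, bidegOk 9 p.1 p.2.2 = true ∧ ((arcsF p.2.1).all fun a => a.2.isF) = true := by
    decide +kernel
  exact ⟨fun i j hij k h0 h9 => orbHom_X_ne_zero (h1 (i, j) (by simpa using hij)) h0 h9,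
    fun p hp => add_hf_le (h2 p hp) (e p hp).1 (e p hp).2, add_hf_le h3 rfl (by decide +kernel),
    add_hf_le h4 rfl (by decide +kernel)⟩

variable {z : Fin 9 → ℂ}

theorem X_nine_mem_fidl (z : Fin 9 → ℂ) : X 9 ∈ fidl z := by
  refine mem_fidl.2 fun i j hij => ?_
  rw [orbHom_X]
  fin_cases j <;> simp [orb, prodCoeff, zext, wt]

theorem didl_le_fidl (z : Fin 9 → ℂ) : didl z ≤ fidl z := by
  intro f hf
  refine mem_fidl.2 fun i j _ => ?_
  have := orbHom_comp (Polynomial.aeval (R := ℂ) (z j)) z (Polynomial.C (z i)) Polynomial.X 1 1 f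
  rw [mem_didl.1 hf, map_zero, Polynomial.aeval_C, Polynomial.aeval_X, map_one] at this
  exact this.symm

theorem mem_didl_of_X_mul {f : MvPolynomial (Fin 10) ℂ} (h : X 9 * f ∈ didl z) : f ∈ didl z := by
  refine mem_didl.2 fun i => ?_
  have := mem_didl.1 h i
  rw [map_mul] at this
  refine (mul_eq_zero.1 this).resolve_left fun h => ?_
  rw [orbHom_X] at h
  simp [orb, prodCoeff, wt, Polynomial.algebraMap_eq, Polynomial.X_sub_C_ne_zero] at h

theorem PointBounds.mem_fidl_of_X_mul (h : PointBounds z) {k : Fin 10} (h0 : k ≠ 0) (h9 : k ≠ 9)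
    {f : MvPolynomial (Fin 10) ℂ} (hf : X k * f ∈ fidl z) : f ∈ fidl z := by
  refine mem_fidl.2 fun i j hij => ?_
  have := mem_fidl.1 hf i j hij
  rw [map_mul] at this
  exact (mul_eq_zero.1 this).resolve_left (h.ne_zero i j hij k h0 h9)

end

noncomputable section
set_option maxRecDepth 100000

variable {z : Fin 9 → ℂ}

/-- Ranks of the coordinate ring of the orbit. -/
def aTab (m : ℕ) (w : ℤ) : ℕ := if w < 0 then 0 else cnt m w.toNat - hTab m w.toNat

theorem NN_of_neg (m : ℕ) {w : ℤ} (hw : w < 0) : NN m w = 0 := by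
  rw [NN, finrank_Rp, if_pos hw]

theorem MidBounds.AA_eq (h : MidBounds z) {m : ℕ} (hm : m ≤ 10) (w : ℤ) : AA z m w = aTab m w := by
  have h1 := AA_add_hh z m w
  unfold aTab
  split_ifs with hw
  · rw [NN_of_neg m hw] at h1
    omega
  · obtain ⟨n, rfl⟩ := Int.eq_ofNat_of_zero_le (not_lt.1 hw)
    rw [NN_eq hm, h.hh_eq hm] at h1
    rw [Int.toNat_natCast]
    omega

theorem hd_le (z : Fin 9 → ℂ) (m : ℕ) (w : ℤ) : hd z m w ≤ NN m w := Submodule.finrank_mono inf_le_right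

theorem hf_le (z : Fin 9 → ℂ) (m : ℕ) (w : ℤ) : hf z m w ≤ NN m w := Submodule.finrank_mono inf_le_right

theorem PointBounds.sup_mulX (h : PointBounds z) (m : ℕ) (w : ℤ) {i : Fin 10} (h0 : i ≠ 0) (h9 : i ≠ 9) :
    hf z (m + 1) w + NN m (w - (i : ℕ)) ≤
      Module.finrank ℂ (pc (fidl z) (m + 1) w ⊔ (Rp m (w - (i : ℕ))).map (mulX i) :
        Submodule ℂ (MvPolynomial (Fin 10) ℂ)) + hf z m (w - (i : ℕ)) :=
  finrank_sup_mulX (fun _ => h.mem_fidl_of_X_mul h0 h9) m w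

theorem pc_sup_map_le (J : Ideal (MvPolynomial (Fin 10) ℂ)) (m : ℕ) (w : ℤ) (i : Fin 10) :
    pc J (m + 1) w ⊔ (Rp m (w - (i : ℕ))).map (mulX i) ≤ Rp (m + 1) w :=
  sup_le inf_le_right (map_mulX_Rp_le m w i)

theorem PointBounds.hf_succ (h : PointBounds z) (m : ℕ) (w : ℤ) {i : Fin 10} (h0 : i ≠ 0) (h9 : i ≠ 9) :
    hf z (m + 1) w + NN m (w - (i : ℕ)) ≤ NN (m + 1) w + hf z m (w - (i : ℕ)) :=
  (h.sup_mulX m w h0 h9).trans (Nat.add_le_add_right (Submodule.finrank_mono (pc_sup_map_le _ m w i)) _)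

theorem PointBounds.add_hf_succ (h : PointBounds z) {m v w n : ℕ} (h1 : n + hf z m v ≤ NN m v)
    (hv : v < w) (hw : w ≤ v + 8) : n + hf z (m + 1) w ≤ NN (m + 1) w := by
  have := h.hf_succ m w (i := ⟨w - v, by omega⟩) (fun h => by have := Fin.ext_iff.1 h; change w - v = 0 at this; omega)
    (fun h => by have := Fin.ext_iff.1 h; change w - v = 9 at this; omega)
  have e : (w : ℤ) - ((⟨w - v, by omega⟩ : Fin 10) : ℕ) = v := by
    change (w : ℤ) - ((w - v : ℕ) : ℤ) = v
    omega
  rw [e] at this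
  omega

theorem PointBounds.hf_nine_full (h : PointBounds z) {x : ℕ} (h1 : 26 ≤ x) (h2 : x ≤ 47) :
    72 + hf z 9 x ≤ NN 9 x := by
  rcases le_or_gt x 33 with h3 | h3
  · exact h.add_hf_succ h.hf_eight (by omega) (by omega)
  · exact h.add_hf_succ (v := max 32 (x - 8)) (h.add_hf_succ h.hf_seven (by omega) (by omega))
      (by omega) (by omega)

/-- The dimensions of the coordinate rings of the orbit, of the boundary curves and of the boundary points
are compatible. -/
structure BaseBounds (z : Fin 9 → ℂ) : Prop extends PointBounds z where
  curve : ∀ x : ℤ, x ≤ 41 → AA z 9 x + hd z 9 x ≤ AA z 8 x + NN 9 x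
  point_ten : ∀ w : ℤ, w ≤ 50 →
    AA z 10 w + AA z 8 (w - 9) + hf z 10 w ≤ AA z 9 w + AA z 9 (w - 9) + NN 10 w
  point_nine : ∀ w : ℤ, w ≤ 40 →
    AA z 10 w + AA z 8 (w - 9) + hf z 9 (w - 1) ≤ AA z 9 w + AA z 9 (w - 9) + NN 9 (w - 1)
  point_le : ∀ w : ℤ, w ≤ 50 → AA z 10 w + AA z 8 (w - 9) ≤ AA z 9 w + AA z 9 (w - 9) + 72

theorem Ranks.baseBounds (h : Ranks z) (hp : PointBounds z) : BaseBounds z := by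
  have hA {m : ℕ} (hm : m ≤ 10) (w : ℤ) := h.midBounds.AA_eq hm w
  have hle : ∀ n < 51, aTab 10 (n : ℕ) + aTab 8 ((n : ℕ) - 9) ≤ aTab 9 (n : ℕ) + aTab 9 ((n : ℕ) - 9) + 72 := by
    decide +kernel
  have hneg {m : ℕ} {w : ℤ} (hw : w < 0) : aTab m w = 0 := if_pos hw
  have h9 : ∀ n : ℕ, n ≤ 48 → aTab 10 n + aTab 8 ((n : ℕ) - 9) + hf z 9 ((n : ℕ) - 1) ≤
      aTab 9 (n : ℕ) + aTab 9 ((n : ℕ) - 9) + NN 9 ((n : ℕ) - 1) := by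
    intro n hn
    rcases le_or_gt n 26 with h26 | h26
    · have e : ∀ n ≤ 26, aTab 10 (n : ℕ) + aTab 8 ((n : ℕ) - 9) ≤ aTab 9 (n : ℕ) + aTab 9 ((n : ℕ) - 9) ∨
          1 ≤ n ∧ ∃ p ∈ tabF, p.1 = n - 1 ∧
            aTab 10 (n : ℕ) + aTab 8 ((n : ℕ) - 9) ≤ aTab 9 (n : ℕ) + aTab 9 ((n : ℕ) - 9) + p.2.1 := by
        decide +kernel
      rcases e n h26 with e | ⟨e1, p, hp', e2, e3⟩
      · have := hf_le z 9 (n - 1)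
        omega
      · have := hp.hf_nine p hp'
        rw [e2, Nat.cast_sub e1] at this
        push_cast at this
        omega
    · have h1 := hp.hf_nine_full (x := n - 1) (by omega) (by omega)
      rw [Nat.cast_sub (by omega)] at h1
      push_cast at h1
      have := hle n (by omega)
      omega
  refine ⟨hp, fun x hx => ?_, fun w hw => ?_, fun w hw => ?_, fun w hw => ?_⟩
  · rw [hA (by norm_num), hA (by norm_num)]
    rcases lt_or_ge x 0 with h0 | h0
    · rw [hneg h0, hneg h0]
      have := hd_le z 9 x
      omega
    · obtain ⟨n, rfl⟩ := Int.eq_ofNat_of_zero_le h0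
      have e : ∀ n ≤ 41, aTab 9 (n : ℕ) ≤ aTab 8 (n : ℕ) ∨ ∃ p ∈ tabD, p.1 = n ∧
          aTab 9 (n : ℕ) ≤ aTab 8 (n : ℕ) + p.2.1 := by
        decide +kernel
      rcases e n (by omega) with e | ⟨p, hp', e2, e3⟩
      · have := hd_le z 9 n
        omega
      · have := h.add_hd_le p hp'
        rw [e2] at this
        omega
  · rw [hA (by norm_num), hA (by norm_num), hA (by norm_num), hA (by norm_num)]
    rcases lt_or_ge w 0 with h0 | h0
    · rw [hneg h0, hneg (by omega)]
      have := hf_le z 10 w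
      omega
    · obtain ⟨n, rfl⟩ := Int.eq_ofNat_of_zero_le h0
      rcases le_or_gt n 48 with h48 | h48
      · have h1 := h9 n h48
        have h2 := hp.hf_succ 9 n (i := 1) (by decide) (by decide)
        rw [show (((1 : Fin 10) : ℕ) : ℤ) = 1 from rfl] at h2
        simp only [Nat.reduceAdd] at h2
        omega
      · have h1 := hp.add_hf_succ (v := n - 3) (w := n) (hp.hf_nine_full (x := n - 3) (by omega) (by omega))
          (by omega) (by omega)
        have := hle n (by omega)
        simp only [Nat.reduceAdd] at h1
        omega
  · rw [hA (by norm_num), hA (by norm_num), hA (by norm_num), hA (by norm_num)]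
    rcases lt_or_ge w 0 with h0 | h0
    · rw [hneg h0, hneg (by omega)]
      have := hf_le z 9 (w - 1)
      omega
    · obtain ⟨n, rfl⟩ := Int.eq_ofNat_of_zero_le h0
      exact h9 n (by omega)
  · rw [hA (by norm_num), hA (by norm_num), hA (by norm_num), hA (by norm_num)]
    rcases lt_or_ge w 0 with h0 | h0
    · rw [hneg h0, hneg (by omega)]
      omega
    · obtain ⟨n, rfl⟩ := Int.eq_ofNat_of_zero_le h0
      exact hle n (by omega)

end

noncomputable section
set_option maxRecDepth 100000

/-- A monomial contains a variable of weight at least the average. -/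
theorem exists_average_le {d : Fin 10 →₀ ℕ} {m : ℕ} {w : ℤ} (h : Finsupp.weight bw d = (m + 1, w)) :
    ∃ i, d i ≠ 0 ∧ w ≤ (i : ℕ) * (m + 1) := by
  rw [weight_bw] at h
  obtain ⟨h1, h2⟩ := Prod.mk.inj h
  by_contra! hi
  have h3 : ∀ i ∈ Finset.univ, (d i : ℤ) * ((i : ℕ) * (m + 1) + 1) ≤ d i * w := fun i _ => by
    rcases eq_or_ne (d i) 0 with h0 | h0
    · simp [h0]
    · exact mul_le_mul_of_nonneg_left (hi i h0) (by positivity)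
  have h4 := Finset.sum_le_sum h3
  have h5 : ∑ i, (d i : ℤ) * ((i : ℕ) * (m + 1) + 1) = (∑ i, (d i : ℤ) * (i : ℕ)) * (m + 1) + ∑ i, (d i : ℤ) := by
    rw [Finset.sum_mul, ← Finset.sum_add_distrib]
    exact Finset.sum_congr rfl fun i _ => by ring
  rw [h5, ← Finset.sum_mul, h2, ← Nat.cast_sum, h1, Nat.cast_add, Nat.cast_one] at h4
  linarith

/-- A monomial contains a variable of weight at most the average. -/
theorem exists_le_average {d : Fin 10 →₀ ℕ} {m : ℕ} {w : ℤ} (h : Finsupp.weight bw d = (m + 1, w)) :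
    ∃ i, d i ≠ 0 ∧ (i : ℕ) * (m + 1) ≤ w := by
  rw [weight_bw] at h
  obtain ⟨h1, h2⟩ := Prod.mk.inj h
  by_contra! hi
  have h3 : ∀ i ∈ Finset.univ, (d i : ℤ) * (w + 1) ≤ d i * ((i : ℕ) * (m + 1)) := fun i _ => by
    rcases eq_or_ne (d i) 0 with h0 | h0
    · simp [h0]
    · exact mul_le_mul_of_nonneg_left (hi i h0) (by positivity)
  have h4 := Finset.sum_le_sum h3
  have h5 : ∑ i, (d i : ℤ) * ((i : ℕ) * (m + 1)) = (∑ i, (d i : ℤ) * (i : ℕ)) * (m + 1) := by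
    rw [Finset.sum_mul]
    exact Finset.sum_congr rfl fun i _ => by ring
  rw [h5, ← Finset.sum_mul, h2, ← Nat.cast_sum, h1, Nat.cast_add, Nat.cast_one] at h4
  linarith

theorem map_mulX_le_sup {U A S : Submodule ℂ (MvPolynomial (Fin 10) ℂ)} {m : ℕ} {w : ℤ} {i k : Fin 10}
    (h : U ≤ A ⊔ (Rp m (w - (i : ℕ) - (k : ℕ))).map (mulX k)) (hA : A.map (mulX i) ≤ S) :
    U.map (mulX i) ≤ S ⊔ (Rp (m + 1) (w - (k : ℕ))).map (mulX k) := by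
  refine (Submodule.map_mono h).trans ?_
  rw [Submodule.map_sup]
  refine sup_le_sup hA ?_
  rintro _ ⟨_, ⟨f, hf, rfl⟩, rfl⟩
  rw [sub_right_comm] at hf
  exact ⟨X i * f, map_mulX_Rp_le _ _ _ ⟨f, hf, rfl⟩, mul_left_comm _ _ _⟩

/-- Transfer of a spanning property to the next degree. -/
theorem Rp_le_sup {J : Ideal (MvPolynomial (Fin 10) ℂ)} {S : Submodule ℂ (MvPolynomial (Fin 10) ℂ)} {m : ℕ}
    {w : ℤ} {k : Fin 10}
    (h : ∀ d, Finsupp.weight bw d = (m + 2, w) → ∃ i : Fin 10, d i ≠ 0 ∧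
      Rp (m + 1) (w - (i : ℕ)) ≤
        pc J (m + 1) (w - (i : ℕ)) ⊔ (Rp m (w - (i : ℕ) - (k : ℕ))).map (mulX k) ∧
      (pc J (m + 1) (w - (i : ℕ))).map (mulX i) ≤ S) :
    Rp (m + 2) w ≤ S ⊔ (Rp (m + 1) (w - (k : ℕ))).map (mulX k) := by
  refine Rp_le fun d hd => ?_
  obtain ⟨i, hi, h1, h2⟩ := h d hd
  obtain ⟨h3, h4⟩ := weight_sub_single hd hi
  exact map_mulX_le_sup h1 h2 ⟨_, monomial_mem_Rp h4 1, (monomial_eq_X_mul h3).symm⟩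

theorem le_sup_pc {J : Ideal (MvPolynomial (Fin 10) ℂ)} {k : Fin 10} (hJ : ∀ f, X k * f ∈ J → f ∈ J)
    {W S : Submodule ℂ (MvPolynomial (Fin 10) ℂ)} {m : ℕ} {v : ℤ} (hW : W ≤ J.restrictScalars ℂ)
    (hS : S ≤ J.restrictScalars ℂ) (h : W ≤ S ⊔ (Rp m v).map (mulX k)) : W ≤ S ⊔ (pc J m v).map (mulX k) := by
  intro f hf
  obtain ⟨s, hs, _, ⟨g, hg, rfl⟩, rfl⟩ := Submodule.mem_sup.1 (h hf)
  exact Submodule.add_mem_sup hs ⟨g, ⟨hJ g ((Submodule.add_mem_iff_right _ (hS hs)).1 (hW hf)), hg⟩, rfl⟩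

/-- The multiples of the pieces of an ideal in low weights. -/
def lowMul (J : Ideal (MvPolynomial (Fin 10) ℂ)) (m : ℕ) (w : ℤ) : Submodule ℂ (MvPolynomial (Fin 10) ℂ) :=
  ⨆ i : Fin 10, ⨆ _ : w - (i : ℕ) ≤ 5 * m, (pc J m (w - (i : ℕ))).map (mulX i)

theorem le_lowMul (J : Ideal (MvPolynomial (Fin 10) ℂ)) {m : ℕ} {w : ℤ} {i : Fin 10} (h : w - (i : ℕ) ≤ 5 * m) :
    (pc J m (w - (i : ℕ))).map (mulX i) ≤ lowMul J m w := le_iSup₂_of_le i h le_rfl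

theorem map_mulX_pc_le_pc (J : Ideal (MvPolynomial (Fin 10) ℂ)) (m : ℕ) (w : ℤ) (i : Fin 10) :
    (pc J m (w - (i : ℕ))).map (mulX i) ≤ pc J (m + 1) w :=
  (map_mulX_pc_le J m w i).trans fun _ h => ⟨irr_le J h.1, h.2⟩

theorem lowMul_le (J : Ideal (MvPolynomial (Fin 10) ℂ)) (m : ℕ) (w : ℤ) : lowMul J m w ≤ pc J (m + 1) w :=
  iSup₂_le fun i _ => map_mulX_pc_le_pc J m w i

/-- The relations between the ideals of the orbit and of its boundary in degree `m + 1`. -/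
structure Generated (z : Fin 9 → ℂ) (m : ℕ) : Prop where
  curve : ∀ w : ℤ, w ≤ 5 * (m + 1) →
    pc (didl z) (m + 1) w ≤ pc (idl z) (m + 1) w ⊔ (Rp m (w - ((0 : Fin 10) : ℕ))).map (mulX 0)
  point : ∀ w : ℤ, w ≤ 5 * (m + 1) →
    pc (fidl z) (m + 1) w ≤ pc (didl z) (m + 1) w ⊔ (Rp m (w - ((9 : Fin 10) : ℕ))).map (mulX 9)
  one : ∀ w : ℤ, w ≤ 4 * (m + 1) →
    Rp (m + 1) w ≤ pc (fidl z) (m + 1) w ⊔ (Rp m (w - ((1 : Fin 10) : ℕ))).map (mulX 1)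
  eight : ∀ w : ℤ, 4 * m ≤ w → w ≤ 5 * (m + 1) →
    Rp (m + 1) w ≤ pc (fidl z) (m + 1) w ⊔ (Rp m (w - ((8 : Fin 10) : ℕ))).map (mulX 8)

variable {z : Fin 9 → ℂ}

theorem didl_sup_le (z : Fin 9 → ℂ) (m : ℕ) (w : ℤ) :
    pc (didl z) (m + 1) w ⊔ (Rp m (w - ((9 : Fin 10) : ℕ))).map (mulX 9) ≤ pc (fidl z) (m + 1) w := by
  refine sup_le (inf_le_inf_right _ fun f hf => didl_le_fidl z hf) ?_
  rintro _ ⟨g, hg, rfl⟩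
  exact ⟨Ideal.mul_mem_right _ _ (X_nine_mem_fidl z), map_mulX_Rp_le _ _ _ ⟨g, hg, rfl⟩⟩

theorem BaseBounds.generated (h : BaseBounds z) : Generated z 9 := by
  have key1 (w : ℤ) : hd z 10 w + NN 9 (w - 9) ≤
      Module.finrank ℂ (pc (didl z) 10 w ⊔ (Rp 9 (w - 9)).map (mulX 9) :
        Submodule ℂ (MvPolynomial (Fin 10) ℂ)) + hd z 9 (w - 9) :=
    finrank_sup_mulX (J := didl z) (i := 9) (fun f => mem_didl_of_X_mul) 9 w
  have key2 (w : ℤ) : Module.finrank ℂ (pc (didl z) 10 w ⊔ (Rp 9 (w - 9)).map (mulX 9) :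
      Submodule ℂ (MvPolynomial (Fin 10) ℂ)) ≤ hf z 10 w := Submodule.finrank_mono (didl_sup_le z 9 w)
  have key3 (w : ℤ) := hh_add_AA_le_hd z 9 w
  have key4 (w : ℤ) := AA_add_hh z 10 w
  refine ⟨fun w hw => ?_, fun w hw => ?_, fun w hw => ?_, fun w hw hw' => ?_⟩ <;> push_cast at hw
  · refine (Submodule.eq_of_le_of_finrank_le (pc_sup_X_zero_le z 9 w) ?_).ge
    have h1 : hh z 10 w + NN 9 (w - ((0 : Fin 10) : ℕ)) ≤
        Module.finrank ℂ (pc (idl z) 10 w ⊔ (Rp 9 (w - ((0 : Fin 10) : ℕ))).map (mulX 0) :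
          Submodule ℂ (MvPolynomial (Fin 10) ℂ)) + hh z 9 (w - ((0 : Fin 10) : ℕ)) :=
      finrank_sup_mulX (J := idl z) (i := 0) (fun f => mem_idl_of_X_mul) 9 w
    have h2 := AA_add_hh z 9 (w - ((0 : Fin 10) : ℕ))
    have h3 := h.point_ten w (by omega)
    have h4 := h.curve (w - 9) (by omega)
    have h5 := key1 w
    have h6 := key2 w
    have h7 := key4 w
    change hd z 10 w ≤ _
    have e : w - ((0 : Fin 10) : ℕ) = w := sub_zero w
    rw [e] at h1 h2 ⊢
    simp only [Nat.reduceAdd] at *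
    omega
  · refine (Submodule.eq_of_le_of_finrank_le (didl_sup_le z 9 w) ?_).ge
    have h3 := h.point_ten w (by omega)
    have h4 := h.curve (w - 9) (by omega)
    have h5 := key1 w
    have h6 := key3 w
    have h7 := key4 w
    change hf z 10 w ≤ Module.finrank ℂ (pc (didl z) 10 w ⊔ (Rp 9 (w - 9)).map (mulX 9) :
      Submodule ℂ (MvPolynomial (Fin 10) ℂ))
    simp only [Nat.reduceAdd] at *
    omega
  · refine (Submodule.eq_of_le_of_finrank_le (pc_sup_map_le (fidl z) 9 w 1) ?_).ge
    have h1 := h.sup_mulX 9 w (i := 1) (by decide) (by decide)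
    have h2 := h.point_nine w (by omega)
    have h4 := h.curve (w - 9) (by omega)
    have h5 := key1 w
    have h6 := key2 w
    have h7 := key4 w
    have h8 := key3 w
    change NN 10 w ≤ _
    simp only [Nat.reduceAdd, show (((1 : Fin 10) : ℕ) : ℤ) = 1 from rfl] at *
    omega
  · refine (Submodule.eq_of_le_of_finrank_le (pc_sup_map_le (fidl z) 9 w 8) ?_).ge
    have h1 := h.sup_mulX 9 w (i := 8) (by decide) (by decide)
    have h2 := h.point_le w (by omega)
    have h3 := h.hf_nine_full (x := (w - 8).toNat) (by omega) (by omega)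
    have h4 := h.curve (w - 9) (by omega)
    have h5 := key1 w
    have h6 := key2 w
    have h7 := key4 w
    have h8 := key3 w
    rw [Int.toNat_of_nonneg (by omega)] at h3
    change NN 10 w ≤ _
    simp only [Nat.reduceAdd, show (((8 : Fin 10) : ℕ) : ℤ) = 8 from rfl] at *
    omega

variable {m : ℕ}

/-- The ideal of the boundary points is generated in lower degrees. -/
theorem Generated.fidl_le (h : Generated z m) (hp : PointBounds z) (hm : 3 ≤ m) {w : ℤ} (hw : w ≤ 5 * (m + 2)) :
    pc (fidl z) (m + 2) w ≤ lowMul (fidl z) (m + 1) w := by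
  have hl : lowMul (fidl z) (m + 1) w ≤ (fidl z).restrictScalars ℂ := (lowMul_le _ _ _).trans inf_le_left
  rcases le_or_gt w (4 * (m + 2)) with h4 | h4
  · have h1 : Rp (m + 2) w ≤ lowMul (fidl z) (m + 1) w ⊔ (Rp (m + 1) (w - ((1 : Fin 10) : ℕ))).map (mulX 1) := by
      refine Rp_le_sup (J := fidl z) fun d hd => ?_
      obtain ⟨i, hi, hi'⟩ := exists_average_le hd
      have hi : w - (i : ℕ) ≤ 4 * (m + 1) := by
        clear hi; fin_cases i <;> simp at hi' ⊢ <;> omega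
      exact ⟨i, by assumption, h.one _ hi, le_lowMul _ (by push_cast; omega)⟩
    refine (le_sup_pc (fun _ => hp.mem_fidl_of_X_mul (by decide) (by decide)) inf_le_left hl
      (inf_le_right.trans h1)).trans (sup_le le_rfl (le_lowMul _ ?_))
    simp; omega
  · have h1 : Rp (m + 2) w ≤ lowMul (fidl z) (m + 1) w ⊔ (Rp (m + 1) (w - ((8 : Fin 10) : ℕ))).map (mulX 8) := by
      refine Rp_le_sup (J := fidl z) fun d hd => ?_
      obtain ⟨i, hi, hi'⟩ := exists_average_le hd
      have hi : 4 * m ≤ w - (i : ℕ) ∧ w - (i : ℕ) ≤ 5 * (m + 1) := by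
        clear hi; fin_cases i <;> simp at hi' ⊢ <;> omega
      exact ⟨i, by assumption, h.eight _ hi.1 hi.2, le_lowMul _ (by push_cast; omega)⟩
    refine (le_sup_pc (fun _ => hp.mem_fidl_of_X_mul (by decide) (by decide)) inf_le_left hl
      (inf_le_right.trans h1)).trans (sup_le le_rfl (le_lowMul _ ?_))
    simp; omega

/-- The ideal of the boundary curves is generated in lower degrees. -/
theorem Generated.didl_le (h : Generated z m) (hp : PointBounds z) (hm : 3 ≤ m) {w : ℤ} (hw : w ≤ 5 * (m + 2)) :
    pc (didl z) (m + 2) w ≤ lowMul (didl z) (m + 1) w := by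
  have h1 : pc (didl z) (m + 2) w ≤
      lowMul (didl z) (m + 1) w ⊔ (Rp (m + 1) (w - ((9 : Fin 10) : ℕ))).map (mulX 9) :=
    (inf_le_inf_right _ fun f hf => didl_le_fidl z hf).trans ((h.fidl_le hp hm hw).trans
      (iSup₂_le fun i hi => map_mulX_le_sup (h.point _ (by push_cast at hi; omega)) (le_lowMul _ hi)))
  refine (le_sup_pc (fun _ => mem_didl_of_X_mul) inf_le_left ((lowMul_le _ _ _).trans inf_le_left) h1).trans
    (sup_le le_rfl (le_lowMul _ ?_))
  simp; omega

theorem Generated.didl_le_irr (h : Generated z m) (hp : PointBounds z) (hm : 3 ≤ m) {w : ℤ}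
    (hw : w ≤ 5 * (m + 2)) :
    pc (didl z) (m + 2) w ≤
      pc (irr (idl z)) (m + 2) w ⊔ (Rp (m + 1) (w - ((0 : Fin 10) : ℕ))).map (mulX 0) :=
  (h.didl_le hp hm hw).trans (iSup₂_le fun i hi =>
    map_mulX_le_sup (h.curve _ (by push_cast at hi; omega)) (map_mulX_pc_le _ _ _ _))

theorem Generated.succ (h : Generated z m) (hp : PointBounds z) (hm : 3 ≤ m) : Generated z (m + 1) := by
  refine ⟨fun w hw => ?_, fun w hw => ?_, fun w hw => ?_, fun w hw hw' => ?_⟩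
  · exact (h.didl_le_irr hp hm (by push_cast at hw; omega)).trans
      (sup_le_sup_right (fun _ h => ⟨irr_le _ h.1, h.2⟩ : pc (irr (idl z)) (m + 2) w ≤ pc (idl z) (m + 2) w) _)
  · exact (h.fidl_le hp hm (by push_cast at hw; omega)).trans (iSup₂_le fun i hi =>
      map_mulX_le_sup (h.point _ (by push_cast at hi; omega)) (map_mulX_pc_le_pc _ _ _ _))
  · refine Rp_le_sup (J := fidl z) fun d hd => ?_
    obtain ⟨i, hi, hi'⟩ := exists_average_le hd
    refine ⟨i, hi, h.one _ ?_, map_mulX_pc_le_pc _ _ _ _⟩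
    push_cast at hw
    clear hi; fin_cases i <;> simp at hi' ⊢ <;> omega
  · refine Rp_le_sup (J := fidl z) fun d hd => ?_
    push_cast at hw hw'
    rcases le_or_gt w (5 * (m + 1)) with h5 | h5
    · obtain ⟨i, hi, hi'⟩ := exists_le_average hd
      have hi : 4 * m ≤ w - (i : ℕ) ∧ w - (i : ℕ) ≤ 5 * (m + 1) := by
        clear hi; fin_cases i <;> simp at hi' ⊢ <;> omega
      exact ⟨i, by assumption, h.eight _ hi.1 hi.2, map_mulX_pc_le_pc _ _ _ _⟩
    · obtain ⟨i, hi, hi'⟩ := exists_average_le hd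
      have hi : 4 * m ≤ w - (i : ℕ) ∧ w - (i : ℕ) ≤ 5 * (m + 1) := by
        clear hi; fin_cases i <;> simp at hi' ⊢ <;> omega
      exact ⟨i, by assumption, h.eight _ hi.1 hi.2, map_mulX_pc_le_pc _ _ _ _⟩

theorem BaseBounds.generated_of_le (h : BaseBounds z) : ∀ m, 9 ≤ m → Generated z m :=
  Nat.le_induction h.generated fun _ hm hg => hg.succ h.toPointBounds (by omega)

/-- The ideal of a general orbit is generated in degrees at most 10. -/
theorem BaseBounds.hh_eq_rr (h : BaseBounds z) {m : ℕ} (hm : 11 ≤ m) (w : ℤ) : hh z m w = rr z m w := by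
  obtain ⟨m, rfl⟩ := Nat.exists_eq_add_of_le' (show 2 ≤ m by omega)
  have key {w : ℤ} (hw : w ≤ 5 * (m + 2)) : hh z (m + 2) w ≤ rr z (m + 2) w := by
    refine Submodule.finrank_mono ?_
    have h1 : pc (idl z) (m + 2) w ≤
        pc (irr (idl z)) (m + 2) w ⊔ (Rp (m + 1) (w - ((0 : Fin 10) : ℕ))).map (mulX 0) :=
      (inf_le_inf_right _ fun f hf => idl_le_didl z hf).trans
        ((h.generated_of_le m (by omega)).didl_le_irr h.toPointBounds (by omega) hw)
    exact (le_sup_pc (fun _ => mem_idl_of_X_mul) inf_le_left (inf_le_left.trans (irr_le (idl z))) h1).trans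
      (sup_le le_rfl (map_mulX_pc_le _ _ _ _))
  refine le_antisymm ?_ (rr_le_hh z _ w)
  rcases le_or_gt w (5 * (m + 2)) with hw | hw
  · exact key hw
  · rw [← hh_rev, ← rr_rev]
    exact key (by push_cast; omega)

end

noncomputable section
set_option maxRecDepth 100000

/-- The bigraded pieces of the homogeneous part of an ideal. -/
def pieceEquiv {J : Ideal (MvPolynomial (Fin 10) ℂ)} (hJ : BiHom J) (m : ℕ) :
    idealPiece 9 m J ≃ₗ[ℂ] ∀ w : Fin (9 * m + 1), pc J m ((w : ℕ) : ℤ) where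
  toFun f w := ⟨comp m ((w : ℕ) : ℤ) f, hJ _ f.2.1 _ _, comp_mem _ _ _⟩
  map_add' f g := by
    ext1 w
    exact Subtype.ext (map_add _ _ _)
  map_smul' c f := by
    ext1 w
    exact Subtype.ext (map_smul _ _ _)
  invFun g := ⟨∑ w, (g w : MvPolynomial (Fin 10) ℂ), Submodule.sum_mem _ fun w _ => ⟨(g w).2.1, fun d hd => by
    have := congrArg Prod.fst ((g w).2.2 hd)
    rw [weight_bw] at this
    rw [Finsupp.weight_apply, Finsupp.sum_fintype _ _ (fun _ => by simp)]
    simpa using this⟩⟩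
  left_inv f := by
    refine Subtype.ext ?_
    ext d
    simp only [coeff_sum, coeff_weightedHomogeneousComponent]
    by_cases hd : coeff d (f : MvPolynomial (Fin 10) ℂ) = 0
    · simp [hd]
    · have h1 := f.2.2 hd
      rw [Finsupp.weight_apply, Finsupp.sum_fintype _ _ (fun _ => by simp)] at h1
      simp only [Pi.one_apply, smul_eq_mul, mul_one] at h1
      have h2 : ∑ i, d i * (i : ℕ) ≤ ∑ i, d i * 9 := Finset.sum_le_sum fun i _ =>
        Nat.mul_le_mul_left _ (Nat.le_of_lt_succ i.2)
      rw [← Finset.sum_mul, h1] at h2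
      rw [Finset.sum_eq_single (⟨∑ i, d i * (i : ℕ), by omega⟩ : Fin (9 * m + 1)), if_pos]
      · rw [weight_bw, h1]
        simp
      · intro w _ hw
        rw [if_neg]
        rw [weight_bw]
        intro h
        refine hw (Fin.ext ?_)
        have := (Prod.mk.inj h).2
        simpa using (by exact_mod_cast this.symm : (w : ℕ) = ∑ i, d i * (i : ℕ))
      · simp
  right_inv g := by
    ext1 w
    refine Subtype.ext ?_
    simp only [map_sum]
    rw [Finset.sum_eq_single w, weightedHomogeneousComponent_eq_self (g w).2.2]
    · intro v _ hv
      classical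
      rw [weightedHomogeneousComponent_of_mem (g v).2.2, if_neg fun h => hv (Fin.ext ?_)]
      exact_mod_cast ((Prod.mk.inj h).2).symm
    · simp

theorem finrank_idealPiece {J : Ideal (MvPolynomial (Fin 10) ℂ)} (hJ : BiHom J) (m : ℕ) :
    Module.finrank ℂ (idealPiece 9 m J) =
      ∑ w : Fin (9 * m + 1), Module.finrank ℂ (pc J m ((w : ℕ) : ℤ)) := by
  rw [(pieceEquiv hJ m).finrank_eq, Module.finrank_pi_fintype]

variable {z : Fin 9 → ℂ} {E : Fin 10 → ℂ}

theorem finite_genPiece (h : orbitIdeal 9 E = idl z) (m : ℕ) : Module.Finite ℂ (genPiece 9 m E) := by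
  rw [genPiece, h]
  exact Module.Finite.equiv (pieceEquiv (idl_biHom z) m).symm

theorem betti_eq (h : orbitIdeal 9 E = idl z) (m : ℕ) :
    betti 9 m E = ∑ w : Fin (9 * m + 1), gg z m ((w : ℕ) : ℤ) := by
  have := finite_genPiece h m
  have hle : trivPiece 9 m E ≤ genPiece 9 m E := inf_le_inf_right _ fun f hf => Ideal.mul_le_right hf
  have h1 := (minGenRel 9 m E).finrank_quotient_add_finrank
  rw [minGenRel, (Submodule.comapSubtypeEquivOfLe hle).finrank_eq] at h1
  have h2 : Module.finrank ℂ (genPiece 9 m E) = ∑ w : Fin (9 * m + 1), hh z m ((w : ℕ) : ℤ) := by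
    rw [genPiece, h]
    exact finrank_idealPiece (idl_biHom z) m
  have h3 : Module.finrank ℂ (trivPiece 9 m E) = ∑ w : Fin (9 * m + 1), rr z m ((w : ℕ) : ℤ) := by
    rw [trivPiece, h]
    exact finrank_idealPiece (idl_biHom z).irr m
  have h4 : ∑ w : Fin (9 * m + 1), gg z m ((w : ℕ) : ℤ) + ∑ w : Fin (9 * m + 1), rr z m ((w : ℕ) : ℤ) =
      ∑ w : Fin (9 * m + 1), hh z m ((w : ℕ) : ℤ) := by
    rw [← Finset.sum_add_distrib]
    exact Finset.sum_congr rfl fun w _ => gg_add_rr z m _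
  rw [h2, h3, ← h4] at h1
  exact Nat.add_right_cancel h1

theorem betti_eq_gTab (h : orbitIdeal 9 E = idl z) (hz : GenBounds z) {m : ℕ} (hm : m ≤ 10) :
    betti 9 m E = ∑ w : Fin (9 * m + 1), gTab m w := by
  rw [betti_eq h]
  exact Finset.sum_congr rfl fun w _ => hz.gg_eq hm w

theorem betti_numbers_of_bounds (h : orbitIdeal 9 E = idl z) (hz : GenBounds z) (hb : BaseBounds z) :
    betti 9 4 E = 1 ∧ betti 9 6 E = 71 ∧ betti 9 7 E = 508 ∧ betti 9 8 E = 324 ∧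
      betti 9 9 E = 86 ∧ betti 9 10 E = 51 ∧
      ∀ m : ℕ, m ∉ ([4, 6, 7, 8, 9, 10] : List ℕ) → Subsingleton (minGenSpace 9 m E) := by
  refine ⟨?_, ?_, ?_, ?_, ?_, ?_, fun m hm => ?_⟩
  iterate 6
    · rw [betti_eq_gTab h hz (by norm_num)]
      decide +kernel
  have := finite_genPiece h m
  refine Module.finrank_zero_iff.1 (show betti 9 m E = 0 from ?_)
  rcases le_or_gt m 10 with h10 | h10
  · have e : ∀ m ≤ 10, m ∉ ([4, 6, 7, 8, 9, 10] : List ℕ) → ∑ w : Fin (9 * m + 1), gTab m w = 0 := by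
      decide +kernel
    rw [betti_eq_gTab h hz h10, e m h10 hm]
  · rw [betti_eq h]
    refine Finset.sum_eq_zero fun w _ => ?_
    rw [gg, hb.hh_eq_rr h10, Nat.sub_self]

end

noncomputable section
set_option maxRecDepth 100000

theorem prodCoeff_smul {B : Type*} [CommRing B] (c : B) (l : List (B × B)) (k : ℕ) :
    prodCoeff (l.map fun x => (c * x.1, c * x.2)) k = c ^ l.length * prodCoeff l k := by
  induction l generalizing k with
  | nil => simp
  | cons a l ih =>
    cases k with
    | zero =>
      rw [List.map_cons, prodCoeff, prodCoeff, ih, List.length_cons]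
      ring
    | succ k =>
      rw [List.map_cons, prodCoeff, prodCoeff, ih, ih, List.length_cons]
      ring

theorem orb_smul {B : Type*} [CommRing B] (z : ℕ → B) (c p q r s : B) (k : ℕ) :
    orb z (c * p) (c * q) (c * r) (c * s) k = c ^ 9 * orb z p q r s k := by
  have h := prodCoeff_smul c ([0, 1, 2, 3, 4, 5, 6, 7, 8].map fun j => (p - z j * r, q - z j * s)) k
  rw [List.map_map, List.length_map] at h
  rw [orb, orb, mul_left_comm]
  refine congrArg _ (Eq.trans ?_ h)
  congr 2
  funext j
  rw [Function.comp_apply, mul_sub, mul_sub, mul_left_comm (z j), mul_left_comm (z j)]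

/-- Coefficients of a product of binary linear forms. -/
theorem coeff_prod_linear (l : List (ℂ × ℂ)) {a b : ℕ} (h : a + b = l.length) :
    coeff (Finsupp.single (0 : Fin 2) a + Finsupp.single (1 : Fin 2) b)
      (l.map fun x => C x.1 * X 0 + C x.2 * X 1 : List (MvPolynomial (Fin 2) ℂ)).prod =
      prodCoeff l b := by
  induction l generalizing a b with
  | nil =>
    obtain ⟨rfl, rfl⟩ : a = 0 ∧ b = 0 := by simpa using h
    simp [prodCoeff]
  | cons x l ih =>
    rw [List.length_cons] at h
    rw [List.map_cons, List.prod_cons, add_mul, mul_assoc, mul_assoc, coeff_add, coeff_C_mul,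
      coeff_C_mul, coeff_X_mul', coeff_X_mul']
    have e0 : ∀ a b : ℕ, Finsupp.single (0 : Fin 2) (a + 1) + Finsupp.single (1 : Fin 2) b -
        Finsupp.single 0 1 = Finsupp.single (0 : Fin 2) a + Finsupp.single (1 : Fin 2) b := by
      intro a b
      ext i
      fin_cases i <;> simp
    have e1 : ∀ a b : ℕ, Finsupp.single (0 : Fin 2) a + Finsupp.single (1 : Fin 2) (b + 1) -
        Finsupp.single 1 1 = Finsupp.single (0 : Fin 2) a + Finsupp.single (1 : Fin 2) b := by
      intro a b
      ext i
      fin_cases i <;> simp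
    cases b with
    | zero =>
      cases a with
      | zero => simp at h
      | succ a =>
        rw [e0, ih (by omega), prodCoeff]
        simp
    | succ b =>
      cases a with
      | zero =>
        rw [e1, ih (by omega), prodCoeff, prodCoeff_eq_zero (by omega : l.length < b + 1)]
        simp
      | succ a =>
        rw [e0, e1, ih (by omega), ih (by omega), prodCoeff]
        simp

/-- The factorization of a binary nonic. -/
def Factors (E : Fin 10 → ℂ) (c : ℂ) (z : Fin 9 → ℂ) : Prop :=
  toForm 9 E = C c * ∏ j : Fin 9, (X 0 - C (z j) * X 1)

theorem wt_mul_choose (i : Fin 10) : wt i * Nat.choose 9 i = 252 := by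
  revert i
  decide

theorem actCoeff_eq {E : Fin 10 → ℂ} {c : ℂ} {z : Fin 9 → ℂ} (h : Factors E c z) (g : SL2)
    (i : Fin 10) : actCoeff 9 g E i =
      c / 252 * orb (zext z) (g.1 0 0) (g.1 0 1) (g.1 1 0) (g.1 1 1) i := by
  have h1 : substAction g (toForm 9 E) = C c * (([0, 1, 2, 3, 4, 5, 6, 7, 8].map fun j =>
      (g.1 0 0 - zext z j * g.1 1 0, g.1 0 1 - zext z j * g.1 1 1)).map
        fun x => C x.1 * X 0 + C x.2 * X 1 : List (MvPolynomial (Fin 2) ℂ)).prod := by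
    have e : ∀ j : Fin 9, zext z j = z j := fun j => dif_pos j.2
    rw [h, substAction, map_mul, map_prod, List.map_map, Fin.prod_univ_def, ← List.ofFn_eq_map]
    simp only [map_sub, map_mul, algHom_C, aeval_X, algebraMap_eq]
    rw [show ([0, 1, 2, 3, 4, 5, 6, 7, 8] : List ℕ) = List.ofFn fun j : Fin 9 => (j : ℕ) from rfl,
      List.map_ofFn]
    congr 3
    funext j
    simp only [Function.comp_apply, e, map_sub, map_mul]
    ring
  have h2 : (Nat.choose 9 i : ℂ) * wt i = 252 := by
    rw [mul_comm]
    exact_mod_cast wt_mul_choose i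
  have h3 : (Nat.choose 9 i : ℂ) ≠ 0 := left_ne_zero_of_mul (h2.trans_ne (by norm_num))
  rw [actCoeff, h1, coeff_C_mul, coeff_prod_linear _ (by simp; omega), orb, div_eq_iff h3, ← h2]
  have h4 : (wt i : ℂ) ≠ 0 := right_ne_zero_of_mul (h2.trans_ne (by norm_num))
  generalize prodCoeff (B := ℂ) _ _ = x
  field_simp

theorem orbitIdeal_eq_idl {E : Fin 10 → ℂ} {c : ℂ} (hc : c ≠ 0) {z : Fin 9 → ℂ} (h : Factors E c z) :
    orbitIdeal 9 E = idl z := by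
  have key : ∀ f : MvPolynomial (Fin 10) ℂ, f ∈ orbitIdeal 9 E ↔ ∀ v ∈ orbitCone 9 E, eval v f = 0 :=
    fun f => ⟨fun hf v hv => hf v fun _ hw => hw v hv, fun hf v hv => hv f hf⟩
  have hev : ∀ (p q r s : ℂ) (f : MvPolynomial (Fin 10) ℂ),
      eval ![p, q, r, s] (phi z f) = eval (fun i : Fin 10 => orb (zext z) p q r s i) f := by
    intro p q r s f
    have := orbHom_comp (aeval ![p, q, r, s]) z (X 0) (X 1) (X 2) (X 3) f
    rw [← phi_eq] at this
    simpa [orbHom, aeval_eq_eval] using this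
  ext f
  rw [key, mem_idl]
  constructor
  · intro hf
    have hdet : (X 0 * X 3 - X 1 * X 2 : MvPolynomial (Fin 4) ℂ) ≠ 0 := by
      intro h0
      have := congrArg (eval ![1, 0, 0, 1]) h0
      simp at this
    refine (mul_eq_zero.1 (MvPolynomial.funext fun v => ?_)).resolve_right hdet
    rw [map_mul, map_zero, mul_eq_zero, or_iff_not_imp_right]
    intro hv
    simp only [map_sub, map_mul, eval_X] at hv
    obtain ⟨n, hn⟩ := IsAlgClosed.exists_pow_nat_eq (v 0 * v 3 - v 1 * v 2) (n := 2) (by norm_num)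
    have hn0 : n ≠ 0 := by
      rintro rfl
      exact hv (by rw [← hn]; norm_num)
    let g : SL2 := ⟨!![n⁻¹ * v 0, n⁻¹ * v 1; n⁻¹ * v 2, n⁻¹ * v 3], by
      rw [Matrix.det_fin_two_of]
      field_simp
      rw [hn]⟩
    have := hf _ ⟨n ^ 9 * (252 / c), g, rfl⟩
    rw [show v = ![v 0, v 1, v 2, v 3] by ext i; fin_cases i <;> rfl, hev, ← this]
    congr 2
    funext i
    rw [Pi.smul_apply, actCoeff_eq h, smul_eq_mul]
    change _ = n ^ 9 * (252 / c) * (c / 252 * orb (zext z) (n⁻¹ * v 0) (n⁻¹ * v 1) (n⁻¹ * v 2) (n⁻¹ * v 3) i)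
    rw [orb_smul]
    field_simp
  · rintro hf _ ⟨a, g, rfl⟩
    obtain ⟨n, hn⟩ := IsAlgClosed.exists_pow_nat_eq (a * (c / 252)) (n := 9) (by norm_num)
    have := hev (n * g.1 0 0) (n * g.1 0 1) (n * g.1 1 0) (n * g.1 1 1) f
    rw [hf, map_zero] at this
    rw [this]
    congr 2
    funext i
    rw [Pi.smul_apply, actCoeff_eq h, smul_eq_mul, orb_smul, hn, mul_assoc]

theorem exists_factors {E : Fin 10 → ℂ} (h0 : E 0 ≠ 0) : ∃ z, Factors E (E 0) z ∧
    ∀ i : Fin 9, eval z (esymm (Fin 9) ℂ (i + 1)) =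
      (-1) ^ ((i : ℕ) + 1) * (Nat.choose 9 (i + 1) : ℂ) * (E i.succ / E 0) := by
  let p : Polynomial ℂ := ∑ i : Fin 10, Polynomial.monomial (9 - (i : ℕ)) (Nat.choose 9 i * E i)
  have hcoeff : ∀ j : Fin 10, p.coeff (9 - (j : ℕ)) = Nat.choose 9 j * E j := by
    intro j
    rw [Polynomial.finsetSum_coeff, Finset.sum_eq_single j]
    · exact Polynomial.coeff_monomial_same _ _
    · intro i _ hij
      refine Polynomial.coeff_monomial_of_ne _ fun h => hij (Fin.ext ?_)
      omega
    · simp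
  have hlead : p.coeff 9 = E 0 := (hcoeff 0).trans (by simp)
  have hdeg : p.natDegree = 9 := by
    refine Polynomial.natDegree_eq_of_le_of_coeff_ne_zero ?_ (hlead.trans_ne h0)
    exact Polynomial.natDegree_sum_le_of_forall_le _ _ fun i _ =>
      (Polynomial.natDegree_monomial_le _).trans (Nat.sub_le _ _)
  have hsplit : p.Splits := IsAlgClosed.splits p
  have hcard : p.roots.card = 9 := hsplit.natDegree_eq_card_roots.symm.trans hdeg
  have hl : p.leadingCoeff = E 0 := by rw [Polynomial.leadingCoeff, hdeg, hlead]
  obtain ⟨z, hz⟩ : ∃ z : Fin 9 → ℂ, Finset.univ.val.map z = p.roots := by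
    have hlen : p.roots.toList.length = 9 := by rw [Multiset.length_toList, hcard]
    refine ⟨fun j => p.roots.toList.get (j.cast hlen.symm), ?_⟩
    rw [Fin.univ_val_map]
    conv_rhs => rw [← Multiset.coe_toList p.roots]
    congr 1
    refine List.ext_get ((List.length_ofFn).trans hlen.symm) fun n h1 h2 => ?_
    rw [List.get_ofFn]
    rfl
  refine ⟨z, ?_, fun i => ?_⟩
  · have hp : ∀ x, ∑ i : Fin 10, Nat.choose 9 i * E i * x ^ (9 - (i : ℕ)) = E 0 * ∏ j, (x - z j) := by
      intro x
      have h1 := hsplit.eval_eq_prod_roots x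
      rw [hl, ← hz, Multiset.map_map, Polynomial.eval_finsetSum] at h1
      simp only [Polynomial.eval_monomial] at h1
      exact h1
    refine MvPolynomial.funext fun v => ?_
    rw [toForm, map_sum, map_mul, map_prod]
    simp only [map_mul, map_pow, map_sub, eval_C, eval_X]
    by_cases hv : v 1 = 0
    · simp [hv, Fin.sum_univ_succ]
    · have h1 := hp (v 0 / v 1)
      have h2 : ∏ j, (v 0 - z j * v 1) = v 1 ^ 9 * ∏ j, (v 0 / v 1 - z j) := by
        rw [show v 1 ^ 9 = ∏ _j : Fin 9, v 1 by simp, ← Finset.prod_mul_distrib]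
        refine Finset.prod_congr rfl fun j _ => ?_
        field_simp
      rw [h2, mul_left_comm, ← h1, Finset.mul_sum]
      refine Finset.sum_congr rfl fun i _ => ?_
      have h3 : v 1 ^ 9 = v 1 ^ (9 - (i : ℕ)) * v 1 ^ (i : ℕ) := by
        rw [← pow_add]
        congr 1
        omega
      rw [h3, div_pow]
      field_simp
  · have h1 := Polynomial.coeff_eq_esymm_roots_of_card (hcard.trans hdeg.symm)
      (k := 9 - ((i.succ : Fin 10) : ℕ)) (by omega)
    have h2 := aeval_esymm_eq_multiset_esymm (Fin 9) ℂ ((i : ℕ) + 1) z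
    rw [hz] at h2
    rw [hcoeff, hl, hdeg, show 9 - (9 - ((i.succ : Fin 10) : ℕ)) = i + 1 by simp; omega, ← h2,
      Fin.val_succ] at h1
    rw [aeval_eq_eval] at h2 h1
    rw [mul_div_assoc', mul_assoc, h1, eq_div_iff h0]
    have h3 : ((-1 : ℂ) ^ ((i : ℕ) + 1)) * (-1) ^ ((i : ℕ) + 1) = 1 := by
      rw [← mul_pow]
      norm_num
    change eval z _ * E 0 = (-1) ^ ((i : ℕ) + 1) * (E 0 * (-1) ^ ((i : ℕ) + 1) * eval z _)
    linear_combination -(eval z (esymm (Fin 9) ℂ (i + 1)) * E 0) * h3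

/-- Homogenization of a polynomial, with rescaled variables. -/
theorem exists_homogenization {n : ℕ} (κ : Fin n → ℂ) (Q : MvPolynomial (Fin n) ℂ) :
    ∃ (N : ℕ) (H : MvPolynomial (Fin (n + 1)) ℂ), ∀ v : Fin (n + 1) → ℂ, v 0 ≠ 0 →
      eval v H = v 0 ^ N * eval (fun i => κ i * (v i.succ / v 0)) Q := by
  induction Q using MvPolynomial.induction_on with
  | C a => exact ⟨0, C a, fun v _ => by simp⟩
  | add p q hp hq =>
    obtain ⟨N, H, h⟩ := hp
    obtain ⟨N', H', h'⟩ := hq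
    refine ⟨N + N', X 0 ^ N' * H + X 0 ^ N * H', fun v hv => ?_⟩
    simp only [map_add, map_mul, map_pow, eval_X, h v hv, h' v hv]
    ring
  | mul_X p i hp =>
    obtain ⟨N, H, h⟩ := hp
    refine ⟨N + 1, H * (C (κ i) * X i.succ), fun v hv => ?_⟩
    simp only [map_mul, eval_X, eval_C, h v hv]
    rw [pow_succ]
    field_simp

theorem Gen.forGeneral {P : (Fin 9 → ℂ) → Prop} {P' : (Fin 10 → ℂ) → Prop} (hP : Gen P)
    (h : ∀ E z, E 0 ≠ 0 → Factors E (E 0) z → P z → P' E) : ForGeneral 9 P' := by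
  obtain ⟨D, hD, hDP⟩ := hP
  let s : MvPolynomial (Fin 9) ℂ := ∏ σ : Equiv.Perm (Fin 9), rename σ D
  have hs0 : s ≠ 0 := Finset.prod_ne_zero_iff.2 fun σ _ h0 => hD (rename_injective _ σ.injective (by
    rw [h0, map_zero]))
  have hsym : s ∈ symmetricSubalgebra (Fin 9) ℂ := by
    intro τ
    change rename τ (∏ σ : Equiv.Perm (Fin 9), rename σ D) = ∏ σ : Equiv.Perm (Fin 9), rename σ D
    rw [map_prod]
    simp only [rename_rename]
    exact Fintype.prod_equiv (Equiv.mulLeft τ) _ _ fun σ => rfl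
  obtain ⟨Q, hQ⟩ := (esymmAlgEquiv (Fin 9) ℂ (Fintype.card_fin 9)).surjective ⟨s, hsym⟩
  have hQ0 : Q ≠ 0 := by
    rintro rfl
    rw [map_zero] at hQ
    exact hs0 (congrArg Subtype.val hQ).symm
  have hQs : aeval (fun i : Fin 9 => esymm (Fin 9) ℂ (i + 1)) Q = s := by
    rw [← esymmAlgHom_apply]
    exact congrArg Subtype.val hQ
  have hκ : ∀ i : Fin 9, (-1) ^ ((i : ℕ) + 1) * (Nat.choose 9 (i + 1) : ℂ) ≠ 0 := fun i =>
    mul_ne_zero (pow_ne_zero _ (by norm_num))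
      (Nat.cast_ne_zero.2 (Nat.choose_pos (by omega)).ne')
  obtain ⟨N, H, hH⟩ := exists_homogenization
    (fun i : Fin 9 => (-1) ^ ((i : ℕ) + 1) * (Nat.choose 9 (i + 1) : ℂ)) Q
  have hH0 : H ≠ 0 := by
    rintro rfl
    refine hQ0 (MvPolynomial.funext fun y => ?_)
    have := hH (Fin.cons 1 fun i => y i / ((-1) ^ ((i : ℕ) + 1) * (Nat.choose 9 (i + 1) : ℂ))) (by simp)
    simp only [map_zero, Fin.cons_zero, one_pow, one_mul, Fin.cons_succ, div_one] at this
    rw [map_zero, this]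
    congr 2
    funext i
    rw [mul_div_cancel₀ _ (hκ i)]
  refine ⟨{v | eval v (X 0 * H) ≠ 0}, ⟨{X 0 * H}, by simp⟩, ?_, fun E hE => ?_⟩
  · refine Set.eq_univ_of_forall fun v f hf => ?_
    have : f * (X 0 * H) = 0 := MvPolynomial.funext fun w => by
      rw [map_mul, map_zero, mul_eq_zero, or_iff_not_imp_right]
      exact hf w
    rw [(mul_eq_zero.1 this).resolve_right (mul_ne_zero (X_ne_zero _) hH0), map_zero]
  · obtain ⟨h0, h1⟩ := mul_ne_zero_iff.1 ((map_mul (eval E) (X 0) H).symm.trans_ne hE)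
    rw [eval_X] at h0
    obtain ⟨z, hz, hez⟩ := exists_factors h0
    refine h E z h0 hz (hDP z ?_)
    rw [hH E h0] at h1
    have h2 : eval z s ≠ 0 := by
      rw [← hQs]
      intro h3
      refine right_ne_zero_of_mul h1 ?_
      rw [← h3]
      simp only [← hez]
      rw [← aeval_eq_eval, ← aeval_eq_eval]
      exact (comp_aeval_apply (fun i : Fin 9 => esymm (Fin 9) ℂ (i + 1)) (aeval z) Q).symm
    rw [map_prod] at h2
    have h3 := Finset.prod_ne_zero_iff.1 h2 1 (Finset.mem_univ _)
    simpa using h3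

end

/-- For a general binary nonic `E` (`d = 9`), the minimal generator
dimensions of `I_E` are `β_4 = 1`, `β_6 = 71`, `β_7 = 508`, `β_8 = 324`, `β_9 = 86`,
`β_10 = 51`, and `β_m = 0` (i.e. `B(0,m) = 0`) for all other `m`. -/
theorem nonic_betti_numbers :
    ForGeneral 9 fun E =>
      betti 9 4 E = 1 ∧ betti 9 6 E = 71 ∧ betti 9 7 E = 508 ∧ betti 9 8 E = 324 ∧
      betti 9 9 E = 86 ∧ betti 9 10 E = 51 ∧
      ∀ m : ℕ, m ∉ ([4, 6, 7, 8, 9, 10] : List ℕ) →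
        Subsingleton (minGenSpace 9 m E) :=
  (gen_genBounds.and (gen_ranks.and gen_pointBounds)).forGeneral fun _ _ h0 hz h =>
    betti_numbers_of_bounds (orbitIdeal_eq_idl h0 hz) h.1 (h.2.1.baseBounds h.2.2)
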